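/- (Schauder estimate for singular elliptic equations of Keldysh type.) Let n ≥ 2, α ∈ (0,1), 0 < λ ≤ Λ, K > 0, and let b > 1 be a constant. Then there exists C > 0, depending only on n, α, λ, Λ, K, b, with the following property. Let B₁⁺ = B₁(0) ∩ ℝⁿ₊ and B⁺_{1/2} = B_{1/2}(0) ∩ ℝⁿ₊. Let u ∈ C²(B₁⁺) ∩ C¹(closure of B₁⁺) with Du α-Hölder continuous on the closure of B₁⁺, and suppose u satisfies Σ_{i,j=1}^n a^{ij} ∂_{ij}u + Σ_{i=1}^{n-1} b^i ∂_i u + (b^n/x_n) ∂_n u + c·u = f in B₁⁺, where a^{ij}, b^i, b^n, c, f are α-Hölder continuous on the closure of B₁⁺ with Hölder norms at most K, λ|ξ|² ≤ Σ a^{ij}(x)ξ_iξ_j ≤ Λ|ξ|² for all ξ ∈ ℝⁿ and x ∈ B₁⁺, and b^n(x)/a^{nn}(x) = b for all x ∈ B₁⁺. Then the second derivatives of u extend continuously to the closure of B⁺_{1/2}, and ‖u‖_{C^{2,α}(closure of B⁺_{1/2})} + ‖(∂_n u)/x_n‖_{C^α(closure of B⁺_{1/2})} ≤ C ( ‖f‖_{C^α(closure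 of B₁⁺)} + sup_{B₁⁺}|u| ). -/

import Mathlib

open MeasureTheory
open scoped ENNReal

noncomputable section

/-- Euclidean n-space. -/
abbrev Eu (n : ℕ) := EuclideanSpace ℝ (Fin n)

/-- Partial derivative ∂ψ/∂xᵢ. -/
def pd {n : ℕ} (ψ : Eu n → ℝ) (i : Fin n) (x : Eu n) : ℝ :=
  fderiv ℝ ψ x (EuclideanSpace.single i 1)

/-- Second partial derivative ∂²ψ/∂xᵢ∂xⱼ. -/
def pd2 {n : ℕ} (ψ : Eu n → ℝ) (i j : Fin n) (x : Eu n) : ℝ :=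
  pd (pd ψ j) i x


/-- The half ball `B_r(0) ∩ ℝⁿ₊`. -/
def halfBall (n : ℕ) (ln : Fin n) (r : ℝ) : Set (Eu n) :=
  Metric.ball 0 r ∩ {x : Eu n | 0 < x ln}

section
open Filter Topology Set

/-- The standard basis vector. -/
abbrev bv {n : ℕ} (i : Fin n) : Eu n := EuclideanSpace.single i (1 : ℝ)

/-- `f` is twice differentiable along the real line at `0`, with the given derivatives. -/
def HasJet (f : ℝ → ℝ) (f1 f2 : ℝ) : Prop :=
  ∃ f' : ℝ → ℝ, (∀ᶠ s in 𝓝 0, HasDerivAt f (f' s) s) ∧ f' 0 = f1 ∧ HasDerivAt f' f2 0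

theorem HasJet.add {f g : ℝ → ℝ} {f1 f2 g1 g2 : ℝ} (hf : HasJet f f1 f2) (hg : HasJet g g1 g2) :
    HasJet (fun s => f s + g s) (f1 + g1) (f2 + g2) := by
  obtain ⟨f', h1, h2, h3⟩ := hf
  obtain ⟨g', k1, k2, k3⟩ := hg
  refine ⟨fun s => f' s + g' s, ?_, by simp [h2, k2], h3.add k3⟩
  filter_upwards [h1, k1] with s hs ks using hs.add ks

theorem HasJet.const_mul {f : ℝ → ℝ} {f1 f2 : ℝ} (c : ℝ) (hf : HasJet f f1 f2) :
    HasJet (fun s => c * f s) (c * f1) (c * f2) := by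
  obtain ⟨f', h1, h2, h3⟩ := hf
  refine ⟨fun s => c * f' s, ?_, by simp [h2], h3.const_mul c⟩
  filter_upwards [h1] with s hs using hs.const_mul c

theorem HasJet.sub {f g : ℝ → ℝ} {f1 f2 g1 g2 : ℝ} (hf : HasJet f f1 f2) (hg : HasJet g g1 g2) :
    HasJet (fun s => f s - g s) (f1 - g1) (f2 - g2) := by
  have := hf.add (hg.const_mul (-1))
  simpa [sub_eq_add_neg] using this

theorem hasJet_quad (c0 c1 c2 : ℝ) : HasJet (fun s => c0 + c1 * s + c2 * s ^ 2) c1 (2 * c2) := by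
  refine ⟨fun s => c1 + 2 * c2 * s, Eventually.of_forall fun s => ?_, by simp, ?_⟩
  · have := (((hasDerivAt_id s).const_mul c1).const_add c0).add
      (((hasDerivAt_id s).pow 2).const_mul c2)
    exact this.congr_deriv (by simp; ring)
  · have := (((hasDerivAt_id (0:ℝ)).const_mul (2 * c2)).const_add c1)
    exact this.congr_deriv (by simp)

theorem hasJet_log {p q : ℝ} (hp : 0 < p) :
    HasJet (fun s => Real.log (p + s * q)) (q / p) (-(q ^ 2) / p ^ 2) := by
  have hl : ∀ s : ℝ, HasDerivAt (fun s => p + s * q) q s := fun s => by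
    simpa using ((hasDerivAt_id s).mul_const q).const_add p
  have hne : ∀ᶠ s in 𝓝 (0 : ℝ), p + s * q ≠ 0 :=
    (hl 0).continuousAt.eventually_ne (by simpa using hp.ne')
  refine ⟨fun s => q / (p + s * q), ?_, by simp, ?_⟩
  · filter_upwards [hne] with s hs using (hl s).log hs
  · have := (hasDerivAt_const (0:ℝ) q).div (hl 0) (by simpa using hp.ne')
    exact this.congr_deriv (by simp; ring)

/-- Necessary conditions at a local maximum along a line. -/
theorem HasJet.localMax {f : ℝ → ℝ} {f1 f2 : ℝ} (hf : HasJet f f1 f2) (hm : IsLocalMax f 0) :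
    f1 = 0 ∧ f2 ≤ 0 := by
  obtain ⟨f', h1, h2, h3⟩ := hf
  have hd0 : HasDerivAt f 0 0 := by
    have := h1.self_of_nhds
    rwa [hm.hasDerivAt_eq_zero this] at this
  have h10 : f' 0 = 0 := h1.self_of_nhds.unique hd0
  refine ⟨h2 ▸ h10, ?_⟩
  by_contra hpos
  push Not at hpos
  have hde : deriv f =ᶠ[𝓝 0] f' := by
    filter_upwards [h1] with s hs using hs.deriv
  have hdd : deriv (deriv f) 0 = f2 := by
    rw [hde.deriv_eq, h3.deriv]
  have hmin := isLocalMin_of_deriv_deriv_pos (f := f) (x₀ := 0) (by rw [hdd]; exact hpos)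
    (by rw [hd0.deriv]) hd0.continuousAt
  have hconst : f =ᶠ[𝓝 0] fun _ => f 0 := by
    filter_upwards [hm, hmin] with s a b using le_antisymm a b
  have : deriv (deriv f) 0 = 0 := by
    have h := hconst.deriv
    rw [h.deriv_eq]
    simp
  linarith [hdd ▸ this]

section
variable {E F : Type*} [NormedAddCommGroup E] [NormedSpace ℝ E]
  [NormedAddCommGroup F] [NormedSpace ℝ F]

/-- The Hessian. -/
abbrev D2 (w : E → F) (x : E) : E →L[ℝ] E →L[ℝ] F := fderiv ℝ (fderiv ℝ w) x

theorem hasDerivAt_line {w : E → F} {p v : E} {s : ℝ} (h : DifferentiableAt ℝ w (p + s • v)) :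
    HasDerivAt (fun s : ℝ => w (p + s • v)) (fderiv ℝ w (p + s • v) v) s := by
  have h1 : HasDerivAt (fun s : ℝ => p + s • v) v s := by
    simpa using ((hasDerivAt_id s).smul_const v).const_add p
  exact h.hasFDerivAt.comp_hasDerivAt s h1

theorem C2on_differentiableAt {w : E → F} {U : Set E} (hU : IsOpen U) (hw : ContDiffOn ℝ 2 w U)
    {x : E} (hx : x ∈ U) : DifferentiableAt ℝ w x :=
  ((hw.contDiffAt (hU.mem_nhds hx)).differentiableAt (by norm_num))

theorem C2on_fderiv {w : E → F} {U : Set E} (hU : IsOpen U) (hw : ContDiffOn ℝ 2 w U) :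
    ContDiffOn ℝ 1 (fderiv ℝ w) U :=
  hw.fderiv_of_isOpen hU (by norm_num)

theorem C2on_differentiableAt_fderiv {w : E → F} {U : Set E} (hU : IsOpen U)
    (hw : ContDiffOn ℝ 2 w U) {x : E} (hx : x ∈ U) : DifferentiableAt ℝ (fderiv ℝ w) x :=
  (((C2on_fderiv hU hw).contDiffAt (hU.mem_nhds hx)).differentiableAt (by norm_num))

theorem C2on_continuousOn_D2 {w : E → F} {U : Set E} (hU : IsOpen U)
    (hw : ContDiffOn ℝ 2 w U) : ContinuousOn (D2 w) U :=
  (C2on_fderiv hU hw).continuousOn_fderiv_of_isOpen hU (by norm_num)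

theorem C2on_symm {w : E → ℝ} {U : Set E} (hU : IsOpen U)
    (hw : ContDiffOn ℝ 2 w U) {x : E} (hx : x ∈ U) (u v : E) : D2 w x u v = D2 w x v u :=
  ((hw.contDiffAt (hU.mem_nhds hx)).isSymmSndFDerivAt (by simp)) u v

theorem hasJet_line {w : E → ℝ} {U : Set E} (hU : IsOpen U) (hw : ContDiffOn ℝ 2 w U) {x : E}
    (hx : x ∈ U) (v : E) :
    HasJet (fun s : ℝ => w (x + s • v)) (fderiv ℝ w x v) (D2 w x v v) := by
  have hc : Continuous fun s : ℝ => x + s • v := by fun_prop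
  have hev : ∀ᶠ s in 𝓝 (0 : ℝ), x + s • v ∈ U :=
    hc.continuousAt.eventually_mem (hU.mem_nhds (by simpa using hx))
  refine ⟨fun s => fderiv ℝ w (x + s • v) v, ?_, by simp, ?_⟩
  · filter_upwards [hev] with s hs
    exact hasDerivAt_line (C2on_differentiableAt hU hw hs)
  · have h := hasDerivAt_line (w := fderiv ℝ w) (p := x) (v := v) (s := 0)
      (by simpa using C2on_differentiableAt_fderiv hU hw hx)
    have := h.clm_apply (hasDerivAt_const (0:ℝ) v)
    simpa using this

end

/-- Constant symmetric matrices with ellipticity constants `lam`, `Lam`. -/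
structure Ell {n : ℕ} (lam Lam : ℝ) (a : Fin n → Fin n → ℝ) : Prop where
  symm : ∀ i j, a i j = a j i
  lower : ∀ ξ : Fin n → ℝ, lam * (∑ i, ξ i ^ 2) ≤ ∑ i, ∑ j, a i j * ξ i * ξ j
  upper : ∀ ξ : Fin n → ℝ, (∑ i, ∑ j, a i j * ξ i * ξ j) ≤ Lam * (∑ i, ξ i ^ 2)

/-- The contraction `∑ aᵢⱼ T(eᵢ, eⱼ)`. -/
def qf {n : ℕ} (a : Fin n → Fin n → ℝ) (T : Eu n →L[ℝ] Eu n →L[ℝ] ℝ) : ℝ :=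
  ∑ i, ∑ j, a i j * T (bv i) (bv j)

section qf
variable {n : ℕ} (a a' : Fin n → Fin n → ℝ) (S T : Eu n →L[ℝ] Eu n →L[ℝ] ℝ)

theorem qf_add : qf a (S + T) = qf a S + qf a T := by
  simp [qf, mul_add, Finset.sum_add_distrib]

theorem qf_sub : qf a (S - T) = qf a S - qf a T := by
  simp [qf, mul_sub, Finset.sum_sub_distrib]

theorem qf_smul (c : ℝ) : qf a (c • T) = c * qf a T := by
  simp only [qf, Finset.mul_sum, smul_apply, smul_eq_mul]
  refine Finset.sum_congr rfl fun i _ => Finset.sum_congr rfl fun j _ => by ring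

theorem qf_sub_left : qf (fun i j => a i j - a' i j) T = qf a T - qf a' T := by
  simp [qf, sub_mul, Finset.sum_sub_distrib]

theorem bv_apply (i j : Fin n) : (bv i : Eu n) j = if i = j then 1 else 0 := by
  simp [bv, eq_comm]

theorem norm_bv (i : Fin n) : ‖(bv i : Eu n)‖ = 1 := by simp [bv]

theorem abs_coord_le (x : Eu n) (i : Fin n) : |x i| ≤ ‖x‖ := by
  have := PiLp.norm_apply_le x i
  simpa using this

theorem T_bv_le (i j : Fin n) : |T (bv i) (bv j)| ≤ ‖T‖ := by
  have := T.le_opNorm₂ (bv i) (bv j)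
  simpa [norm_bv] using this

theorem qf_abs_le {c : ℝ} (hc : ∀ i j, |a i j| ≤ c) : |qf a T| ≤ n ^ 2 * c * ‖T‖ := by
  unfold qf
  calc _ ≤ ∑ i, ∑ j, |a i j * T (bv i) (bv j)| :=
        (Finset.abs_sum_le_sum_abs _ _).trans
          (Finset.sum_le_sum fun i _ => Finset.abs_sum_le_sum_abs _ _)
    _ ≤ ∑ i : Fin n, ∑ j : Fin n, c * ‖T‖ := by
        refine Finset.sum_le_sum fun i _ => Finset.sum_le_sum fun j _ => ?_
        rw [abs_mul]
        exact mul_le_mul (hc i j) (T_bv_le T i j) (abs_nonneg _) ((abs_nonneg _).trans (hc i j))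
    _ = _ := by simp; ring

end qf

namespace Ell
variable {n : ℕ} {lam Lam : ℝ} {a : Fin n → Fin n → ℝ}

theorem diag (h : Ell lam Lam a) (i : Fin n) : lam ≤ a i i ∧ a i i ≤ Lam := by
  have h1 := h.lower (Pi.single i 1)
  have h2 := h.upper (Pi.single i 1)
  simp [Pi.single_apply] at h1 h2
  exact ⟨h1, h2⟩

theorem abs_le (h : Ell lam Lam a) (hl : 0 < lam) (i j : Fin n) : |a i j| ≤ Lam := by
  by_cases hij : i = j
  · subst hij
    rw [abs_of_pos (hl.trans_le (h.diag i).1)]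
    exact (h.diag i).2
  have key : ∀ σ : ℝ, 0 ≤ a i i + σ * a i j + σ * a j i + σ ^ 2 * a j j := by
    intro σ
    have h1 := h.lower (fun k => (if k = i then 1 else 0) + (if k = j then σ else 0))
    have h0 : 0 ≤ lam * (∑ k : Fin n,
        ((if k = i then (1:ℝ) else 0) + (if k = j then σ else 0)) ^ 2) := by positivity
    have h2 := h0.trans h1
    simp [mul_add, add_mul, Finset.sum_add_distrib] at h2
    nlinarith
  have k1 := key 1
  have k2 := key (-1)
  have := h.symm i j
  have := (h.diag i).2
  have := (h.diag j).2
  rw [_root_.abs_le]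
  constructor <;> linarith

theorem decomp (h : Ell lam Lam a) (hl : 0 < lam) (i0 : Fin n) :
    ∃ (m : ℕ) (v : Fin m → Eu n), ∀ T : Eu n →L[ℝ] Eu n →L[ℝ] ℝ,
      qf a T = lam * T (bv i0) (bv i0) + ∑ k, T (v k) (v k) := by
  let M : Matrix (Fin n) (Fin n) ℝ := fun i j =>
    a i j - lam * (if i = i0 then 1 else 0) * (if j = i0 then 1 else 0)
  have hM : M.PosSemidef := by
    rw [Matrix.posSemidef_iff_dotProduct_mulVec]
    constructor
    · ext i j
      rw [Matrix.conjTranspose_apply]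
      simp only [M, star_trivial]
      rw [h.symm]; ring
    · intro ξ
      have h1 := h.lower ξ
      have h2 : star ξ ⬝ᵥ M.mulVec ξ = (∑ i, ∑ j, a i j * ξ i * ξ j) - lam * ξ i0 ^ 2 := by
        simp only [dotProduct, Matrix.mulVec, M, star_trivial, Finset.mul_sum, sub_mul, mul_sub,
          Finset.sum_sub_distrib]
        congr 1
        · refine Finset.sum_congr rfl fun i _ => Finset.sum_congr rfl fun j _ => by ring
        · simp
          ring
      rw [h2]
      have h3 : ξ i0 ^ 2 ≤ ∑ i, ξ i ^ 2 :=
        Finset.single_le_sum (f := fun i => ξ i ^ 2) (fun i _ => sq_nonneg _) (Finset.mem_univ i0)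
      nlinarith
  obtain ⟨m, v, hv⟩ := Matrix.posSemidef_iff_eq_sum_vecMulVec.1 hM
  refine ⟨m, fun k => ∑ i, v k i • bv i, fun T => ?_⟩
  have hv' : ∀ i j, a i j = lam * (if i = i0 then 1 else 0) * (if j = i0 then 1 else 0)
      + ∑ k, v k i * v k j := by
    intro i j
    have := congrFun (congrFun hv i) j
    simp only [M, Matrix.sum_apply, Matrix.vecMulVec_apply, star_trivial] at this
    linarith
  simp only [qf, hv', add_mul, Finset.sum_add_distrib, Finset.sum_mul, map_sum, map_smul,
    smul_apply, FunLike.coe_sum, Finset.sum_apply, smul_eq_mul,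
    Finset.mul_sum]
  congr 1
  · simp
  · calc (∑ i, ∑ j, ∑ k, v k i * v k j * T (bv i) (bv j))
        = ∑ i, ∑ k, ∑ j, v k i * v k j * T (bv i) (bv j) :=
          Finset.sum_congr rfl fun i _ => Finset.sum_comm
      _ = ∑ k, ∑ i, ∑ j, v k i * v k j * T (bv i) (bv j) := Finset.sum_comm
      _ = _ := by
        refine Finset.sum_congr rfl fun k _ => ?_
        rw [Finset.sum_comm]
        refine Finset.sum_congr rfl fun i _ => Finset.sum_congr rfl fun j _ => by ring

end Ell

/-- The Keldysh operator with frozen coefficient matrix `a`. -/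
def opL {n : ℕ} (ln : Fin n) (b : ℝ) (a : Fin n → Fin n → ℝ) (w : Eu n → ℝ) (x : Eu n) : ℝ :=
  qf a (D2 w x) + b * a ln ln / x ln * fderiv ℝ w x (bv ln)

theorem isOpen_halfBall {n : ℕ} (ln : Fin n) (r : ℝ) : IsOpen (halfBall n ln r) := by
  refine Metric.isOpen_ball.inter (isOpen_lt continuous_const ?_)
  fun_prop

theorem mem_halfBall {n : ℕ} {ln : Fin n} {r : ℝ} {x : Eu n} :
    x ∈ halfBall n ln r ↔ ‖x‖ < r ∧ 0 < x ln := by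
  simp [halfBall]

section forms
variable {n : ℕ}

/-- The bilinear form `xᵢ yᵢ`. -/
def coF (i : Fin n) : Eu n →L[ℝ] Eu n →L[ℝ] ℝ :=
  (EuclideanSpace.proj i : Eu n →L[ℝ] ℝ).smulRight (EuclideanSpace.proj i : Eu n →L[ℝ] ℝ)

@[simp] theorem coF_apply (i : Fin n) (x y : Eu n) : coF i x y = x i * y i := by
  simp [coF]

/-- The Euclidean inner product as a bilinear form. -/
def idF : Eu n →L[ℝ] Eu n →L[ℝ] ℝ := ∑ i, coF i

theorem idF_apply (x y : Eu n) : idF x y = ∑ i, x i * y i := by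
  simp [idF]

theorem idF_self (x : Eu n) : idF x x = ‖x‖ ^ 2 := by
  rw [idF_apply, EuclideanSpace.real_norm_sq_eq]
  exact Finset.sum_congr rfl fun i _ => (sq _).symm

theorem qf_coF (a : Fin n → Fin n → ℝ) (i : Fin n) : qf a (coF i) = a i i := by
  simp [qf]

theorem qf_idF (a : Fin n → Fin n → ℝ) : qf a idF = ∑ i, a i i := by
  simp [qf, idF_apply]

end forms

set_option maxHeartbeats 1000000 in
/-- The maximum principle on the doubled half ball, one-sided form. -/
theorem diff_le_aux {n : ℕ} {ln i : Fin n} (hi : i ≠ ln) {lam Lam b r M ε : ℝ}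
    {a : Fin n → Fin n → ℝ} (ha : Ell lam Lam a) (hl : 0 < lam) (hb : 1 < b)
    (hr : 0 < r) (hr1 : r ≤ 1) (hε : 0 ≤ ε) {w : Eu n → ℝ}
    (hw : ContDiffOn ℝ 2 w (halfBall n ln r)) (hM : ∀ x ∈ halfBall n ln r, |w x| ≤ M)
    (hL : ∀ x ∈ halfBall n ln r, |opL ln b a w x| ≤ ε / x ln)
    {x0 : Eu n} (hx0 : x0 ∈ halfBall n ln (r / 2)) {t0 : ℝ} (ht0 : 0 ≤ t0) (ht1 : t0 ≤ r / 4) :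
    w (x0 + t0 • bv i) - w (x0 - t0 • bv i) ≤
      2 * M * (1 + (n * Lam + b * Lam) / lam) * (t0 / (r / 4)) + 2 * ε / (b * a ln ln) := by
  have hUo := isOpen_halfBall (n := n) ln r
  have hx0' := mem_halfBall.1 hx0
  have hann := (ha.diag ln).1
  have hann2 := (ha.diag ln).2
  have hann0 : 0 < a ln ln := hl.trans_le hann
  have hM0 : 0 ≤ M := (abs_nonneg _).trans (hM x0 (mem_halfBall.2 ⟨by linarith, hx0'.2⟩))
  obtain ⟨m, v, hv⟩ := ha.decomp hl i
  set ρ := r / 4 with hρ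
  have hρ0 : 0 < ρ := by positivity
  set k1 := (n * Lam + b * Lam) / lam with hk1
  have hLam0 : 0 < Lam := hl.trans_le (hann.trans hann2)
  have hk10 : 0 ≤ k1 := by positivity
  have hk1l : k1 * lam = n * Lam + b * Lam := by rw [hk1]; field_simp
  set κ := 2 * ε / (b * a ln ln) with hκ
  have hκ0 : 0 ≤ κ := by positivity
  have hκ1 : b * a ln ln * κ = 2 * ε := by rw [hκ]; field_simp
  set g : ℝ → Eu n → ℝ → ℝ := fun μ x t => 2 * M / ρ ^ 2 * ‖x - x0‖ ^ 2
    + 2 * M * ((1 + k1) * (t / ρ) - k1 * (t / ρ) ^ 2) + κ * (1 - x ln) - μ * Real.log (x ln) with hg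
  set Φ : ℝ → Eu n → ℝ → ℝ := fun μ x t => w (x + t • bv i) - w (x - t • bv i) - g μ x t with hΦ
  have bvn : (bv i : Eu n) ln = 0 := by rw [bv_apply]; simp [hi]
  have hmem : ∀ x : Eu n, ‖x - x0‖ ≤ ρ → 0 < x ln → ∀ t : ℝ, |t| ≤ ρ →
      x + t • bv i ∈ halfBall n ln r ∧ x ln ≤ 1 := by
    intro x hx hxn t ht
    have h1 : ‖x‖ < r / 2 + ρ := by
      calc ‖x‖ = ‖x0 + (x - x0)‖ := by congr 1; abel
        _ ≤ ‖x0‖ + ‖x - x0‖ := norm_add_le _ _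
        _ < _ := by linarith
    refine ⟨mem_halfBall.2 ⟨?_, ?_⟩, ?_⟩
    · calc ‖x + t • bv i‖ ≤ ‖x‖ + ‖t • (bv i : Eu n)‖ := norm_add_le _ _
        _ = ‖x‖ + |t| := by rw [norm_smul, norm_bv]; simp
        _ < r := by linarith
    · simp [hxn, hi.symm]
    · have := abs_coord_le x ln
      have := le_abs_self (x ln)
      linarith
  have hmem' : ∀ x : Eu n, ‖x - x0‖ ≤ ρ → 0 < x ln → ∀ t : ℝ, |t| ≤ ρ →
      x - t • bv i ∈ halfBall n ln r := by
    intro x hx hxn t ht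
    have := (hmem x hx hxn (-t) (by simpa using ht)).1
    simpa [sub_eq_add_neg] using this
  have hquad : ∀ t, 0 ≤ t → t ≤ ρ → 0 ≤ (1 + k1) * (t / ρ) - k1 * (t / ρ) ^ 2 := by
    intro t h0 h1
    have h2 : 0 ≤ t / ρ := by positivity
    have h3 : t / ρ ≤ 1 := (div_le_one hρ0).2 h1
    nlinarith [mul_nonneg hk10 (mul_nonneg h2 (sub_nonneg.2 h3))]
  have claim : ∀ μ > 0, ∀ x : Eu n, ‖x - x0‖ ≤ ρ → 0 < x ln → ∀ t, 0 ≤ t → t ≤ ρ →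
      Φ μ x t ≤ 0 := by
    intro μ hμ x' hx' hxn' t' ht0' ht1'
    by_contra hpos
    push Not at hpos
    set δ := Real.exp (-(2 * M) / μ) with hδ
    have hδ0 : 0 < δ := Real.exp_pos _
    have hw2 : ∀ x : Eu n, ‖x - x0‖ ≤ ρ → 0 < x ln → ∀ t, 0 ≤ t → t ≤ ρ →
        w (x + t • bv i) - w (x - t • bv i) ≤ 2 * M := by
      intro x h1 h2 t h3 h4
      have e1 := (abs_le.1 (hM _ (hmem x h1 h2 t (by rwa [abs_of_nonneg h3])).1)).2
      have e2 := (abs_le.1 (hM _ (hmem' x h1 h2 t (by rwa [abs_of_nonneg h3])))).1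
      linarith
    have hlog : ∀ x : Eu n, ‖x - x0‖ ≤ ρ → 0 < x ln → μ * Real.log (x ln) ≤ 0 := by
      intro x h1 h2
      have := (hmem x h1 h2 0 (by simpa using hρ0.le)).2
      exact mul_nonpos_of_nonneg_of_nonpos hμ.le (Real.log_nonpos h2.le this)
    have hone : ∀ x : Eu n, ‖x - x0‖ ≤ ρ → 0 < x ln → 0 ≤ κ * (1 - x ln) := by
      intro x h1 h2
      have := (hmem x h1 h2 0 (by simpa using hρ0.le)).2
      exact mul_nonneg hκ0 (by linarith)
    have bd : ∀ x : Eu n, ‖x - x0‖ ≤ ρ → 0 < x ln → ∀ t, 0 ≤ t → t ≤ ρ → 0 < Φ μ x t →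
        ‖x - x0‖ < ρ ∧ δ < x ln ∧ 0 < t ∧ t < ρ := by
      intro x h1 h2 t h3 h4 h5
      have e1 := hw2 x h1 h2 t h3 h4
      have e2 := hlog x h1 h2
      have e3 := hone x h1 h2
      have e4 := mul_nonneg (mul_nonneg zero_le_two hM0) (hquad t h3 h4)
      have e5 : 0 ≤ 2 * M / ρ ^ 2 * ‖x - x0‖ ^ 2 := by positivity
      simp only [hΦ, hg] at h5
      refine ⟨lt_of_le_of_ne h1 fun h => ?_, ?_, lt_of_le_of_ne h3 fun h => ?_,
        lt_of_le_of_ne h4 fun h => ?_⟩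
      · rw [h] at h5
        have : 2 * M / ρ ^ 2 * ρ ^ 2 = 2 * M := by field_simp
        linarith
      · by_contra hle
        push Not at hle
        have : μ * Real.log (x ln) ≤ μ * (-(2 * M) / μ) := by
          refine mul_le_mul_of_nonneg_left ?_ hμ.le
          rw [← Real.log_exp (-(2 * M) / μ)]
          exact Real.log_le_log h2 hle
        have : μ * (-(2 * M) / μ) = -(2 * M) := by field_simp
        linarith
      · subst h
        simp at h5
        linarith
      · subst h
        rw [div_self hρ0.ne'] at h5
        linarith
    set S : Set (Eu n × ℝ) := {p | ‖p.1 - x0‖ ≤ ρ ∧ δ ≤ p.1 ln ∧ 0 ≤ p.2 ∧ p.2 ≤ ρ} with hS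
    have hScl : IsClosed S := by
      refine IsClosed.and (isClosed_le ?_ ?_) (IsClosed.and (isClosed_le ?_ ?_)
        (IsClosed.and (isClosed_le ?_ ?_) (isClosed_le ?_ ?_))) <;> fun_prop
    have hScomp : IsCompact S := by
      refine ((isCompact_closedBall x0 ρ).prod (isCompact_Icc (a := (0:ℝ)) (b := ρ))).of_isClosed_subset
        hScl ?_
      rintro ⟨x, t⟩ ⟨h1, h2, h3, h4⟩
      exact ⟨by simpa [dist_eq_norm] using h1, h3, h4⟩
    have hΦc : ContinuousOn (fun p : Eu n × ℝ => Φ μ p.1 p.2) S := by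
      have c1 : ContinuousOn (fun p : Eu n × ℝ => w (p.1 + p.2 • bv i)) S :=
        hw.continuousOn.comp (by fun_prop) fun p hp =>
          (hmem p.1 hp.1 (hδ0.trans_le hp.2.1) p.2 (by rw [abs_of_nonneg hp.2.2.1]; exact hp.2.2.2)).1
      have c2 : ContinuousOn (fun p : Eu n × ℝ => w (p.1 - p.2 • bv i)) S :=
        hw.continuousOn.comp (by fun_prop) fun p hp =>
          (hmem' p.1 hp.1 (hδ0.trans_le hp.2.1) p.2 (by rw [abs_of_nonneg hp.2.2.1]; exact hp.2.2.2))
      have c3 : ContinuousOn (fun p : Eu n × ℝ => Real.log (p.1 ln)) S :=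
        ContinuousOn.log (by fun_prop) fun p hp => (hδ0.trans_le hp.2.1).ne'
      simp only [hΦ, hg]
      refine (c1.sub c2).sub ((ContinuousOn.add (ContinuousOn.add ?_ ?_) ?_).sub
        (continuousOn_const.mul c3))
      all_goals fun_prop
    have hx'S : (x', t') ∈ S := ⟨hx', (bd x' hx' hxn' t' ht0' ht1' hpos).2.1.le, ht0', ht1'⟩
    obtain ⟨⟨x1, t1⟩, hp1, hmax⟩ := hScomp.exists_isMaxOn ⟨_, hx'S⟩ hΦc
    have hpos1 : 0 < Φ μ x1 t1 := hpos.trans_le (hmax hx'S)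
    have hx1n : 0 < x1 ln := hδ0.trans_le hp1.2.1
    obtain ⟨i1, i2, i3, i4⟩ := bd x1 hp1.1 hx1n t1 hp1.2.2.1 hp1.2.2.2 hpos1
    have hSn : S ∈ 𝓝 (x1, t1) := by
      have o : IsOpen {p : Eu n × ℝ | ‖p.1 - x0‖ < ρ ∧ δ < p.1 ln ∧ 0 < p.2 ∧ p.2 < ρ} := by
        refine IsOpen.and (isOpen_lt ?_ ?_) (IsOpen.and (isOpen_lt ?_ ?_)
          (IsOpen.and (isOpen_lt ?_ ?_) (isOpen_lt ?_ ?_))) <;> fun_prop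
      exact mem_of_superset (o.mem_nhds ⟨i1, i2, i3, i4⟩)
        fun p hp => ⟨hp.1.le, hp.2.1.le, hp.2.2.1.le, hp.2.2.2.le⟩
    have hlocal : ∀ (y : Eu n) (τ : ℝ), IsLocalMax (fun s : ℝ => Φ μ (x1 + s • y) (t1 + s * τ)) 0 := by
      intro y τ
      have hc : ContinuousAt (fun s : ℝ => (x1 + s • y, t1 + s * τ)) 0 := by fun_prop
      have : ∀ᶠ s in 𝓝 (0:ℝ), (x1 + s • y, t1 + s * τ) ∈ S := hc.eventually_mem (by simpa using hSn)
      filter_upwards [this] with s hs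
      simpa using hmax hs
    have ht1a : |t1| ≤ ρ := by rw [abs_of_pos i3]; exact i4.le
    set xp := x1 + t1 • bv i with hxp
    set xm := x1 - t1 • bv i with hxm
    have hxpU : xp ∈ halfBall n ln r := (hmem x1 i1.le hx1n t1 ht1a).1
    have hxmU : xm ∈ halfBall n ln r := hmem' x1 i1.le hx1n t1 ht1a
    have hxpn : xp ln = x1 ln := by simp [hxp, hi.symm]
    have hxmn : xm ln = x1 ln := by simp [hxm, hi.symm]
    -- spatial directions
    have hsp : ∀ y : Eu n,
        fderiv ℝ w xp y - fderiv ℝ w xm y - (4 * M / ρ ^ 2) * inner ℝ (x1 - x0) y + κ * y ln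
          + μ * (y ln / x1 ln) = 0 ∧
        D2 w xp y y - D2 w xm y y - (4 * M / ρ ^ 2) * ‖y‖ ^ 2 - μ * (y ln ^ 2 / x1 ln ^ 2) ≤ 0 := by
      intro y
      have j1 := hasJet_line hUo hw hxpU y
      have j2 := hasJet_line hUo hw hxmU y
      have j3 := hasJet_quad (2 * M / ρ ^ 2 * ‖x1 - x0‖ ^ 2
          + 2 * M * ((1 + k1) * (t1 / ρ) - k1 * (t1 / ρ) ^ 2) + κ * (1 - x1 ln))
          (2 * M / ρ ^ 2 * (2 * inner ℝ (x1 - x0) y) - κ * y ln) (2 * M / ρ ^ 2 * ‖y‖ ^ 2)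
      have j4 := (hasJet_log (q := y ln) hx1n).const_mul μ
      have j := (j1.sub j2).sub (j3.sub j4)
      have hlm := hlocal y 0
      have heq : (fun s : ℝ => Φ μ (x1 + s • y) (t1 + s * 0)) = fun s =>
          w (xp + s • y) - w (xm + s • y) - ((2 * M / ρ ^ 2 * ‖x1 - x0‖ ^ 2
          + 2 * M * ((1 + k1) * (t1 / ρ) - k1 * (t1 / ρ) ^ 2) + κ * (1 - x1 ln)) +
          (2 * M / ρ ^ 2 * (2 * inner ℝ (x1 - x0) y) - κ * y ln) * s +
          (2 * M / ρ ^ 2 * ‖y‖ ^ 2) * s ^ 2 - μ * Real.log (x1 ln + s * y ln)) := by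
        funext s
        have n1 : ‖x1 + s • y - x0‖ ^ 2 = ‖x1 - x0‖ ^ 2 + 2 * s * inner ℝ (x1 - x0) y
            + s ^ 2 * ‖y‖ ^ 2 := by
          rw [show x1 + s • y - x0 = (x1 - x0) + s • y by abel, norm_add_sq_real, inner_smul_right,
            norm_smul, mul_pow, Real.norm_eq_abs, sq_abs]
          ring
        have n2 : x1 + s • y + t1 • bv i = xp + s • y := by rw [hxp]; abel
        have n3 : x1 + s • y - t1 • bv i = xm + s • y := by rw [hxm]; abel
        have n4 : (x1 + s • y) ln = x1 ln + s * y ln := by simp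
        simp only [hΦ, hg, mul_zero, add_zero, n1, n2, n3, n4]
        ring
      rw [heq] at hlm
      obtain ⟨q1, q2⟩ := j.localMax hlm
      constructor
      · linear_combination q1
      · have : μ * (-(y ln ^ 2) / x1 ln ^ 2) = - (μ * (y ln ^ 2 / x1 ln ^ 2)) := by ring
        have : 2 * (2 * M / ρ ^ 2 * ‖y‖ ^ 2) = 4 * M / ρ ^ 2 * ‖y‖ ^ 2 := by ring
        linarith
    have htd : D2 w xp (bv i) (bv i) - D2 w xm (bv i) (bv i) + 4 * M / ρ ^ 2 * k1 ≤ 0 := by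
      have j1 := hasJet_line hUo hw hxpU (bv i)
      have j2 := hasJet_line hUo hw hxmU (-(bv i))
      have j3 := hasJet_quad (2 * M / ρ ^ 2 * ‖x1 - x0‖ ^ 2
          + 2 * M * ((1 + k1) * (t1 / ρ) - k1 * (t1 / ρ) ^ 2) + κ * (1 - x1 ln)
          - μ * Real.log (x1 ln))
          (2 * M * ((1 + k1) / ρ - 2 * k1 * t1 / ρ ^ 2)) (-(2 * M * k1 / ρ ^ 2))
      have j := (j1.sub j2).sub j3
      have hlm := hlocal 0 1
      have heq : (fun s : ℝ => Φ μ (x1 + s • (0 : Eu n)) (t1 + s * 1)) = fun s =>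
          w (xp + s • bv i) - w (xm + s • (-(bv i))) - ((2 * M / ρ ^ 2 * ‖x1 - x0‖ ^ 2
          + 2 * M * ((1 + k1) * (t1 / ρ) - k1 * (t1 / ρ) ^ 2) + κ * (1 - x1 ln)
          - μ * Real.log (x1 ln)) +
          (2 * M * ((1 + k1) / ρ - 2 * k1 * t1 / ρ ^ 2)) * s +
          (-(2 * M * k1 / ρ ^ 2)) * s ^ 2) := by
        funext s
        have n2 : x1 + (t1 + s) • bv i = xp + s • bv i := by rw [hxp, add_smul]; abel
        have n3 : x1 - (t1 + s) • bv i = xm + s • (-(bv i)) := by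
          rw [hxm, add_smul, smul_neg]; abel
        simp only [hΦ, hg, smul_zero, add_zero, mul_one, n2, n3]
        ring
      rw [heq] at hlm
      obtain ⟨q1, q2⟩ := j.localMax hlm
      simp only [map_neg, ContinuousLinearMap.neg_apply, neg_neg] at q2
      have : 2 * (-(2 * M * k1 / ρ ^ 2)) = -(4 * M / ρ ^ 2 * k1) := by ring
      linarith
    -- contract with the coefficients
    set T : Eu n →L[ℝ] Eu n →L[ℝ] ℝ := D2 w xp - D2 w xm - (4 * M / ρ ^ 2) • idF
      - (μ / x1 ln ^ 2) • coF ln with hT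
    have hTyy : ∀ y, T y y = D2 w xp y y - D2 w xm y y - (4 * M / ρ ^ 2) * ‖y‖ ^ 2
        - μ * (y ln ^ 2 / x1 ln ^ 2) := by
      intro y
      simp only [hT, sub_apply, smul_apply, smul_eq_mul, idF_self, coF_apply]
      ring
    have hTe := hTyy (bv i)
    rw [norm_bv, bvn] at hTe
    have hqT : qf a T ≤ lam * (-(4 * M / ρ ^ 2 * k1) - 4 * M / ρ ^ 2) := by
      rw [hv T]
      have h1 : ∑ k, T (v k) (v k) ≤ 0 := Finset.sum_nonpos fun k _ => by
        rw [hTyy]; exact (hsp (v k)).2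
      have h2 : T (bv i) (bv i) ≤ -(4 * M / ρ ^ 2 * k1) - 4 * M / ρ ^ 2 := by
        rw [hTe]; simp; linarith
      have h3 := mul_le_mul_of_nonneg_left h2 hl.le
      linarith
    have hqT2 : qf a T = qf a (D2 w xp) - qf a (D2 w xm) - (4 * M / ρ ^ 2) * ∑ k, a k k
        - μ / x1 ln ^ 2 * a ln ln := by
      rw [hT, qf_sub, qf_sub, qf_sub, qf_smul, qf_smul, qf_idF, qf_coF]
    have htr : ∑ k, a k k ≤ n * Lam := by
      calc ∑ k, a k k ≤ ∑ _k : Fin n, Lam := Finset.sum_le_sum fun k _ => (ha.diag k).2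
        _ = _ := by simp
    have hfo := (hsp (bv ln)).1
    have e1 := (abs_le.1 (hL xp hxpU)).1
    have e2 := (abs_le.1 (hL xm hxmU)).2
    have e3 : (inner ℝ (x1 - x0) (bv ln) : ℝ) = x1 ln - x0 ln := by
      rw [EuclideanSpace.inner_single_right]; simp
    have e4 : (bv ln : Eu n) ln = 1 := by rw [bv_apply]; simp
    rw [e3, e4] at hfo
    simp only [opL, hxpn, hxmn] at e1 e2
    set A := 4 * M / ρ ^ 2 with hA
    have hA0 : 0 ≤ A := by positivity
    set p := fderiv ℝ w xp (bv ln)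
    set q := fderiv ℝ w xm (bv ln)
    set X := x1 ln with hX
    have hpq : p - q = A * (X - x0 ln) - κ - μ / X := by
      have : μ * (1 / X) = μ / X := by ring
      linarith
    have h5 : b * a ln ln / X * (p - q) = b * a ln ln / X * (A * (X - x0 ln)) - 2 * ε / X
        - b * (μ / X ^ 2 * a ln ln) := by
      rw [hpq, mul_sub, mul_sub, ← hκ1]
      field_simp
    have h6 : b * a ln ln / X * (A * (X - x0 ln)) ≤ b * Lam * A := by
      have : b * a ln ln / X * (A * (X - x0 ln)) = b * a ln ln * A * ((X - x0 ln) / X) := by ring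
      rw [this]
      have h7 : (X - x0 ln) / X ≤ 1 := by rw [div_le_one hx1n]; linarith [hx0'.2]
      calc b * a ln ln * A * ((X - x0 ln) / X) ≤ b * a ln ln * A * 1 :=
            mul_le_mul_of_nonneg_left h7 (by positivity)
        _ ≤ b * Lam * A := by
            rw [mul_one]
            gcongr
    have h8 : 0 < (b - 1) * (μ / X ^ 2 * a ln ln) := by
      have : 0 < b - 1 := by linarith
      positivity
    have h9 : A * ∑ k, a k k ≤ A * (n * Lam) := mul_le_mul_of_nonneg_left htr hA0
    have h10 : lam * (-(A * k1) - A) = -(A * (n * Lam + b * Lam)) - lam * A := by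
      rw [← hk1l]; ring
    have h11 : 0 ≤ lam * A := by positivity
    have h12 : 2 * ε / X = ε / X + ε / X := by ring
    have h13 : b * a ln ln / X * (p - q) = b * a ln ln / X * p - b * a ln ln / X * q := by ring
    rw [hqT2, h10] at hqT
    linarith
  have hlim : ∀ μ > 0, w (x0 + t0 • bv i) - w (x0 - t0 • bv i) ≤ g 0 x0 t0
      - μ * Real.log (x0 ln) := by
    intro μ hμ
    have := claim μ hμ x0 (by simpa using hρ0.le) hx0'.2 t0 ht0 ht1
    simp only [hΦ, hg] at this ⊢
    linarith
  have h0 : w (x0 + t0 • bv i) - w (x0 - t0 • bv i) ≤ g 0 x0 t0 := by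
    refine le_of_forall_pos_le_add fun η hη => ?_
    set l := |Real.log (x0 ln)| + 1 with hl'
    have hl0 : 0 < l := by positivity
    have := hlim (η / l) (by positivity)
    have h1 : -(η / l * Real.log (x0 ln)) ≤ η / l * l := by
      rw [← mul_neg]
      refine mul_le_mul_of_nonneg_left ?_ (by positivity)
      have := neg_abs_le (Real.log (x0 ln))
      linarith
    have h2 : η / l * l = η := by field_simp
    linarith
  refine h0.trans ?_
  have e1 : 0 ≤ M * k1 * (t0 / ρ) ^ 2 := by positivity
  have e2 : 0 ≤ κ * x0 ln := mul_nonneg hκ0 hx0'.2.le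
  simp only [hg, sub_self, norm_zero]
  linarith

section avg
variable {E G : Type*} [NormedAddCommGroup E] [NormedSpace ℝ E] [ProperSpace E]
  [NormedAddCommGroup G] [NormedSpace ℝ G]

/-- The average of `w` over the segment from `x` to `x + h`. -/
def avg (h : E) (w : E → G) (x : E) : G := ∫ s in (0:ℝ)..1, w (x + s • h)

theorem segment_tube {U : Set E} (hU : IsOpen U) {h x : E}
    (hx : ∀ s ∈ Icc (0:ℝ) 1, x + s • h ∈ U) :
    ∃ K ⊆ U, IsCompact K ∧ ∃ δ > 0, ∀ y ∈ Metric.ball x δ, ∀ s ∈ Icc (0:ℝ) 1, y + s • h ∈ K := by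
  set S := (fun s : ℝ => x + s • h) '' Icc (0:ℝ) 1 with hS
  have hSc : IsCompact S := isCompact_Icc.image (by fun_prop)
  have hSU : S ⊆ U := by
    rintro _ ⟨s, hs, rfl⟩; exact hx s hs
  obtain ⟨δ, hδ, hsub⟩ := hSc.exists_cthickening_subset_open hU hSU
  refine ⟨_, hsub, hSc.cthickening, δ, hδ, fun y hy s hs => ?_⟩
  refine Metric.mem_cthickening_of_dist_le _ (x + s • h) _ _ ⟨s, hs, rfl⟩ ?_
  simpa using (Metric.mem_ball.1 hy).le

theorem continuousOn_segment {U : Set E} {F : E → G} (hF : ContinuousOn F U) {h x : E}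
    (hx : ∀ s ∈ Icc (0:ℝ) 1, x + s • h ∈ U) :
    ContinuousOn (fun s : ℝ => F (x + s • h)) (Icc 0 1) :=
  hF.comp (by fun_prop) fun s hs => hx s hs

theorem intervalIntegrable_segment {U : Set E} {F : E → G} (hF : ContinuousOn F U) {h x : E}
    (hx : ∀ s ∈ Icc (0:ℝ) 1, x + s • h ∈ U) :
    IntervalIntegrable (fun s : ℝ => F (x + s • h)) volume 0 1 := by
  refine ContinuousOn.intervalIntegrable ?_
  rw [uIcc_of_le zero_le_one]
  exact continuousOn_segment hF hx

theorem continuousOn_avg {U V : Set E} (hU : IsOpen U) {h : E} {F : E → G} (hF : ContinuousOn F U)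
    (hx : ∀ x ∈ V, ∀ s ∈ Icc (0:ℝ) 1, x + s • h ∈ U) : ContinuousOn (avg h F) V := by
  intro x hxV
  refine ContinuousAt.continuousWithinAt ?_
  obtain ⟨K, hKU, hK, δ, hδ, hball⟩ := segment_tube hU (hx x hxV)
  obtain ⟨B, hB⟩ := hK.exists_bound_of_continuousOn (hF.mono hKU)
  have hnh : Metric.ball x δ ∈ 𝓝 x := Metric.ball_mem_nhds x hδ
  have hI : ∀ t : ℝ, t ∈ uIoc (0:ℝ) 1 → t ∈ Icc (0:ℝ) 1 := fun t ht => by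
    rw [uIoc_of_le zero_le_one] at ht; exact Ioc_subset_Icc_self ht
  refine intervalIntegral.continuousAt_of_dominated_interval (bound := fun _ => B) ?_ ?_ (by simp) ?_
  · filter_upwards [hnh] with y hy
    have := intervalIntegrable_segment hF (h := h) (x := y) fun s hs => hKU (hball y hy s hs)
    rw [intervalIntegrable_iff] at this
    exact this.aestronglyMeasurable
  · filter_upwards [hnh] with y hy
    refine Eventually.of_forall fun t ht => hB _ (hball y hy t (hI t ht))
  · refine Eventually.of_forall fun t ht => ?_
    have h1 : ContinuousAt F (x + t • h) := hF.continuousAt (hU.mem_nhds (hx x hxV t (hI t ht)))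
    exact ContinuousAt.comp (f := fun y : E => y + t • h) h1 (by fun_prop)

theorem hasFDerivAt_avg {U : Set E} (hU : IsOpen U) {h x : E} {F : E → G}
    (hF : ContDiffOn ℝ 1 F U) (hx : ∀ s ∈ Icc (0:ℝ) 1, x + s • h ∈ U) :
    HasFDerivAt (avg h F) (avg h (fderiv ℝ F) x) x := by
  obtain ⟨K, hKU, hK, δ, hδ, hball⟩ := segment_tube hU hx
  have hF' : ContinuousOn (fderiv ℝ F) U := hF.continuousOn_fderiv_of_isOpen hU (by norm_num)
  obtain ⟨B, hB⟩ := hK.exists_bound_of_continuousOn (hF'.mono hKU)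
  have hnh : Metric.ball x δ ∈ 𝓝 x := Metric.ball_mem_nhds x hδ
  have hI : ∀ t : ℝ, t ∈ uIoc (0:ℝ) 1 → t ∈ Icc (0:ℝ) 1 := fun t ht => by
    rw [uIoc_of_le zero_le_one] at ht; exact Ioc_subset_Icc_self ht
  refine intervalIntegral.hasFDerivAt_integral_of_dominated_of_fderiv_le (𝕜 := ℝ)
    (F := fun x t => F (x + t • h)) (F' := fun x t => fderiv ℝ F (x + t • h))
    (bound := fun _ => B) hnh ?_ (intervalIntegrable_segment hF.continuousOn hx) ?_ ?_ (by simp) ?_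
  · filter_upwards [hnh] with y hy
    have := intervalIntegrable_segment hF.continuousOn (h := h) (x := y)
      fun s hs => hKU (hball y hy s hs)
    rw [intervalIntegrable_iff] at this
    exact this.aestronglyMeasurable
  · have := intervalIntegrable_segment hF' hx
    rw [intervalIntegrable_iff] at this
    exact this.aestronglyMeasurable
  · exact Eventually.of_forall fun t ht y hy => hB _ (hball y hy t (hI t ht))
  · refine Eventually.of_forall fun t ht y hy => ?_
    have h1 : HasFDerivAt F (fderiv ℝ F (y + t • h)) (y + t • h) :=
      ((hF.contDiffAt (hU.mem_nhds (hKU (hball y hy t (hI t ht))))).differentiableAt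
        (by norm_num)).hasFDerivAt
    exact (hasFDerivAt_comp_add_right (t • h)).2 h1

theorem contDiffOn_one_of {V : Set E} (hV : IsOpen V) {F : E → G} {F' : E → E →L[ℝ] G}
    (h1 : ∀ x ∈ V, HasFDerivAt F (F' x) x) (h2 : ContinuousOn F' V) : ContDiffOn ℝ 1 F V := by
  have : ContDiffOn ℝ (0 + 1) F V := by
    rw [contDiffOn_succ_iff_fderiv_of_isOpen hV]
    refine ⟨fun x hx => (h1 x hx).differentiableAt.differentiableWithinAt, by simp, ?_⟩
    rw [contDiffOn_zero]
    exact h2.congr fun x hx => (h1 x hx).fderiv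
  simpa using this

theorem contDiffOn_two_of {V : Set E} (hV : IsOpen V) {F : E → G} {F' : E → E →L[ℝ] G}
    (h1 : ∀ x ∈ V, HasFDerivAt F (F' x) x) (h2 : ContDiffOn ℝ 1 F' V) : ContDiffOn ℝ 2 F V := by
  have : ContDiffOn ℝ (1 + 1) F V := by
    rw [contDiffOn_succ_iff_fderiv_of_isOpen hV]
    refine ⟨fun x hx => (h1 x hx).differentiableAt.differentiableWithinAt, by simp, ?_⟩
    exact h2.congr fun x hx => (h1 x hx).fderiv
  norm_num at this
  exact this

theorem contDiffOn_one_avg {U V : Set E} (hU : IsOpen U) (hV : IsOpen V) {h : E} {F : E → G}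
    (hF : ContDiffOn ℝ 1 F U) (hx : ∀ x ∈ V, ∀ s ∈ Icc (0:ℝ) 1, x + s • h ∈ U) :
    ContDiffOn ℝ 1 (avg h F) V :=
  contDiffOn_one_of hV (fun x hxV => hasFDerivAt_avg hU hF (hx x hxV))
    (continuousOn_avg hU (hF.continuousOn_fderiv_of_isOpen hU (by norm_num)) hx)

variable {U V : Set E} {h : E} {w : E → ℝ}

theorem contDiffOn_two_avg (hU : IsOpen U) (hV : IsOpen V)
    (hF : ContDiffOn ℝ 2 w U) (hx : ∀ x ∈ V, ∀ s ∈ Icc (0:ℝ) 1, x + s • h ∈ U) :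
    ContDiffOn ℝ 2 (avg h w) V :=
  contDiffOn_two_of hV (fun x hxV => hasFDerivAt_avg hU (hF.of_le (by norm_num)) (hx x hxV))
    (contDiffOn_one_avg hU hV (C2on_fderiv hU hF) hx)

theorem fderiv_avg (hU : IsOpen U) (hF : ContDiffOn ℝ 2 w U) {x : E}
    (hx : ∀ s ∈ Icc (0:ℝ) 1, x + s • h ∈ U) (v : E) :
    fderiv ℝ (avg h w) x v = avg h (fun y => fderiv ℝ w y v) x := by
  rw [(hasFDerivAt_avg hU (hF.of_le (by norm_num)) hx).fderiv]
  exact ContinuousLinearMap.intervalIntegral_apply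
    (intervalIntegrable_segment (C2on_fderiv hU hF).continuousOn hx) v

theorem D2_avg (hU : IsOpen U) (hV : IsOpen V) (hF : ContDiffOn ℝ 2 w U)
    (hx : ∀ x ∈ V, ∀ s ∈ Icc (0:ℝ) 1, x + s • h ∈ U) {x : E} (hxV : x ∈ V) (u v : E) :
    D2 (avg h w) x u v = avg h (fun y => D2 w y u v) x := by
  have h1 : fderiv ℝ (avg h w) =ᶠ[𝓝 x] avg h (fderiv ℝ w) := by
    filter_upwards [hV.mem_nhds hxV] with y hy
    exact (hasFDerivAt_avg hU (hF.of_le (by norm_num)) (hx y hy)).fderiv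
  have h2 := hasFDerivAt_avg hU (C2on_fderiv hU hF) (hx x hxV)
  unfold D2
  rw [h1.fderiv_eq, h2.fderiv]
  have i1 := intervalIntegrable_segment (G := E →L[ℝ] E →L[ℝ] ℝ) (C2on_continuousOn_D2 hU hF) (hx x hxV)
  have e1 : avg h (fderiv ℝ (fderiv ℝ w)) x u = avg h (fun y => D2 w y u) x :=
    ContinuousLinearMap.intervalIntegral_apply i1 u
  rw [e1]
  have hc : ContinuousOn (fun y => D2 w y u) U :=
    (ContinuousLinearMap.apply ℝ (E →L[ℝ] ℝ) u).continuous.comp_continuousOn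
      (C2on_continuousOn_D2 hU hF)
  exact ContinuousLinearMap.intervalIntegral_apply (intervalIntegrable_segment hc (hx x hxV)) v

theorem abs_avg_le {M : ℝ} {x : E} (hM : ∀ s ∈ Icc (0:ℝ) 1, |w (x + s • h)| ≤ M) :
    |avg h w x| ≤ M := by
  have := intervalIntegral.norm_integral_le_of_norm_le_const (a := (0:ℝ)) (b := 1) (C := M)
    (f := fun s : ℝ => w (x + s • h)) fun s hs => by
      rw [uIoc_of_le zero_le_one] at hs
      exact hM s (Ioc_subset_Icc_self hs)
  simpa [avg] using this

theorem avg_fderiv_self (hU : IsOpen U) (hF : ContDiffOn ℝ 2 w U) {x : E}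
    (hx : ∀ s ∈ Icc (0:ℝ) 1, x + s • h ∈ U) :
    avg h (fun y => fderiv ℝ w y h) x = w (x + h) - w x := by
  have := intervalIntegral.integral_eq_sub_of_hasDerivAt (a := (0:ℝ)) (b := 1)
    (f := fun s : ℝ => w (x + s • h)) (f' := fun s => fderiv ℝ w (x + s • h) h) (fun s hs => by
      rw [uIcc_of_le zero_le_one] at hs
      exact hasDerivAt_line (C2on_differentiableAt hU hF (hx s hs)))
    (intervalIntegrable_segment (F := fun y => fderiv ℝ w y h) (U := U)
      ((C2on_fderiv hU hF).continuousOn.clm_apply continuousOn_const) hx)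
  simpa [avg] using this

theorem avg_sub_self (hw : ContinuousOn w U) {x : E}
    (hx : ∀ s ∈ Icc (0:ℝ) 1, x + s • h ∈ U) :
    avg h w x - w x = ∫ s in (0:ℝ)..1, (w (x + s • h) - w x) := by
  rw [intervalIntegral.integral_sub (intervalIntegrable_segment hw hx) (by simp)]
  simp [avg]

end avg

/-- Approximate solutions of the frozen homogeneous equation on a half ball. -/
structure Sol {n : ℕ} (ln : Fin n) (b : ℝ) (a : Fin n → Fin n → ℝ) (r M ε : ℝ) (w : Eu n → ℝ) :
    Prop where
  c2 : ContDiffOn ℝ 2 w (halfBall n ln r)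
  bd : ∀ x ∈ halfBall n ln r, |w x| ≤ M
  op : ∀ x ∈ halfBall n ln r, |opL ln b a w x| ≤ ε / x ln
  nb : ∃ B, ∀ x ∈ halfBall n ln r, |fderiv ℝ w x (bv ln)| ≤ B
  M0 : 0 ≤ M
  e0 : 0 ≤ ε

/-- The constant in the tangential difference estimate. -/
def cDiff (n : ℕ) (lam Lam b r : ℝ) : ℝ :=
  1 + 8 * (1 + (n * Lam + b * Lam) / lam) / r + 2 / (b * lam)

section
variable {n : ℕ} {ln i : Fin n} {lam Lam b r M ε : ℝ} {a : Fin n → Fin n → ℝ} {w w' : Eu n → ℝ}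

theorem halfBall_mono {r r' : ℝ} (h : r' ≤ r) : halfBall n ln r' ⊆ halfBall n ln r :=
  inter_subset_inter_left _ (Metric.ball_subset_ball h)

theorem halfBall_add {r r' σ : ℝ} (hi : i ≠ ln) (h : r' + |σ| ≤ r) {x : Eu n}
    (hx : x ∈ halfBall n ln r') : x + σ • bv i ∈ halfBall n ln r := by
  rw [mem_halfBall] at hx ⊢
  refine ⟨?_, ?_⟩
  · calc ‖x + σ • bv i‖ ≤ ‖x‖ + ‖σ • (bv i : Eu n)‖ := norm_add_le _ _
      _ = ‖x‖ + |σ| := by rw [norm_smul, norm_bv]; simp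
      _ < r := by linarith [hx.1]
  · simpa [hi.symm] using hx.2

theorem Ell.pos (ha : Ell lam Lam a) (hl : 0 < lam) (i : Fin n) : 0 < Lam :=
  hl.trans_le ((ha.diag i).1.trans (ha.diag i).2)

theorem one_le_cDiff (hl : 0 < lam) (hL : 0 < Lam) (hb : 1 < b) (hr : 0 < r) :
    1 ≤ cDiff n lam Lam b r := by
  unfold cDiff
  have h1 : 0 ≤ 8 * (1 + (n * Lam + b * Lam) / lam) / r := by positivity
  have h2 : 0 ≤ 2 / (b * lam) := by positivity
  linarith

theorem Sol.mono {r' M' ε' : ℝ} (h : Sol ln b a r M ε w) (hr : r' ≤ r) (hM : M ≤ M')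
    (hε : ε ≤ ε') : Sol ln b a r' M' ε' w where
  c2 := h.c2.mono (halfBall_mono hr)
  bd x hx := (h.bd x (halfBall_mono hr hx)).trans hM
  op x hx := (h.op x (halfBall_mono hr hx)).trans <| by
    have := (mem_halfBall.1 hx).2
    gcongr
  nb := h.nb.imp fun B hB x hx => hB x (halfBall_mono hr hx)
  M0 := h.M0.trans hM
  e0 := h.e0.trans hε

theorem eqOn_fderiv {E : Type*} [NormedAddCommGroup E] [NormedSpace ℝ E] {F : Type*}
    [NormedAddCommGroup F] [NormedSpace ℝ F] {w w' : E → F} {U : Set E} (hU : IsOpen U)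
    (h : EqOn w w' U) : EqOn (fderiv ℝ w) (fderiv ℝ w') U := fun _ hx =>
  (h.eventuallyEq_of_mem (hU.mem_nhds hx)).fderiv_eq

theorem eqOn_opL {U : Set (Eu n)} (hU : IsOpen U) (h : EqOn w w' U) :
    EqOn (opL ln b a w) (opL ln b a w') U := fun x hx => by
  simp only [opL, D2]
  rw [eqOn_fderiv hU (eqOn_fderiv hU h) hx, eqOn_fderiv hU h hx]

theorem Sol.congr (h : Sol ln b a r M ε w) (he : EqOn w w' (halfBall n ln r)) :
    Sol ln b a r M ε w' where
  c2 := h.c2.congr fun x hx => (he hx).symm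
  bd x hx := by rw [← he hx]; exact h.bd x hx
  op x hx := by rw [← eqOn_opL (isOpen_halfBall ln r) he hx]; exact h.op x hx
  nb := h.nb.imp fun B hB x hx => by
    rw [← eqOn_fderiv (isOpen_halfBall ln r) he hx]; exact hB x hx
  M0 := h.M0
  e0 := h.e0

theorem opL_neg (x : Eu n) : opL ln b a (fun y => -w y) x = -opL ln b a w x := by
  have h1 : fderiv ℝ (fun y => -w y) = fun y => -fderiv ℝ w y := by
    funext y; exact fderiv_fun_neg
  have h2 : fderiv ℝ (fun y => -fderiv ℝ w y) x = -D2 w x := fderiv_fun_neg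
  simp only [opL, D2, h1]
  rw [h2]
  simp [qf, Finset.sum_neg_distrib]
  ring

theorem Sol.diff (h : Sol ln b a r M ε w) (hi : i ≠ ln) (ha : Ell lam Lam a) (hl : 0 < lam)
    (hb : 1 < b) (hr : 0 < r) (hr1 : r ≤ 1) {x : Eu n} (hx : x ∈ halfBall n ln (r / 2)) {t : ℝ}
    (ht0 : 0 ≤ t) (ht : t ≤ r / 4) :
    |w (x + t • bv i) - w (x - t • bv i)| ≤ cDiff n lam Lam b r * (t * M + ε) := by
  have hL := ha.pos hl ln
  have h1 := diff_le_aux hi ha hl hb hr hr1 h.e0 h.c2 h.bd h.op hx ht0 ht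
  have h2 := diff_le_aux (w := fun y => -w y) hi ha hl hb hr hr1 h.e0 h.c2.neg
    (fun x hx => by rw [abs_neg]; exact h.bd x hx)
    (fun x hx => by rw [opL_neg, abs_neg]; exact h.op x hx) hx ht0 ht
  have h3 : 2 * M * (1 + (n * Lam + b * Lam) / lam) * (t / (r / 4)) + 2 * ε / (b * a ln ln) ≤
      cDiff n lam Lam b r * (t * M + ε) := by
    have e1 : 2 * M * (1 + (n * Lam + b * Lam) / lam) * (t / (r / 4)) =
        8 * (1 + (n * Lam + b * Lam) / lam) / r * (t * M) := by field_simp; ring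
    have e2 : 2 * ε / (b * a ln ln) ≤ 2 / (b * lam) * ε := by
      rw [div_mul_eq_mul_div]
      have := h.e0
      gcongr
      exact (ha.diag ln).1
    have e3 : 0 ≤ 8 * (1 + (n * Lam + b * Lam) / lam) / r := by positivity
    have e4 : 0 ≤ 2 / (b * lam) := by positivity
    have e5 : 0 ≤ t * M := mul_nonneg ht0 h.M0
    unfold cDiff
    rw [e1]
    nlinarith [h.e0, mul_nonneg e3 h.e0, mul_nonneg e4 e5]
  rw [abs_le]
  constructor <;> linarith

/-- The tangential difference quotient. -/
def dq (i : Fin n) (σ : ℝ) (w : Eu n → ℝ) (x : Eu n) : ℝ := (w (x + σ • bv i) - w x) / σ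

theorem fderiv_dq {F : Type*} [NormedAddCommGroup F] [NormedSpace ℝ F] {w : Eu n → F}
    {h x : Eu n} {σ : ℝ} (h1 : DifferentiableAt ℝ w (x + h)) (h2 : DifferentiableAt ℝ w x) :
    fderiv ℝ (fun x => σ • (w (x + h) - w x)) x = σ • (fderiv ℝ w (x + h) - fderiv ℝ w x) := by
  have e1 : DifferentiableAt ℝ (fun x => w (x + h)) x :=
    (differentiableAt_comp_add_right h).2 h1
  have := (e1.hasFDerivAt.fun_sub h2.hasFDerivAt).fun_const_smul σ
  rw [this.fderiv, fderiv_comp_add_right]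

theorem fderiv_dq' {r' σ : ℝ} (hi : i ≠ ln) (h : r' + |σ| ≤ r)
    (hw : ContDiffOn ℝ 2 w (halfBall n ln r)) {x : Eu n} (hx : x ∈ halfBall n ln r') :
    fderiv ℝ (dq i σ w) x = σ⁻¹ • (fderiv ℝ w (x + σ • bv i) - fderiv ℝ w x) := by
  have hrr : r' ≤ r := by linarith [abs_nonneg σ]
  have hd : ∀ {y}, y ∈ halfBall n ln r → DifferentiableAt ℝ w y := fun hy =>
    C2on_differentiableAt (isOpen_halfBall ln r) hw hy
  rw [← fderiv_dq (hd (halfBall_add hi h hx)) (hd (halfBall_mono hrr hx))]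
  congr 1
  funext y
  simp [dq, div_eq_inv_mul]

theorem D2_dq' {r' σ : ℝ} (hi : i ≠ ln) (h : r' + |σ| ≤ r)
    (hw : ContDiffOn ℝ 2 w (halfBall n ln r)) {x : Eu n} (hx : x ∈ halfBall n ln r') :
    D2 (dq i σ w) x = σ⁻¹ • (D2 w (x + σ • bv i) - D2 w x) := by
  have hrr : r' ≤ r := by linarith [abs_nonneg σ]
  have hd : ∀ {y}, y ∈ halfBall n ln r → DifferentiableAt ℝ (fderiv ℝ w) y := fun hy =>
    C2on_differentiableAt_fderiv (isOpen_halfBall ln r) hw hy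
  rw [D2, D2, D2, ← fderiv_dq (hd (halfBall_add hi h hx)) (hd (halfBall_mono hrr hx))]
  exact eqOn_fderiv (isOpen_halfBall ln r') (fun y hy => fderiv_dq' hi h hw hy) hx

theorem contDiffOn_dq {r' σ : ℝ} (hi : i ≠ ln) (h : r' + |σ| ≤ r)
    (hw : ContDiffOn ℝ 2 w (halfBall n ln r)) : ContDiffOn ℝ 2 (dq i σ w) (halfBall n ln r') := by
  have hrr : r' ≤ r := by linarith [abs_nonneg σ]
  have h1 : ContDiffOn ℝ 2 (fun x => w (x + σ • bv i)) (halfBall n ln r') :=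
    hw.comp (by fun_prop) fun x hx => halfBall_add hi h hx
  exact (h1.sub (hw.mono (halfBall_mono hrr))).div_const σ

theorem Sol.dq (h : Sol ln b a r M ε w) (hi : i ≠ ln) (ha : Ell lam Lam a) (hl : 0 < lam)
    (hb : 1 < b) (hr : 0 < r) (hr1 : r ≤ 1) {σ : ℝ} (hσ : 0 < σ) (hσr : σ ≤ r / 4) :
    Sol ln b a (r / 4) (cDiff n lam Lam b r * (M + ε / σ)) (2 * ε / σ) (dq i σ w) := by
  have hL := ha.pos hl ln
  have hrr : r / 4 + |σ| ≤ r := by rw [abs_of_pos hσ]; linarith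
  have h14 : r / 4 ≤ r := by linarith
  have hC := one_le_cDiff (n := n) hl hL hb hr
  have hM0 := h.M0
  have he0 := h.e0
  refine ⟨contDiffOn_dq hi hrr h.c2, fun x hx => ?_, fun x hx => ?_, ?_, ?_, ?_⟩
  · have hx2 : x + (σ / 2) • bv i ∈ halfBall n ln (r / 2) :=
      halfBall_add hi (by rw [abs_of_pos (by positivity)]; linarith) hx
    have := h.diff hi ha hl hb hr hr1 hx2 (t := σ / 2) (by positivity) (by linarith)
    rw [add_assoc, ← add_smul, add_halves, add_sub_cancel_right] at this
    rw [_root_.dq, abs_div, abs_of_pos hσ, div_le_iff₀ hσ]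
    refine this.trans ?_
    have : cDiff n lam Lam b r * (M + ε / σ) * σ = cDiff n lam Lam b r * (σ * M + ε) := by
      field_simp
    rw [this]
    gcongr
    linarith
  · have h1 := h.op _ (halfBall_add hi hrr hx)
    have h2 := h.op _ (halfBall_mono h14 hx)
    have hxn := (mem_halfBall.1 hx).2
    have e0 : (x + σ • bv i) ln = x ln := by simp [hi.symm]
    have e : opL ln b a (_root_.dq i σ w) x =
        σ⁻¹ * (opL ln b a w (x + σ • bv i) - opL ln b a w x) := by
      simp only [opL]
      rw [fderiv_dq' hi hrr h.c2 hx, D2_dq' hi hrr h.c2 hx, qf_smul, qf_sub, e0]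
      simp only [smul_apply, sub_apply, smul_eq_mul]
      ring
    rw [e, abs_mul, abs_of_pos (inv_pos.2 hσ)]
    rw [e0] at h1
    calc σ⁻¹ * |opL ln b a w (x + σ • bv i) - opL ln b a w x|
        ≤ σ⁻¹ * (ε / x ln + ε / x ln) := by
          gcongr
          exact (abs_sub _ _).trans (add_le_add h1 h2)
      _ = _ := by field_simp; ring
  · obtain ⟨B, hB⟩ := h.nb
    refine ⟨σ⁻¹ * (B + B), fun x hx => ?_⟩
    rw [fderiv_dq' hi hrr h.c2 hx]
    simp only [smul_apply, sub_apply, smul_eq_mul]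
    rw [abs_mul, abs_of_pos (inv_pos.2 hσ)]
    gcongr
    exact (abs_sub _ _).trans (add_le_add (hB _ (halfBall_add hi hrr hx))
      (hB _ (halfBall_mono h14 hx)))
  · positivity
  · positivity

theorem segment_halfBall {r' σ : ℝ} (hi : i ≠ ln) (hσ : 0 ≤ σ) (hr : r' + σ ≤ r) :
    ∀ x ∈ halfBall n ln r', ∀ s ∈ Icc (0:ℝ) 1, x + s • σ • bv i ∈ halfBall n ln r := by
  intro x hx s hs
  rw [smul_smul]
  refine halfBall_add hi ?_ hx
  rw [abs_of_nonneg (mul_nonneg hs.1 hσ)]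
  nlinarith [hs.2]

theorem intervalIntegrable_fun_sum {ι : Type*} (s : Finset ι) {f : ι → ℝ → ℝ}
    (h : ∀ p ∈ s, IntervalIntegrable (f p) volume 0 1) :
    IntervalIntegrable (fun t => ∑ p ∈ s, f p t) volume 0 1 := by
  have := IntervalIntegrable.sum s h
  rwa [Finset.sum_fn] at this

theorem Sol.avg (h : Sol ln b a r M ε w) (hi : i ≠ ln) {r' σ : ℝ} (hσ : 0 ≤ σ) (hr : r' + σ ≤ r) :
    Sol ln b a r' M ε (avg (σ • bv i) w) := by
  have hU := isOpen_halfBall (n := n) ln r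
  have hV := isOpen_halfBall (n := n) ln r'
  have hseg := segment_halfBall (n := n) hi hσ hr
  have hco : ∀ (x : Eu n) (s : ℝ), (x + s • σ • bv i) ln = x ln := fun x s => by simp [hi.symm]
  refine ⟨contDiffOn_two_avg hU hV h.c2 hseg, fun x hx => abs_avg_le fun s hs =>
    h.bd _ (hseg x hx s hs), fun x hx => ?_, ?_, h.M0, h.e0⟩
  · have e : opL ln b a (_root_.avg (σ • bv i) w) x = _root_.avg (σ • bv i) (opL ln b a w) x := by
      have hD : ∀ u v : Eu n, IntervalIntegrable (fun s : ℝ => D2 w (x + s • σ • bv i) u v)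
          volume 0 1 := fun u v => by
        have hc : ContinuousOn (fun y => D2 w y u v) (halfBall n ln r) :=
          (ContinuousLinearMap.apply ℝ ℝ v).continuous.comp_continuousOn
            ((ContinuousLinearMap.apply ℝ (Eu n →L[ℝ] ℝ) u).continuous.comp_continuousOn
              (C2on_continuousOn_D2 hU h.c2))
        exact intervalIntegrable_segment hc (hseg x hx)
      have hD1 : IntervalIntegrable (fun s : ℝ => fderiv ℝ w (x + s • σ • bv i) (bv ln))
          volume 0 1 := by
        have hc : ContinuousOn (fun y => fderiv ℝ w y (bv ln)) (halfBall n ln r) :=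
          (ContinuousLinearMap.apply ℝ ℝ (bv ln)).continuous.comp_continuousOn
              (C2on_fderiv hU h.c2).continuousOn
        exact intervalIntegrable_segment hc (hseg x hx)
      simp only [opL, qf]
      simp_rw [D2_avg hU hV h.c2 hseg hx]
      rw [fderiv_avg hU h.c2 (hseg x hx)]
      simp only [_root_.avg, opL, qf, hco]
      rw [intervalIntegral.integral_add, intervalIntegral.integral_const_mul,
        intervalIntegral.integral_finsetSum]
      · congr 1
        refine Finset.sum_congr rfl fun p _ => ?_
        rw [intervalIntegral.integral_finsetSum]
        · refine Finset.sum_congr rfl fun q _ => ?_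
          rw [intervalIntegral.integral_const_mul]
        · exact fun q _ => (hD _ _).const_mul _
      · exact fun p _ => intervalIntegrable_fun_sum _ fun q _ => (hD _ _).const_mul _
      · exact intervalIntegrable_fun_sum _ fun p _ =>
          intervalIntegrable_fun_sum _ fun q _ => (hD _ _).const_mul _
      · exact hD1.const_mul _
    rw [e]
    refine abs_avg_le fun s hs => ?_
    have := h.op _ (hseg x hx s hs)
    rwa [hco] at this
  · obtain ⟨B, hB⟩ := h.nb
    refine ⟨B, fun x hx => ?_⟩
    rw [fderiv_avg hU h.c2 (hseg x hx)]
    exact abs_avg_le fun s hs => hB _ (hseg x hx s hs)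

end

/-- Approximate solutions all of whose tangential derivatives up to order `k` are again
approximate solutions. -/
def Good {n : ℕ} (ln : Fin n) (b : ℝ) (a : Fin n → Fin n → ℝ) (r M ε : ℝ) :
    ℕ → (Eu n → ℝ) → Prop
  | 0, w => Sol ln b a r M ε w
  | k + 1, w => Sol ln b a r M ε w ∧ ∀ i, i ≠ ln → Good ln b a r M ε k (pd w i)

section
variable {n : ℕ} {ln i : Fin n} {lam Lam b r M ε : ℝ} {a : Fin n → Fin n → ℝ}

theorem Good.sol {k : ℕ} {w : Eu n → ℝ} (h : Good ln b a r M ε k w) : Sol ln b a r M ε w := by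
  cases k with
  | zero => exact h
  | succ k => exact h.1

theorem Good.congr {k : ℕ} {w w' : Eu n → ℝ} (h : Good ln b a r M ε k w)
    (he : EqOn w w' (halfBall n ln r)) : Good ln b a r M ε k w' := by
  induction k generalizing w w' with
  | zero => exact Sol.congr h he
  | succ k ih =>
    refine ⟨h.1.congr he, fun i hi => ih (h.2 i hi) fun x hx => ?_⟩
    simp only [pd]
    rw [eqOn_fderiv (isOpen_halfBall ln r) he hx]

theorem Good.mono {k : ℕ} {w : Eu n → ℝ} {r' M' ε' : ℝ} (h : Good ln b a r M ε k w) (hr : r' ≤ r)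
    (hM : M ≤ M') (hε : ε ≤ ε') : Good ln b a r' M' ε' k w := by
  induction k generalizing w with
  | zero => exact Sol.mono h hr hM hε
  | succ k ih => exact ⟨h.1.mono hr hM hε, fun i hi => ih (h.2 i hi)⟩

theorem Good.avg {k : ℕ} {w : Eu n → ℝ} (h : Good ln b a r M ε k w) (hi : i ≠ ln) {r' σ : ℝ}
    (hσ : 0 ≤ σ) (hr : r' + σ ≤ r) : Good ln b a r' M ε k (avg (σ • bv i) w) := by
  induction k generalizing w with
  | zero => exact Sol.avg h hi hσ hr
  | succ k ih =>
    refine ⟨h.1.avg hi hσ hr, fun j hj => (ih (h.2 j hj)).congr fun x hx => ?_⟩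
    exact (fderiv_avg (isOpen_halfBall ln r) h.1.c2 (segment_halfBall hi hσ hr x hx) _).symm

theorem pd_dq {w : Eu n → ℝ} {r' σ : ℝ} (hi : i ≠ ln) (h : r' + |σ| ≤ r)
    (hw : ContDiffOn ℝ 2 w (halfBall n ln r)) (j : Fin n) {x : Eu n} (hx : x ∈ halfBall n ln r') :
    pd (dq i σ w) j x = dq i σ (pd w j) x := by
  rw [pd, fderiv_dq' hi h hw hx]
  simp [dq, pd, div_eq_inv_mul]

theorem Good.dq {k : ℕ} {w : Eu n → ℝ} (h : Good ln b a r M ε k w) (hi : i ≠ ln)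
    (ha : Ell lam Lam a) (hl : 0 < lam)
    (hb : 1 < b) (hr : 0 < r) (hr1 : r ≤ 1) {σ : ℝ} (hσ : 0 < σ) (hσr : σ ≤ r / 4) :
    Good ln b a (r / 4) (cDiff n lam Lam b r * (M + ε / σ)) (2 * ε / σ) k (dq i σ w) := by
  induction k generalizing w with
  | zero => exact Sol.dq h hi ha hl hb hr hr1 hσ hσr
  | succ k ih =>
    refine ⟨h.1.dq hi ha hl hb hr hr1 hσ hσr, fun j hj => (ih (h.2 j hj)).congr fun x hx => ?_⟩
    exact (pd_dq hi (by rw [abs_of_pos hσ]; linarith) h.1.c2 j hx).symm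

theorem pd_avg_self {w : Eu n → ℝ} (hw : ContDiffOn ℝ 2 w (halfBall n ln r)) (hi : i ≠ ln)
    {r' σ : ℝ} (hσ : 0 < σ) (hr : r' + σ ≤ r) {x : Eu n} (hx : x ∈ halfBall n ln r') :
    pd (_root_.avg (σ • bv i) w) i x = _root_.dq i σ w x := by
  have hseg := segment_halfBall hi hσ.le hr x hx
  have h1 := avg_fderiv_self (isOpen_halfBall ln r) hw hseg
  have h2 := fderiv_avg (isOpen_halfBall ln r) hw hseg (bv i)
  rw [pd, h2, _root_.dq, eq_div_iff hσ.ne', ← h1]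
  simp [_root_.avg, mul_comm]

theorem Sol.avg_close {w : Eu n → ℝ} (h : Sol ln b a r M ε w) (hi : i ≠ ln)
    (ha : Ell lam Lam a) (hl : 0 < lam)
    (hb : 1 < b) (hr : 0 < r) (hr1 : r ≤ 1) {σ : ℝ} (hσ : 0 < σ) (hσr : σ ≤ r / 4) {x : Eu n}
    (hx : x ∈ halfBall n ln (r / 4)) :
    |_root_.avg (σ • bv i) w x - w x| ≤ cDiff n lam Lam b r * (σ * M + ε) := by
  have hseg := segment_halfBall (r := r) hi hσ.le (by linarith) x hx
  have hC := one_le_cDiff (n := n) hl (ha.pos hl ln) hb hr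
  rw [avg_sub_self h.c2.continuousOn hseg]
  have := intervalIntegral.norm_integral_le_of_norm_le_const (a := (0:ℝ)) (b := 1)
    (C := cDiff n lam Lam b r * (σ * M + ε))
    (f := fun s : ℝ => w (x + s • σ • bv i) - w x) fun s hs => by
      rw [uIoc_of_le zero_le_one] at hs
      have hs0 : 0 ≤ s * σ / 2 := by have := hs.1; positivity
      have hs1 : s * σ / 2 ≤ σ / 2 := by
        have := mul_le_mul_of_nonneg_right hs.2 hσ.le
        linarith
      have hx2 : x + (s * σ / 2) • bv i ∈ halfBall n ln (r / 2) :=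
        halfBall_add hi (by rw [abs_of_nonneg hs0]; linarith) hx
      have := h.diff hi ha hl hb hr hr1 hx2 hs0 (by linarith)
      rw [add_assoc, ← add_smul, add_halves, add_sub_cancel_right] at this
      rw [Real.norm_eq_abs, smul_smul]
      refine this.trans ?_
      have := h.M0
      gcongr
      linarith
  simpa using this

end

theorem raise_list {n : ℕ} (ln : Fin n) {lam Lam b : ℝ} (hl : 0 < lam) (hL : 0 < Lam) (hb : 1 < b)
    (l : List (Fin n)) (hl' : ∀ i ∈ l, i ≠ ln) {r : ℝ} (hr : 0 < r) (hr1 : r ≤ 1) :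
    ∃ r' C σ0 : ℝ, 0 < r' ∧ r' ≤ r ∧ 1 ≤ C ∧ 0 < σ0 ∧ ∀ σ, 0 < σ → σ ≤ σ0 → ∃ Cσ : ℝ, 1 ≤ Cσ ∧
      ∀ a : Fin n → Fin n → ℝ, Ell lam Lam a → ∀ M ε k w, Good ln b a r M ε k w →
        ∃ W, Good ln b a r' (C * M + Cσ * ε) (Cσ * ε) k W ∧
          (∀ i ∈ l, Good ln b a r' (C * M + Cσ * ε) (Cσ * ε) k (pd W i)) ∧
          ∀ x ∈ halfBall n ln r', |W x - w x| ≤ C * σ * M + Cσ * ε := by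
  induction l with
  | nil =>
    refine ⟨r, 1, 1, hr, le_rfl, le_rfl, one_pos, fun σ hσ hσ1 => ⟨1, le_rfl, fun a ha M ε k w hw =>
      ⟨w, hw.mono le_rfl ?_ ?_, by simp, fun x _ => ?_⟩⟩⟩
    · linarith [hw.sol.e0]
    · linarith [hw.sol.e0]
    · have := hw.sol.e0
      have := hw.sol.M0
      simp only [sub_self, abs_zero]
      positivity
  | cons j l ih =>
    obtain ⟨r1, C1, σ1, hr1p, hr1r, hC1, hσ1, H⟩ := ih fun i hi => hl' i (by simp [hi])
    have hj : j ≠ ln := hl' j (by simp)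
    have hr11 : r1 ≤ 1 := hr1r.trans hr1
    set c := cDiff n lam Lam b r1 with hc
    have hc1 : 1 ≤ c := one_le_cDiff hl hL hb hr1p
    refine ⟨r1 / 4, c * C1 + C1, min σ1 (r1 / 4), by positivity, by linarith, by nlinarith,
      by positivity, fun σ hσ hσ' => ?_⟩
    have hσr : σ ≤ r1 / 4 := hσ'.trans (min_le_right _ _)
    obtain ⟨D, hD, H⟩ := H σ hσ (hσ'.trans (min_le_left _ _))
    have hD2 : D ≤ D * (2 * c + 1 + (c + 2) / σ) := by
      have : 0 ≤ (c + 2) / σ := by positivity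
      nlinarith
    refine ⟨D * (2 * c + 1 + (c + 2) / σ), hD.trans hD2, fun a ha M ε k w hw => ?_⟩
    obtain ⟨W, h1, h2, h3⟩ := H a ha M ε k w hw
    have hM0 := hw.sol.M0
    have he0 := hw.sol.e0
    have hs0 : 0 ≤ 1 / σ := by positivity
    have hb1 : C1 * M + D * ε ≤ (c * C1 + C1) * M + D * (2 * c + 1 + (c + 2) / σ) * ε := by
      have : 0 ≤ c * C1 * M := by positivity
      have := mul_le_mul_of_nonneg_right hD2 he0
      linarith
    have hb2 : D * ε ≤ D * (2 * c + 1 + (c + 2) / σ) * ε := mul_le_mul_of_nonneg_right hD2 he0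
    have hq : r1 / 4 + σ ≤ r1 := by linarith
    have h14 : r1 / 4 ≤ r1 := by linarith
    have hDe : 0 ≤ D * ε := by positivity
    have hDes : 0 ≤ D * ε / σ := by positivity
    refine ⟨avg (σ • bv j) W, (h1.avg hj hσ.le hq).mono le_rfl hb1 hb2, ?_, fun x hx => ?_⟩
    · intro i hi
      by_cases hij : i = j
      · subst hij
        have := (h1.dq hj ha hl hb hr1p hr11 hσ hσr).congr fun x hx =>
          (pd_avg_self h1.sol.c2 hj hσ hq hx).symm
        refine this.mono le_rfl ?_ ?_
        · rw [← hc]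
          have e : (c * C1 + C1) * M + D * (2 * c + 1 + (c + 2) / σ) * ε -
            c * (C1 * M + D * ε + D * ε / σ) = C1 * M + c * (D * ε) + D * ε + 2 * (D * ε / σ) := by
            field_simp; ring
          have : 0 ≤ C1 * M + c * (D * ε) + D * ε + 2 * (D * ε / σ) := by positivity
          linarith
        · have e : D * (2 * c + 1 + (c + 2) / σ) * ε - 2 * (D * ε) / σ =
            2 * c * (D * ε) + D * ε + c * (D * ε / σ) := by
            field_simp; ring
          have : 0 ≤ 2 * c * (D * ε) + D * ε + c * (D * ε / σ) := by positivity
          linarith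
      · have hil : i ∈ l := by simpa [hij] using hi
        refine ((h2 i hil).avg hj hσ.le hq).congr (fun x hx => ?_) |>.mono le_rfl hb1 hb2
        exact (fderiv_avg (isOpen_halfBall ln r1) h1.sol.c2
          (segment_halfBall hj hσ.le hq x hx) _).symm
    · have e1 := h1.sol.avg_close hj ha hl hb hr1p hr11 hσ hσr hx
      have e2 := h3 x (halfBall_mono h14 hx)
      have e3 := abs_sub_le (avg (σ • bv j) W x) (W x) (w x)
      rw [← hc] at e1
      have e : (c * C1 + C1) * σ * M + D * (2 * c + 1 + (c + 2) / σ) * ε -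
          (c * (σ * (C1 * M + D * ε) + D * ε) + (C1 * σ * M + D * ε)) =
          c * (D * ε) * (1 - σ) + (c + 2) * (D * ε / σ) := by
        field_simp; ring
      have : 0 ≤ c * (D * ε) * (1 - σ) + (c + 2) * (D * ε / σ) := by
        have : 0 ≤ 1 - σ := by linarith
        positivity
      linarith

theorem raise_sol {n : ℕ} (ln : Fin n) {lam Lam b : ℝ} (hl : 0 < lam) (hL : 0 < Lam) (hb : 1 < b)
    (k : ℕ) :
    ∃ r' C σ0 : ℝ, 0 < r' ∧ r' ≤ 1 ∧ 1 ≤ C ∧ 0 < σ0 ∧ ∀ σ, 0 < σ → σ ≤ σ0 → ∃ Cσ : ℝ, 1 ≤ Cσ ∧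
      ∀ a : Fin n → Fin n → ℝ, Ell lam Lam a → ∀ M ε w, Sol ln b a 1 M ε w →
        ∃ W, Good ln b a r' (C * M + Cσ * ε) (Cσ * ε) k W ∧
          ∀ x ∈ halfBall n ln r', |W x - w x| ≤ C * σ * M + Cσ * ε := by
  induction k with
  | zero =>
    refine ⟨1, 1, 1, one_pos, le_rfl, le_rfl, one_pos, fun σ hσ hσ1 => ⟨1, le_rfl,
      fun a ha M ε w hw => ⟨w, Sol.mono hw le_rfl ?_ ?_, fun x _ => ?_⟩⟩⟩
    · linarith [hw.e0]
    · linarith [hw.e0]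
    · have := hw.e0
      have := hw.M0
      simp only [sub_self, abs_zero]
      positivity
  | succ k ih =>
    obtain ⟨r1, C1, σ1, hr1, hr11, hC1, hσ1, H1⟩ := ih
    obtain ⟨r2, C2, σ2, hr2, hr21, hC2, hσ2, H2⟩ := raise_list ln hl hL hb
      ((Finset.univ.erase ln).toList) (by simp) hr1 hr11
    refine ⟨r2, C2 * C1 + C1, min σ1 σ2, hr2, hr21.trans hr11, by nlinarith, by positivity,
      fun σ hσ hσ' => ?_⟩
    obtain ⟨D1, hD1, H1⟩ := H1 σ hσ (hσ'.trans (min_le_left _ _))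
    obtain ⟨D2, hD2, H2⟩ := H2 σ hσ (hσ'.trans (min_le_right _ _))
    refine ⟨C2 * (1 + σ) * D1 + D2 * D1 + D1, by
      have : 0 ≤ C2 * (1 + σ) * D1 := by positivity
      have : 0 ≤ D2 * D1 := by positivity
      linarith, fun a ha M ε w hw => ?_⟩
    obtain ⟨W1, g1, c1⟩ := H1 a ha M ε w hw
    obtain ⟨W2, g2, g3, c2⟩ := H2 a ha _ _ k W1 g1
    have hM0 := hw.M0
    have he0 := hw.e0
    have p1 : 0 ≤ C2 * D1 * ε := by positivity
    have p2 : 0 ≤ C2 * σ * D1 * ε := by positivity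
    have p3 : 0 ≤ D1 * ε := by positivity
    have p4 : 0 ≤ C1 * M := by positivity
    have p5 : 0 ≤ D2 * D1 * ε := by positivity
    have hm1 : C2 * (C1 * M + D1 * ε) + D2 * (D1 * ε) ≤
        (C2 * C1 + C1) * M + (C2 * (1 + σ) * D1 + D2 * D1 + D1) * ε := by
      linarith
    have hm2 : D2 * (D1 * ε) ≤ (C2 * (1 + σ) * D1 + D2 * D1 + D1) * ε := by
      linarith
    refine ⟨W2, ⟨g2.sol.mono le_rfl hm1 hm2, fun i hi => (g3 i ?_).mono le_rfl hm1 hm2⟩,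
      fun x hx => ?_⟩
    · simpa using hi
    · have e1 := c1 x (halfBall_mono hr21 hx)
      have e2 := c2 x hx
      have e3 := abs_sub_le (W2 x) (W1 x) (w x)
      linarith

/-- One-sided estimate for the singular first-order equation `f' + (b / s) f = O(H + ε / s)`. -/
theorem ode_le {b H ε B X : ℝ} (hb : 1 < b) (hH : 0 ≤ H) (hε : 0 ≤ ε) (hX : 0 < X) {f f' : ℝ → ℝ}
    (hf : ∀ s, 0 < s → s ≤ X → HasDerivAt f (f' s) s)
    (hfb : ∀ s, 0 < s → s ≤ X → f s ≤ B)
    (he : ∀ s, 0 < s → s ≤ X → f' s + b / s * f s ≤ H + ε / s) : f X ≤ H * X + ε := by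
  have key : ∀ μ : ℝ, 0 < μ → f X ≤ H * X + ε + μ / X := fun μ hμ => by
    set δ := min X (μ / (|B| + 1)) with hδ
    have hδ0 : 0 < δ := by positivity
    have hδX : δ ≤ X := min_le_left _ _
    have hBδ : B ≤ μ / δ := by
      rw [le_div_iff₀ hδ0]
      have h1 : δ ≤ μ / (|B| + 1) := min_le_right _ _
      rw [le_div_iff₀ (by positivity)] at h1
      nlinarith [le_abs_self B]
    have hcont : ContinuousOn f (Icc δ X) := fun s hs =>
      (hf s (hδ0.trans_le hs.1) hs.2).continuousAt.continuousWithinAt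
    refine image_le_of_deriv_right_lt_deriv_boundary' (f' := f')
      (B := fun s => H * s + ε + μ / s) (B' := fun s => H - μ / s ^ 2) hcont
      (fun s hs => (hf s (hδ0.trans_le hs.1) hs.2.le).hasDerivWithinAt) ?_ ?_ ?_ ?_
      (right_mem_Icc.2 hδX)
    · have := hfb δ hδ0 hδX
      have : 0 ≤ H * δ := by positivity
      linarith
    · refine ContinuousOn.add (by fun_prop) (continuousOn_const.div continuousOn_id fun s hs => ?_)
      exact (hδ0.trans_le hs.1).ne'
    · intro s hs
      have hs0 : s ≠ 0 := (hδ0.trans_le hs.1).ne'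
      have h1 := ((((hasDerivAt_id s).const_mul H).add_const ε).fun_add
        ((hasDerivAt_inv hs0).const_mul μ)).hasDerivWithinAt (s := Ici s)
      refine (h1.congr_deriv ?_).congr (fun y _ => ?_) ?_
      · field_simp; ring
      · simp [div_eq_mul_inv]
      · simp [div_eq_mul_inv]
    · intro s hs heq
      have hs0 : 0 < s := hδ0.trans_le hs.1
      have h1 := he s hs0 hs.2.le
      rw [heq] at h1
      have e : b / s * (H * s + ε + μ / s) = b * H + b * (ε / s) + b * (μ / s ^ 2) := by
        field_simp
      rw [e] at h1
      have h2 : 0 < μ / s ^ 2 := by positivity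
      have h3 : 0 ≤ ε / s := by positivity
      nlinarith
  refine le_of_forall_pos_le_add fun η hη => ?_
  have := key (η * X) (by positivity)
  rwa [mul_div_assoc, div_self hX.ne', mul_one] at this

theorem ode_abs_le {b H ε B X : ℝ} (hb : 1 < b) (hH : 0 ≤ H) (hε : 0 ≤ ε) (hX : 0 < X)
    {f f' : ℝ → ℝ} (hf : ∀ s, 0 < s → s ≤ X → HasDerivAt f (f' s) s)
    (hfb : ∀ s, 0 < s → s ≤ X → |f s| ≤ B)
    (he : ∀ s, 0 < s → s ≤ X → |f' s + b / s * f s| ≤ H + ε / s) : |f X| ≤ H * X + ε := by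
  rw [abs_le]
  constructor
  · have := ode_le (f := fun s => -f s) (f' := fun s => -f' s) (B := B) hb hH hε hX
      (fun s h1 h2 => (hf s h1 h2).fun_neg) (fun s h1 h2 => (neg_le_abs _).trans (hfb s h1 h2))
      (fun s h1 h2 => by
        have := (neg_le_abs _).trans (he s h1 h2)
        linarith)
    linarith
  · exact ode_le (B := B) hb hH hε hX hf (fun s h1 h2 => (le_abs_self _).trans (hfb s h1 h2))
      (fun s h1 h2 => (le_abs_self _).trans (he s h1 h2))

section
variable {n : ℕ} {ln : Fin n} {lam Lam b : ℝ} {a : Fin n → Fin n → ℝ}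

theorem qf_split (hs : ∀ i j, a i j = a j i) {T : Eu n →L[ℝ] Eu n →L[ℝ] ℝ}
    (hT : ∀ x y, T x y = T y x) (ln : Fin n) :
    qf a T = a ln ln * T (bv ln) (bv ln) +
      2 * (∑ i ∈ Finset.univ.erase ln, a i ln * T (bv i) (bv ln)) +
      ∑ i ∈ Finset.univ.erase ln, ∑ j ∈ Finset.univ.erase ln, a i j * T (bv i) (bv j) := by
  have h1 : ∀ i, ∑ j, a i j * T (bv i) (bv j) = a i ln * T (bv i) (bv ln) +
      ∑ j ∈ Finset.univ.erase ln, a i j * T (bv i) (bv j) := fun i =>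
    (Finset.add_sum_erase _ _ (Finset.mem_univ ln)).symm
  unfold qf
  rw [← Finset.add_sum_erase _ _ (Finset.mem_univ ln), h1 ln]
  simp_rw [h1]
  rw [Finset.sum_add_distrib]
  have h2 : ∑ j ∈ Finset.univ.erase ln, a ln j * T (bv ln) (bv j) =
      ∑ i ∈ Finset.univ.erase ln, a i ln * T (bv i) (bv ln) :=
    Finset.sum_congr rfl fun i _ => by rw [hs, hT]
  rw [h2]
  ring

/-- Dilation factor for characteristics. -/
def cN (n : ℕ) (lam Lam : ℝ) : ℝ := 2 + 2 * n * Lam / lam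

theorem one_le_cN (hl : 0 < lam) (hL : 0 < Lam) : 2 ≤ cN n lam Lam := by
  unfold cN
  have : 0 ≤ 2 * n * Lam / lam := by positivity
  linarith

/-- The characteristic direction. -/
def chi (ln : Fin n) (a : Fin n → Fin n → ℝ) : Eu n :=
  bv ln + ∑ i ∈ Finset.univ.erase ln, (2 * a i ln / a ln ln) • bv i

theorem chi_ln : (chi ln a) ln = 1 := by
  simp only [chi, PiLp.add_apply, WithLp.ofLp_sum, Finset.sum_apply, PiLp.smul_apply, bv_apply]
  rw [Finset.sum_eq_zero]
  · simp
  · intro i hi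
    simp [Finset.ne_of_mem_erase hi]

theorem norm_chi_le (ha : Ell lam Lam a) (hl : 0 < lam) : ‖chi ln a‖ ≤ cN n lam Lam - 1 := by
  have hL := ha.pos hl ln
  have h1 : ‖chi ln a‖ ≤ 1 + ∑ i ∈ Finset.univ.erase ln, 2 * Lam / lam := by
    refine (norm_add_le _ _).trans (add_le_add (norm_bv ln).le ((norm_sum_le _ _).trans
      (Finset.sum_le_sum fun i _ => ?_)))
    rw [norm_smul, norm_bv, mul_one, Real.norm_eq_abs, abs_div,
      abs_of_pos (hl.trans_le (ha.diag ln).1), abs_mul, abs_two]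
    have := ha.abs_le hl i ln
    have := (ha.diag ln).1
    gcongr
  have h2 : ∑ i ∈ Finset.univ.erase ln, 2 * Lam / lam ≤ ∑ _i : Fin n, 2 * Lam / lam :=
    Finset.sum_le_sum_of_subset_of_nonneg (Finset.erase_subset _ _) fun _ _ _ => by positivity
  simp only [Finset.sum_const, Finset.card_univ, Fintype.card_fin, nsmul_eq_mul] at h1 h2
  unfold cN
  have : (n : ℝ) * (2 * Lam / lam) = 2 * n * Lam / lam := by ring
  linarith

theorem sum_tang_le {S : Fin n → Fin n → ℝ} {A : ℝ} (hA : 0 ≤ A)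
    (h : ∀ i, i ≠ ln → ∀ j, j ≠ ln → |S i j| ≤ A) :
    |∑ i ∈ Finset.univ.erase ln, ∑ j ∈ Finset.univ.erase ln, S i j| ≤ n ^ 2 * A := by
  have hc : ((Finset.univ.erase ln).card : ℝ) ≤ n := by
    have := Finset.card_le_univ (Finset.univ.erase ln)
    rw [Fintype.card_fin] at this
    exact_mod_cast this
  calc _ ≤ ∑ i ∈ Finset.univ.erase ln, ∑ j ∈ Finset.univ.erase ln, |S i j| :=
        (Finset.abs_sum_le_sum_abs _ _).trans
          (Finset.sum_le_sum fun i _ => Finset.abs_sum_le_sum_abs _ _)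
    _ ≤ ∑ i ∈ Finset.univ.erase ln, ∑ j ∈ Finset.univ.erase ln, A :=
        Finset.sum_le_sum fun i hi => Finset.sum_le_sum fun j hj =>
          h i (Finset.ne_of_mem_erase hi) j (Finset.ne_of_mem_erase hj)
    _ = ((Finset.univ.erase ln).card : ℝ) * (((Finset.univ.erase ln).card : ℝ) * A) := by
        simp only [Finset.sum_const, nsmul_eq_mul]
    _ ≤ n * (n * A) := by gcongr
    _ = _ := by ring

/-- Along characteristics the equation becomes an ODE for the normal derivative. -/
theorem normal_bound (ha : Ell lam Lam a) (hl : 0 < lam) (hb : 1 < b) {ρ M2 ε : ℝ}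
    {w : Eu n → ℝ} (hw : ContDiffOn ℝ 2 w (halfBall n ln ρ))
    (hop : ∀ x ∈ halfBall n ln ρ, |opL ln b a w x| ≤ ε / x ln)
    (hnb : ∃ B, ∀ x ∈ halfBall n ln ρ, |fderiv ℝ w x (bv ln)| ≤ B)
    (he0 : 0 ≤ ε) (hM2 : 0 ≤ M2)
    (ht : ∀ x ∈ halfBall n ln ρ, ∀ i, i ≠ ln → ∀ j, j ≠ ln → |D2 w x (bv i) (bv j)| ≤ M2)
    {x : Eu n} (hx : x ∈ halfBall n ln (ρ / cN n lam Lam)) :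
    |fderiv ℝ w x (bv ln)| ≤ n ^ 2 * Lam / lam * M2 * x ln + ε / lam := by
  have hL := ha.pos hl ln
  have hc := one_le_cN (n := n) hl hL
  have hc0 : 0 < cN n lam Lam := by linarith
  have hU := isOpen_halfBall ln ρ
  rw [mem_halfBall, lt_div_iff₀ hc0] at hx
  obtain ⟨hx1, hxn⟩ := hx
  obtain ⟨B, hB⟩ := hnb
  have han := hl.trans_le (ha.diag ln).1
  set γ : ℝ → Eu n := fun s => (x - x ln • chi ln a) + s • chi ln a with hγ
  have hγn : ∀ s, (γ s) ln = s := fun s => by simp [hγ, chi_ln]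
  have hγm : ∀ s, 0 < s → s ≤ x ln → γ s ∈ halfBall n ln ρ := fun s h1 h2 => by
    rw [mem_halfBall, hγn]
    refine ⟨?_, h1⟩
    have : γ s = x + (s - x ln) • chi ln a := by simp only [hγ]; module
    rw [this]
    have h3 : |s - x ln| ≤ ‖x‖ := by
      rw [abs_le]
      have := (le_abs_self _).trans (abs_coord_le x ln)
      constructor <;> linarith
    calc _ ≤ ‖x‖ + ‖x‖ * (cN n lam Lam - 1) := by
          refine (norm_add_le _ _).trans ?_
          rw [norm_smul, Real.norm_eq_abs]
          gcongr
          exact norm_chi_le ha hl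
      _ = ‖x‖ * cN n lam Lam := by ring
      _ < ρ := hx1
  have hγx : γ (x ln) = x := by simp [hγ]
  have main := ode_abs_le (b := b) (H := n ^ 2 * Lam / lam * M2) (ε := ε / lam) (B := B) (X := x ln)
    (f := fun s => fderiv ℝ w (γ s) (bv ln)) (f' := fun s => D2 w (γ s) (chi ln a) (bv ln))
    hb (by positivity) (by positivity) hxn (fun s h1 h2 => ?_) (fun s h1 h2 => hB _ (hγm s h1 h2))
    (fun s h1 h2 => ?_)
  · simpa only [hγx] using main
  · have h3 := hasDerivAt_line (C2on_differentiableAt_fderiv hU hw (hγm s h1 h2))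
    exact (ContinuousLinearMap.apply ℝ ℝ (bv ln : Eu n)).hasFDerivAt.comp_hasDerivAt s h3
  · have hm := hγm s h1 h2
    have h3 := hop _ hm
    rw [hγn] at h3
    have hsymm := C2on_symm hU hw hm
    have h4 : |∑ i ∈ Finset.univ.erase ln, ∑ j ∈ Finset.univ.erase ln,
        a i j * D2 w (γ s) (bv i) (bv j)| ≤ n ^ 2 * (Lam * M2) :=
      sum_tang_le (by positivity) fun i hi j hj => by
        rw [abs_mul]
        exact mul_le_mul (ha.abs_le hl i j) (ht _ hm i hi j hj) (abs_nonneg _) hL.le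
    have e1 : opL ln b a w (γ s) = a ln ln * (D2 w (γ s) (chi ln a) (bv ln) +
        b / s * fderiv ℝ w (γ s) (bv ln)) + ∑ i ∈ Finset.univ.erase ln,
        ∑ j ∈ Finset.univ.erase ln, a i j * D2 w (γ s) (bv i) (bv j) := by
      rw [opL, qf_split ha.symm hsymm ln, hγn]
      have : D2 w (γ s) (chi ln a) (bv ln) = D2 w (γ s) (bv ln) (bv ln) +
          ∑ i ∈ Finset.univ.erase ln, 2 * a i ln / a ln ln * D2 w (γ s) (bv i) (bv ln) := by
        simp [chi, map_add, map_sum, ContinuousLinearMap.sum_apply]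
      rw [this, mul_add, mul_add, Finset.mul_sum, Finset.mul_sum]
      have : ∀ i, a ln ln * (2 * a i ln / a ln ln * D2 w (γ s) (bv i) (bv ln)) =
        2 * (a i ln * D2 w (γ s) (bv i) (bv ln)) := fun i => by field_simp
      simp_rw [this]
      ring
    have e2 : |a ln ln * (D2 w (γ s) (chi ln a) (bv ln) + b / s * fderiv ℝ w (γ s) (bv ln))| ≤
        ε / s + n ^ 2 * (Lam * M2) := by
      rw [e1] at h3
      have := abs_sub (opL ln b a w (γ s)) (∑ i ∈ Finset.univ.erase ln,
        ∑ j ∈ Finset.univ.erase ln, a i j * D2 w (γ s) (bv i) (bv j))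
      rw [e1, add_sub_cancel_right] at this
      linarith
    rw [abs_mul, abs_of_pos han] at e2
    have e3 := (mul_le_mul_of_nonneg_right (ha.diag ln).1 (abs_nonneg _)).trans e2
    rw [mul_comm, ← le_div_iff₀ hl] at e3
    refine e3.trans (le_of_eq ?_)
    field_simp
    ring

theorem sum_bv (x : Eu n) : x = ∑ i, x i • bv i := by
  ext j
  rw [WithLp.ofLp_sum, Finset.sum_apply]
  simp [bv_apply, -EuclideanSpace.ofLp_single]

theorem clm_abs_le {ℓ : Eu n →L[ℝ] ℝ} {A : ℝ} (h : ∀ i, |ℓ (bv i)| ≤ A) : ‖ℓ‖ ≤ n * A := by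
  by_cases hn : n = 0
  · subst hn
    have : ℓ = 0 := by ext x; rw [Subsingleton.elim x 0]; simp
    simp [this]
  have hA : 0 ≤ A := (abs_nonneg _).trans (h ⟨0, Nat.pos_of_ne_zero hn⟩)
  refine ℓ.opNorm_le_bound (by positivity) fun x => ?_
  have e := sum_bv x
  calc ‖ℓ x‖ = |∑ i, x i * ℓ (bv i)| := by
        conv_lhs => rw [e, map_sum]
        simp [Real.norm_eq_abs]
    _ ≤ ∑ i, |x i * ℓ (bv i)| := Finset.abs_sum_le_sum_abs _ _
    _ ≤ ∑ _i : Fin n, ‖x‖ * A := Finset.sum_le_sum fun i _ => by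
        rw [abs_mul]
        exact mul_le_mul (abs_coord_le x i) (h i) (abs_nonneg _) (norm_nonneg _)
    _ = n * A * ‖x‖ := by simp; ring

theorem convex_halfBall (r : ℝ) : Convex ℝ (halfBall n ln r) := by
  refine (convex_ball _ _).inter fun x hx y hy s t hs ht hst => ?_
  simp only [mem_setOf_eq, PiLp.add_apply, PiLp.smul_apply, smul_eq_mul] at hx hy ⊢
  rcases hs.eq_or_lt with rfl | hs
  · rw [zero_add] at hst
    subst hst
    simpa using hy
  · have : 0 < s * x ln := mul_pos hs hx
    have : 0 ≤ t * y ln := mul_nonneg ht hy.le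
    linarith

theorem mvt_convex {g : Eu n → ℝ} {A : ℝ} {U : Set (Eu n)} (hU : Convex ℝ U)
    (hd : ∀ x ∈ U, DifferentiableAt ℝ g x)
    (h : ∀ x ∈ U, ∀ i, |fderiv ℝ g x (bv i)| ≤ A) {x y : Eu n} (hx : x ∈ U) (hy : y ∈ U) :
    |g x - g y| ≤ n * A * ‖x - y‖ :=
  hU.norm_image_sub_le_of_norm_fderiv_le hd (fun x hx => clm_abs_le (h x hx)) hy hx

/-- Quadratic polynomials. -/
def poly (p0 : ℝ) (p : Eu n →L[ℝ] ℝ) (Q : Eu n →L[ℝ] Eu n →L[ℝ] ℝ) (x : Eu n) : ℝ :=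
  p0 + p x + 1 / 2 * Q x x

/-- Admissible coefficients: no mixed normal terms. -/
structure PP (ln : Fin n) (p : Eu n →L[ℝ] ℝ) (Q : Eu n →L[ℝ] Eu n →L[ℝ] ℝ) : Prop where
  symm : ∀ x y, Q x y = Q y x
  pn : p (bv ln) = 0
  qn : ∀ i, i ≠ ln → Q (bv i) (bv ln) = 0

/-- The value of the operator on an admissible polynomial. -/
def LQ (ln : Fin n) (b : ℝ) (a : Fin n → Fin n → ℝ) (Q : Eu n →L[ℝ] Eu n →L[ℝ] ℝ) : ℝ :=
  qf a Q + b * a ln ln * Q (bv ln) (bv ln)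

variable {p0 : ℝ} {p : Eu n →L[ℝ] ℝ} {Q : Eu n →L[ℝ] Eu n →L[ℝ] ℝ}

theorem hasFDerivAt_poly (hQ : ∀ x y, Q x y = Q y x) (x : Eu n) :
    HasFDerivAt (poly p0 p Q) (p + Q x) x := by
  have h1 : HasFDerivAt (fun y => Q y y) ((2:ℝ) • Q x) x := by
    refine (Q.hasFDerivAt.clm_apply (hasFDerivAt_id x)).congr_fderiv ?_
    ext v
    simp [hQ v x]
    ring
  have := ((p.hasFDerivAt (x := x)).const_add p0).fun_add (h1.const_mul (1/2))
  refine this.congr_fderiv ?_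
  ext v
  simp

theorem fderiv_poly (hQ : ∀ x y, Q x y = Q y x) (x : Eu n) :
    fderiv ℝ (poly p0 p Q) x = p + Q x := (hasFDerivAt_poly hQ x).fderiv

theorem D2_poly (hQ : ∀ x y, Q x y = Q y x) (x : Eu n) : D2 (poly p0 p Q) x = Q := by
  have : fderiv ℝ (poly p0 p Q) = fun x => p + Q x := funext fun x => fderiv_poly hQ x
  rw [D2, this]
  exact (Q.hasFDerivAt.const_add p).fderiv

theorem contDiff_poly : ContDiff ℝ 2 (poly p0 p Q) := by
  unfold poly
  have : ContDiff ℝ 2 fun x => Q x x := Q.contDiff.clm_apply contDiff_id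
  exact (contDiff_const.add p.contDiff).add (contDiff_const.mul this)

theorem PP.Q_bv (h : PP ln p Q) (x : Eu n) : Q x (bv ln) = x ln * Q (bv ln) (bv ln) := by
  have e := sum_bv x
  conv_lhs => rw [e, map_sum, ContinuousLinearMap.sum_apply]
  rw [Finset.sum_eq_single ln]
  · simp
  · intro i _ hi
    simp [h.qn i hi]
  · simp

theorem opL_poly (h : PP ln p Q) {x : Eu n} (hx : x ln ≠ 0) :
    opL ln b a (poly p0 p Q) x = LQ ln b a Q := by
  rw [opL, fderiv_poly h.symm, D2_poly h.symm, LQ, add_apply, h.pn, h.Q_bv]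
  field_simp
  ring

theorem opL_sub {U : Set (Eu n)} (hU : IsOpen U) {v w : Eu n → ℝ} (hv : ContDiffOn ℝ 2 v U)
    (hw : ContDiffOn ℝ 2 w U) {x : Eu n} (hx : x ∈ U) :
    fderiv ℝ (fun y => v y - w y) x = fderiv ℝ v x - fderiv ℝ w x ∧
    D2 (fun y => v y - w y) x = D2 v x - D2 w x ∧
    opL ln b a (fun y => v y - w y) x = opL ln b a v x - opL ln b a w x := by
  have h1 : EqOn (fderiv ℝ (fun y => v y - w y)) (fun y => fderiv ℝ v y - fderiv ℝ w y) U :=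
    fun y hy => fderiv_fun_sub (C2on_differentiableAt hU hv hy) (C2on_differentiableAt hU hw hy)
  have h2 : D2 (fun y => v y - w y) x = D2 v x - D2 w x := by
    rw [D2, eqOn_fderiv hU h1 hx]
    exact fderiv_fun_sub (C2on_differentiableAt_fderiv hU hv hx)
      (C2on_differentiableAt_fderiv hU hw hx)
  refine ⟨h1 hx, h2, ?_⟩
  rw [opL, opL, opL, h2, h1 hx, qf_sub]
  simp only [sub_apply]
  ring

end

section
variable {n : ℕ} {ln : Fin n} {lam Lam b : ℝ} {a : Fin n → Fin n → ℝ}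

theorem fderiv_pd {w : Eu n → ℝ} {U : Set (Eu n)} (hU : IsOpen U) (hw : ContDiffOn ℝ 2 w U)
    {x : Eu n} (hx : x ∈ U) (i : Fin n) (v : Eu n) :
    fderiv ℝ (pd w i) x v = D2 w x v (bv i) := by
  have h := C2on_differentiableAt_fderiv hU hw hx
  have := (ContinuousLinearMap.apply ℝ ℝ (bv i : Eu n)).hasFDerivAt.comp x h.hasFDerivAt
  have h2 : fderiv ℝ (pd w i) x = _ := this.fderiv
  rw [h2]
  simp

theorem differentiableAt_pd {w : Eu n → ℝ} {U : Set (Eu n)} (hU : IsOpen U)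
    (hw : ContDiffOn ℝ 2 w U) {x : Eu n} (hx : x ∈ U) (i : Fin n) :
    DifferentiableAt ℝ (pd w i) x := by
  have h := C2on_differentiableAt_fderiv hU hw hx
  exact ((ContinuousLinearMap.apply ℝ ℝ (bv i : Eu n)).hasFDerivAt.comp x
    h.hasFDerivAt).differentiableAt

/-- Projection to the tangential directions. -/
def tanP (ln : Fin n) : Eu n →L[ℝ] Eu n :=
  ContinuousLinearMap.id ℝ (Eu n) - (EuclideanSpace.proj ln : Eu n →L[ℝ] ℝ).smulRight (bv ln)

theorem tanP_ln : tanP ln (bv ln) = 0 := by simp [tanP]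

theorem tanP_tan {i : Fin n} (hi : i ≠ ln) : tanP ln (bv i) = bv i := by
  simp [tanP, hi.symm]

theorem good_approx_aux (hl : 0 < lam) (hb : 1 < b) (ha : Ell lam Lam a) {r1 M ε θ : ℝ}
    (hθ : 0 < θ) (hθ1 : θ ≤ 1) (hr : cN n lam Lam * θ ≤ r1 / cN n lam Lam)
    {W : Eu n → ℝ} (hW : Good ln b a r1 M ε 4 W) (A0 B2 B1 Bn : ℝ)
    (hA0 : A0 = n ^ 2 * Lam / lam * M * (cN n lam Lam * θ) + ε / lam)
    (hB2 : B2 = n * (M + A0) * (2 * (cN n lam Lam * θ)))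
    (hB1 : B1 = n * (B2 + A0) * (2 * θ))
    (hBn : Bn = n ^ 2 * Lam / lam * B2 * θ + ε / lam) :
    ∃ p0 p Q, PP ln p Q ∧ LQ ln b a Q = 0 ∧ ∀ x ∈ halfBall n ln θ,
      |W x - poly p0 p Q x| ≤ n * (B1 + Bn) * (2 * θ) := by
  have hL := ha.pos hl ln
  have hc2 := one_le_cN (n := n) hl hL
  set κ := cN n lam Lam with hκ
  have hκ0 : 0 < κ := by linarith
  have hM0 := hW.sol.M0
  have he0 := hW.sol.e0
  have hA0' : 0 ≤ A0 := by rw [hA0]; positivity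
  have hB2' : 0 ≤ B2 := by rw [hB2]; positivity
  have hB1' : 0 ≤ B1 := by rw [hB1]; positivity
  have hBn' : 0 ≤ Bn := by rw [hBn]; positivity
  have han := hl.trans_le (ha.diag ln).1
  have hκθ : κ * θ ≤ r1 := by
    have : 0 ≤ κ * θ := by positivity
    have h1 := (le_div_iff₀ hκ0).1 hr
    nlinarith
  have hθκ : θ ≤ κ * θ := by nlinarith
  have hU := isOpen_halfBall ln r1
  have hV := isOpen_halfBall ln (κ * θ)
  have hcv := convex_halfBall (ln := ln) (κ * θ)
  have hcθ := convex_halfBall (ln := ln) θ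
  have hVU : halfBall n ln (κ * θ) ⊆ halfBall n ln r1 := halfBall_mono hκθ
  have hθV : halfBall n ln θ ⊆ halfBall n ln (κ * θ) := halfBall_mono hθκ
  set c : Eu n := (θ / 2) • bv ln with hc
  have hcn : c ln = θ / 2 := by simp [hc]
  have hcT : c ∈ halfBall n ln θ := by
    rw [mem_halfBall, hcn, hc, norm_smul, norm_bv, Real.norm_eq_abs, abs_of_pos (by positivity)]
    constructor <;> linarith
  have hcU : c ∈ halfBall n ln r1 := hVU (hθV hcT)
  have hwc := hW.sol.c2
  -- normal bounds
  have nb : ∀ v : Eu n → ℝ, Sol ln b a r1 M ε v →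
      (∀ x ∈ halfBall n ln r1, ∀ i, i ≠ ln → ∀ j, j ≠ ln → |D2 v x (bv i) (bv j)| ≤ M) →
      ∀ x ∈ halfBall n ln (κ * θ), |fderiv ℝ v x (bv ln)| ≤ A0 := by
    intro v hv ht x hx
    have h1 := normal_bound ha hl hb hv.c2 hv.op hv.nb he0 hM0 ht
      (halfBall_mono (r := r1 / κ) hr hx)
    refine h1.trans ?_
    rw [hA0]
    have h2 : x ln ≤ κ * θ :=
      ((le_abs_self _).trans (abs_coord_le x ln)).trans (mem_halfBall.1 hx).1.le
    have : 0 ≤ n ^ 2 * Lam / lam * M := by positivity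
    gcongr
  have tb : ∀ k, ∀ v : Eu n → ℝ, Good ln b a r1 M ε (k + 2) v →
      (∀ x ∈ halfBall n ln r1, ∀ i, i ≠ ln → ∀ j, j ≠ ln → |D2 v x (bv i) (bv j)| ≤ M) := by
    intro k v hv x hx i hi j hj
    rw [← fderiv_pd hU hv.sol.c2 hx]
    exact ((hv.2 j hj).2 i hi).sol.bd x hx
  have n1 : ∀ i, i ≠ ln → ∀ x ∈ halfBall n ln (κ * θ), |fderiv ℝ (pd W i) x (bv ln)| ≤ A0 :=
    fun i hi => nb _ (hW.2 i hi).sol (tb 1 _ (hW.2 i hi))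
  have n2 : ∀ i, i ≠ ln → ∀ j, j ≠ ln → ∀ x ∈ halfBall n ln (κ * θ),
      |fderiv ℝ (pd (pd W i) j) x (bv ln)| ≤ A0 :=
    fun i hi j hj => nb _ ((hW.2 i hi).2 j hj).sol (tb 0 _ ((hW.2 i hi).2 j hj))
  set S : ℝ := ∑ i ∈ Finset.univ.erase ln, ∑ j ∈ Finset.univ.erase ln,
    a i j * D2 W c (bv i) (bv j) with hS
  set q : ℝ := -S / (2 * (1 + b) * a ln ln) with hq
  set p : Eu n →L[ℝ] ℝ := (fderiv ℝ W c).comp (tanP ln) with hp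
  set Q : Eu n →L[ℝ] Eu n →L[ℝ] ℝ :=
    (D2 W c).bilinearComp (tanP ln) (tanP ln) + (2 * q) • coF ln with hQ
  have hQa : ∀ x y, Q x y = D2 W c (tanP ln x) (tanP ln y) + 2 * q * (x ln * y ln) := fun x y => by
    simp [hQ]
  have hQt : ∀ i, i ≠ ln → ∀ j, j ≠ ln → Q (bv i) (bv j) = D2 W c (bv i) (bv j) := by
    intro i hi j hj
    rw [hQa, tanP_tan hi, tanP_tan hj]
    simp [hi.symm]
  have hPP : PP ln p Q := by
    refine ⟨fun x y => ?_, by simp [hp, tanP_ln], fun i hi => ?_⟩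
    · rw [hQa, hQa, C2on_symm hU hwc hcU]; ring
    · rw [hQa, tanP_ln]; simp [hi.symm]
  have hQnn : Q (bv ln) (bv ln) = 2 * q := by rw [hQa, tanP_ln]; simp
  have hLQ : LQ ln b a Q = 0 := by
    rw [LQ, qf_split ha.symm hPP.symm ln, hQnn]
    have e1 : ∑ i ∈ Finset.univ.erase ln, a i ln * Q (bv i) (bv ln) = 0 :=
      Finset.sum_eq_zero fun i hi => by rw [hPP.qn i (Finset.ne_of_mem_erase hi), mul_zero]
    have e2 : ∑ i ∈ Finset.univ.erase ln, ∑ j ∈ Finset.univ.erase ln,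
        a i j * Q (bv i) (bv j) = S :=
      Finset.sum_congr rfl fun i hi => Finset.sum_congr rfl fun j hj => by
        rw [hQt i (Finset.ne_of_mem_erase hi) j (Finset.ne_of_mem_erase hj)]
    rw [e1, e2, hq]
    field_simp
    ring
  refine ⟨W c - q * (θ / 2) ^ 2, p, Q, hPP, hLQ, fun x hx => ?_⟩
  set P := poly (W c - q * (θ / 2) ^ 2) p Q with hP
  have hPc : ContDiffOn ℝ 2 P (halfBall n ln r1) := contDiff_poly.contDiffOn
  set Ψ : Eu n → ℝ := fun y => W y - P y with hΨ
  have hΨc : ContDiffOn ℝ 2 Ψ (halfBall n ln r1) := hwc.sub hPc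
  have hΨ1 : ∀ y ∈ halfBall n ln r1, fderiv ℝ Ψ y = fderiv ℝ W y - (p + Q y) := fun y hy => by
    rw [(opL_sub (b := b) (a := a) (ln := ln) hU hwc hPc hy).1, hP, fderiv_poly hPP.symm]
  have hΨ2 : ∀ y ∈ halfBall n ln r1, D2 Ψ y = D2 W y - Q := fun y hy => by
    rw [(opL_sub (b := b) (a := a) (ln := ln) hU hwc hPc hy).2.1, hP, D2_poly hPP.symm]
  have hnorm : ∀ y ∈ halfBall n ln (κ * θ), ‖y - c‖ ≤ 2 * (κ * θ) := fun y hy => by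
    have h1 := (mem_halfBall.1 hy).1
    have h2 := (mem_halfBall.1 hcT).1
    have := norm_sub_le y c
    linarith
  have hnorm' : ∀ y ∈ halfBall n ln θ, ‖y - c‖ ≤ 2 * θ := fun y hy => by
    have h1 := (mem_halfBall.1 hy).1
    have h2 := (mem_halfBall.1 hcT).1
    have := norm_sub_le y c
    linarith
  -- tangential second derivatives
  have t2 : ∀ y ∈ halfBall n ln (κ * θ), ∀ i, i ≠ ln → ∀ j, j ≠ ln →
      |D2 Ψ y (bv i) (bv j)| ≤ B2 := by
    intro y hy i hi j hj
    have hg := ((hW.2 j hj).2 i hi).sol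
    have e : D2 Ψ y (bv i) (bv j) = pd (pd W j) i y - pd (pd W j) i c := by
      rw [hΨ2 y (hVU hy), sub_apply, sub_apply, hQt i hi j hj, ← fderiv_pd hU hwc (hVU hy),
        ← fderiv_pd hU hwc hcU]
      rfl
    rw [e]
    have := mvt_convex hcv (fun x hx => C2on_differentiableAt hU hg.c2 (hVU hx))
      (A := M + A0) (fun x hx k => ?_) hy (hθV hcT)
    · refine this.trans ?_
      rw [hB2]
      have := hnorm y hy
      gcongr
    · by_cases hk : k = ln
      · subst hk
        have := n2 j hj i hi x hx
        linarith
      · have := (((hW.2 j hj).2 i hi).2 k hk).sol.bd x (hVU hx)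
        change |pd _ _ _| ≤ _
        linarith
  -- tangential first derivatives
  have t1 : ∀ y ∈ halfBall n ln θ, ∀ i, i ≠ ln → |fderiv ℝ Ψ y (bv i)| ≤ B1 := by
    intro y hy i hi
    have hc0 : pd Ψ i c = 0 := by
      change fderiv ℝ Ψ c (bv i) = 0
      rw [hΨ1 c hcU, sub_apply, add_apply, hQa]
      have : tanP ln c = 0 := by rw [hc, map_smul, tanP_ln, smul_zero]
      rw [this]
      simp [hp, tanP_tan hi, hi.symm]
    have := mvt_convex hcθ (fun x hx => differentiableAt_pd hU hΨc (hVU (hθV hx)) i)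
      (A := B2 + A0) (fun x hx k => ?_) hy hcT
    · rw [hc0, sub_zero] at this
      refine this.trans ?_
      rw [hB1]
      have := hnorm' y hy
      gcongr
    · rw [fderiv_pd hU hΨc (hVU (hθV hx))]
      by_cases hk : k = ln
      · subst hk
        have h1 := n1 i hi x (hθV hx)
        rw [fderiv_pd hU hwc (hVU (hθV hx))] at h1
        rw [hΨ2 x (hVU (hθV hx)), sub_apply, sub_apply, hPP.symm, hPP.qn i hi, sub_zero]
        linarith
      · have := t2 x (hθV hx) k hk i hi
        linarith
  -- normal derivative
  have tn : ∀ y ∈ halfBall n ln θ, |fderiv ℝ Ψ y (bv ln)| ≤ Bn := by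
    intro y hy
    have h1 := normal_bound (ρ := κ * θ) (w := Ψ) ha hl hb (hΨc.mono hVU) (ε := ε)
      (fun z hz => ?_) ?_ he0 hB2' t2 (x := y) (by rwa [← hκ, mul_div_cancel_left₀ _ hκ0.ne'])
    · refine h1.trans ?_
      rw [hBn]
      have h2 : y ln ≤ θ :=
        ((le_abs_self _).trans (abs_coord_le y ln)).trans (mem_halfBall.1 hy).1.le
      gcongr
    · rw [(opL_sub hU hwc hPc (hVU hz)).2.2, hP, opL_poly hPP (mem_halfBall.1 hz).2.ne', hLQ,
        sub_zero]
      exact hW.sol.op z (hVU hz)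
    · obtain ⟨B, hB⟩ := hW.sol.nb
      refine ⟨B + 1 * r1 * |2 * q|, fun z hz => ?_⟩
      rw [hΨ1 z (hVU hz), sub_apply, add_apply, hPP.pn, hPP.Q_bv, hQnn, zero_add]
      have h1 := abs_sub (fderiv ℝ W z (bv ln)) (z ln * (2 * q))
      have h2 := hB z (hVU hz)
      have h3 : |z ln| ≤ r1 := (abs_coord_le z ln).trans (mem_halfBall.1 (hVU hz)).1.le
      rw [abs_mul] at h1
      have := mul_le_mul_of_nonneg_right h3 (abs_nonneg (2 * q))
      linarith
  have hΨ0 : Ψ c = 0 := by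
    have : tanP ln c = 0 := by rw [hc, map_smul, tanP_ln, smul_zero]
    simp only [hΨ, hP, poly, hQa, hp, ContinuousLinearMap.comp_apply, this, hcn, map_zero]
    ring
  have := mvt_convex hcθ (fun x hx => C2on_differentiableAt hU hΨc (hVU (hθV hx)))
      (A := B1 + Bn) (fun x hx k => ?_) hx hcT
  · rw [hΨ0, sub_zero] at this
    refine this.trans ?_
    have := hnorm' x hx
    gcongr
  · by_cases hk : k = ln
    · subst hk
      have := tn x hx
      linarith
    · have := t1 x hx k hk
      linarith

theorem good_approx (hl : 0 < lam) (hL : 0 < Lam) (hb : 1 < b) : ∃ C : ℝ, 0 ≤ C ∧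
    ∀ a : Fin n → Fin n → ℝ, Ell lam Lam a → ∀ r1 M ε θ : ℝ,
    0 < θ → θ ≤ 1 → cN n lam Lam * θ ≤ r1 / cN n lam Lam →
    ∀ W : Eu n → ℝ, Good ln b a r1 M ε 4 W →
    ∃ p0 p Q, PP ln p Q ∧ LQ ln b a Q = 0 ∧ ∀ x ∈ halfBall n ln θ,
      |W x - poly p0 p Q x| ≤ C * (θ ^ 3 * M + ε) := by
  have hκ := one_le_cN (n := n) hl hL
  set κ := cN n lam Lam
  set k : ℝ := n ^ 2 * Lam / lam with hk
  have hk0 : 0 ≤ k := by positivity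
  set l : ℝ := 1 / lam with hl'
  have hl0 : 0 < l := by positivity
  set D0 := k * κ + l with hD0
  set D2 := 2 * n * κ * (1 + D0) with hD2
  set D1 := 2 * n * (D2 + D0) with hD1
  have h0 : 0 ≤ D0 := by positivity
  have h2 : 0 ≤ D2 := by positivity
  have h1 : 0 ≤ D1 := by positivity
  refine ⟨2 * n * (D1 + k * D2 + l), by positivity, fun a ha r1 M ε θ hθ hθ1 hr W hW => ?_⟩
  have hM0 := hW.sol.M0
  have he0 := hW.sol.e0
  obtain ⟨p0, p, Q, hP, hQ, H⟩ := good_approx_aux hl hb ha hθ hθ1 hr hW _ _ _ _ rfl rfl rfl rfl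
  refine ⟨p0, p, Q, hP, hQ, fun x hx => (H x hx).trans ?_⟩
  have el : ε / lam = l * ε := by rw [hl']; ring
  rw [el, ← hk]
  set A0 := k * M * (κ * θ) + l * ε with hA0
  set t := θ * M + ε with ht
  have ht0 : 0 ≤ t := by positivity
  have a0 : A0 ≤ D0 * t := by
    have : D0 * t - A0 = l * (θ * M) + k * κ * ε := by rw [hD0, ht, hA0]; ring
    have : 0 ≤ l * (θ * M) + k * κ * ε := by positivity
    linarith
  have hA0' : 0 ≤ A0 := by positivity
  have b2 : n * (M + A0) * (2 * (κ * θ)) ≤ D2 * t := by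
    have e1 : θ * (M + A0) ≤ (1 + D0) * t := by
      have : θ * A0 ≤ A0 := mul_le_of_le_one_left hA0' hθ1
      have : θ * M ≤ t := by linarith
      linarith
    calc _ = 2 * n * κ * (θ * (M + A0)) := by ring
      _ ≤ 2 * n * κ * ((1 + D0) * t) := by gcongr
      _ = _ := by rw [hD2]; ring
  set B2 := n * (M + A0) * (2 * (κ * θ)) with hB2
  have hB2' : 0 ≤ B2 := by positivity
  have b1 : n * (B2 + A0) * (2 * θ) ≤ D1 * θ * t := by
    calc _ ≤ n * (D2 * t + D0 * t) * (2 * θ) := by gcongr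
      _ = _ := by rw [hD1]; ring
  have bn : k * B2 * θ + l * ε ≤ k * D2 * θ * t + l * ε := by
    have : k * B2 * θ ≤ k * (D2 * t) * θ := by gcongr
    linarith
  calc _ ≤ n * (D1 * θ * t + (k * D2 * θ * t + l * ε)) * (2 * θ) := by gcongr
    _ = 2 * n * ((D1 + k * D2) * (θ ^ 3 * M + θ ^ 2 * ε) + θ * (l * ε)) := by rw [ht]; ring
    _ ≤ 2 * n * ((D1 + k * D2) * (θ ^ 3 * M + 1 * ε) + 1 * (l * (θ ^ 3 * M + ε))) := by
        have : θ ^ 2 ≤ 1 := pow_le_one₀ hθ.le hθ1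
        have : ε ≤ θ ^ 3 * M + ε := le_add_of_nonneg_left (by positivity)
        gcongr
    _ = _ := by ring

/-- Approximate solutions on the half ball are close to admissible homogeneous quadratic
polynomials. -/
theorem half_decay (ln : Fin n) (hl : 0 < lam) (hL : 0 < Lam) (hb : 1 < b) :
    ∃ C θ0 : ℝ, 0 ≤ C ∧ 0 < θ0 ∧ θ0 ≤ 1 ∧ ∀ θ, 0 < θ → θ ≤ θ0 → ∃ Cθ : ℝ, 0 ≤ Cθ ∧
      ∀ a : Fin n → Fin n → ℝ, Ell lam Lam a → ∀ M ε w, Sol ln b a 1 M ε w →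
        ∃ p0 p Q, PP ln p Q ∧ LQ ln b a Q = 0 ∧ ∀ x ∈ halfBall n ln θ,
          |w x - poly p0 p Q x| ≤ C * θ ^ 3 * M + Cθ * ε := by
  obtain ⟨r, C1, σ0, hr, hr1, hC1, hσ0, H1⟩ := raise_sol ln (n := n) hl hL hb 4
  obtain ⟨C2, hC2, H2⟩ := good_approx (n := n) (ln := ln) hl hL hb
  have hκ := one_le_cN (n := n) hl hL
  set κ := cN n lam Lam
  have hκ0 : 0 < κ := by linarith
  refine ⟨C1 + C2 * C1, min (min σ0 1) (r / κ ^ 2), by positivity, by positivity,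
    (min_le_left _ _).trans (min_le_right _ _), fun θ hθ hθ' => ?_⟩
  have hθσ : θ ≤ σ0 := hθ'.trans ((min_le_left _ _).trans (min_le_left _ _))
  have hθ1 : θ ≤ 1 := hθ'.trans ((min_le_left _ _).trans (min_le_right _ _))
  have hθr : θ ≤ r / κ ^ 2 := hθ'.trans (min_le_right _ _)
  have hθ3 : θ ^ 3 ≤ θ := by
    have : θ ^ 2 ≤ 1 := pow_le_one₀ hθ.le hθ1
    calc θ ^ 3 = θ * θ ^ 2 := by ring
      _ ≤ θ * 1 := by gcongr
      _ = θ := mul_one _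
  obtain ⟨D, hD, H1⟩ := H1 (θ ^ 3) (by positivity) (hθ3.trans hθσ)
  refine ⟨D + C2 * (θ ^ 3 * D + D), by positivity, fun a ha M ε w hw => ?_⟩
  obtain ⟨W, g, hc⟩ := H1 a ha M ε w hw
  have hκθr : κ * θ ≤ r / κ := by
    rw [le_div_iff₀ hκ0]
    rw [le_div_iff₀ (by positivity)] at hθr
    linarith
  obtain ⟨p0, p, Q, hP, hQ, H⟩ := H2 a ha r _ _ θ hθ hθ1 hκθr W g
  refine ⟨p0, p, Q, hP, hQ, fun x hx => ?_⟩
  have hθr' : θ ≤ r := hθr.trans (div_le_self hr.le (by nlinarith))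
  have e1 := hc x (halfBall_mono hθr' hx)
  have e2 := H x hx
  have e3 := abs_sub_le (w x) (W x) (poly p0 p Q x)
  rw [abs_sub_comm (w x) (W x)] at e3
  calc _ ≤ _ := e3
    _ ≤ (C1 * θ ^ 3 * M + D * ε) + C2 * (θ ^ 3 * (C1 * M + D * ε) + D * ε) := add_le_add e1 e2
    _ = _ := by ring

end

section affine
variable {E E' : Type*} [NormedAddCommGroup E] [NormedSpace ℝ E] [NormedAddCommGroup E']
  [NormedSpace ℝ E'] {w : E' → ℝ} {U : Set E'} {V : Set E} {L : E →L[ℝ] E'} {z : E'}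

theorem contDiffOn_affine (hw : ContDiffOn ℝ 2 w U) (hV : ∀ y ∈ V, z + L y ∈ U) :
    ContDiffOn ℝ 2 (fun y => w (z + L y)) V :=
  hw.comp ((contDiff_const.add L.contDiff).contDiffOn) hV

theorem fderiv_affine (hU : IsOpen U) (hw : ContDiffOn ℝ 2 w U) {y : E} (hy : z + L y ∈ U) :
    fderiv ℝ (fun y => w (z + L y)) y = (fderiv ℝ w (z + L y)).comp L :=
  ((C2on_differentiableAt hU hw hy).hasFDerivAt.comp y (L.hasFDerivAt.const_add z)).fderiv

theorem D2_affine (hU : IsOpen U) (hw : ContDiffOn ℝ 2 w U) {y : E} (hy : z + L y ∈ U)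
    (u v : E) : D2 (fun y => w (z + L y)) y u v = D2 w (z + L y) (L u) (L v) := by
  have hev : fderiv ℝ (fun y => w (z + L y)) =ᶠ[𝓝 y] fun y =>
      ((ContinuousLinearMap.compL ℝ E E' ℝ).flip L) (fderiv ℝ w (z + L y)) := by
    have hc : ContinuousAt (fun y => z + L y) y := by fun_prop
    filter_upwards [hc.preimage_mem_nhds (hU.mem_nhds hy)] with x hx
    exact fderiv_affine hU hw hx
  have h1 := (C2on_differentiableAt_fderiv hU hw hy).hasFDerivAt.comp y
    (L.hasFDerivAt.const_add z)
  have h2 := (((ContinuousLinearMap.compL ℝ E E' ℝ).flip L).hasFDerivAt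
    (x := fderiv ℝ w (z + L y))).comp y h1
  rw [D2, hev.fderiv_eq]
  have h3 : fderiv ℝ (fun y => ((ContinuousLinearMap.compL ℝ E E' ℝ).flip L)
    (fderiv ℝ w (z + L y))) y = _ := h2.fderiv
  rw [h3]
  rfl

end affine

section
variable {n : ℕ} {ln : Fin n} {lam Lam b : ℝ} {a : Fin n → Fin n → ℝ}

/-- The half ball of radius `R` about `z`. -/
def hB (ln : Fin n) (z : Eu n) (R : ℝ) : Set (Eu n) := Metric.ball z R ∩ {x : Eu n | 0 < x ln}

theorem mem_hB {z x : Eu n} {R : ℝ} : x ∈ hB ln z R ↔ ‖x - z‖ < R ∧ 0 < x ln := by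
  simp [hB, dist_eq_norm]

theorem isOpen_hB (ln : Fin n) (z : Eu n) (R : ℝ) : IsOpen (hB ln z R) := by
  refine Metric.isOpen_ball.inter (isOpen_lt continuous_const ?_)
  fun_prop

/-- Homothety as a continuous linear map. -/
def hom (n : ℕ) (R : ℝ) : Eu n →L[ℝ] Eu n := R • ContinuousLinearMap.id ℝ (Eu n)

@[simp] theorem hom_apply (R : ℝ) (x : Eu n) : hom n R x = R • x := by simp [hom]

theorem D2_hom {w : Eu n → ℝ} {U : Set (Eu n)} {z : Eu n} {R : ℝ} (hU : IsOpen U)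
    (hw : ContDiffOn ℝ 2 w U) {y : Eu n} (hy : z + hom n R y ∈ U) :
    D2 (fun y => w (z + hom n R y)) y = R ^ 2 • D2 w (z + hom n R y) := by
  ext u v
  rw [D2_affine hU hw hy]
  simp
  ring

theorem poly_scale (p0 : ℝ) (p : Eu n →L[ℝ] ℝ) (Q : Eu n →L[ℝ] Eu n →L[ℝ] ℝ) {R : ℝ}
    (hR : R ≠ 0) (y : Eu n) :
    poly p0 (R⁻¹ • p) ((R ^ 2)⁻¹ • Q) (R • y) = poly p0 p Q y := by
  simp only [poly, map_smul, smul_apply, smul_eq_mul]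
  field_simp

theorem half_decay_scaled (ln : Fin n) (hl : 0 < lam) (hL : 0 < Lam) (hb : 1 < b) :
    ∃ C θ0 : ℝ, 0 ≤ C ∧ 0 < θ0 ∧ θ0 ≤ 1 ∧ ∀ θ, 0 < θ → θ ≤ θ0 → ∃ Cθ : ℝ, 0 ≤ Cθ ∧
      ∀ a : Fin n → Fin n → ℝ, Ell lam Lam a → ∀ (z : Eu n) (R M η : ℝ) (w : Eu n → ℝ),
        z ln = 0 → 0 < R → 0 ≤ M → 0 ≤ η → ContDiffOn ℝ 2 w (hB ln z R) →
        (∀ x ∈ hB ln z R, |w x| ≤ M) → (∀ x ∈ hB ln z R, |opL ln b a w x| ≤ η / (R * x ln)) →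
        (∃ B, ∀ x ∈ hB ln z R, |fderiv ℝ w x (bv ln)| ≤ B) →
        ∃ p0 p Q, PP ln p Q ∧ LQ ln b a Q = 0 ∧ ∀ x ∈ hB ln z (θ * R),
          |w x - poly p0 p Q (x - z)| ≤ C * θ ^ 3 * M + Cθ * η := by
  obtain ⟨C, θ0, hC, hθ0, hθ1, H⟩ := half_decay ln hl hL hb
  refine ⟨C, θ0, hC, hθ0, hθ1, fun θ hθ hθ' => ?_⟩
  obtain ⟨D, hD, H⟩ := H θ hθ hθ'
  refine ⟨D, hD, fun a ha z R M η w hz hR hM hη hw hwM hop hnb => ?_⟩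
  have hU := isOpen_hB ln z R
  have hmem : ∀ y ∈ halfBall n ln 1, z + hom n R y ∈ hB ln z R := fun y hy => by
    rw [mem_halfBall] at hy
    rw [mem_hB, add_sub_cancel_left, hom_apply, norm_smul, Real.norm_eq_abs, abs_of_pos hR]
    refine ⟨by nlinarith, ?_⟩
    simp only [PiLp.add_apply, PiLp.smul_apply, smul_eq_mul, hz, zero_add]
    exact mul_pos hR hy.2
  have hln : ∀ y : Eu n, (z + hom n R y) ln = R * y ln := fun y => by simp [hz]
  have hs : Sol ln b a 1 M η (fun y => w (z + hom n R y)) := by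
    refine ⟨contDiffOn_affine hw hmem, fun y hy => hwM _ (hmem y hy), fun y hy => ?_, ?_, hM, hη⟩
    · have h1 := hop _ (hmem y hy)
      have hyn := (mem_halfBall.1 hy).2
      have e : opL ln b a (fun y => w (z + hom n R y)) y = R ^ 2 * opL ln b a w (z + hom n R y) := by
        rw [opL, opL, D2_hom hU hw (hmem y hy), fderiv_affine hU hw (hmem y hy), qf_smul, hln]
        simp only [ContinuousLinearMap.comp_apply, hom_apply, map_smul, smul_eq_mul]
        field_simp
      rw [e, abs_mul, abs_of_pos (by positivity)]
      rw [hln] at h1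
      calc _ ≤ R ^ 2 * (η / (R * (R * y ln))) := by gcongr
        _ = _ := by field_simp
    · obtain ⟨B, hB⟩ := hnb
      refine ⟨R * B, fun y hy => ?_⟩
      rw [fderiv_affine hU hw (hmem y hy)]
      simp only [ContinuousLinearMap.comp_apply, hom_apply, map_smul, smul_eq_mul]
      rw [abs_mul, abs_of_pos hR]
      exact mul_le_mul_of_nonneg_left (hB _ (hmem y hy)) hR.le
  obtain ⟨p0, p, Q, hP, hQ, h⟩ := H a ha M η _ hs
  refine ⟨p0, R⁻¹ • p, (R ^ 2)⁻¹ • Q, ⟨fun x y => by simp [hP.symm x y], by simp [hP.pn],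
    fun i hi => by simp [hP.qn i hi]⟩, ?_, fun x hx => ?_⟩
  · rw [LQ, qf_smul]
    have : (R ^ 2)⁻¹ * qf a Q + b * a ln ln * ((R ^ 2)⁻¹ • Q) (bv ln) (bv ln) =
      (R ^ 2)⁻¹ * LQ ln b a Q := by simp [LQ]; ring
    rw [this, hQ, mul_zero]
  · rw [mem_hB] at hx
    set y : Eu n := R⁻¹ • (x - z) with hy
    have hxy : x - z = R • y := by rw [hy, smul_inv_smul₀ hR.ne']
    have hxz : z + hom n R y = x := by rw [hom_apply, ← hxy]; abel
    rw [hxy, poly_scale _ _ _ hR.ne', ← hxz]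
    refine h y (mem_halfBall.2 ⟨?_, ?_⟩)
    · rw [hy, norm_smul, norm_inv, Real.norm_eq_abs, abs_of_pos hR, inv_mul_lt_iff₀ hR]
      linarith [hx.1]
    · have := hx.2
      rw [← hxz, hln] at this
      exact pos_of_mul_pos_right this hR.le

/-- Forgetting the last variable. -/
def prL (n : ℕ) : Eu (n + 1) →L[ℝ] Eu n :=
  ∑ i, (EuclideanSpace.proj (Fin.castSucc i) : Eu (n + 1) →L[ℝ] ℝ).smulRight (bv i)

/-- Adding a vanishing last variable. -/
def inL (n : ℕ) : Eu n →L[ℝ] Eu (n + 1) :=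
  ∑ i, (EuclideanSpace.proj i : Eu n →L[ℝ] ℝ).smulRight (bv (Fin.castSucc i))

theorem prL_apply (x : Eu (n + 1)) (j : Fin n) : (prL n x) j = x (Fin.castSucc j) := by
  simp only [prL, ContinuousLinearMap.sum_apply, ContinuousLinearMap.smulRight_apply,
    WithLp.ofLp_sum, Finset.sum_apply, PiLp.smul_apply, bv_apply]
  simp

theorem inL_castSucc (y : Eu n) (j : Fin n) : (inL n y) (Fin.castSucc j) = y j := by
  simp only [inL, ContinuousLinearMap.sum_apply, ContinuousLinearMap.smulRight_apply,
    WithLp.ofLp_sum, Finset.sum_apply, PiLp.smul_apply, bv_apply]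
  simp

theorem inL_last (y : Eu n) : (inL n y) (Fin.last n) = 0 := by
  simp only [inL, ContinuousLinearMap.sum_apply, ContinuousLinearMap.smulRight_apply,
    WithLp.ofLp_sum, Finset.sum_apply, PiLp.smul_apply, bv_apply]
  simp [(Fin.castSucc_lt_last _).ne]

theorem prL_inL (y : Eu n) : prL n (inL n y) = y := by
  ext j; rw [prL_apply, inL_castSucc]

theorem prL_bv_last : prL n (bv (Fin.last n)) = 0 := by
  ext j
  rw [prL_apply, bv_apply]
  simp [(Fin.castSucc_lt_last _).ne']

theorem prL_bv (i : Fin n) : prL n (bv i.castSucc) = bv i := by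
  ext j
  rw [prL_apply, bv_apply, bv_apply]
  simp

theorem inL_bv (i : Fin n) : inL n (bv i) = bv i.castSucc := by
  ext j
  induction j using Fin.lastCases with
  | last => rw [inL_last, bv_apply]; simp [(Fin.castSucc_lt_last _).ne]
  | cast j => rw [inL_castSucc, bv_apply, bv_apply]; simp

theorem norm_sq_succ (x : Eu (n + 1)) : ‖x‖ ^ 2 = ‖prL n x‖ ^ 2 + x (Fin.last n) ^ 2 := by
  rw [EuclideanSpace.real_norm_sq_eq, EuclideanSpace.real_norm_sq_eq, Fin.sum_univ_castSucc]
  simp [prL_apply]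

/-- Extension of a coefficient matrix by a one in the last diagonal entry. -/
def extA (a : Fin n → Fin n → ℝ) (i j : Fin (n + 1)) : ℝ :=
  Fin.lastCases (motive := fun _ => ℝ) (Fin.lastCases (motive := fun _ => ℝ) 1 (fun _ => 0) j)
    (fun i => Fin.lastCases (motive := fun _ => ℝ) 0 (fun j => a i j) j) i

theorem extA_sum (a : Fin n → Fin n → ℝ) (T : Fin (n + 1) → Fin (n + 1) → ℝ) :
    ∑ i, ∑ j, extA a i j * T i j =
      (∑ i : Fin n, ∑ j : Fin n, a i j * T i.castSucc j.castSucc) +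
        T (Fin.last n) (Fin.last n) := by
  rw [Fin.sum_univ_castSucc]
  simp_rw [Fin.sum_univ_castSucc]
  simp [extA]

theorem extA_ell (ha : Ell lam Lam a) : Ell (min lam 1) (max Lam 1) (extA a) := by
  refine ⟨fun i j => ?_, fun ξ => ?_, fun ξ => ?_⟩
  · induction i using Fin.lastCases <;> induction j using Fin.lastCases <;>
      simp [extA, ha.symm]
  · have := extA_sum a fun i j => ξ i * ξ j
    simp_rw [← mul_assoc] at this
    rw [this, Fin.sum_univ_castSucc, mul_add]
    refine add_le_add ((mul_le_mul_of_nonneg_right (min_le_left _ _) ?_).trans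
      (ha.lower fun i => ξ i.castSucc)) ?_
    · exact Finset.sum_nonneg fun i _ => sq_nonneg _
    · nlinarith [min_le_right lam 1, sq_nonneg (ξ (Fin.last n))]
  · have := extA_sum a fun i j => ξ i * ξ j
    simp_rw [← mul_assoc] at this
    rw [this, Fin.sum_univ_castSucc, mul_add]
    refine add_le_add ((ha.upper fun i => ξ i.castSucc).trans
      (mul_le_mul_of_nonneg_right (le_max_left _ _) ?_)) ?_
    · exact Finset.sum_nonneg fun i _ => sq_nonneg _
    · nlinarith [le_max_right Lam 1, sq_nonneg (ξ (Fin.last n))]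

theorem qf_extA (a : Fin n → Fin n → ℝ) (T : Eu (n + 1) →L[ℝ] Eu (n + 1) →L[ℝ] ℝ) :
    qf (extA a) T = (∑ i : Fin n, ∑ j : Fin n, a i j * T (bv i.castSucc) (bv j.castSucc)) +
      T (bv (Fin.last n)) (bv (Fin.last n)) :=
  extA_sum a fun i j => T (bv i) (bv j)

theorem int_decay (i0 : Fin n) (hl : 0 < lam) (hL : 0 < Lam) :
    ∃ C θ0 : ℝ, 0 ≤ C ∧ 0 < θ0 ∧ θ0 ≤ 1 ∧ ∀ θ, 0 < θ → θ ≤ θ0 → ∃ Cθ : ℝ, 0 ≤ Cθ ∧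
      ∀ a : Fin n → Fin n → ℝ, Ell lam Lam a → ∀ (M ε : ℝ) (w : Eu n → ℝ), 0 ≤ M → 0 ≤ ε →
        ContDiffOn ℝ 2 w (Metric.ball 0 1) →
        (∀ x ∈ Metric.ball 0 1, |w x| ≤ M) → (∀ x ∈ Metric.ball 0 1, |qf a (D2 w x)| ≤ ε) →
        ∃ p0 p Q, (∀ x y, Q x y = Q y x) ∧ qf a Q = 0 ∧ ∀ x ∈ Metric.ball 0 θ,
          |w x - poly p0 p Q x| ≤ C * θ ^ 3 * M + Cθ * ε := by
  obtain ⟨C, θ0, hC, hθ0, hθ1, H⟩ := half_decay (Fin.last n) (lam := min lam 1) (Lam := max Lam 1)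
    (b := 2) (by positivity) (by positivity) (by norm_num)
  set k : ℝ := 1 + 24 / lam with hk
  have hk0 : 0 ≤ k := by positivity
  refine ⟨k * C, θ0, by positivity, hθ0, hθ1, fun θ hθ hθ' => ?_⟩
  obtain ⟨D, hD, H⟩ := H θ hθ hθ'
  refine ⟨k * D, by positivity, fun a ha M ε w hM hε hw hwM hop => ?_⟩
  have hU : IsOpen (Metric.ball (0 : Eu n) 1) := Metric.isOpen_ball
  have hpr : ∀ {r : ℝ}, 0 < r → ∀ x : Eu (n + 1), ‖x‖ < r → 0 + prL n x ∈ Metric.ball 0 r := by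
    intro r hr x hx
    rw [zero_add, mem_ball_zero_iff]
    refine lt_of_le_of_lt ?_ hx
    refine (sq_le_sq₀ (norm_nonneg _) (norm_nonneg _)).1 ?_
    rw [norm_sq_succ x]
    linarith [sq_nonneg (x (Fin.last n))]
  have hmem : ∀ y ∈ halfBall (n + 1) (Fin.last n) 1, 0 + prL n y ∈ Metric.ball (0 : Eu n) 1 :=
    fun y hy => hpr one_pos y (mem_halfBall.1 hy).1
  have hs : Sol (Fin.last n) 2 (extA a) 1 M ε (fun y => w (0 + prL n y)) := by
    have hfd : ∀ y ∈ halfBall (n + 1) (Fin.last n) 1,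
        fderiv ℝ (fun y => w (0 + prL n y)) y (bv (Fin.last n)) = 0 := fun y hy => by
      rw [fderiv_affine hU hw (hmem y hy), ContinuousLinearMap.comp_apply, prL_bv_last, map_zero]
    refine ⟨contDiffOn_affine hw hmem, fun y hy => hwM _ (hmem y hy), fun y hy => ?_,
      ⟨0, fun y hy => by rw [hfd y hy, abs_zero]⟩, hM, hε⟩
    rw [opL, hfd y hy, mul_zero, add_zero, qf_extA]
    simp_rw [D2_affine hU hw (hmem y hy), prL_bv, prL_bv_last]
    have h1 := hop _ (hmem y hy)
    simp only [map_zero, add_zero]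
    refine h1.trans ?_
    rw [mem_halfBall] at hy
    rw [le_div_iff₀ hy.2]
    have := ((le_abs_self _).trans (abs_coord_le y (Fin.last n))).trans hy.1.le
    exact mul_le_of_le_one_right hε this
  obtain ⟨p0, p, Q, hP, hQ, h⟩ := H (extA a) (extA_ell ha) M ε _ hs
  set E := C * θ ^ 3 * M + D * ε with hE
  have hE0 : 0 ≤ E := by positivity
  set q := Q (bv (Fin.last n)) (bv (Fin.last n)) with hq
  have hcp : Continuous (poly p0 p Q) := contDiff_poly.continuous
  -- the trace on the last hyperplane
  have h0 : ∀ y ∈ Metric.ball (0 : Eu n) θ, |w y - poly p0 p Q (inL n y)| ≤ E := by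
    intro y hy
    rw [mem_ball_zero_iff] at hy
    have hc : Continuous fun s : ℝ => inL n y + s • (bv (Fin.last n) : Eu (n + 1)) := by fun_prop
    have ht : Tendsto (fun s : ℝ => |w y - poly p0 p Q (inL n y + s • bv (Fin.last n))|)
        (𝓝[>] 0) (𝓝 |w y - poly p0 p Q (inL n y)|) := by
      have : Continuous (fun s : ℝ => |w y - poly p0 p Q (inL n y + s • bv (Fin.last n))|) :=
        (continuous_const.sub (hcp.comp hc)).abs
      have := this.tendsto 0
      simp only [zero_smul, add_zero] at this
      exact this.mono_left nhdsWithin_le_nhds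
    refine le_of_tendsto ht ?_
    have hny : ‖inL n y‖ < θ := by
      have := norm_sq_succ (inL n y)
      rw [prL_inL, inL_last] at this
      have : ‖inL n y‖ ≤ ‖y‖ := (sq_le_sq₀ (norm_nonneg _) (norm_nonneg _)).1 (by linarith)
      linarith
    have hev : ∀ᶠ s in 𝓝[>] (0:ℝ), ‖inL n y + s • (bv (Fin.last n) : Eu (n + 1))‖ < θ := by
      refine nhdsWithin_le_nhds (hc.norm.continuousAt.eventually_lt continuousAt_const ?_)
      simpa using hny
    filter_upwards [hev, self_mem_nhdsWithin] with s h1 h2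
    have := h (inL n y + s • bv (Fin.last n)) (mem_halfBall.2 ⟨h1, by
      rw [PiLp.add_apply, inL_last]; simpa using h2⟩)
    rwa [zero_add, map_add, prL_inL, map_smul, prL_bv_last, smul_zero, add_zero] at this
  have hqb : |q| ≤ 16 * E / θ ^ 2 := by
    have e1 := h0 0 (by simpa using hθ)
    have e2 := h ((θ / 2) • bv (Fin.last n)) (mem_halfBall.2 ⟨by
      rw [norm_smul, norm_bv, Real.norm_eq_abs, abs_of_pos (by positivity)]; linarith,
      by simpa using hθ⟩)
    rw [zero_add, map_smul, prL_bv_last, smul_zero] at e2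
    have e3 : poly p0 p Q ((θ / 2) • bv (Fin.last n)) - poly p0 p Q (inL n 0) =
        1 / 2 * ((θ / 2) ^ 2 * q) := by
      simp only [poly, map_smul, hP.pn, smul_apply, smul_eq_mul, map_zero,
        mul_zero]
      ring
    have e4 : |1 / 2 * ((θ / 2) ^ 2 * q)| ≤ 2 * E := by
      rw [← e3]
      have := abs_sub_le (poly p0 p Q ((θ / 2) • bv (Fin.last n))) (w 0) (poly p0 p Q (inL n 0))
      rw [abs_sub_comm _ (w 0)] at this
      linarith
    rw [abs_mul, abs_mul, abs_of_pos (by norm_num), abs_of_pos (by positivity)] at e4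
    rw [le_div_iff₀ (by positivity)]
    linarith
  have htr : lam ≤ ∑ i, a i i :=
    (ha.diag i0).1.trans (Finset.single_le_sum (f := fun i => a i i)
      (fun i _ => (hl.trans_le (ha.diag i).1).le) (Finset.mem_univ i0))
  have htr0 : 0 < ∑ i, a i i := hl.trans_le htr
  set c := 3 * q / ∑ i, a i i with hc
  have hcb : |c| ≤ 48 / lam * E / θ ^ 2 := by
    rw [hc, abs_div, abs_of_pos htr0, abs_mul, abs_of_pos (by norm_num : (0:ℝ) < 3)]
    calc _ ≤ 3 * (16 * E / θ ^ 2) / lam := by gcongr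
      _ = _ := by field_simp; ring
  refine ⟨p0, p.comp (inL n), Q.bilinearComp (inL n) (inL n) + c • idF, fun x y => ?_, ?_,
    fun x hx => ?_⟩
  · simp [hP.symm (inL n x), idF_apply, mul_comm]
  · rw [qf_add, qf_smul, qf_idF]
    rw [LQ, qf_extA] at hQ
    have e : qf a (Q.bilinearComp (inL n) (inL n)) =
        ∑ i : Fin n, ∑ j : Fin n, a i j * Q (bv i.castSucc) (bv j.castSucc) := by
      simp [qf, inL_bv]
    have e2 : extA a (Fin.last n) (Fin.last n) = 1 := by simp [extA]
    rw [e2, ← hq] at hQ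
    rw [e, hc, div_mul_cancel₀ _ htr0.ne']
    linarith
  · have e1 := h0 x hx
    have e2 : poly p0 (p.comp (inL n)) (Q.bilinearComp (inL n) (inL n) + c • idF) x =
        poly p0 p Q (inL n x) + 1 / 2 * (c * ‖x‖ ^ 2) := by
      simp only [poly, ContinuousLinearMap.comp_apply, add_apply, smul_apply,
        ContinuousLinearMap.bilinearComp_apply, idF_self, smul_eq_mul]
      ring
    rw [e2]
    have e3 : |1 / 2 * (c * ‖x‖ ^ 2)| ≤ 24 / lam * E := by
      rw [abs_mul, abs_mul, abs_of_pos (by norm_num : (0:ℝ) < 1/2), abs_of_nonneg (sq_nonneg ‖x‖)]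
      rw [mem_ball_zero_iff] at hx
      calc _ ≤ 1 / 2 * (48 / lam * E / θ ^ 2 * θ ^ 2) := by gcongr
        _ = _ := by field_simp; ring
    have e4 := abs_sub (w x - poly p0 p Q (inL n x)) (1 / 2 * (c * ‖x‖ ^ 2))
    have e5 : k * C * θ ^ 3 * M + k * D * ε = E + 24 / lam * E := by rw [hE, hk]; ring
    rw [e5, ← sub_sub]
    linarith

theorem int_decay_scaled (i0 : Fin n) (hl : 0 < lam) (hL : 0 < Lam) :
    ∃ C θ0 : ℝ, 0 ≤ C ∧ 0 < θ0 ∧ θ0 ≤ 1 ∧ ∀ θ, 0 < θ → θ ≤ θ0 → ∃ Cθ : ℝ, 0 ≤ Cθ ∧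
      ∀ a : Fin n → Fin n → ℝ, Ell lam Lam a → ∀ (z : Eu n) (R M ε : ℝ) (w : Eu n → ℝ), 0 < R →
        0 ≤ M → 0 ≤ ε → ContDiffOn ℝ 2 w (Metric.ball z R) →
        (∀ x ∈ Metric.ball z R, |w x| ≤ M) →
        (∀ x ∈ Metric.ball z R, |qf a (D2 w x)| ≤ ε) →
        ∃ p0 p Q, (∀ x y, Q x y = Q y x) ∧ qf a Q = 0 ∧ ∀ x ∈ Metric.ball z (θ * R),
          |w x - poly p0 p Q (x - z)| ≤ C * θ ^ 3 * M + Cθ * (R ^ 2 * ε) := by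
  obtain ⟨C, θ0, hC, hθ0, hθ1, H⟩ := int_decay i0 hl hL
  refine ⟨C, θ0, hC, hθ0, hθ1, fun θ hθ hθ' => ?_⟩
  obtain ⟨D, hD, H⟩ := H θ hθ hθ'
  refine ⟨D, hD, fun a ha z R M ε w hR hM hε hw hwM hop => ?_⟩
  have hU : IsOpen (Metric.ball z R) := Metric.isOpen_ball
  have hmem : ∀ y ∈ Metric.ball (0 : Eu n) 1, z + hom n R y ∈ Metric.ball z R := fun y hy => by
    rw [mem_ball_zero_iff] at hy
    rw [mem_ball_iff_norm, add_sub_cancel_left, hom_apply, norm_smul, Real.norm_eq_abs,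
      abs_of_pos hR]
    nlinarith
  obtain ⟨p0, p, Q, hP, hQ, h⟩ := H a ha M (R ^ 2 * ε) (fun y => w (z + hom n R y)) hM
    (by positivity) (contDiffOn_affine hw hmem) (fun y hy => hwM _ (hmem y hy)) (fun y hy => by
      rw [D2_hom hU hw (hmem y hy), qf_smul, abs_mul, abs_of_pos (by positivity)]
      exact mul_le_mul_of_nonneg_left (hop _ (hmem y hy)) (by positivity))
  refine ⟨p0, R⁻¹ • p, (R ^ 2)⁻¹ • Q, fun x y => by simp [hP x y], by rw [qf_smul, hQ, mul_zero],
    fun x hx => ?_⟩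
  rw [mem_ball_iff_norm] at hx
  set y : Eu n := R⁻¹ • (x - z) with hy
  have hxy : x - z = R • y := by rw [hy, smul_inv_smul₀ hR.ne']
  have hxz : z + hom n R y = x := by rw [hom_apply, ← hxy]; abel
  rw [hxy, poly_scale _ _ _ hR.ne', ← hxz]
  refine h y ?_
  rw [mem_ball_zero_iff, hy, norm_smul, norm_inv, Real.norm_eq_abs, abs_of_pos hR,
    inv_mul_lt_iff₀ hR]
  linarith

end

theorem absorb {S : Set ℝ} {C0 : ℝ} (hC : 0 < C0) (hup : ∀ A ∈ S, ∀ A', A ≤ A' → A' ∈ S)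
    (hne : ∃ A, A ∈ S) (h : ∀ A ∈ S, 0 ≤ A → A / 2 + C0 ∈ S) : 3 * C0 ∈ S := by
  obtain ⟨A, hA⟩ := hne
  have hA' : |A| ∈ S := hup A hA _ (le_abs_self A)
  have key : ∀ k : ℕ, 2 * C0 + |A| / 2 ^ k ∈ S := by
    intro k
    induction k with
    | zero => exact hup _ hA' _ (by simp; positivity)
    | succ k ih =>
      have := h _ ih (by positivity)
      refine hup _ this _ (le_of_eq ?_)
      rw [pow_succ]
      field_simp
      ring
  obtain ⟨k, hk⟩ := pow_unbounded_of_one_lt (|A| / C0) (one_lt_two)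
  refine hup _ (key k) _ ?_
  have : |A| / 2 ^ k ≤ C0 := by
    rw [div_le_iff₀ (by positivity)]
    rw [div_lt_iff₀ hC] at hk
    linarith
  linarith

theorem sym_norm_le {n : ℕ} {T : Eu n →L[ℝ] Eu n →L[ℝ] ℝ} {c : ℝ} (hc : 0 ≤ c)
    (hs : ∀ x y, T x y = T y x) (h : ∀ e, ‖e‖ ≤ 1 → |T e e| ≤ c) : ‖T‖ ≤ 2 * c := by
  refine ContinuousLinearMap.opNorm_le_of_unit_norm (by positivity) fun u hu => ?_
  refine ContinuousLinearMap.opNorm_le_of_unit_norm (by positivity) fun v hv => ?_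
  have h1 := h ((1 / 2 : ℝ) • (u + v)) (by
    rw [norm_smul]; have := norm_add_le u v; norm_num; linarith)
  have h2 := h ((1 / 2 : ℝ) • (u - v)) (by
    rw [norm_smul]; have := norm_sub_le u v; norm_num; linarith)
  have e : T u v = T ((1 / 2 : ℝ) • (u + v)) ((1 / 2 : ℝ) • (u + v)) -
      T ((1 / 2 : ℝ) • (u - v)) ((1 / 2 : ℝ) • (u - v)) := by
    simp only [map_smul, map_add, map_sub, smul_apply, add_apply, sub_apply, smul_eq_mul]
    rw [hs v u]; ring
  rw [Real.norm_eq_abs, e]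
  have := abs_sub (T ((1 / 2 : ℝ) • (u + v)) ((1 / 2 : ℝ) • (u + v)))
    (T ((1 / 2 : ℝ) • (u - v)) ((1 / 2 : ℝ) • (u - v)))
  linarith

theorem HasJet.tendsto_second_diff {f : ℝ → ℝ} {f1 f2 : ℝ} (hf : HasJet f f1 f2) :
    Tendsto (fun s => (f s + f (-s) - 2 * f 0) / s ^ 2) (𝓝[>] 0) (𝓝 f2) := by
  obtain ⟨f', h1, -, h3⟩ := hf
  have hneg : Tendsto (fun s : ℝ => -s) (𝓝 0) (𝓝 0) := by
    simpa using (continuous_neg (G := ℝ)).tendsto 0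
  have h1' : ∀ᶠ s in 𝓝 (0:ℝ), HasDerivAt (fun s => f (-s)) (-f' (-s)) s := by
    filter_upwards [hneg.eventually h1] with s hs
    have := hs.comp s (hasDerivAt_neg s)
    exact this.congr_deriv (by ring)
  have hd := h1.self_of_nhds.continuousAt
  refine HasDerivAt.lhopital_zero_nhdsGT (f' := fun s => f' s - f' (-s)) (g' := fun s => 2 * s)
    ?_ ?_ ?_ ?_ ?_ ?_
  · refine nhdsWithin_le_nhds ?_
    filter_upwards [h1, h1'] with s a c
    exact ((a.add c).sub_const (2 * f 0)).congr_deriv (by ring)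
  · exact Eventually.of_forall fun s => by simpa using hasDerivAt_pow 2 s
  · filter_upwards [self_mem_nhdsWithin] with s hs
    have : (0:ℝ) < s := hs
    positivity
  · have : Tendsto (fun s => f s + f (-s) - 2 * f 0) (𝓝 0) (𝓝 (f 0 + f 0 - 2 * f 0)) :=
      (hd.tendsto.add (hd.tendsto.comp hneg)).sub_const _
    refine (this.mono_left nhdsWithin_le_nhds).trans ?_
    rw [show f 0 + f 0 - 2 * f 0 = 0 by ring]
  · have : Tendsto (fun s : ℝ => s ^ 2) (𝓝 0) (𝓝 (0 ^ 2)) := (continuous_pow 2).tendsto 0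
    refine (this.mono_left nhdsWithin_le_nhds).trans ?_
    simp
  · have hs := h3.tendsto_slope_zero_right
    have h3' : HasDerivAt (fun s => f' (-s)) (-f2) 0 := by
      have := HasDerivAt.comp (h₂ := f') (h := fun s : ℝ => -s) (0:ℝ) (by simpa using h3)
        (hasDerivAt_neg (0:ℝ))
      exact this.congr_deriv (by ring)
    have hs' := h3'.tendsto_slope_zero_right
    have := (hs.sub hs').const_mul (1 / 2)
    rw [show 1 / 2 * (f2 - -f2) = f2 by ring] at this
    refine this.congr' ?_
    filter_upwards [self_mem_nhdsWithin] with s hs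
    have : s ≠ 0 := ne_of_gt hs
    simp only [zero_add, neg_zero, smul_eq_mul]
    field_simp
    ring

/-- Symmetric second difference quotient. -/
def sdq {n : ℕ} (w : Eu n → ℝ) (x e : Eu n) (h : ℝ) : ℝ :=
  (w (x + h • e) + w (x - h • e) - 2 * w x) / h ^ 2

theorem sdq_abs_le {n : ℕ} {w : Eu n → ℝ} {x e : Eu n} {h M : ℝ} (hh : 0 < h) (h1 : |w x| ≤ M)
    (h2 : |w (x + h • e)| ≤ M) (h3 : |w (x - h • e)| ≤ M) : |sdq w x e h| ≤ 4 * M / h ^ 2 := by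
  rw [sdq, abs_div, abs_of_pos (a := h ^ 2) (by positivity)]
  refine div_le_div_of_nonneg_right ?_ (by positivity)
  rw [abs_le] at *
  constructor <;> linarith

theorem sdq_sub_poly {n : ℕ} {w : Eu n → ℝ} {x z e : Eu n} {h p0 : ℝ} {p : Eu n →L[ℝ] ℝ}
    {Q : Eu n →L[ℝ] Eu n →L[ℝ] ℝ} (hQ : ∀ x y, Q x y = Q y x) (hh : h ≠ 0) :
    sdq (fun y => w y - poly p0 p Q (y - z)) x e h = sdq w x e h - Q e e := by
  have : poly p0 p Q (x + h • e - z) + poly p0 p Q (x - h • e - z) - 2 * poly p0 p Q (x - z) =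
      h ^ 2 * Q e e := by
    rw [show x + h • e - z = (x - z) + h • e by abel, show x - h • e - z = (x - z) - h • e by abel]
    simp only [poly, map_smul, map_add, map_sub, smul_apply, add_apply, sub_apply, smul_eq_mul]
    ring
  rw [sdq, sdq, eq_sub_iff_add_eq, ← mul_div_cancel_left₀ (Q e e) (pow_ne_zero 2 hh), ← this,
    ← add_div]
  congr 1
  ring

/-- On a ball of radius `2 * h` around `z`, approximating by a quadratic approximates second
difference quotients. -/
theorem sdq_approx {n : ℕ} {w : Eu n → ℝ} {x z e : Eu n} {h r p0 E : ℝ} {p : Eu n →L[ℝ] ℝ}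
    {Q : Eu n →L[ℝ] Eu n →L[ℝ] ℝ} (hQ : ∀ x y, Q x y = Q y x) (hh : 0 < h) (he : ‖e‖ ≤ 1)
    (hr : ‖x - z‖ + h < r) (hE : ∀ y ∈ Metric.ball z r, |w y - poly p0 p Q (y - z)| ≤ E) :
    |sdq w x e h - Q e e| ≤ 4 * E / h ^ 2 := by
  rw [← sdq_sub_poly (p0 := p0) (p := p) (z := z) hQ hh.ne']
  have hn : ‖h • e‖ ≤ h := by
    rw [norm_smul, Real.norm_eq_abs, abs_of_pos hh]
    exact mul_le_of_le_one_right hh.le he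
  refine sdq_abs_le hh (hE _ ?_) (hE _ ?_) (hE _ ?_) <;> rw [mem_ball_iff_norm]
  · linarith
  · rw [show x + h • e - z = (x - z) + h • e by abel]
    linarith [norm_add_le (x - z) (h • e)]
  · rw [show x - h • e - z = (x - z) - h • e by abel]
    linarith [norm_sub_le (x - z) (h • e)]

theorem tendsto_sdq {n : ℕ} {w : Eu n → ℝ} {U : Set (Eu n)} (hU : IsOpen U)
    (hw : ContDiffOn ℝ 2 w U) {x : Eu n} (hx : x ∈ U) (e : Eu n) :
    Tendsto (sdq w x e) (𝓝[>] 0) (𝓝 (D2 w x e e)) := by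
  have := (hasJet_line hU hw hx e).tendsto_second_diff
  refine this.congr fun s => ?_
  simp [sdq, sub_eq_add_neg]

theorem rpow_two_add {h α : ℝ} (hh : 0 < h) : h ^ (2 + α) = h ^ 2 * h ^ α := by
  rw [Real.rpow_add hh]; norm_num

theorem sdq_D2 {α : ℝ} (hα : 0 < α) (hα1 : α < 1) : ∃ C : ℝ, 0 < C ∧ ∀ {n : ℕ} {w : Eu n → ℝ}
    {U : Set (Eu n)} {x : Eu n} {A r0 : ℝ}, IsOpen U → ContDiffOn ℝ 2 w U → x ∈ U → 0 ≤ A →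
    (∀ r, 0 < r → r ≤ r0 → ∃ p0 p Q, (∀ x y, Q x y = Q y x) ∧ ∀ y ∈ Metric.ball x r,
      |w y - poly p0 p Q (y - x)| ≤ A * r ^ (2 + α)) →
    ∀ e, ‖e‖ ≤ 1 → ∀ h, 0 < h → 2 * h ≤ r0 → |sdq w x e h - D2 w x e e| ≤ C * A * h ^ α := by
  set q : ℝ := (1 / 2) ^ α with hq
  have hq1 : q < 1 := Real.rpow_lt_one (by norm_num) (by norm_num) hα
  have hq0 : 0 < q := by positivity
  refine ⟨160 / (1 - q), div_pos (by norm_num) (by linarith), ?_⟩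
  intro n w U x A r0 hU hw hx hA H e he h hh hhr
  set g : ℕ → ℝ := fun j => sdq w x e (h * (1 / 2) ^ j) with hg
  have hstep : ∀ j, dist (g j) (g (j + 1)) ≤ 160 * A * h ^ α * q ^ j := by
    intro j
    set t : ℝ := h * (1 / 2) ^ j with ht
    have ht0 : 0 < t := by positivity
    have hth : t ≤ h := mul_le_of_le_one_right hh.le (pow_le_one₀ (by norm_num) (by norm_num))
    have ht1 : h * (1 / 2) ^ (j + 1) = t / 2 := by rw [ht, pow_succ]; ring
    obtain ⟨p0, p, Q, hQ, hP⟩ := H (2 * t) (by positivity) (by linarith)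
    have e1 := sdq_approx (x := x) (h := t) hQ ht0 he (by simp; linarith) hP
    have e2 := sdq_approx (x := x) (h := t / 2) hQ (by positivity) he (by simp; linarith) hP
    rw [Real.dist_eq, hg]
    simp only []
    rw [← ht, ht1]
    have e3 : (2 * t) ^ (2 + α) ≤ 8 * (t ^ 2 * t ^ α) := by
      rw [Real.mul_rpow (by norm_num) ht0.le, rpow_two_add ht0]
      refine mul_le_mul_of_nonneg_right ?_ (by positivity)
      calc (2:ℝ) ^ (2 + α) ≤ 2 ^ (3:ℝ) :=
            Real.rpow_le_rpow_of_exponent_le (by norm_num) (by linarith)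
        _ = 8 := by norm_num
    have e4 : t ^ α = h ^ α * q ^ j := by
      rw [ht, Real.mul_rpow hh.le (by positivity), hq, ← Real.rpow_natCast, ← Real.rpow_mul
        (by norm_num), ← Real.rpow_natCast, ← Real.rpow_mul (by norm_num), mul_comm (j:ℝ)]
    have e5 : A * (2 * t) ^ (2 + α) ≤ A * (8 * (t ^ 2 * t ^ α)) :=
      mul_le_mul_of_nonneg_left e3 hA
    have e6 : 4 * (A * (2 * t) ^ (2 + α)) / t ^ 2 ≤ 32 * A * t ^ α := by
      rw [div_le_iff₀ (by positivity)]; linarith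
    have e7 : 4 * (A * (2 * t) ^ (2 + α)) / (t / 2) ^ 2 ≤ 128 * A * t ^ α := by
      rw [div_le_iff₀ (by positivity)]; linarith
    have e8 := abs_sub_le (sdq w x e t) (Q e e) (sdq w x e (t / 2))
    rw [abs_sub_comm (Q e e)] at e8
    calc _ ≤ 32 * A * t ^ α + 128 * A * t ^ α := by linarith
      _ = _ := by rw [e4]; ring
  have hlim : Tendsto g atTop (𝓝 (D2 w x e e)) := by
    refine (tendsto_sdq hU hw hx e).comp ?_
    rw [tendsto_nhdsWithin_iff]
    refine ⟨?_, Eventually.of_forall fun j => ?_⟩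
    · have := (tendsto_pow_atTop_nhds_zero_of_lt_one (r := (1/2:ℝ)) (by norm_num)
        (by norm_num)).const_mul h
      simpa using this
    · simp only [mem_Ioi]; positivity
  have := dist_le_of_le_geometric_of_tendsto₀ q (160 * A * h ^ α) hq1 hstep hlim
  rw [Real.dist_eq] at this
  simp only [hg, pow_zero, mul_one] at this
  calc _ ≤ _ := this
    _ = _ := by ring

variable {n : ℕ} {lam Lam α : ℝ}

/-- The factor beating `C θ³` by `θ^(2+α)`. -/
theorem exists_theta {C θ0 : ℝ} (hC : 0 ≤ C) (hθ0 : 0 < θ0) (c : ℝ) (hc : 0 < c) (hα1 : α < 1) :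
    ∃ θ, 0 < θ ∧ θ ≤ θ0 ∧ θ ≤ 1 / 2 ∧ C * θ ^ 3 ≤ c * θ ^ (2 + α) := by
  have ht : Tendsto (fun θ : ℝ => C * θ ^ (1 - α)) (𝓝[>] 0) (𝓝 0) := by
    have : ContinuousAt (fun θ : ℝ => C * θ ^ (1 - α)) 0 :=
      (Real.continuousAt_rpow_const _ _ (Or.inr (by linarith))).const_mul C
    have := this.tendsto
    rw [Real.zero_rpow (by linarith), mul_zero] at this
    exact this.mono_left nhdsWithin_le_nhds
  have h1 := ht.eventually (gt_mem_nhds hc)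
  have h2 : ∀ᶠ θ : ℝ in 𝓝[>] 0, θ < min θ0 (1 / 2) :=
    nhdsWithin_le_nhds (gt_mem_nhds (by positivity))
  obtain ⟨θ, ⟨h1, h2⟩, h3⟩ := ((h1.and h2).and self_mem_nhdsWithin).exists
  have h3 : 0 < θ := h3
  refine ⟨θ, h3, h2.le.trans (min_le_left _ _), h2.le.trans (min_le_right _ _), ?_⟩
  have e : θ ^ 3 = θ ^ (1 - α) * θ ^ (2 + α) := by
    rw [← Real.rpow_add h3, ← Real.rpow_natCast]; congr 1; push_cast; ring
  rw [e, ← mul_assoc]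
  exact mul_le_mul_of_nonneg_right h1.le (by positivity)

theorem poly_add (p0 p0' : ℝ) (p p' : Eu n →L[ℝ] ℝ) (Q Q' : Eu n →L[ℝ] Eu n →L[ℝ] ℝ) (x : Eu n) :
    poly (p0 + p0') (p + p') (Q + Q') x = poly p0 p Q x + poly p0' p' Q' x := by
  simp only [poly, add_apply]; ring

theorem contDiff_poly_sub {p0 : ℝ} {p : Eu n →L[ℝ] ℝ} {Q : Eu n →L[ℝ] Eu n →L[ℝ] ℝ} (z : Eu n) :
    ContDiff ℝ 2 (fun x => poly p0 p Q (x - z)) :=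
  contDiff_poly.comp (contDiff_id.sub contDiff_const)

theorem fderiv_poly_sub {p0 : ℝ} {p : Eu n →L[ℝ] ℝ} {Q : Eu n →L[ℝ] Eu n →L[ℝ] ℝ}
    (hQ : ∀ x y, Q x y = Q y x) (z x : Eu n) :
    fderiv ℝ (fun x => poly p0 p Q (x - z)) x = p + Q (x - z) := by
  have h := (contDiff_poly (p0 := p0) (p := p) (Q := Q)).differentiable (by norm_num) (x - z)
  have := h.hasFDerivAt.comp x ((hasFDerivAt_id x).sub_const z)
  rw [fderiv_poly hQ] at this
  exact this.fderiv

theorem D2_poly_sub {p0 : ℝ} {p : Eu n →L[ℝ] ℝ} {Q : Eu n →L[ℝ] Eu n →L[ℝ] ℝ}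
    (hQ : ∀ x y, Q x y = Q y x) (z x : Eu n) :
    D2 (fun x => poly p0 p Q (x - z)) x = Q := by
  have : fderiv ℝ (fun x => poly p0 p Q (x - z)) = fun x => p + Q (x - z) :=
    funext fun x => fderiv_poly_sub hQ z x
  rw [D2, this]
  have h : HasFDerivAt (fun x => p + Q (x - z)) Q x := by
    have := (Q.hasFDerivAt.comp x ((hasFDerivAt_id x).sub_const z)).const_add p
    simpa using this
  exact h.fderiv

theorem D2_sub_poly {w : Eu n → ℝ} {U : Set (Eu n)} (hU : IsOpen U) (hw : ContDiffOn ℝ 2 w U)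
    {p0 : ℝ} {p : Eu n →L[ℝ] ℝ} {Q : Eu n →L[ℝ] Eu n →L[ℝ] ℝ} (hQ : ∀ x y, Q x y = Q y x)
    (z : Eu n) {x : Eu n} (hx : x ∈ U) :
    D2 (fun x => w x - poly p0 p Q (x - z)) x = D2 w x - Q ∧
      fderiv ℝ (fun x => w x - poly p0 p Q (x - z)) x = fderiv ℝ w x - (p + Q (x - z)) := by
  have h1 : ∀ y ∈ U, fderiv ℝ (fun x => w x - poly p0 p Q (x - z)) y =
      fderiv ℝ w y - fderiv ℝ (fun x => poly p0 p Q (x - z)) y := fun y hy =>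
    fderiv_fun_sub (C2on_differentiableAt hU hw hy)
      ((contDiff_poly_sub z).differentiable (by norm_num) y)
  refine ⟨?_, by rw [h1 x hx, fderiv_poly_sub hQ]⟩
  have hev : fderiv ℝ (fun x => w x - poly p0 p Q (x - z)) =ᶠ[𝓝 x] fun y =>
      fderiv ℝ w y - fderiv ℝ (fun x => poly p0 p Q (x - z)) y := by
    filter_upwards [hU.mem_nhds hx] with y hy using h1 y hy
  rw [D2, hev.fderiv_eq, fderiv_fun_sub (C2on_differentiableAt_fderiv hU hw hx)
    (C2on_differentiableAt_fderiv isOpen_univ (contDiff_poly_sub z).contDiffOn (mem_univ x))]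
  exact congrArg _ (D2_poly_sub hQ z x)

theorem exists_scale {θ t : ℝ} (hθ : 0 < θ) (hθ1 : θ < 1) (ht : 0 < t) (ht1 : t ≤ 1) :
    ∃ k : ℕ, θ ^ (k + 1) < t ∧ t ≤ θ ^ k :=
  exists_nat_pow_near_of_lt_one ht ht1 hθ hθ1

theorem pw_decay (i0 : Fin n) (hl : 0 < lam) (hL : 0 < Lam) (hα : 0 < α) (hα1 : α < 1) :
    ∃ C : ℝ, 0 < C ∧ ∀ a : Fin n → Fin n → ℝ, Ell lam Lam a → ∀ (x0 : Eu n) (ρ M Γ h0 : ℝ)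
      (w : Eu n → ℝ), 0 < ρ → 0 ≤ M → 0 ≤ Γ → ContDiffOn ℝ 2 w (Metric.ball x0 ρ) →
      (∀ x ∈ Metric.ball x0 ρ, |w x| ≤ M) →
      (∀ x ∈ Metric.ball x0 ρ, |qf a (D2 w x) - h0| ≤ Γ * ‖x - x0‖ ^ α) →
      ∀ r, 0 < r → r ≤ ρ → ∃ p0 p Q, (∀ x y, Q x y = Q y x) ∧ ∀ x ∈ Metric.ball x0 r,
        |w x - poly p0 p Q (x - x0)| ≤ C * (M + ρ ^ 2 * |h0| + ρ ^ (2 + α) * Γ) *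
          (r / ρ) ^ (2 + α) := by
  obtain ⟨C, θ0, hC, hθ0, hθ1, H⟩ := int_decay_scaled i0 hl hL
  obtain ⟨θ, hθ, hθθ, hθ2, hθ3⟩ := exists_theta hC hθ0 (1 / 2) (by norm_num) hα1
  obtain ⟨D, hD, H⟩ := H θ hθ hθθ
  have hθlt : θ < 1 := by linarith
  set c : ℝ := θ ^ (2 + α) with hc
  have hc0 : 0 < c := by positivity
  set k0 : ℝ := 1 + 1 / lam + 2 * D / c with hk0
  have hk1 : 1 ≤ k0 := by
    have : 0 ≤ 1 / lam + 2 * D / c := by positivity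
    linarith
  refine ⟨k0 / c, by positivity, ?_⟩
  intro a ha x0 ρ M Γ h0 w hρ hM hΓ hw hwM hop
  set S : ℝ := M + ρ ^ 2 * |h0| + ρ ^ (2 + α) * Γ with hS
  have hS0 : 0 ≤ S := by positivity
  set B : ℝ := k0 * S with hB
  have hB0 : 0 ≤ B := by positivity
  have h1 := ha.diag i0
  -- approximating polynomials on the geometric scales
  have key : ∀ k : ℕ, ∃ p0 p Q, (∀ x y, Q x y = Q y x) ∧ qf a Q = h0 ∧
      ∀ x ∈ Metric.ball x0 (θ ^ k * ρ), |w x - poly p0 p Q (x - x0)| ≤ B * c ^ k := by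
    intro k
    induction k with
    | zero =>
      refine ⟨0, 0, (h0 / a i0 i0) • coF i0, fun x y => by simp only [smul_apply, coF_apply, smul_eq_mul]; ring, ?_, fun x hx => ?_⟩
      · rw [qf_smul, qf_coF]
        exact div_mul_cancel₀ _ (by linarith)
      · rw [pow_zero, one_mul] at hx
        have e1 := hwM x hx
        rw [mem_ball_iff_norm] at hx
        have e2 : poly 0 0 ((h0 / a i0 i0) • coF i0) (x - x0) =
            1 / 2 * (h0 / a i0 i0 * ((x - x0) i0) ^ 2) := by
          simp only [poly, smul_apply, coF_apply, smul_eq_mul, zero_apply]; ring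
        have e3 := abs_coord_le (x - x0) i0
        have e4 : ((x - x0) i0) ^ 2 ≤ ρ ^ 2 := by
          rw [← sq_abs]
          exact pow_le_pow_left₀ (abs_nonneg _) (e3.trans hx.le) 2
        have e5 : |h0 / a i0 i0| ≤ |h0| / lam := by
          rw [abs_div, abs_of_pos (a := a i0 i0) (by linarith)]
          exact div_le_div_of_nonneg_left (abs_nonneg _) hl h1.1
        have e6 : |poly 0 0 ((h0 / a i0 i0) • coF i0) (x - x0)| ≤ |h0| / lam * ρ ^ 2 := by
          rw [e2, abs_mul, abs_mul, abs_of_nonneg (sq_nonneg ((x - x0) i0)),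
            abs_of_pos (by norm_num : (0:ℝ) < 1 / 2)]
          have := mul_le_mul e5 e4 (sq_nonneg _) (by positivity)
          have : 0 ≤ |h0 / a i0 i0| * ((x - x0) i0) ^ 2 := by positivity
          linarith
        have e7 := abs_sub (w x) (poly 0 0 ((h0 / a i0 i0) • coF i0) (x - x0))
        have e8 : M + |h0| / lam * ρ ^ 2 ≤ (1 + 1 / lam) * S := by
          have : 0 ≤ 1 / lam * M := by positivity
          have : 0 ≤ (1 + 1 / lam) * (ρ ^ (2 + α) * Γ) := by positivity
          have : 0 ≤ ρ ^ 2 * |h0| := by positivity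
          rw [hS]
          have : |h0| / lam * ρ ^ 2 = 1 / lam * (ρ ^ 2 * |h0|) := by ring
          linarith
        have e9 : (1 + 1 / lam) * S ≤ B := by
          rw [hB, hk0]
          refine mul_le_mul_of_nonneg_right ?_ hS0
          have : 0 ≤ 2 * D / c := by positivity
          linarith
        rw [pow_zero, mul_one]
        linarith
    | succ k ih =>
      obtain ⟨p0, p, Q, hQ, hQa, hP⟩ := ih
      set R : ℝ := θ ^ k * ρ with hR
      have hR0 : 0 < R := by positivity
      have hRρ : R ≤ ρ := mul_le_of_le_one_left hρ.le (pow_le_one₀ hθ.le hθlt.le)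
      have hsub : Metric.ball x0 R ⊆ Metric.ball x0 ρ := Metric.ball_subset_ball hRρ
      obtain ⟨p0', p', Q', hQ', hQa', hP'⟩ := H a ha x0 R (B * c ^ k) (Γ * R ^ α)
        (fun x => w x - poly p0 p Q (x - x0)) hR0 (by positivity) (by positivity)
        ((hw.mono hsub).sub (contDiff_poly_sub x0).contDiffOn) hP (fun x hx => by
          rw [(D2_sub_poly Metric.isOpen_ball hw hQ x0 (hsub hx)).1, qf_sub, hQa]
          refine (hop x (hsub hx)).trans (mul_le_mul_of_nonneg_left ?_ hΓ)
          rw [mem_ball_iff_norm] at hx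
          exact Real.rpow_le_rpow (norm_nonneg _) hx.le hα.le)
      refine ⟨p0 + p0', p + p', Q + Q', fun x y => by simp [hQ x y, hQ' x y], by
        rw [qf_add, hQa, hQa', add_zero], fun x hx => ?_⟩
      rw [poly_add, ← sub_sub]
      refine (hP' x (by rwa [hR, ← mul_assoc, ← pow_succ'])).trans ?_
      have e1 : R ^ 2 * (Γ * R ^ α) = c ^ k * (ρ ^ (2 + α) * Γ) := by
        have : R ^ (2 + α) = c ^ k * ρ ^ (2 + α) := by
          rw [hR, Real.mul_rpow (by positivity) hρ.le, hc, ← Real.rpow_natCast,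
            ← Real.rpow_natCast, ← Real.rpow_mul hθ.le, ← Real.rpow_mul hθ.le,
            mul_comm (k:ℝ)]
        calc _ = (R ^ 2 * R ^ α) * Γ := by ring
          _ = _ := by rw [← rpow_two_add hR0, this]; ring
      rw [e1, pow_succ c k]
      have e2 : C * θ ^ 3 * (B * c ^ k) ≤ 1 / 2 * c * (B * c ^ k) :=
        mul_le_mul_of_nonneg_right hθ3 (by positivity)
      have e3 : 2 * D * (ρ ^ (2 + α) * Γ) ≤ c * B := by
        have : 2 * D * S ≤ c * B := by
          have : c * B = (1 + 1 / lam) * c * S + 2 * D * S := by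
            rw [hB, hk0]; field_simp
          have : 0 ≤ (1 + 1 / lam) * c * S := by positivity
          linarith
        refine le_trans (mul_le_mul_of_nonneg_left ?_ (by positivity)) this
        have : 0 ≤ M + ρ ^ 2 * |h0| := by positivity
        linarith
      have e4 := mul_le_mul_of_nonneg_left e3 (by positivity : 0 ≤ c ^ k)
      linarith
  intro r hr hrρ
  obtain ⟨k, hk1, hk2⟩ := exists_scale hθ hθlt (div_pos hr hρ) ((div_le_one hρ).2 hrρ)
  obtain ⟨p0, p, Q, hQ, -, hP⟩ := key k
  refine ⟨p0, p, Q, hQ, fun x hx => (hP x (Metric.ball_subset_ball ?_ hx)).trans ?_⟩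
  · rwa [div_le_iff₀ hρ] at hk2
  · have e1 : c ^ (k + 1) ≤ (r / ρ) ^ (2 + α) := by
      rw [hc, ← Real.rpow_natCast, ← Real.rpow_mul hθ.le, mul_comm, Real.rpow_mul hθ.le,
        Real.rpow_natCast]
      exact Real.rpow_le_rpow (by positivity) hk1.le (by linarith)
    rw [pow_succ] at e1
    have : c ^ k ≤ (r / ρ) ^ (2 + α) / c := by rwa [le_div_iff₀ hc0]
    calc B * c ^ k ≤ B * ((r / ρ) ^ (2 + α) / c) := mul_le_mul_of_nonneg_left this hB0
      _ = _ := by rw [hB]; ring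

theorem fderiv_lip {w : Eu n → ℝ} {U V : Set (Eu n)} (hU : IsOpen U) (hw : ContDiffOn ℝ 2 w U)
    (hV : Convex ℝ V) (hVU : V ⊆ U) {T : ℝ} (hT : ∀ y ∈ V, ‖D2 w y‖ ≤ T) {x y : Eu n}
    (hx : x ∈ V) (hy : y ∈ V) : ‖fderiv ℝ w x - fderiv ℝ w y‖ ≤ T * ‖x - y‖ :=
  hV.norm_image_sub_le_of_norm_fderiv_le
    (fun z hz => C2on_differentiableAt_fderiv hU hw (hVU hz)) hT hy hx

theorem grad_interp {w : Eu n → ℝ} {x : Eu n} {d s M T : ℝ}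
    (hw : ContDiffOn ℝ 2 w (Metric.ball x d)) (hs : 0 < s) (hsd : s < d) (hM : 0 ≤ M) (hT : 0 ≤ T)
    (hwM : ∀ y ∈ Metric.ball x d, |w y| ≤ M) (hD : ∀ y ∈ Metric.ball x d, ‖D2 w y‖ ≤ T) :
    ‖fderiv ℝ w x‖ ≤ 2 * M / s + s * T := by
  refine ContinuousLinearMap.opNorm_le_of_unit_norm (by positivity) fun v hv => ?_
  have hmem : ∀ t ∈ Icc (0:ℝ) s, x + t • v ∈ Metric.ball x d := fun t ht => by
    rw [mem_ball_iff_norm, add_sub_cancel_left, norm_smul, hv, mul_one, Real.norm_eq_abs,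
      abs_of_nonneg ht.1]
    linarith [ht.2]
  have hd : ∀ t ∈ Icc (0:ℝ) s, HasDerivAt (fun t => w (x + t • v)) (fderiv ℝ w (x + t • v) v) t :=
    fun t ht => hasDerivAt_line (C2on_differentiableAt Metric.isOpen_ball hw (hmem t ht))
  obtain ⟨ξ, hξ, he⟩ := exists_hasDerivAt_eq_slope (fun t => w (x + t • v))
    (fun t => fderiv ℝ w (x + t • v) v) hs
    (fun t ht => (hd t ht).continuousAt.continuousWithinAt)
    (fun t ht => hd t (Ioo_subset_Icc_self ht))
  simp only [sub_zero, zero_smul, add_zero] at he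
  have h0 : x ∈ Metric.ball x d := Metric.mem_ball_self (hs.trans hsd)
  have h1 := hwM _ (hmem s ⟨hs.le, le_rfl⟩)
  have h2 := hwM _ h0
  have hξ' := hmem ξ (Ioo_subset_Icc_self hξ)
  have h3 := fderiv_lip Metric.isOpen_ball hw (convex_ball x d) le_rfl hD h0 hξ'
  have h4 : ‖x - (x + ξ • v)‖ ≤ s := by
    rw [sub_add_cancel_left, norm_neg, norm_smul, hv, mul_one, Real.norm_eq_abs,
      abs_of_pos hξ.1]
    exact hξ.2.le
  have h5 : |fderiv ℝ w x v - fderiv ℝ w (x + ξ • v) v| ≤ s * T := by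
    rw [← sub_apply]
    calc _ ≤ ‖fderiv ℝ w x - fderiv ℝ w (x + ξ • v)‖ * ‖v‖ := ContinuousLinearMap.le_opNorm _ _
      _ ≤ T * s := by
        rw [hv, mul_one]; exact h3.trans (mul_le_mul_of_nonneg_left h4 hT)
      _ = _ := mul_comm _ _
  have h6 : |fderiv ℝ w (x + ξ • v) v| ≤ 2 * M / s := by
    rw [he, abs_div, abs_of_pos hs]
    refine div_le_div_of_nonneg_right ?_ hs.le
    have := abs_sub (w (x + s • v)) (w x)
    linarith
  rw [Real.norm_eq_abs]
  have := abs_sub_abs_le_abs_sub (fderiv ℝ w x v) (fderiv ℝ w (x + ξ • v) v)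
  linarith

theorem two_point (hα : 0 < α) (hα1 : α < 1) : ∃ C : ℝ, 0 < C ∧ ∀ {n : ℕ} {w : Eu n → ℝ}
    {U : Set (Eu n)} {x y : Eu n} {A r0 : ℝ}, IsOpen U → ContDiffOn ℝ 2 w U → x ∈ U → y ∈ U →
    0 ≤ A →
    (∀ z ∈ ({x, y} : Set (Eu n)), ∀ r, 0 < r → r ≤ r0 → ∃ p0 p Q, (∀ x y, Q x y = Q y x) ∧
      ∀ y ∈ Metric.ball z r, |w y - poly p0 p Q (y - z)| ≤ A * r ^ (2 + α)) →
    4 * ‖x - y‖ ≤ r0 → ‖D2 w x - D2 w y‖ ≤ C * A * ‖x - y‖ ^ α := by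
  obtain ⟨C, hC, H⟩ := sdq_D2 hα hα1
  refine ⟨2 * (2 * C + 512), by positivity, ?_⟩
  intro n w U x y A r0 hU hw hx hy hA hP hr
  rcases eq_or_ne x y with rfl | hxy
  · rw [sub_self]
    exact (norm_zero (E := Eu n →L[ℝ] Eu n →L[ℝ] ℝ)).le.trans (by positivity)
  set h := ‖x - y‖ with hh
  have hh0 : 0 < h := norm_pos_iff.2 (sub_ne_zero.2 hxy)
  have key : ∀ e, ‖e‖ ≤ 1 → |(D2 w x - D2 w y) e e| ≤ (2 * C + 512) * A * h ^ α := by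
    intro e he
    have e1 := H hU hw hx hA (hP x (by simp)) e he h hh0 (by linarith)
    have e2 := H hU hw hy hA (hP y (by simp)) e he h hh0 (by linarith)
    obtain ⟨p0, p, Q, hQ, hE⟩ := hP x (by simp) (4 * h) (by positivity) hr
    have e3 := sdq_approx (x := x) hQ hh0 he (by simp; linarith) hE
    have e4 := sdq_approx (x := y) hQ hh0 he (by rw [norm_sub_rev, ← hh]; linarith) hE
    have e5 : (4 * h) ^ (2 + α) ≤ 64 * (h ^ 2 * h ^ α) := by
      rw [Real.mul_rpow (by norm_num) hh0.le, rpow_two_add hh0]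
      refine mul_le_mul_of_nonneg_right ?_ (by positivity)
      calc (4:ℝ) ^ (2 + α) ≤ 4 ^ (3:ℝ) :=
            Real.rpow_le_rpow_of_exponent_le (by norm_num) (by linarith)
        _ = 64 := by norm_num
    have e6 : 4 * (A * (4 * h) ^ (2 + α)) / h ^ 2 ≤ 256 * A * h ^ α := by
      rw [div_le_iff₀ (by positivity)]
      have := mul_le_mul_of_nonneg_left e5 hA
      linarith
    rw [sub_apply, sub_apply]
    rw [abs_le] at *
    constructor <;> linarith
  refine (sym_norm_le (by positivity) (fun u v => ?_) key).trans (le_of_eq (by ring))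
  rw [sub_apply, sub_apply, sub_apply, sub_apply, C2on_symm hU hw hx u v, C2on_symm hU hw hy u v]

/-- Coefficients on a set with Hölder bounds. -/
structure IntData (lam Lam α K : ℝ) (V : Set (Eu n)) (a : Eu n → Fin n → Fin n → ℝ)
    (β : Eu n → ℝ) : Prop where
  ell : ∀ x ∈ V, Ell lam Lam (a x)
  aH : ∀ x ∈ V, ∀ y ∈ V, ∀ i j, |a x i j - a y i j| ≤ K * ‖x - y‖ ^ α
  bb : ∀ x ∈ V, |β x| ≤ K
  bH : ∀ x ∈ V, ∀ y ∈ V, |β x - β y| ≤ K * ‖x - y‖ ^ α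

theorem rpow_le_one_of {α t : ℝ} (hα : 0 < α) (h0 : 0 ≤ t) (h1 : t ≤ 1) : t ^ α ≤ 1 :=
  Real.rpow_le_one h0 h1 hα.le

theorem le_rpow_of {α t : ℝ} (hα1 : α < 1) (h0 : 0 ≤ t) (h1 : t ≤ 1) : t ≤ t ^ α :=
  Real.self_le_rpow_of_le_one h0 h1 hα1.le

theorem int_core (ln : Fin n) (hl : 0 < lam) (hL : 0 < Lam) (hα : 0 < α) (hα1 : α < 1) (K : ℝ)
    (hK : 0 ≤ K) :
    ∃ C : ℝ, 0 < C ∧ ∀ (a : Eu n → Fin n → Fin n → ℝ) (β : Eu n → ℝ) (x0 : Eu n)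
      (ρ M F N : ℝ) (h w : Eu n → ℝ), 0 < ρ → ρ ≤ 1 → 0 ≤ M → 0 ≤ F → 0 ≤ N →
      IntData lam Lam α K (Metric.ball x0 ρ) a β →
      ContDiffOn ℝ 2 w (Metric.ball x0 ρ) → (∀ x ∈ Metric.ball x0 ρ, |w x| ≤ M) →
      (∀ x ∈ Metric.ball x0 ρ, |h x| ≤ F) →
      (∀ x ∈ Metric.ball x0 ρ, ∀ y ∈ Metric.ball x0 ρ, |h x - h y| ≤ F * ‖x - y‖ ^ α) →
      (∀ x ∈ Metric.ball x0 ρ, qf (a x) (D2 w x) + β x * fderiv ℝ w x (bv ln) = h x) →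
      (∀ x ∈ Metric.ball x0 ρ, ρ ^ 2 * ‖D2 w x‖ ≤ N) →
      (∀ x ∈ Metric.ball x0 ρ, ρ * ‖fderiv ℝ w x‖ ≤ 8 * M + N) →
      ∀ r, 0 < r → r ≤ ρ → ∃ p0 p Q, (∀ x y, Q x y = Q y x) ∧ ∀ x ∈ Metric.ball x0 r,
        |w x - poly p0 p Q (x - x0)| ≤ C * (M + F + N) / ρ ^ (2 + α) * r ^ (2 + α) := by
  obtain ⟨C, hC, H⟩ := pw_decay ln hl hL hα hα1
  set k : ℝ := n ^ 2 * K + 9 * K + 1 with hk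
  have hk0 : 0 ≤ n ^ 2 * K := by positivity
  refine ⟨C * (1 + k + 2 * k), by positivity, ?_⟩
  intro a β x0 ρ M F N h w hρ hρ1 hM hF hN hd hw hwM hhF hhH heq hD2 hD1
  have hx0 : x0 ∈ Metric.ball x0 ρ := Metric.mem_ball_self hρ
  set h0 : ℝ := h x0 - β x0 * fderiv ℝ w x0 (bv ln) with hh0
  set Γ : ℝ := 2 * k * (M + F + N) / ρ ^ 2 with hΓ
  have hΓ0 : 0 ≤ Γ := by positivity
  have hdn : ∀ T : Eu n →L[ℝ] ℝ, |T (bv ln)| ≤ ‖T‖ := fun T => by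
    simpa [norm_bv] using T.le_opNorm (bv ln)
  have hρ2 : ρ ^ 2 ≤ ρ := by rw [sq]; exact mul_le_of_le_one_left hρ.le hρ1
  have hρ21 : ρ ^ 2 ≤ 1 := hρ2.trans hρ1
  have hop : ∀ x ∈ Metric.ball x0 ρ, |qf (a x0) (D2 w x) - h0| ≤ Γ * ‖x - x0‖ ^ α := by
    intro x hx
    have hxn := mem_ball_iff_norm.1 hx
    set t := ‖x - x0‖ with ht
    have ht0 : 0 ≤ t := norm_nonneg _
    have hta : t ≤ t ^ α := le_rpow_of hα1 ht0 (by linarith)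
    have hid : qf (a x0) (D2 w x) - h0 = (h x - h x0) - qf (fun i j => a x i j - a x0 i j) (D2 w x)
        - (β x - β x0) * fderiv ℝ w x (bv ln)
        - β x0 * (fderiv ℝ w x - fderiv ℝ w x0) (bv ln) := by
      rw [qf_sub_left, sub_apply, hh0]
      linarith [heq x hx]
    have g1 := hhH x hx x0 hx0
    have g2 := qf_abs_le (fun i j => a x i j - a x0 i j) (D2 w x) (hd.aH x hx x0 hx0)
    have g3 : |(β x - β x0) * fderiv ℝ w x (bv ln)| ≤ K * t ^ α * ‖fderiv ℝ w x‖ := by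
      rw [abs_mul]
      exact mul_le_mul (hd.bH x hx x0 hx0) (hdn _) (abs_nonneg _) (by positivity)
    have g4 : |β x0 * (fderiv ℝ w x - fderiv ℝ w x0) (bv ln)| ≤ K * (N / ρ ^ 2 * t) := by
      rw [abs_mul]
      refine mul_le_mul (hd.bb x0 hx0) ((hdn _).trans ?_) (abs_nonneg _) hK
      refine fderiv_lip Metric.isOpen_ball hw (convex_ball x0 ρ) le_rfl (fun y hy => ?_) hx hx0
      rw [le_div_iff₀ (by positivity), mul_comm]
      exact hD2 y hy
    have g5 : ‖D2 w x‖ ≤ N / ρ ^ 2 := by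
      rw [le_div_iff₀ (by positivity), mul_comm]; exact hD2 x hx
    have g6 : ‖fderiv ℝ w x‖ ≤ (8 * M + N) / ρ ^ 2 := by
      rw [le_div_iff₀ (by positivity), mul_comm]
      exact (mul_le_mul_of_nonneg_right hρ2 (norm_nonneg _)).trans (hD1 x hx)
    have g7 : F ≤ F / ρ ^ 2 := by
      rw [le_div_iff₀ (by positivity)]; exact mul_le_of_le_one_right hF hρ21
    have hsum : |qf (a x0) (D2 w x) - h0| ≤ F * t ^ α + n ^ 2 * (K * t ^ α) * ‖D2 w x‖
        + K * t ^ α * ‖fderiv ℝ w x‖ + K * (N / ρ ^ 2 * t) := by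
      rw [hid]
      have k1 := abs_sub ((h x - h x0) - qf (fun i j => a x i j - a x0 i j) (D2 w x)
        - (β x - β x0) * fderiv ℝ w x (bv ln)) (β x0 * (fderiv ℝ w x - fderiv ℝ w x0) (bv ln))
      have k2 := abs_sub ((h x - h x0) - qf (fun i j => a x i j - a x0 i j) (D2 w x))
        ((β x - β x0) * fderiv ℝ w x (bv ln))
      have k3 := abs_sub (h x - h x0) (qf (fun i j => a x i j - a x0 i j) (D2 w x))
      linarith
    have hta0 : 0 ≤ t ^ α := by positivity
    have l1 := mul_le_mul_of_nonneg_right g7 hta0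
    have l2 := mul_le_mul_of_nonneg_left g5 (by positivity : 0 ≤ n ^ 2 * (K * t ^ α))
    have l3 := mul_le_mul_of_nonneg_left g6 (by positivity : 0 ≤ K * t ^ α)
    have l4 := mul_le_mul_of_nonneg_left hta (by positivity : 0 ≤ K * (N / ρ ^ 2))
    refine hsum.trans ?_
    have : Γ * t ^ α = (2 * (n ^ 2 * K) * (M + F + N) + 18 * K * (M + F + N) + 2 * (M + F + N))
        / ρ ^ 2 * t ^ α := by rw [hΓ, hk]; ring
    rw [this]
    calc _ ≤ F / ρ ^ 2 * t ^ α + n ^ 2 * (K * t ^ α) * (N / ρ ^ 2) +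
          K * t ^ α * ((8 * M + N) / ρ ^ 2) + K * (N / ρ ^ 2) * t ^ α := by linarith
      _ = (F + n ^ 2 * K * N + K * (8 * M + N) + K * N) / ρ ^ 2 * t ^ α := by ring
      _ ≤ _ := by
        refine mul_le_mul_of_nonneg_right (div_le_div_of_nonneg_right ?_ (by positivity)) hta0
        have : 0 ≤ n ^ 2 * K * M := by positivity
        have : 0 ≤ n ^ 2 * K * F := by positivity
        have : 0 ≤ n ^ 2 * K * N := by positivity
        have : 0 ≤ K * M := by positivity
        have : 0 ≤ K * F := by positivity
        have : 0 ≤ K * N := by positivity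
        linarith
  intro r hr hrρ
  obtain ⟨p0, p, Q, hQ, hP⟩ := H (a x0) (hd.ell x0 hx0) x0 ρ M Γ h0 w hρ hM hΓ0 hw hwM hop r hr hrρ
  refine ⟨p0, p, Q, hQ, fun x hx => (hP x hx).trans ?_⟩
  · have e1 : ρ ^ 2 * |h0| ≤ k * (M + F + N) := by
      have f1 := abs_sub (h x0) (β x0 * fderiv ℝ w x0 (bv ln))
      rw [abs_mul, ← hh0] at f1
      have f2 := mul_le_mul (hd.bb x0 hx0) (hdn (fderiv ℝ w x0)) (abs_nonneg _) hK
      have f3 := hhF x0 hx0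
      have f4 := mul_le_mul_of_nonneg_left (hD1 x0 hx0) hK
      have f5 : ρ ^ 2 * |h0| ≤ ρ ^ 2 * F + ρ * (K * (ρ * ‖fderiv ℝ w x0‖)) := by
        have := mul_le_mul_of_nonneg_left (f1.trans (add_le_add f3 f2)) (sq_nonneg ρ)
        linarith
      have f6 : ρ * (K * (ρ * ‖fderiv ℝ w x0‖)) ≤ K * (ρ * ‖fderiv ℝ w x0‖) :=
        mul_le_of_le_one_left (by positivity) hρ1
      have f7 : ρ ^ 2 * F ≤ F := mul_le_of_le_one_left hF hρ21
      have : k * (M + F + N) = n ^ 2 * K * (M + F + N) + 9 * (K * M) + 9 * (K * F) + 9 * (K * N)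
        + M + F + N := by rw [hk]; ring
      have : 0 ≤ n ^ 2 * K * (M + F + N) := by positivity
      have : 0 ≤ K * M := by positivity
      have : 0 ≤ K * F := by positivity
      have : 0 ≤ K * N := by positivity
      linarith
    have e2 : ρ ^ (2 + α) * Γ ≤ 2 * k * (M + F + N) := by
      rw [rpow_two_add hρ, hΓ]
      have : ρ ^ 2 * ρ ^ α * (2 * k * (M + F + N) / ρ ^ 2) = ρ ^ α * (2 * k * (M + F + N)) := by
        field_simp
      rw [this]
      exact mul_le_of_le_one_left (by positivity) (rpow_le_one_of hα hρ.le hρ1)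
    rw [Real.div_rpow hr.le hρ.le]
    calc C * (M + ρ ^ 2 * |h0| + ρ ^ (2 + α) * Γ) * (r ^ (2 + α) / ρ ^ (2 + α))
        ≤ C * ((M + F + N) + k * (M + F + N) + 2 * k * (M + F + N)) *
          (r ^ (2 + α) / ρ ^ (2 + α)) := by
          refine mul_le_mul_of_nonneg_right (mul_le_mul_of_nonneg_left ?_ hC.le) (by positivity)
          linarith
      _ = _ := by ring

theorem IntData.mono {K : ℝ} {V V' : Set (Eu n)} {a : Eu n → Fin n → Fin n → ℝ} {β : Eu n → ℝ}
    (h : IntData lam Lam α K V a β) (hV : V' ⊆ V) : IntData lam Lam α K V' a β :=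
  ⟨fun x hx => h.ell x (hV hx), fun x hx y hy => h.aH x (hV hx) y (hV hy),
    fun x hx => h.bb x (hV hx), fun x hx y hy => h.bH x (hV hx) y (hV hy)⟩

/-- The factor making `C κ^α` small. -/
theorem exists_kappa {C : ℝ} (hC : 0 ≤ C) (hα : 0 < α) (c : ℝ) (hc : 0 < c) (m : ℝ) (hm : 0 < m) :
    ∃ κ, 0 < κ ∧ κ ≤ m ∧ C * κ ^ α ≤ c := by
  have : ContinuousAt (fun κ : ℝ => C * κ ^ α) 0 :=
    (Real.continuousAt_rpow_const _ _ (Or.inr hα.le)).const_mul C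
  have ht := this.tendsto
  rw [Real.zero_rpow hα.ne', mul_zero] at ht
  have ht : Tendsto (fun κ : ℝ => C * κ ^ α) (𝓝[>] 0) (𝓝 0) := ht.mono_left nhdsWithin_le_nhds
  have h1 := ht.eventually (gt_mem_nhds hc)
  have h2 : ∀ᶠ κ : ℝ in 𝓝[>] 0, κ < m := nhdsWithin_le_nhds (gt_mem_nhds hm)
  obtain ⟨κ, ⟨h1, h2⟩, h3⟩ := ((h1.and h2).and self_mem_nhdsWithin).exists
  exact ⟨κ, h3, h2.le, h1.le⟩

theorem int_unit (ln : Fin n) (hl : 0 < lam) (hL : 0 < Lam) (hα : 0 < α) (hα1 : α < 1) (K : ℝ)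
    (hK : 0 ≤ K) :
    ∃ C : ℝ, 0 < C ∧ ∀ (a : Eu n → Fin n → Fin n → ℝ) (β : Eu n → ℝ)
      (M F : ℝ) (h w : Eu n → ℝ), 0 < M → 0 ≤ F →
      IntData lam Lam α K (Metric.ball 0 1) a β →
      ContDiffOn ℝ 2 w (Metric.ball 0 1) → (∀ x ∈ Metric.ball (0 : Eu n) 1, |w x| ≤ M) →
      (∀ x ∈ Metric.ball (0 : Eu n) 1, |h x| ≤ F) →
      (∀ x ∈ Metric.ball (0 : Eu n) 1, ∀ y ∈ Metric.ball (0 : Eu n) 1,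
        |h x - h y| ≤ F * ‖x - y‖ ^ α) →
      (∀ x ∈ Metric.ball (0 : Eu n) 1, qf (a x) (D2 w x) + β x * fderiv ℝ w x (bv ln) = h x) →
      (∃ N, ∀ x ∈ Metric.ball (0 : Eu n) 1, ‖D2 w x‖ ≤ N) →
      (∀ x ∈ Metric.ball (0 : Eu n) (1 / 2),
        ‖fderiv ℝ w x‖ ≤ C * (M + F) ∧ ‖D2 w x‖ ≤ C * (M + F)) ∧
      ∀ x ∈ Metric.ball (0 : Eu n) (1 / 2), ∀ y ∈ Metric.ball (0 : Eu n) (1 / 2),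
        ‖D2 w x - D2 w y‖ ≤ C * (M + F) * ‖x - y‖ ^ α := by
  obtain ⟨C1, hC1, H1⟩ := int_core ln hl hL hα hα1 K hK
  obtain ⟨C2, hC2, H2⟩ := sdq_D2 hα hα1
  obtain ⟨C3, hC3, H3⟩ := two_point hα hα1
  obtain ⟨κ, hκ, hκ2, hκα⟩ := exists_kappa (C := 8 * (C2 * C1)) (by positivity) hα (1 / 2)
    (by norm_num) (1 / 2) (by norm_num)
  set C4 : ℝ := 32 / κ ^ 2 + 1 / 2 with hC4
  have hC40 : 0 < C4 := by positivity
  set N1 : ℝ := 3 * C4 with hN1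
  set C5 : ℝ := C3 * (C1 * (1 + N1) * 64) with hC5
  refine ⟨16 + 16 * N1 + C5 + 8 * N1 * 16, by positivity, ?_⟩
  intro a β M F h w hM hF hd hw hwM hhF hhH heq ⟨N0, hN0⟩
  have hU : IsOpen (Metric.ball (0 : Eu n) 1) := Metric.isOpen_ball
  have hball : ∀ {x : Eu n} {s : ℝ}, s ≤ 1 - ‖x‖ → Metric.ball x s ⊆ Metric.ball 0 1 := by
    intro x s hs y hy
    rw [mem_ball_iff_norm] at *
    rw [sub_zero]
    have := norm_add_le (y - x) x
    rw [sub_add_cancel] at this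
    linarith
  have hdist : ∀ {x y : Eu n} {s : ℝ}, y ∈ Metric.ball x s → 1 - ‖x‖ - s ≤ 1 - ‖y‖ := by
    intro x y s hy
    rw [mem_ball_iff_norm] at hy
    have := norm_add_le (y - x) x
    rw [sub_add_cancel] at this
    linarith
  set S : Set ℝ := {N | ∀ x ∈ Metric.ball (0 : Eu n) 1, (1 - ‖x‖) ^ 2 * ‖D2 w x‖ ≤ N} with hS
  have hgrad : ∀ N ∈ S, 0 ≤ N → ∀ x ∈ Metric.ball (0 : Eu n) 1,
      (1 - ‖x‖) * ‖fderiv ℝ w x‖ ≤ 8 * M + N := by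
    intro N hN hN0 x hx
    rw [mem_ball_zero_iff] at hx
    have hdx : 0 < 1 - ‖x‖ := by linarith
    set d := 1 - ‖x‖ with hd'
    have hsub : Metric.ball x (d / 2) ⊆ Metric.ball 0 1 := hball (by linarith)
    have := grad_interp (s := d / 4) (T := 4 * N / d ^ 2) (hw.mono hsub) (by linarith)
      (by linarith) hM.le (by positivity) (fun y hy => hwM y (hsub hy)) (fun y hy => by
        have e1 := hN y (hsub hy)
        have e2 := hdist hy
        rw [le_div_iff₀ (by positivity)]
        have e3 : (d / 2) ^ 2 ≤ (1 - ‖y‖) ^ 2 := pow_le_pow_left₀ (by linarith) (by linarith) 2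
        have e4 := mul_le_mul_of_nonneg_right e3 (norm_nonneg (D2 w y))
        linarith)
    calc d * ‖fderiv ℝ w x‖ ≤ d * (2 * M / (d / 4) + d / 4 * (4 * N / d ^ 2)) :=
          mul_le_mul_of_nonneg_left this hdx.le
      _ = 8 * M + N := by field_simp; ring
  -- approximation at points, relative to a valid bound for the second derivatives
  have happ : ∀ N ∈ S, 0 ≤ N → ∀ x ∈ Metric.ball (0 : Eu n) 1, ∀ ρ, 0 < ρ → 2 * ρ ≤ 1 - ‖x‖ →
      ∀ r, 0 < r → r ≤ ρ → ∃ p0 p Q, (∀ x y, Q x y = Q y x) ∧ ∀ y ∈ Metric.ball x r,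
        |w y - poly p0 p Q (y - x)| ≤ C1 * (M + F + N) / ρ ^ (2 + α) * r ^ (2 + α) := by
    intro N hN hN0 x hx ρ hρ hρx
    have hsub : Metric.ball x ρ ⊆ Metric.ball 0 1 := hball (by linarith)
    refine H1 a β x ρ M F N h w hρ (by linarith [norm_nonneg x]) hM.le hF hN0 (hd.mono hsub)
      (hw.mono hsub) (fun y hy => hwM y (hsub hy)) (fun y hy => hhF y (hsub hy))
      (fun y hy z hz => hhH y (hsub hy) z (hsub hz)) (fun y hy => heq y (hsub hy))
      (fun y hy => ?_) (fun y hy => ?_)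
    · refine le_trans (mul_le_mul_of_nonneg_right ?_ (norm_nonneg (D2 w y))) (hN y (hsub hy))
      exact pow_le_pow_left₀ hρ.le (by linarith [hdist hy]) 2
    · refine le_trans (mul_le_mul_of_nonneg_right ?_ (norm_nonneg _)) (hgrad N hN hN0 y (hsub hy))
      linarith [hdist hy]
  have hSC : 3 * (C4 * (M + F)) ∈ S := by
    refine absorb (by positivity) (fun A hA A' hAA x hx => (hA x hx).trans hAA)
      ⟨N0, fun x hx => ?_⟩ ?_
    · have e := hN0 x hx
      rw [mem_ball_zero_iff] at hx
      have : (1 - ‖x‖) ^ 2 ≤ 1 := pow_le_one₀ (by linarith) (by linarith [norm_nonneg x])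
      exact (mul_le_of_le_one_left (norm_nonneg (D2 w x)) this).trans e
    · intro N hN hN0 x hx
      have hx' := mem_ball_zero_iff.1 hx
      set ρ := (1 - ‖x‖) / 2 with hρ
      have hρ0 : 0 < ρ := by rw [hρ]; linarith
      have hap := happ N hN hN0 x hx ρ hρ0 (by linarith)
      have hκρ : 0 < κ * ρ := by positivity
      have h2κ : 2 * (κ * ρ) ≤ ρ := by
        have := mul_le_mul_of_nonneg_right hκ2 hρ0.le
        linarith
      have hsub : Metric.ball x (2 * ρ) ⊆ Metric.ball 0 1 := hball (by linarith)
      have key : ∀ e, ‖e‖ ≤ 1 → |D2 w x e e| ≤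
          4 * M / (κ * ρ) ^ 2 + C2 * (C1 * (M + F + N) / ρ ^ (2 + α)) * (κ * ρ) ^ α := by
        intro e he
        have e1 := H2 hU hw hx (by positivity) hap e he (κ * ρ) hκρ h2κ
        have hn : ‖(κ * ρ) • e‖ ≤ κ * ρ := by
          rw [norm_smul, Real.norm_eq_abs, abs_of_pos hκρ]
          exact mul_le_of_le_one_right hκρ.le he
        have e2 : |sdq w x e (κ * ρ)| ≤ 4 * M / (κ * ρ) ^ 2 := by
          refine sdq_abs_le hκρ (hwM _ hx) (hwM _ (hsub ?_)) (hwM _ (hsub ?_)) <;>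
            rw [mem_ball_iff_norm]
          · rw [add_sub_cancel_left]; linarith
          · rw [sub_sub_cancel_left, norm_neg]; linarith
        rw [abs_le] at *
        constructor <;> linarith
      have e3 := sym_norm_le (by positivity) (C2on_symm hU hw hx) key
      have e4 : 2 * (4 * M / (κ * ρ) ^ 2 +
          C2 * (C1 * (M + F + N) / ρ ^ (2 + α)) * (κ * ρ) ^ α) =
          (8 / κ ^ 2 * M + 2 * (C2 * C1) * κ ^ α * (M + F + N)) / ρ ^ 2 := by
        rw [rpow_two_add hρ0, Real.mul_rpow hκ.le hρ0.le]
        field_simp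
        ring
      rw [e4, le_div_iff₀ (by positivity)] at e3
      have e5 : (1 - ‖x‖) ^ 2 = 4 * ρ ^ 2 := by rw [hρ]; ring
      rw [e5]
      have e6 := mul_le_mul_of_nonneg_right hκα (by positivity : 0 ≤ M + F + N)
      have e7 : 0 ≤ 32 / κ ^ 2 * F := by positivity
      have e8 : C4 * (M + F) = 32 / κ ^ 2 * M + 32 / κ ^ 2 * F + 1 / 2 * (M + F) := by
        rw [hC4]; ring
      have e9 : 4 * (8 / κ ^ 2 * M) = 32 / κ ^ 2 * M := by ring
      linarith
  rw [← mul_assoc, ← hN1] at hSC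
  set N := N1 * (M + F) with hN
  have hN0' : 0 ≤ N := by positivity
  have hhalf : ∀ x ∈ Metric.ball (0 : Eu n) (1 / 2), x ∈ Metric.ball (0 : Eu n) 1 ∧
      1 / 2 ≤ 1 - ‖x‖ := fun x hx => by
    rw [mem_ball_zero_iff] at *; constructor <;> linarith
  have hD2 : ∀ x ∈ Metric.ball (0 : Eu n) (1 / 2), ‖D2 w x‖ ≤ 4 * N := by
    intro x hx
    obtain ⟨h1, h2⟩ := hhalf x hx
    have e1 := hSC x h1
    have e2 : (1 / 2 : ℝ) ^ 2 ≤ (1 - ‖x‖) ^ 2 := pow_le_pow_left₀ (by norm_num) h2 2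
    have := mul_le_mul_of_nonneg_right e2 (norm_nonneg (D2 w x))
    linarith
  have hC50 : 0 < C5 := by positivity
  have hMF : 0 ≤ M + F := by positivity
  have hNN : N1 * (M + F) = N := rfl
  have hC5M : 0 ≤ C5 * (M + F) := by positivity
  refine ⟨fun x hx => ⟨?_, ?_⟩, fun x hx y hy => ?_⟩
  · obtain ⟨h1, h2⟩ := hhalf x hx
    have e1 := hgrad N hSC hN0' x h1
    have := mul_le_mul_of_nonneg_right h2 (norm_nonneg (fderiv ℝ w x))
    calc ‖fderiv ℝ w x‖ ≤ 16 * M + 2 * N := by linarith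
      _ ≤ _ := by linarith
  · have := hD2 x hx
    linarith
  · set t := ‖x - y‖ with ht
    have ht0 : 0 ≤ t ^ α := by positivity
    rcases le_or_gt (4 * t) (1 / 4) with htl | htl
    · obtain ⟨hx1, hx2⟩ := hhalf x hx
      obtain ⟨hy1, hy2⟩ := hhalf y hy
      have := H3 (r0 := 1 / 4) (A := C1 * (M + F + N) / (1 / 4 : ℝ) ^ (2 + α)) hU hw hx1 hy1
        (by positivity) (fun z hz => by
          rcases hz with rfl | hz
          · exact happ N hSC hN0' z hx1 (1 / 4) (by norm_num) (by linarith)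
          · rw [mem_singleton_iff] at hz
            subst hz
            exact happ N hSC hN0' z hy1 (1 / 4) (by norm_num) (by linarith)) htl
      refine this.trans (mul_le_mul_of_nonneg_right ?_ ht0)
      have e1 : (1 / 64 : ℝ) ≤ (1 / 4 : ℝ) ^ (2 + α) := by
        calc (1 / 64 : ℝ) = (1 / 4 : ℝ) ^ (3:ℝ) := by norm_num
          _ ≤ _ := Real.rpow_le_rpow_of_exponent_ge (by norm_num) (by norm_num) (by linarith)
      have e2 : C1 * (M + F + N) / (1 / 4 : ℝ) ^ (2 + α) ≤ C1 * (M + F + N) * 64 := by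
        calc _ ≤ C1 * (M + F + N) / (1 / 64) :=
              div_le_div_of_nonneg_left (by positivity) (by norm_num) e1
          _ = _ := by ring
      have e3 := mul_le_mul_of_nonneg_left e2 hC3.le
      have e4 : C3 * (C1 * (M + F + N) * 64) = C5 * (M + F) := by rw [hC5, hN]; ring
      linarith
    · have e1 := norm_sub_le (D2 w x) (D2 w y)
      have e2 := hD2 x hx
      have e3 := hD2 y hy
      have e4 : 1 / 16 ≤ t ^ α := by
        rcases le_or_gt t 1 with h1 | h1
        · exact le_trans (by linarith) (le_rpow_of hα1 (norm_nonneg _) h1)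
        · exact le_trans (by norm_num) (Real.one_le_rpow h1.le hα.le)
      have e5 := mul_le_mul_of_nonneg_left e4 (by positivity : 0 ≤ 8 * N1 * 16 * (M + F))
      have e6 : 0 ≤ (16 + 16 * N1 + C5) * (M + F) * t ^ α := by positivity
      linarith

theorem clm_norm_smul' {E F : Type*} [NormedAddCommGroup E] [NormedSpace ℝ E]
    [NormedAddCommGroup F] [NormedSpace ℝ F] (c : ℝ) (T : E →L[ℝ] F) : ‖c • T‖ = |c| * ‖T‖ := norm_smul c T

theorem clm2_norm_smul (c : ℝ) (T : Eu n →L[ℝ] Eu n →L[ℝ] ℝ) : ‖c • T‖ = |c| * ‖T‖ :=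
  clm_norm_smul' c T

theorem clm_cnorm {X E F : Type*} [TopologicalSpace X] [NormedAddCommGroup E] [NormedSpace ℝ E] [NormedAddCommGroup F] [NormedSpace ℝ F] {f : X → E →L[ℝ] F} {s : Set X} (h : ContinuousOn f s) : ContinuousOn (fun x => ‖f x‖) s := h.norm

theorem clm2_cnorm {s : Set (Eu n)} {f : Eu n → Eu n →L[ℝ] Eu n →L[ℝ] ℝ} (h : ContinuousOn f s) : ContinuousOn (fun x => ‖f x‖) s :=
  clm_cnorm h

theorem clm2_smul_sub (c : ℝ) (S T : Eu n →L[ℝ] Eu n →L[ℝ] ℝ) : c • S - c • T = c • (S - T) :=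
  (smul_sub c S T).symm

/-- Elliptic Hölder coefficient matrices on a set. -/
structure CoefOn (lam Lam α K : ℝ) (V : Set (Eu n)) (a : Eu n → Fin n → Fin n → ℝ) : Prop where
  ell : ∀ x ∈ V, Ell lam Lam (a x)
  aH : ∀ x ∈ V, ∀ y ∈ V, ∀ i j, |a x i j - a y i j| ≤ K * ‖x - y‖ ^ α

theorem CoefOn.mono {K : ℝ} {V V' : Set (Eu n)} {a : Eu n → Fin n → Fin n → ℝ}
    (h : CoefOn lam Lam α K V a) (hV : V' ⊆ V) : CoefOn lam Lam α K V' a :=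
  ⟨fun x hx => h.ell x (hV hx), fun x hx y hy => h.aH x (hV hx) y (hV hy)⟩

theorem int_scaled (ln : Fin n) (hl : 0 < lam) (hL : 0 < Lam) (hα : 0 < α) (hα1 : α < 1) {b : ℝ}
    (hb : 0 < b) (K : ℝ) (hK : 0 ≤ K) :
    ∃ C : ℝ, 0 < C ∧ ∀ (a : Eu n → Fin n → Fin n → ℝ) (x0 : Eu n) (ρ M F : ℝ) (U : Set (Eu n))
      (g w : Eu n → ℝ), 0 < ρ → ρ ≤ 1 → 2 * ρ ≤ x0 ln → 0 < M → 0 ≤ F → IsOpen U →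
      Metric.closedBall x0 ρ ⊆ U → ContDiffOn ℝ 2 w U →
      CoefOn lam Lam α K (Metric.ball x0 ρ) a →
      (∀ x ∈ Metric.ball x0 ρ, |w x| ≤ M) →
      (∀ x ∈ Metric.ball x0 ρ, ρ ^ 2 * |g x| ≤ F) →
      (∀ x ∈ Metric.ball x0 ρ, ∀ y ∈ Metric.ball x0 ρ,
        ρ ^ (2 + α) * |g x - g y| ≤ F * ‖x - y‖ ^ α) →
      (∀ x ∈ Metric.ball x0 ρ, opL ln b (a x) w x = g x) →
      (∀ x ∈ Metric.ball x0 (ρ / 2),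
        ρ * ‖fderiv ℝ w x‖ ≤ C * (M + F) ∧ ρ ^ 2 * ‖D2 w x‖ ≤ C * (M + F)) ∧
      ∀ x ∈ Metric.ball x0 (ρ / 2), ∀ y ∈ Metric.ball x0 (ρ / 2),
        ρ ^ (2 + α) * ‖D2 w x - D2 w y‖ ≤ C * (M + F) * ‖x - y‖ ^ α := by
  set K' : ℝ := K + b * Lam + b * K + 2 * b * Lam with hK'
  obtain ⟨C, hC, H⟩ := int_unit ln hl hL hα hα1 K' (by positivity)
  refine ⟨C, hC, ?_⟩
  intro a x0 ρ M F U g w hρ hρ1 hρx hM hF hU hcb hw hd hwM hgF hgH heq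
  set φ : Eu n → Eu n := fun y => x0 + hom n ρ y with hφ
  have hφball : ∀ {y : Eu n} {s : ℝ}, y ∈ Metric.ball 0 s → φ y ∈ Metric.ball x0 (ρ * s) := by
    intro y s hy
    rw [mem_ball_zero_iff] at hy
    rw [mem_ball_iff_norm, hφ]
    simp only [hom_apply, add_sub_cancel_left]
    rw [norm_smul, Real.norm_eq_abs, abs_of_pos hρ]
    exact mul_lt_mul_of_pos_left hy hρ
  have hφ1 : ∀ y ∈ Metric.ball (0 : Eu n) 1, φ y ∈ Metric.ball x0 ρ := fun y hy => by
    simpa using hφball hy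
  have hsub : Metric.ball x0 ρ ⊆ U := Metric.ball_subset_closedBall.trans hcb
  have hφU : ∀ y ∈ Metric.ball (0 : Eu n) 1, φ y ∈ U := fun y hy => hsub (hφ1 y hy)
  have hφd : ∀ y z : Eu n, ‖φ y - φ z‖ = ρ * ‖y - z‖ := fun y z => by
    rw [hφ]; simp only [hom_apply]
    rw [add_sub_add_left_eq_sub, ← smul_sub, norm_smul, Real.norm_eq_abs, abs_of_pos hρ]
  have hφα : ∀ y z : Eu n, ‖φ y - φ z‖ ^ α = ρ ^ α * ‖y - z‖ ^ α := fun y z => by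
    rw [hφd, Real.mul_rpow hρ.le (norm_nonneg _)]
  have hρα : ρ ^ α ≤ 1 := rpow_le_one_of hα hρ.le hρ1
  have hφln : ∀ y, (φ y) ln = x0 ln + ρ * y ln := fun y => by simp [hφ]
  have hs1 : ∀ y ∈ Metric.ball (0 : Eu n) 1, |y ln| < 1 := fun y hy =>
    (abs_coord_le y ln).trans_lt (mem_ball_zero_iff.1 hy)
  have hs2 : ∀ y ∈ Metric.ball (0 : Eu n) 1, ρ ≤ (φ y) ln := fun y hy => by
    rw [hφln]
    have := (abs_lt.1 (hs1 y hy)).1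
    have : ρ * (-1) ≤ ρ * y ln := mul_le_mul_of_nonneg_left this.le hρ.le
    linarith
  have hs3 : ∀ y ∈ Metric.ball (0 : Eu n) 1, 0 ≤ ρ / (φ y) ln ∧ ρ / (φ y) ln ≤ 1 := fun y hy => by
    have := hs2 y hy
    exact ⟨div_nonneg hρ.le (by linarith), div_le_one_of_le₀ this (by linarith)⟩
  set β : Eu n → ℝ := fun y => b * a (φ y) ln ln * (ρ / (φ y) ln) with hβ
  have haL : ∀ y ∈ Metric.ball (0 : Eu n) 1, |a (φ y) ln ln| ≤ Lam := fun y hy =>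
    (hd.ell _ (hφ1 y hy)).abs_le hl ln ln
  have haH : ∀ x ∈ Metric.ball (0 : Eu n) 1, ∀ y ∈ Metric.ball (0 : Eu n) 1, ∀ i j,
      |a (φ x) i j - a (φ y) i j| ≤ K * ‖x - y‖ ^ α := fun x hx y hy i j => by
    refine (hd.aH _ (hφ1 x hx) _ (hφ1 y hy) i j).trans (mul_le_mul_of_nonneg_left ?_ hK)
    rw [hφα]
    exact mul_le_of_le_one_left (by positivity) hρα
  have hid : IntData lam Lam α K' (Metric.ball 0 1) (fun y => a (φ y)) β := by
    refine ⟨fun x hx => hd.ell _ (hφ1 x hx), fun x hx y hy i j => ?_, fun x hx => ?_,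
      fun x hx y hy => ?_⟩
    · refine (haH x hx y hy i j).trans (mul_le_mul_of_nonneg_right ?_ (by positivity))
      have : 0 ≤ b * Lam + b * K + 2 * b * Lam := by positivity
      linarith
    · have h3 := hs3 x hx
      rw [hβ]; simp only []
      rw [abs_mul, abs_mul, abs_of_pos hb, abs_of_nonneg h3.1]
      have e1 := mul_le_mul_of_nonneg_left (haL x hx) hb.le
      have e2 := mul_le_of_le_one_right (by positivity : 0 ≤ b * |a (φ x) ln ln|) h3.2
      have : 0 ≤ K + b * K + 2 * b * Lam := by positivity
      linarith
    · have hx3 := hs3 x hx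
      have hy3 := hs3 y hy
      have hx2 := hs2 x hx
      have hy2 := hs2 y hy
      set t := ‖x - y‖ with ht
      have ht0 : 0 ≤ t ^ α := by positivity
      have hdiff : |ρ / (φ x) ln - ρ / (φ y) ln| ≤ 2 * t ^ α := by
        have e0 : ρ / (φ x) ln - ρ / (φ y) ln = ρ / (φ x) ln * (ρ / (φ y) ln) * ((y - x) ln) := by
          have h1 : (φ x) ln ≠ 0 := by linarith
          have h2 : (φ y) ln ≠ 0 := by linarith
          rw [div_sub_div _ _ h1 h2, div_mul_div_comm, div_mul_eq_mul_div]
          congr 1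
          rw [hφln, hφln, PiLp.sub_apply]; ring
        rw [e0, abs_mul, abs_of_nonneg (mul_nonneg hx3.1 hy3.1)]
        have e1 := mul_le_one₀ hx3.2 hy3.1 hy3.2
        have e2 := abs_coord_le (y - x) ln
        rw [norm_sub_rev, ← ht] at e2
        have e3 : t ≤ 2 * t ^ α := by
          have ht2 : t ≤ 2 := by
            have := norm_sub_le x y
            rw [mem_ball_zero_iff] at hx hy
            linarith
          have := le_rpow_of hα1 (by positivity : 0 ≤ t / 2) (by linarith)
          have h5 : (t / 2) ^ α ≤ t ^ α :=
            Real.rpow_le_rpow (by positivity) (by linarith [norm_nonneg (x - y)]) hα.le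
          linarith
        exact (mul_le_of_le_one_left (abs_nonneg _) e1).trans (e2.trans e3)
      have e : β x - β y = b * (a (φ x) ln ln - a (φ y) ln ln) * (ρ / (φ x) ln) +
          b * a (φ y) ln ln * (ρ / (φ x) ln - ρ / (φ y) ln) := by rw [hβ]; ring
      rw [e]
      refine (abs_add_le _ _).trans ?_
      rw [abs_mul, abs_mul, abs_mul, abs_mul, abs_of_pos hb, abs_of_nonneg hx3.1]
      have f1 := mul_le_mul_of_nonneg_left (haH x hx y hy ln ln) hb.le
      have f2 := mul_le_of_le_one_right
        (by positivity : 0 ≤ b * |a (φ x) ln ln - a (φ y) ln ln|) hx3.2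
      have f3 := mul_le_mul (mul_le_mul_of_nonneg_left (haL y hy) hb.le) hdiff (abs_nonneg _)
        (by positivity)
      have : 0 ≤ (K + b * Lam) * t ^ α := by positivity
      rw [hK']
      linarith
  have hW : ContDiffOn ℝ 2 (fun y => w (φ y)) (Metric.ball 0 1) := contDiffOn_affine hw hφU
  have hfd : ∀ y ∈ Metric.ball (0 : Eu n) 1, fderiv ℝ (fun y => w (φ y)) y =
      ρ • fderiv ℝ w (φ y) := fun y hy => by
    ext v
    rw [hφ, fderiv_affine hU hw (hφU y hy)]
    simp
  have hD2 : ∀ y ∈ Metric.ball (0 : Eu n) 1, D2 (fun y => w (φ y)) y =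
      ρ ^ 2 • D2 w (φ y) := fun y hy => D2_hom hU hw (hφU y hy)
  have hbdd : ∃ N, ∀ x ∈ Metric.ball (0 : Eu n) 1, ‖D2 (fun y => w (φ y)) x‖ ≤ N := by
    have hcn : ContinuousOn (fun x => ‖D2 w x‖) (Metric.closedBall x0 ρ) :=
      clm2_cnorm ((C2on_continuousOn_D2 hU hw).mono hcb)
    obtain ⟨B, hB⟩ := (isCompact_closedBall x0 ρ).bddAbove_image hcn
    replace hB : ∀ x ∈ Metric.closedBall x0 ρ, ‖D2 w x‖ ≤ B := fun x hx => hB ⟨x, hx, rfl⟩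
    refine ⟨ρ ^ 2 * B, fun x hx => ?_⟩
    rw [hD2 x hx, clm2_norm_smul, abs_of_pos (by positivity)]
    exact mul_le_mul_of_nonneg_left (hB _ (Metric.ball_subset_closedBall (hφ1 x hx)))
      (by positivity)
  obtain ⟨R1, R2⟩ := H (fun y => a (φ y)) β M F (fun y => ρ ^ 2 * g (φ y)) (fun y => w (φ y)) hM hF
    hid hW (fun x hx => hwM _ (hφ1 x hx)) (fun x hx => by
      rw [abs_mul, abs_of_pos (by positivity)]; exact hgF _ (hφ1 x hx))
    (fun x hx y hy => by
      have := hgH _ (hφ1 x hx) _ (hφ1 y hy)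
      rw [hφα, rpow_two_add hρ] at this
      rw [← mul_sub, abs_mul, abs_of_pos (by positivity)]
      refine le_of_mul_le_mul_left ?_ (by positivity : 0 < ρ ^ α)
      linarith)
    (fun x hx => by
      rw [hD2 x hx, hfd x hx, qf_smul, ← heq _ (hφ1 x hx), opL, smul_apply, smul_eq_mul, hβ]
      ring) hbdd
  have hinv : ∀ x ∈ Metric.ball x0 (ρ / 2), ∃ y ∈ Metric.ball (0 : Eu n) (1 / 2), φ y = x := by
    intro x hx
    rw [mem_ball_iff_norm] at hx
    refine ⟨ρ⁻¹ • (x - x0), ?_, ?_⟩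
    · rw [mem_ball_zero_iff, norm_smul, norm_inv, Real.norm_eq_abs, abs_of_pos hρ,
        inv_mul_lt_iff₀ hρ]
      linarith
    · rw [hφ]; simp only [hom_apply]
      rw [smul_inv_smul₀ hρ.ne']; abel
  have hmem : ∀ y ∈ Metric.ball (0 : Eu n) (1 / 2), y ∈ Metric.ball (0 : Eu n) 1 :=
    fun y hy => Metric.ball_subset_ball (by norm_num) hy
  refine ⟨fun x hx => ?_, fun x hx y hy => ?_⟩
  · obtain ⟨y, hy, rfl⟩ := hinv x hx
    have := R1 y hy
    rw [hD2 y (hmem y hy), hfd y (hmem y hy), norm_smul, clm2_norm_smul, Real.norm_eq_abs,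
      abs_of_pos hρ, abs_of_pos (by positivity)] at this
    exact this
  · obtain ⟨x, hx', rfl⟩ := hinv x hx
    obtain ⟨y, hy', rfl⟩ := hinv y hy
    have := R2 x hx' y hy'
    rw [hD2 y (hmem y hy'), hD2 x (hmem x hx'), clm2_smul_sub, clm2_norm_smul,
      abs_of_pos (by positivity)] at this
    rw [hφα, rpow_two_add hρ]
    have := mul_le_mul_of_nonneg_left this (by positivity : 0 ≤ ρ ^ α)
    linarith

/-- The regularized decay rate. -/
def ms (α δ r : ℝ) : ℝ := r * max r δ ^ (1 + α)

theorem ms_pos {δ r : ℝ} (hr : 0 < r) : 0 < ms α δ r :=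
  mul_pos hr (Real.rpow_pos_of_pos (lt_max_of_lt_left hr) _)

theorem ms_scale (hα : 0 < α) {δ r c : ℝ} (hr : 0 < r) (hc : 0 < c) (hc1 : c ≤ 1) (hδ : 0 ≤ δ) :
    ms α δ r * c ^ (2 + α) ≤ ms α δ (c * r) := by
  have h1 : c * max r δ ≤ max (c * r) δ := by
    rcases le_total r δ with h | h
    · rw [max_eq_right h]; exact (mul_le_of_le_one_left hδ hc1).trans (le_max_right _ _)
    · rw [max_eq_left h]; exact le_max_left _ _
  have h0 : 0 ≤ max r δ := hδ.trans (le_max_right _ _)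
  have h2 : (c * max r δ) ^ (1 + α) ≤ max (c * r) δ ^ (1 + α) :=
    Real.rpow_le_rpow (by positivity) h1 (by linarith)
  rw [Real.mul_rpow hc.le h0] at h2
  have h3 := mul_le_mul_of_nonneg_left h2 (by positivity : 0 ≤ c * r)
  have h4 : c ^ (2 + α) = c * c ^ (1 + α) := by
    rw [show 2 + α = 1 + (1 + α) by ring, Real.rpow_add hc, Real.rpow_one]
  rw [ms, ms, h4]
  linarith

theorem ms_two (hα : 0 < α) (hα1 : α < 1) {δ r R : ℝ} (hr : 0 < r) (hrR : r ≤ R) (hR : R ≤ 2 * r)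
    (hδ : 0 ≤ δ) : ms α δ R ≤ 8 * ms α δ r := by
  have h := ms_scale hα (hr.trans_le hrR) (show (0:ℝ) < r / R from div_pos hr (hr.trans_le hrR))
    ((div_le_one (hr.trans_le hrR)).2 hrR) hδ
  rw [div_mul_cancel₀ _ (hr.trans_le hrR).ne'] at h
  have h1 : (1/2:ℝ) ≤ r / R := by
    rw [le_div_iff₀ (hr.trans_le hrR)]; linarith
  have h2 : (1/8:ℝ) ≤ (r / R) ^ (2 + α) := by
    have e1 : (1/2:ℝ) ^ (2 + α) ≤ (r / R) ^ (2 + α) :=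
      Real.rpow_le_rpow (by norm_num) h1 (by linarith)
    have e2 : (1/2:ℝ) ^ (3:ℝ) ≤ (1/2:ℝ) ^ (2 + α) :=
      Real.rpow_le_rpow_of_exponent_ge (by norm_num) (by norm_num) (by linarith)
    norm_num at e2
    norm_num at e1
    linarith
  have h3 := mul_le_mul_of_nonneg_left h2 (ms_pos (α := α) (δ := δ) (hr.trans_le hrR)).le
  linarith

theorem ms_div (hα : 0 < α) {δ r : ℝ} (hr : 0 < r) (hδ : 0 ≤ δ) :
    ms α δ r / r ^ 2 ≤ r ^ α + δ ^ (1 + α) / r := by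
  have h1 : max r δ ^ (1 + α) ≤ r ^ (1 + α) + δ ^ (1 + α) := by
    have e1 : 0 ≤ r ^ (1 + α) := by positivity
    have e2 : 0 ≤ δ ^ (1 + α) := by positivity
    rcases le_total r δ with h | h
    · rw [max_eq_right h]; linarith
    · rw [max_eq_left h]; linarith
  have h2 : r ^ (1 + α) = r * r ^ α := by rw [Real.rpow_add hr, Real.rpow_one]
  rw [ms, div_le_iff₀ (by positivity)]
  have h3 := mul_le_mul_of_nonneg_left h1 hr.le
  have h4 : (r ^ α + δ ^ (1 + α) / r) * r ^ 2 = r * (r * r ^ α + δ ^ (1 + α)) := by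
    field_simp
  rw [h4, ← h2]; exact h3

theorem ms_eq {δ r : ℝ} (h : δ ≤ r) (hr : 0 < r) : ms α δ r = r ^ (2 + α) := by
  rw [ms, max_eq_left h, show 2 + α = 1 + (1 + α) by ring, Real.rpow_add hr 1 (1 + α), Real.rpow_one]

theorem le_ms (hα : 0 < α) {δ r : ℝ} (hr : 0 < r) : r ^ (2 + α) ≤ ms α δ r := by
  rw [ms, show 2 + α = 1 + (1 + α) by ring, Real.rpow_add hr 1 (1 + α), Real.rpow_one]
  exact mul_le_mul_of_nonneg_left (Real.rpow_le_rpow hr.le (le_max_left _ _) (by linarith)) hr.le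

theorem le_ms' (hα : 0 < α) {δ r : ℝ} (hr : 0 < r) (hδ : 0 ≤ δ) :
    r * δ ^ (1 + α) ≤ ms α δ r :=
  mul_le_mul_of_nonneg_left (Real.rpow_le_rpow hδ (le_max_right _ _) (by linarith)) hr.le

theorem poly_cmp {p0 p0' : ℝ} {p p' : Eu n →L[ℝ] ℝ} {Q Q' : Eu n →L[ℝ] Eu n →L[ℝ] ℝ}
    (hQ : ∀ x y, Q x y = Q y x) (hQ' : ∀ x y, Q' x y = Q' y x) {z z' y0 : Eu n} {s E : ℝ}
    (hs : 0 < s) (h : ∀ y ∈ Metric.ball y0 s,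
      |poly p0 p Q (y - z) - poly p0' p' Q' (y - z')| ≤ E) :
    ‖Q - Q'‖ ≤ 32 * E / s ^ 2 := by
  have hE : 0 ≤ E := (abs_nonneg _).trans (h y0 (Metric.mem_ball_self hs))
  have := sym_norm_le (T := Q - Q') (c := 16 * E / s ^ 2) (by positivity)
    (fun x y => by rw [sub_apply, sub_apply, sub_apply, sub_apply, hQ, hQ']) (fun e he => ?_)
  · calc _ ≤ _ := this
      _ = _ := by ring
  · have e1 := sdq_sub_poly (w := fun y => poly p0 p Q (y - z)) (x := y0) (z := z') (e := e)
      (p0 := p0') (p := p') hQ' (half_pos hs).ne'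
    have e2 := sdq_sub_poly (w := fun y => poly p0 p Q (y - z)) (x := y0) (z := z) (e := e)
      (p0 := p0) (p := p) hQ (half_pos hs).ne'
    simp only [sub_self] at e2
    have e3 : sdq (fun _ : Eu n => (0:ℝ)) y0 e (s / 2) = 0 := by simp [sdq]
    rw [e3] at e2
    have hn : ‖(s / 2) • e‖ ≤ s / 2 := by
      rw [norm_smul, Real.norm_eq_abs, abs_of_pos (by positivity)]
      exact mul_le_of_le_one_right (by positivity) he
    have e4 := sdq_abs_le (w := fun y => poly p0 p Q (y - z) - poly p0' p' Q' (y - z')) (x := y0)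
      (e := e) (half_pos hs) (h _ (Metric.mem_ball_self hs))
      (h _ (by rw [mem_ball_iff_norm, add_sub_cancel_left]; linarith))
      (h _ (by rw [mem_ball_iff_norm, sub_sub_cancel_left, norm_neg]; linarith))
    rw [e1] at e4
    rw [sub_apply, sub_apply, show Q e e - Q' e e =
      sdq (fun y => poly p0 p Q (y - z)) y0 e (s / 2) - Q' e e by linarith]
    calc _ ≤ _ := e4
      _ = _ := by ring

/-- Approximation by an admissible quadratic solution on a half ball. -/
structure App (ln : Fin n) (b : ℝ) (a0 : Fin n → Fin n → ℝ) (f0 : ℝ) (u : Eu n → ℝ) (z : Eu n)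
    (r E : ℝ) (p0 : ℝ) (p : Eu n →L[ℝ] ℝ) (Q : Eu n →L[ℝ] Eu n →L[ℝ] ℝ) : Prop where
  pp : PP ln p Q
  lq : LQ ln b a0 Q = f0
  ap : ∀ x ∈ hB ln z r, |u x - poly p0 p Q (x - z)| ≤ E

theorem ball_sub_hB {ln : Fin n} {z : Eu n} (hz : z ln = 0) {r : ℝ} (hr : 0 < r) :
    Metric.ball (z + (r / 2) • bv ln) (r / 4) ⊆ hB ln z r := by
  intro y hy
  rw [mem_ball_iff_norm] at hy
  have h1 : ‖(r / 2) • (bv ln : Eu n)‖ = r / 2 := by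
    rw [norm_smul, norm_bv, Real.norm_eq_abs, abs_of_pos (by positivity), mul_one]
  rw [mem_hB]
  constructor
  · have := norm_add_le (y - (z + (r / 2) • bv ln)) ((r / 2) • bv ln)
    rw [show y - (z + (r / 2) • bv ln) + (r / 2) • bv ln = y - z by abel, h1] at this
    linarith
  · have := (abs_coord_le (y - (z + (r / 2) • bv ln)) ln).trans hy.le
    have h2 : (y - (z + (r / 2) • bv ln)) ln = y ln - r / 2 := by simp [hz]
    rw [h2, abs_le] at this
    linarith [this.1]

variable {ln : Fin n} {b : ℝ} {a0 : Fin n → Fin n → ℝ} {f0 : ℝ} {u : Eu n → ℝ} {z : Eu n}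

theorem app_cmp (hα : 0 < α) (hα1 : α < 1) (hz : z ln = 0) {r R N δ : ℝ} (hr : 0 < r) (hrR : r ≤ R)
    (hR : R ≤ 2 * r) (hδ : 0 ≤ δ) (hN : 0 ≤ N)
    {p0 p0' : ℝ} {p p' : Eu n →L[ℝ] ℝ} {Q Q' : Eu n →L[ℝ] Eu n →L[ℝ] ℝ}
    (h : App ln b a0 f0 u z r (N * ms α δ r) p0 p Q)
    (h' : App ln b a0 f0 u z R (N * ms α δ R) p0' p' Q') :
    ‖Q - Q'‖ ≤ 5000 * N * (r ^ α + δ ^ (1 + α) / r) := by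
  have h1 := poly_cmp (p0 := p0) (p0' := p0') (p := p) (p' := p') (z := z) (z' := z)
    (y0 := z + (r / 2) • bv ln) (s := r / 4) (E := 9 * N * ms α δ r) h.pp.symm h'.pp.symm
    (by positivity) (fun y hy => ?_)
  · have h2 := mul_le_mul_of_nonneg_left (ms_div hα hr hδ) (by positivity : 0 ≤ 5000 * N)
    have h3 : 0 ≤ ms α δ r / r ^ 2 * N := by
      have := ms_pos (α := α) (δ := δ) hr
      positivity
    have h4 : 32 * (9 * N * ms α δ r) / (r / 4) ^ 2 = 4608 * (ms α δ r / r ^ 2 * N) := by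
      field_simp; ring
    rw [h4] at h1
    linarith
  · have hy1 := ball_sub_hB hz hr hy
    have hy2 : y ∈ hB ln z R := by
      rw [mem_hB] at *; exact ⟨hy1.1.trans_le hrR, hy1.2⟩
    have e1 := h.ap y hy1
    have e2 := h'.ap y hy2
    have e3 := mul_le_mul_of_nonneg_left (ms_two hα hα1 hr hrR hR hδ) hN
    rw [abs_le] at *
    constructor <;> linarith

theorem app_chain (hα : 0 < α) (hα1 : α < 1) (hz : z ln = 0) {N δ R1 c0 : ℝ}
    (hc0 : c0 * (2 ^ α - 1) = 1) (hδ : 0 ≤ δ) (hN : 0 ≤ N)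
    (hv : ∀ r, 0 < r → r ≤ R1 → ∃ p0 p Q, App ln b a0 f0 u z r (N * ms α δ r) p0 p Q) :
    ∀ (k : ℕ) (r R : ℝ) (p0 p0' : ℝ) (p p' : Eu n →L[ℝ] ℝ) (Q Q' : Eu n →L[ℝ] Eu n →L[ℝ] ℝ),
      0 < r → 2 ^ k * r ≤ R → R ≤ 2 ^ (k + 1) * r → R ≤ R1 →
      App ln b a0 f0 u z r (N * ms α δ r) p0 p Q →
      App ln b a0 f0 u z R (N * ms α δ R) p0' p' Q' →
      ‖Q - Q'‖ ≤ 5000 * N * (c0 * (2 * R) ^ α - c0 * r ^ α + 2 * (δ ^ (1 + α) / r)) := by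
  have h2 : (0:ℝ) < 2 ^ α - 1 := by
    have := Real.one_lt_rpow (by norm_num : (1:ℝ) < 2) hα
    linarith
  have hc : 0 < c0 := by
    by_contra hneg
    push Not at hneg
    have := mul_nonpos_of_nonpos_of_nonneg hneg h2.le
    linarith
  have key : ∀ r : ℝ, 0 < r → c0 * (2 * r) ^ α = c0 * r ^ α + r ^ α := fun r hr => by
    rw [Real.mul_rpow (by norm_num) hr.le]
    have : c0 * (2 ^ α - 1) * r ^ α = 1 * r ^ α := by rw [hc0]
    linarith
  intro k
  induction k with
  | zero =>
    intro r R p0 p0' p p' Q Q' hr h1 h1' hR1 hP hP'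
    rw [pow_zero, one_mul] at h1
    rw [zero_add, pow_one] at h1'
    refine (app_cmp hα hα1 hz hr h1 h1' hδ hN hP hP').trans
      (mul_le_mul_of_nonneg_left ?_ (by positivity))
    have e1 := key r hr
    have e2 : c0 * (2 * r) ^ α ≤ c0 * (2 * R) ^ α :=
      mul_le_mul_of_nonneg_left (Real.rpow_le_rpow (by positivity) (by linarith) hα.le) hc.le
    have e3 : 0 ≤ δ ^ (1 + α) / r := by positivity
    linarith
  | succ k ih =>
    intro r R p0 p0' p p' Q Q' hr h1 h1' hR1 hP hP'
    have h3 : 2 ^ k * (2 * r) ≤ R := by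
      calc _ = 2 ^ (k + 1) * r := by ring
        _ ≤ R := h1
    have h3' : R ≤ 2 ^ (k + 1) * (2 * r) := by
      calc R ≤ _ := h1'
        _ = _ := by ring
    have h4 : 2 * r ≤ R := by
      have : (1:ℝ) ≤ 2 ^ k := one_le_pow₀ (by norm_num)
      have := mul_le_mul_of_nonneg_right this (by positivity : 0 ≤ 2 * r)
      linarith
    obtain ⟨q0, q, S, hS⟩ := hv (2 * r) (by positivity) (h4.trans hR1)
    have e1 := app_cmp hα hα1 hz hr (by linarith) le_rfl hδ hN hP hS
    have e2 := ih (2 * r) R q0 p0' q p' S Q' (by positivity) h3 h3' hR1 hS hP'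
    have e3 := norm_sub_le_norm_sub_add_norm_sub (E := Eu n →L[ℝ] Eu n →L[ℝ] ℝ) Q S Q'
    have e4 := key r hr
    have e5 : δ ^ (1 + α) / (2 * r) = 1 / 2 * (δ ^ (1 + α) / r) := by field_simp
    rw [e5, e4] at e2
    linarith

theorem app_Q (hα : 0 < α) (hα1 : α < 1) : ∃ C : ℝ, 0 < C ∧ ∀ {n : ℕ} {ln : Fin n} {b : ℝ}
    {a0 : Fin n → Fin n → ℝ} {f0 : ℝ} {u : Eu n → ℝ} {z : Eu n} {N δ R1 : ℝ}, z ln = 0 → 0 ≤ δ →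
    0 ≤ N → (∀ r, 0 < r → r ≤ R1 → ∃ p0 p Q, App ln b a0 f0 u z r (N * ms α δ r) p0 p Q) →
    ∀ (r : ℝ) (p0 : ℝ) (p : Eu n →L[ℝ] ℝ) (Q : Eu n →L[ℝ] Eu n →L[ℝ] ℝ),
      0 < r → App ln b a0 f0 u z r (N * ms α δ r) p0 p Q →
      (∀ (R : ℝ) (p0' : ℝ) (p' : Eu n →L[ℝ] ℝ) (Q' : Eu n →L[ℝ] Eu n →L[ℝ] ℝ),
        r ≤ R → R ≤ R1 → App ln b a0 f0 u z R (N * ms α δ R) p0' p' Q' →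
        ‖Q - Q'‖ ≤ C * N * (R ^ α + δ ^ (1 + α) / r)) ∧
      ∀ M, r ≤ R1 → (∀ x ∈ hB ln z R1, |u x| ≤ M) →
        ‖Q‖ ≤ C * (M / R1 ^ 2 + N * (R1 ^ α + δ ^ (1 + α) / r)) := by
  have h2 : (0:ℝ) < 2 ^ α - 1 := by
    have := Real.one_lt_rpow (by norm_num : (1:ℝ) < 2) hα
    linarith
  set c0 : ℝ := 1 / (2 ^ α - 1) with hc0
  have hc00 : 0 < c0 := by positivity
  refine ⟨5000 * (2 * c0 + 2) + 512, by positivity, ?_⟩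
  intro n ln b a0 f0 u z N δ R1 hz hδ hN hv r p0 p Q hr hP
  have hA : ∀ (R : ℝ) (p0' : ℝ) (p' : Eu n →L[ℝ] ℝ) (Q' : Eu n →L[ℝ] Eu n →L[ℝ] ℝ),
        r ≤ R → R ≤ R1 → App ln b a0 f0 u z R (N * ms α δ R) p0' p' Q' →
        ‖Q - Q'‖ ≤ 5000 * (2 * c0 + 2) * N * (R ^ α + δ ^ (1 + α) / r) := by
    intro R p0' p' Q' hrR hR hP'
    have hR0 := hr.trans_le hrR
    obtain ⟨k, hk1, hk2⟩ := exists_nat_pow_near ((one_le_div hr).2 hrR) (by norm_num : (1:ℝ) < 2)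
    rw [le_div_iff₀ hr] at hk1
    rw [div_lt_iff₀ hr] at hk2
    have hc1 : c0 * (2 ^ α - 1) = 1 := by rw [hc0]; field_simp
    have h3 := app_chain hα hα1 hz hc1 hδ hN hv k r R p0 p0' p p' Q Q' hr hk1
      hk2.le hR hP hP'
    refine h3.trans ?_
    rw [show 5000 * (2 * c0 + 2) * N * (R ^ α + δ ^ (1 + α) / r) =
      5000 * N * ((2 * c0 + 2) * (R ^ α + δ ^ (1 + α) / r)) by ring]
    refine mul_le_mul_of_nonneg_left ?_ (by positivity)
    have e1 : (2 * R) ^ α ≤ 2 * R ^ α := by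
      rw [Real.mul_rpow (by norm_num) hR0.le]
      refine mul_le_mul_of_nonneg_right ?_ (by positivity)
      calc (2:ℝ) ^ α ≤ 2 ^ (1:ℝ) := Real.rpow_le_rpow_of_exponent_le (by norm_num) hα1.le
        _ = 2 := Real.rpow_one 2
    have e2 := mul_le_mul_of_nonneg_left e1 hc00.le
    have e3 : 0 ≤ c0 * r ^ α := by positivity
    have e4 : 0 ≤ c0 * (δ ^ (1 + α) / r) := by positivity
    have e5 : 0 ≤ R ^ α := by positivity
    linarith
  refine ⟨fun R p0' p' Q' h1 h3 h4 => (hA R p0' p' Q' h1 h3 h4).trans ?_, fun M hrR hM => ?_⟩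
  · have : 0 ≤ N * (R ^ α + δ ^ (1 + α) / r) := by
      have := hr.trans_le h1
      positivity
    linarith
  · have hR := hr.trans_le hrR
    obtain ⟨q0, q, S, hS⟩ := hv R1 hR le_rfl
    have e1 := hA R1 q0 q S hrR le_rfl hS
    have e2 := poly_cmp (p0 := q0) (p0' := 0) (p := q) (p' := 0) (Q := S) (Q' := 0) (z := z)
      (z' := z) (y0 := z + (R1 / 2) • bv ln) (s := R1 / 4) (E := M + N * ms α δ R1) hS.pp.symm
      (by simp) (by positivity) (fun y hy => by
        have hy1 := ball_sub_hB hz hR hy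
        have e3 := hM y hy1
        have e4 := hS.ap y hy1
        have e5 : poly 0 0 0 (y - z) = 0 := by simp [poly]
        rw [e5]
        rw [abs_le] at *
        constructor <;> linarith)
    rw [show S - 0 = S by ext; simp] at e2
    have e3 : 32 * (M + N * ms α δ R1) / (R1 / 4) ^ 2 =
        512 * (M / R1 ^ 2 + N * (ms α δ R1 / R1 ^ 2)) := by field_simp; ring
    have e4 := mul_le_mul_of_nonneg_left (ms_div hα hR hδ) hN
    have e5 : δ ^ (1 + α) / R1 ≤ δ ^ (1 + α) / r :=
      div_le_div_of_nonneg_left (by positivity) hr hrR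
    have e6 := mul_le_mul_of_nonneg_left e5 hN
    have e7 : ‖Q‖ ≤ ‖Q - S‖ + ‖S‖ := norm_le_norm_sub_add (E := Eu n →L[ℝ] Eu n →L[ℝ] ℝ) Q S
    have hM0 : 0 ≤ M := (abs_nonneg _).trans (hM _ (ball_sub_hB hz hR (Metric.mem_ball_self
      (by positivity))))
    have e8 : 0 ≤ M / R1 ^ 2 := by positivity
    have e9 := mul_nonneg (by positivity : 0 ≤ 5000 * (2 * c0 + 2)) e8
    rw [e3] at e2
    linarith

/-- Relatively closed half ball. -/
def hBc (ln : Fin n) (z : Eu n) (R : ℝ) : Set (Eu n) := Metric.ball z R ∩ {x : Eu n | 0 ≤ x ln}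

theorem mem_hBc {ln : Fin n} {z x : Eu n} {R : ℝ} : x ∈ hBc ln z R ↔ ‖x - z‖ < R ∧ 0 ≤ x ln := by
  simp [hBc, dist_eq_norm]

theorem hB_sub_hBc {ln : Fin n} {z : Eu n} {R : ℝ} : hB ln z R ⊆ hBc ln z R := fun x hx => by
  rw [mem_hB] at hx; rw [mem_hBc]; exact ⟨hx.1, hx.2.le⟩

/-- Local data near a boundary point. -/
structure Loc (ln : Fin n) (b lam Lam α K : ℝ) (a : Eu n → Fin n → Fin n → ℝ) (f1 u : Eu n → ℝ)
    (z : Eu n) (R M F : ℝ) : Prop where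
  z0 : z ln = 0
  reg : ContDiffOn ℝ 2 u (hB ln z R)
  coef : CoefOn lam Lam α K (hBc ln z R) a
  bd : ∀ x ∈ hB ln z R, |u x| ≤ M
  fH : ∀ x ∈ hBc ln z R, ∀ y ∈ hBc ln z R, |f1 x - f1 y| ≤ F * ‖x - y‖ ^ α
  eq : ∀ x ∈ hB ln z R, opL ln b (a x) u x = f1 x

theorem abs_apply2_le (Q : Eu n →L[ℝ] Eu n →L[ℝ] ℝ) (i j : Fin n) : |Q (bv i) (bv j)| ≤ ‖Q‖ := by
  have := Q.le_opNorm₂ (bv i) (bv j)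
  rwa [norm_bv, norm_bv, mul_one, mul_one] at this

theorem LQ_diff {ln : Fin n} {b c : ℝ} (hb : 0 ≤ b) {a a' : Fin n → Fin n → ℝ}
    (h : ∀ i j, |a i j - a' i j| ≤ c) (Q : Eu n →L[ℝ] Eu n →L[ℝ] ℝ) :
    |LQ ln b a Q - LQ ln b a' Q| ≤ (n ^ 2 + b) * c * ‖Q‖ := by
  have e : LQ ln b a Q - LQ ln b a' Q = qf (fun i j => a i j - a' i j) Q +
      b * ((a ln ln - a' ln ln) * Q (bv ln) (bv ln)) := by
    rw [qf_sub_left, LQ, LQ]; ring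
  rw [e]
  refine (abs_add_le _ _).trans ?_
  have h1 := qf_abs_le (fun i j => a i j - a' i j) Q h
  rw [abs_mul b, abs_mul, abs_of_nonneg hb]
  have h2 := mul_le_mul (h ln ln) (abs_apply2_le Q ln ln) (abs_nonneg _)
    ((abs_nonneg _).trans (h ln ln))
  have h3 := mul_le_mul_of_nonneg_left h2 hb
  linarith

theorem near_est (ln : Fin n) (hl : 0 < lam) (hL : 0 < Lam) (hα : 0 < α) (hα1 : α < 1) {b : ℝ}
    (hb : 0 < b) (K : ℝ) (hK : 0 ≤ K) :
    ∃ C : ℝ, 0 < C ∧ ∀ (a : Eu n → Fin n → Fin n → ℝ) (f1 u : Eu n → ℝ) (z : Eu n)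
      (R1 M F N δ d p0 : ℝ) (p : Eu n →L[ℝ] ℝ) (Q : Eu n →L[ℝ] Eu n →L[ℝ] ℝ),
      Loc ln b lam Lam α K a f1 u z R1 M F → R1 ≤ 1 → 0 < N → 0 ≤ F → 0 ≤ δ → 0 < d → 2 * d ≤ R1 →
      App ln b (a z) (f1 z) u z (2 * d) (N * ms α δ (2 * d)) p0 p Q →
      ‖D2 u (z + d • bv ln) - Q‖ ≤
        C * (N * (d ^ α + δ ^ (1 + α) / d) + d ^ α * (F + ‖Q‖)) ∧
      |fderiv ℝ u (z + d • bv ln) (bv ln) / d - Q (bv ln) (bv ln)| ≤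
        C * (N * (d ^ α + δ ^ (1 + α) / d) + d ^ α * (F + ‖Q‖)) ∧
      ∀ y ∈ Metric.ball (z + d • bv ln) (d / 4),
        d ^ α * ‖D2 u (z + d • bv ln) - D2 u y‖ ≤
        C * (N * (d ^ α + δ ^ (1 + α) / d) + d ^ α * (F + ‖Q‖)) * ‖z + d • bv ln - y‖ ^ α := by
  obtain ⟨C, hC, H⟩ := int_scaled ln hl hL hα hα1 hb K hK
  set C3 : ℝ := 2 * (1 + (n ^ 2 + b) * K) with hC3
  have hC30 : 0 < C3 := by positivity
  refine ⟨8 * C * (8 + C3), by positivity, ?_⟩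
  intro a f1 u z R1 M F N δ d p0 p Q hloc hR1 hN hF hδ hd hdR hP
  set x0 : Eu n := z + d • bv ln with hx0
  set U := hB ln z (2 * d) with hU
  have hUo : IsOpen U := isOpen_hB ln z (2 * d)
  have hz := hloc.z0
  have hx0n : x0 ln = d := by simp [hx0, hz]
  have hx0z : ‖x0 - z‖ = d := by
    rw [hx0, add_sub_cancel_left, norm_smul, norm_bv, Real.norm_eq_abs, abs_of_pos hd, mul_one]
  have hcb : Metric.closedBall x0 (d / 2) ⊆ U := by
    intro y hy
    rw [mem_closedBall_iff_norm] at hy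
    rw [hU, mem_hB]
    constructor
    · have := norm_add_le (y - x0) (x0 - z)
      rw [sub_add_sub_cancel] at this
      linarith
    · have := (abs_coord_le (y - x0) ln).trans hy
      rw [PiLp.sub_apply, hx0n, abs_le] at this
      linarith [this.1]
  have hbU : Metric.ball x0 (d / 2) ⊆ U := Metric.ball_subset_closedBall.trans hcb
  have hUR : U ⊆ hB ln z R1 := fun y hy => by
    rw [hU, mem_hB] at hy; rw [mem_hB]; exact ⟨hy.1.trans_le hdR, hy.2⟩
  have hUR' : U ⊆ hBc ln z R1 := hUR.trans hB_sub_hBc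
  have hzR : z ∈ hBc ln z R1 := by
    rw [mem_hBc]; simp only [sub_self, norm_zero]; exact ⟨by linarith, hz.ge⟩
  have hu : ContDiffOn ℝ 2 u U := hloc.reg.mono hUR
  set w : Eu n → ℝ := fun y => u y - poly p0 p Q (y - z) with hw
  have hP2 : ContDiffOn ℝ 2 (fun y => poly p0 p Q (y - z)) U := (contDiff_poly_sub z).contDiffOn
  have hwU : ContDiffOn ℝ 2 w U := hu.sub hP2
  have hopP : ∀ y ∈ U, opL ln b (a y) (fun y => poly p0 p Q (y - z)) y = LQ ln b (a y) Q := by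
    intro y hy
    have hy0 : y ln ≠ 0 := by rw [hU, mem_hB] at hy; exact hy.2.ne'
    rw [opL, D2_poly_sub hP.pp.symm, fderiv_poly_sub hP.pp.symm, LQ, add_apply, hP.pp.pn,
      hP.pp.Q_bv, PiLp.sub_apply, hz]
    field_simp
    ring
  set g : Eu n → ℝ := fun y => f1 y - LQ ln b (a y) Q with hg
  have heq : ∀ y ∈ U, opL ln b (a y) w y = g y := by
    intro y hy
    rw [hw, (opL_sub hUo hu hP2 hy).2.2, hopP y hy, hloc.eq y (hUR hy)]
  have hdiff : ∀ x ∈ hBc ln z R1, ∀ y ∈ hBc ln z R1,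
      |g x - g y| ≤ C3 / 2 * (F + ‖Q‖) * ‖x - y‖ ^ α := by
    intro x hx y hy
    have e1 := hloc.fH x hx y hy
    have e2 := LQ_diff (ln := ln) hb.le (hloc.coef.aH x hx y hy) Q
    have e3 : g x - g y = (f1 x - f1 y) - (LQ ln b (a x) Q - LQ ln b (a y) Q) := by
      rw [hg]; ring
    rw [e3]
    refine (abs_sub _ _).trans ?_
    have e4 : 0 ≤ ((n ^ 2 + b) * K * F + ‖Q‖) * ‖x - y‖ ^ α := by
      have := norm_nonneg Q
      positivity
    rw [hC3]
    linarith
  have hgz : g z = 0 := by rw [hg]; simp only []; rw [hP.lq, sub_self]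
  have hQF : 0 ≤ F + ‖Q‖ := add_nonneg hF (norm_nonneg Q)
  have hdα : 0 ≤ d ^ α := by positivity
  have h2d : (2 * d) ^ α ≤ 2 * d ^ α := by
    rw [Real.mul_rpow (by norm_num) hd.le]
    refine mul_le_mul_of_nonneg_right ?_ hdα
    calc (2:ℝ) ^ α ≤ 2 ^ (1:ℝ) := Real.rpow_le_rpow_of_exponent_le (by norm_num) hα1.le
      _ = 2 := Real.rpow_one 2
  have hgb : ∀ y ∈ U, |g y| ≤ C3 * (F + ‖Q‖) * d ^ α := by
    intro y hy
    have e1 := hdiff y (hUR' hy) z hzR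
    rw [hgz, sub_zero] at e1
    have e2 : ‖y - z‖ ^ α ≤ 2 * d ^ α := by
      rw [hU, mem_hB] at hy
      exact (Real.rpow_le_rpow (norm_nonneg _) hy.1.le hα.le).trans h2d
    have e3 := mul_le_mul_of_nonneg_left e2 (by positivity : 0 ≤ C3 / 2 * (F + ‖Q‖))
    linarith
  set W : ℝ := N * (d ^ α + δ ^ (1 + α) / d) + d ^ α * (F + ‖Q‖) with hW
  have hD : 0 ≤ δ ^ (1 + α) / d := by positivity
  have hW0 : 0 ≤ W := by positivity
  have hms : N * ms α δ (2 * d) + C3 * (F + ‖Q‖) * d ^ α * d ^ 2 ≤ d ^ 2 * ((8 + C3) * W) := by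
    have e1 := ms_div hα (α := α) (δ := δ) (r := 2 * d) (by positivity) hδ
    rw [div_le_iff₀ (by positivity)] at e1
    have e2 : δ ^ (1 + α) / (2 * d) = 1 / 2 * (δ ^ (1 + α) / d) := by field_simp
    rw [e2] at e1
    have e3 : ((2 * d) ^ α + 1 / 2 * (δ ^ (1 + α) / d)) * (2 * d) ^ 2 ≤
        8 * (d ^ α + δ ^ (1 + α) / d) * d ^ 2 := by
      have : (2 * d) ^ α + 1 / 2 * (δ ^ (1 + α) / d) ≤ 2 * (d ^ α + δ ^ (1 + α) / d) := by linarith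
      have := mul_le_mul_of_nonneg_right this (by positivity : 0 ≤ (2 * d) ^ 2)
      linarith
    have e4 := mul_le_mul_of_nonneg_left (e1.trans e3) hN.le
    have e5 : 0 ≤ C3 * (N * (d ^ α + δ ^ (1 + α) / d)) * d ^ 2 := by positivity
    have e6 : 0 ≤ 8 * (d ^ α * (F + ‖Q‖)) * d ^ 2 := by positivity
    rw [hW]
    linarith
  have hρ1 : (d / 2) ^ 2 = 1 / 4 * d ^ 2 := by ring
  have hρ2 : (d / 2) ^ (2 + α) = (1 / 2) ^ (2 + α) * (d ^ 2 * d ^ α) := by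
    rw [← rpow_two_add hd, ← Real.mul_rpow (by norm_num) hd.le]; congr 1; ring
  have hhalf : (1/2:ℝ) ^ (2 + α) ≤ 1 := Real.rpow_le_one (by norm_num) (by norm_num) (by linarith)
  have hhalf' : (1/8:ℝ) ≤ (1/2:ℝ) ^ (2 + α) := by
    have e2 : (1/2:ℝ) ^ (3:ℝ) ≤ (1/2:ℝ) ^ (2 + α) :=
      Real.rpow_le_rpow_of_exponent_ge (by norm_num) (by norm_num) (by linarith)
    norm_num at e2 ⊢
    linarith
  have hd2 : 0 < d ^ 2 := by positivity
  have hFi : 0 ≤ C3 * (F + ‖Q‖) * d ^ α * d ^ 2 := by positivity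
  obtain ⟨R1', R2'⟩ := H a x0 (d / 2) (N * ms α δ (2 * d)) (C3 * (F + ‖Q‖) * d ^ α * d ^ 2) U g w
    (by positivity) (by linarith) (by rw [hx0n]; linarith)
    (mul_pos hN (ms_pos (by positivity))) hFi hUo hcb hwU
    (hloc.coef.mono (hbU.trans hUR')) (fun y hy => hP.ap y (hbU hy))
    (fun y hy => by
      have e1 := mul_le_mul_of_nonneg_left (hgb y (hbU hy)) hd2.le
      have e2 : 0 ≤ d ^ 2 * |g y| := by positivity
      rw [hρ1]; linarith)
    (fun x hx y hy => by
      have e1 := hdiff x (hUR' (hbU hx)) y (hUR' (hbU hy))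
      have e2 := mul_le_mul_of_nonneg_left e1 (by positivity : 0 ≤ d ^ 2 * d ^ α)
      have e3 := mul_le_mul_of_nonneg_right hhalf
        (by positivity : 0 ≤ d ^ 2 * d ^ α * |g x - g y|)
      have e4 : 0 ≤ C3 * (F + ‖Q‖) * d ^ α * d ^ 2 * ‖x - y‖ ^ α := by positivity
      rw [hρ2]; linarith)
    (fun y hy => heq y (hbU hy))
  have hCW := mul_le_mul_of_nonneg_left hms hC.le
  have hx0m : x0 ∈ Metric.ball x0 (d / 2 / 2) := Metric.mem_ball_self (by positivity)
  have hx0U : x0 ∈ U := hbU (Metric.mem_ball_self (by positivity))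
  have hCW0 : 0 ≤ C * (8 + C3) * W := by positivity
  have hDw : ∀ y ∈ U, D2 w y = D2 u y - Q ∧ fderiv ℝ w y = fderiv ℝ u y - (p + Q (y - z)) :=
    fun y hy => D2_sub_poly hUo hu hP.pp.symm z hy
  obtain ⟨g1, g2⟩ := R1' x0 hx0m
  rw [(hDw x0 hx0U).1] at g2
  rw [(hDw x0 hx0U).2] at g1
  refine ⟨?_, ?_, ?_⟩
  · refine le_of_mul_le_mul_left ?_ hd2
    have := mul_nonneg hd2.le hCW0
    rw [hρ1] at g2
    linarith
  · have e1 : fderiv ℝ u x0 (bv ln) / d - Q (bv ln) (bv ln) =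
        (fderiv ℝ u x0 - (p + Q (x0 - z))) (bv ln) / d := by
      rw [sub_apply, add_apply, hP.pp.pn, hP.pp.Q_bv (x0 - z), PiLp.sub_apply, hx0n, hz]
      field_simp
      ring
    rw [e1, abs_div, abs_of_pos hd, div_le_iff₀ hd]
    have e2 := (fderiv ℝ u x0 - (p + Q (x0 - z))).le_opNorm (bv ln)
    rw [norm_bv, mul_one, Real.norm_eq_abs] at e2
    refine e2.trans ?_
    refine le_of_mul_le_mul_left ?_ hd
    have := mul_nonneg hd2.le hCW0
    linarith
  · intro y hy
    have hyb : y ∈ Metric.ball x0 (d / 2 / 2) := by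
      rwa [show d / 2 / 2 = d / 4 by ring]
    have hyU : y ∈ U := hbU (Metric.ball_subset_ball (by linarith) hy)
    have e1 := R2' x0 hx0m y hyb
    rw [(hDw x0 hx0U).1, (hDw y hyU).1, sub_sub_sub_cancel_right, hρ2] at e1
    have e2 : 0 ≤ ‖x0 - y‖ ^ α := by positivity
    have e3 := mul_le_mul_of_nonneg_right hCW e2
    have e4 := mul_le_mul_of_nonneg_right hhalf' (mul_nonneg (by positivity : 0 ≤ d ^ 2 * d ^ α)
      (norm_nonneg (D2 u x0 - D2 u y)))
    refine le_of_mul_le_mul_left ?_ hd2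
    linarith

/-- Projection to the boundary hyperplane. -/
def pr (ln : Fin n) (x : Eu n) : Eu n := x - x ln • bv ln

theorem pr_ln (ln : Fin n) (x : Eu n) : (pr ln x) ln = 0 := by simp [pr]

theorem pr_add (ln : Fin n) (x : Eu n) : pr ln x + x ln • bv ln = x := by simp [pr]

theorem norm_pr_le (ln : Fin n) (x : Eu n) : ‖pr ln x‖ ≤ ‖x‖ := by
  rw [← sq_le_sq₀ (norm_nonneg _) (norm_nonneg _), EuclideanSpace.norm_sq_eq,
    EuclideanSpace.norm_sq_eq]
  refine Finset.sum_le_sum fun i _ => ?_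
  by_cases hi : i = ln
  · subst hi; rw [pr_ln]; simp; positivity
  · simp [pr, Ne.symm hi]

theorem pr_sub (ln : Fin n) (x y : Eu n) : pr ln x - pr ln y = pr ln (x - y) := by
  simp only [pr, PiLp.sub_apply, sub_smul]; abel

theorem pr_of_zero {ln : Fin n} {z : Eu n} (hz : z ln = 0) : pr ln z = z := by simp [pr, hz]

theorem norm_pr_sub_le {ln : Fin n} {z : Eu n} (hz : z ln = 0) (x : Eu n) :
    ‖pr ln x - z‖ ≤ ‖x - z‖ := by
  have := norm_pr_le ln (x - z)
  rwa [← pr_sub, pr_of_zero hz] at this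

theorem S_bound (ln : Fin n) (hl : 0 < lam) (hL : 0 < Lam) (hα : 0 < α) (hα1 : α < 1) {b : ℝ}
    (hb : 0 < b) (K : ℝ) (hK : 0 ≤ K) :
    ∃ C : ℝ, 0 < C ∧ ∀ (a : Eu n → Fin n → Fin n → ℝ) (f1 u : Eu n → ℝ) (z : Eu n)
      (R1 M F N δ d : ℝ),
      Loc ln b lam Lam α K a f1 u z R1 M F → R1 ≤ 1 → 0 < N → 0 ≤ F → 0 ≤ δ → 0 < d → 2 * d ≤ R1 →
      (∀ r, 0 < r → r ≤ R1 → ∃ p0 p Q, App ln b (a z) (f1 z) u z r (N * ms α δ r) p0 p Q) →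
      ‖D2 u (z + d • bv ln)‖ ≤
        C * (M / R1 ^ 2 + N * (R1 ^ α + δ ^ (1 + α) / d) + F * R1 ^ α) ∧
      |fderiv ℝ u (z + d • bv ln) (bv ln) / d| ≤
        C * (M / R1 ^ 2 + N * (R1 ^ α + δ ^ (1 + α) / d) + F * R1 ^ α) := by
  obtain ⟨C, hC, H⟩ := near_est ln hl hL hα hα1 hb K hK
  obtain ⟨C1, hC1, H1⟩ := app_Q hα hα1
  refine ⟨C + (C + 1) * C1, by positivity, ?_⟩
  intro a f1 u z R1 M F N δ d hloc hR1 hN hF hδ hd hdR hv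
  obtain ⟨p0, p, Q, hP⟩ := hv (2 * d) (by positivity) hdR
  have hQ := (H1 hloc.z0 hδ hN.le hv (2 * d) p0 p Q (by positivity) hP).2 M hdR hloc.bd
  obtain ⟨h1, h2, -⟩ := H a f1 u z R1 M F N δ d p0 p Q hloc hR1 hN hF hδ hd hdR hP
  have hR0 : 0 < R1 := by linarith
  have hM0 : 0 ≤ M := (abs_nonneg _).trans (hloc.bd _ (ball_sub_hB hloc.z0 hR0
    (Metric.mem_ball_self (by positivity))))
  set D := δ ^ (1 + α) / d with hD
  have hD0 : 0 ≤ D := by positivity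
  have e1 : δ ^ (1 + α) / (2 * d) = 1 / 2 * D := by rw [hD]; field_simp
  rw [e1] at hQ
  have hdα : d ^ α ≤ R1 ^ α := Real.rpow_le_rpow hd.le (by linarith) hα.le
  have hR1α : R1 ^ α ≤ 1 := rpow_le_one_of hα hR0.le hR1
  set B := M / R1 ^ 2 + N * (R1 ^ α + D) + F * R1 ^ α with hB
  have hQn := norm_nonneg Q
  have hQ' : ‖Q‖ ≤ C1 * B := by
    refine hQ.trans (mul_le_mul_of_nonneg_left ?_ hC1.le)
    have : 0 ≤ N * D := by positivity
    have : 0 ≤ F * R1 ^ α := by positivity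
    rw [hB]; linarith
  have hW : N * (d ^ α + D) + d ^ α * (F + ‖Q‖) ≤ (1 + C1) * B := by
    have f1 := mul_le_mul_of_nonneg_left hdα hN.le
    have f2 := mul_le_mul_of_nonneg_right hdα hF
    have f3 := mul_le_of_le_one_left hQn (hdα.trans hR1α)
    have f4 : 0 ≤ M / R1 ^ 2 := by positivity
    have : (1 + C1) * B = B + C1 * B := by ring
    rw [this]
    nth_rewrite 1 [hB]
    linarith
  have hCW := mul_le_mul_of_nonneg_left hW hC.le
  constructor
  · have f1 : ‖D2 u (z + d • bv ln)‖ ≤ ‖D2 u (z + d • bv ln) - Q‖ + ‖Q‖ :=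
      norm_le_norm_sub_add (E := Eu n →L[ℝ] Eu n →L[ℝ] ℝ) _ Q
    linarith
  · have f1 := abs_sub_abs_le_abs_sub (fderiv ℝ u (z + d • bv ln) (bv ln) / d) (Q (bv ln) (bv ln))
    have f2 := abs_apply2_le Q ln ln
    linarith

theorem step_local (ln : Fin n) (hl : 0 < lam) (hL : 0 < Lam) (hα : 0 < α) (hα1 : α < 1) {b : ℝ}
    (hb : 1 < b) (K : ℝ) (hK : 0 ≤ K) (c : ℝ) (hc : 0 < c) :
    ∃ θ C : ℝ, 0 < θ ∧ θ ≤ 1 / 2 ∧ 0 < C ∧ ∀ (a : Eu n → Fin n → Fin n → ℝ) (f1 u : Eu n → ℝ)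
      (z : Eu n) (R1 M F N δ R : ℝ), R1 ≤ 1 → 0 < N → 0 ≤ F → 0 ≤ δ → 0 < R → 2 * R ≤ R1 →
      z ln = 0 →
      (∀ z', z' ln = 0 → ‖z' - z‖ < R → Loc ln b lam Lam α K a f1 u z' R1 M F ∧
        ∀ r, 0 < r → r ≤ R1 → ∃ p0 p Q, App ln b (a z') (f1 z') u z' r (N * ms α δ r) p0 p Q) →
      (∃ B, ∀ x ∈ hB ln z R, |fderiv ℝ u x (bv ln)| ≤ B) →
      ∃ p0 p Q, App ln b (a z) (f1 z) u z (θ * R)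
        ((c * N + C * (M / R1 ^ 2 + N * R1 ^ α + F)) * ms α δ (θ * R)) p0 p Q := by
  have hb0 : 0 < b := by linarith
  obtain ⟨C1, hC1, H1⟩ := S_bound ln hl hL hα hα1 hb0 K hK
  obtain ⟨C2, θ0, hC2, hθ0, hθ01, H2⟩ := half_decay_scaled ln hl hL hb
  obtain ⟨θ, hθ, hθ', hθ2, hθc⟩ := exists_theta hC2 hθ0 c hc hα1
  obtain ⟨C3, hC3, H2⟩ := H2 θ hθ hθ'
  set C4 : ℝ := 1 + 2 * ((n ^ 2 + b) * K * C1) with hC4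
  have hC40 : 0 < C4 := by positivity
  have hθp : 0 < θ ^ (2 + α) := by positivity
  refine ⟨θ, (C3 * C4 + 1) / θ ^ (2 + α), hθ, hθ2, by positivity, ?_⟩
  intro a f1 u z R1 M F N δ R hR1 hN hF hδ hR hRR hz hloc ⟨B, hBn⟩
  have hR10 : 0 < R1 := by linarith
  obtain ⟨hlz, hvz⟩ := hloc z hz (by simpa using hR)
  obtain ⟨q0, q, S, hS⟩ := hvz R hR (by linarith)
  have hM0 : 0 ≤ M := (abs_nonneg _).trans (hlz.bd _ (ball_sub_hB hz hR10
    (Metric.mem_ball_self (by positivity))))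
  set G : ℝ := M / R1 ^ 2 + N * R1 ^ α + F with hG
  have hG0 : 0 ≤ G := by positivity
  have hms := ms_pos (α := α) (δ := δ) hR
  set U := hB ln z R with hU
  have hUo : IsOpen U := isOpen_hB ln z R
  have hUR : U ⊆ hB ln z R1 := fun y hy => by
    rw [hU, mem_hB] at hy; rw [mem_hB]; exact ⟨by linarith [hy.1], hy.2⟩
  have hu : ContDiffOn ℝ 2 u U := hlz.reg.mono hUR
  have hP2 : ContDiffOn ℝ 2 (fun y => poly q0 q S (y - z)) U := (contDiff_poly_sub z).contDiffOn
  have hzR : z ∈ hBc ln z R1 := by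
    rw [mem_hBc]; simp only [sub_self, norm_zero]; exact ⟨hR10, hz.ge⟩
  have hop : ∀ x ∈ U, |opL ln b (a z) (fun y => u y - poly q0 q S (y - z)) x| ≤
      C4 * G * ms α δ R / (R * x ln) := by
    intro x hx
    have hx' := hx
    rw [hU, mem_hB] at hx
    have hd := hx.2
    have hdR : x ln < R := by
      have := (le_abs_self _).trans (abs_coord_le (x - z) ln)
      rw [PiLp.sub_apply, hz, sub_zero] at this
      linarith
    have e1 : opL ln b (a z) (fun y => poly q0 q S (y - z)) x = f1 z := by
      rw [← hS.lq, opL, D2_poly_sub hS.pp.symm, fderiv_poly_sub hS.pp.symm, LQ, add_apply,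
        hS.pp.pn, hS.pp.Q_bv (x - z), PiLp.sub_apply, hz]
      have := hd.ne'
      field_simp
      ring
    rw [(opL_sub hUo hu hP2 hx').2.2, e1]
    have e2 := hlz.eq x (hUR hx')
    set V := fderiv ℝ u x (bv ln) / x ln with hV
    have e3 : opL ln b (a z) u x - f1 z = (f1 x - f1 z) -
        (qf (fun i j => a x i j - a z i j) (D2 u x) + b * ((a x ln ln - a z ln ln) * V)) := by
      rw [← e2, opL, opL, qf_sub_left, hV]; ring
    have hxR := hB_sub_hBc (hUR hx')
    have e4 := hlz.fH x hxR z hzR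
    have e5 := qf_abs_le (fun i j => a x i j - a z i j) (D2 u x) (hlz.coef.aH x hxR z hzR)
    have e6 := hlz.coef.aH x hxR z hzR ln ln
    obtain ⟨hl', hv'⟩ := hloc (pr ln x) (pr_ln ln x) ((norm_pr_sub_le hz x).trans_lt hx.1)
    obtain ⟨s1, s2⟩ := H1 a f1 u (pr ln x) R1 M F N δ (x ln) hl' hR1 hN hF hδ hd (by linarith) hv'
    rw [pr_add] at s1 s2
    rw [← hV] at s2
    set T := M / R1 ^ 2 + N * (R1 ^ α + δ ^ (1 + α) / x ln) + F * R1 ^ α with hT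
    have hxα : ‖x - z‖ ^ α ≤ R ^ α := Real.rpow_le_rpow (norm_nonneg _) hx.1.le hα.le
    have hT0 : 0 ≤ T := by positivity
    have hRα : 0 ≤ R ^ α := by positivity
    have k1 : |opL ln b (a z) u x - f1 z| ≤ R ^ α * (F + (n ^ 2 + b) * K * C1 * T) := by
      rw [e3]
      refine (abs_sub _ _).trans ?_
      have t1 := abs_add_le (qf (fun i j => a x i j - a z i j) (D2 u x))
        (b * ((a x ln ln - a z ln ln) * V))
      rw [abs_mul b, abs_mul, abs_of_pos hb0] at t1
      have t2 := mul_le_mul_of_nonneg_left hxα hF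
      have t3 := mul_le_mul_of_nonneg_left hxα hK
      have t4 := mul_le_mul t3 s1 (norm_nonneg (D2 u x)) (by positivity)
      have t5 := mul_le_mul (e6.trans t3) s2 (abs_nonneg _) (by positivity)
      have t6 := mul_le_mul_of_nonneg_left t4 (by positivity : 0 ≤ (n:ℝ) ^ 2)
      have t7 := mul_le_mul_of_nonneg_left t5 hb0.le
      linarith
    refine k1.trans ?_
    rw [le_div_iff₀ (by positivity)]
    have m1 : R ^ (2 + α) ≤ ms α δ R := le_ms hα hR
    have m2 : R * δ ^ (1 + α) ≤ ms α δ R := le_ms' hα hR hδ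
    rw [rpow_two_add hR] at m1
    have m3 : R ^ α * (R * x ln) ≤ ms α δ R := by
      have := mul_le_mul_of_nonneg_left hdR.le (by positivity : 0 ≤ R ^ α * R)
      linarith
    have hRR1 : R ^ α ≤ R1 ^ α := Real.rpow_le_rpow hR.le (by linarith) hα.le
    have hR1α : R1 ^ α ≤ 1 := rpow_le_one_of hα hR10.le hR1
    have m4 : R ^ α * T * (R * x ln) ≤ 2 * (G * ms α δ R) := by
      have r1 : R ^ α * T * (R * x ln) = (M / R1 ^ 2 + N * R1 ^ α + F * R1 ^ α) *
          (R ^ α * (R * x ln)) + N * (R * δ ^ (1 + α)) * R ^ α := by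
        rw [hT]; have := hd.ne'; field_simp; ring
      rw [r1]
      have r2 : M / R1 ^ 2 + N * R1 ^ α + F * R1 ^ α ≤ G := by
        have := mul_le_of_le_one_right hF hR1α
        rw [hG]; linarith
      have r3 := mul_le_mul r2 m3 (by positivity) hG0
      have r4 : N * R1 ^ α ≤ G := by
        have : 0 ≤ M / R1 ^ 2 := by positivity
        rw [hG]; linarith
      have r5 := mul_le_mul (mul_le_mul_of_nonneg_left m2 hN.le) hRR1 hRα (by positivity)
      have r6 := mul_le_mul_of_nonneg_right r4 hms.le
      linarith
    have m5 : F * (R ^ α * (R * x ln)) ≤ G * ms α δ R := by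
      refine mul_le_mul ?_ m3 (by positivity) hG0
      have : 0 ≤ M / R1 ^ 2 + N * R1 ^ α := by positivity
      rw [hG]; linarith
    have m6 := mul_le_mul_of_nonneg_left m4 (by positivity : 0 ≤ (n ^ 2 + b) * K * C1)
    rw [hC4]
    linarith
  have hbd : ∃ B', ∀ x ∈ U, |fderiv ℝ (fun y => u y - poly q0 q S (y - z)) x (bv ln)| ≤ B' := by
    refine ⟨B + R * ‖S‖, fun x hx => ?_⟩
    rw [(opL_sub (ln := ln) (b := b) (a := a z) hUo hu hP2 hx).1, sub_apply,
      fderiv_poly_sub hS.pp.symm, add_apply, hS.pp.pn, zero_add]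
    have e1 := hBn x hx
    have e2 := S.le_opNorm₂ (x - z) (bv ln)
    rw [norm_bv, mul_one, Real.norm_eq_abs] at e2
    rw [hU, mem_hB] at hx
    have e3 := mul_le_mul_of_nonneg_left hx.1.le (norm_nonneg S)
    have := abs_sub (fderiv ℝ u x (bv ln)) (S (x - z) (bv ln))
    linarith
  obtain ⟨p0, p, Q, hPP, hLQ, hap⟩ := H2 (a z) (hlz.coef.ell z hzR) z R (N * ms α δ R)
    (C4 * G * ms α δ R) (fun y => u y - poly q0 q S (y - z)) hz hR (by positivity) (by positivity)
    (hu.sub hP2) hS.ap hop hbd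
  refine ⟨q0 + p0, q + p, S + Q, ⟨⟨fun x y => ?_, ?_, fun i hi => ?_⟩, ?_, fun x hx => ?_⟩⟩
  · rw [add_apply, add_apply, add_apply, add_apply, hS.pp.symm, hPP.symm]
  · rw [add_apply, hS.pp.pn, hPP.pn, add_zero]
  · rw [add_apply, add_apply, hS.pp.qn i hi, hPP.qn i hi, add_zero]
  · rw [LQ, qf_add, add_apply, add_apply, ← hS.lq]
    rw [LQ] at hLQ ⊢
    linarith
  · have e1 := hap x hx
    rw [poly_add]
    rw [show u x - (poly q0 q S (x - z) + poly p0 p Q (x - z)) =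
      u x - poly q0 q S (x - z) - poly p0 p Q (x - z) by ring]
    refine e1.trans ?_
    have e2 := ms_scale hα (δ := δ) hR hθ (by linarith) hδ
    have e3 : ms α δ R ≤ ms α δ (θ * R) / θ ^ (2 + α) := by rwa [le_div_iff₀ hθp]
    have e4 := mul_le_mul_of_nonneg_right hθc (by positivity : 0 ≤ N * ms α δ R)
    have e5 := mul_le_mul_of_nonneg_left e2 (by positivity : 0 ≤ c * N)
    have e6 := mul_le_mul_of_nonneg_left e3 (by positivity : 0 ≤ (C3 * C4 + 1) * G)
    have e7 : 0 ≤ G * ms α δ R := by positivity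
    have e8 : (C3 * C4 + 1) / θ ^ (2 + α) * G * ms α δ (θ * R) =
      (C3 * C4 + 1) * G * (ms α δ (θ * R) / θ ^ (2 + α)) := by ring
    rw [add_mul (c * N), e8]
    linarith

/-- Weighted global data for the equation without lower order terms. -/
structure Glob (ln : Fin n) (b lam Lam α K : ℝ) (a : Eu n → Fin n → Fin n → ℝ) (f1 u : Eu n → ℝ)
    (M F : ℝ) : Prop where
  reg : ContDiffOn ℝ 2 u (halfBall n ln 1)
  coef : CoefOn lam Lam α K (hBc ln 0 1) a
  bd : ∀ x ∈ halfBall n ln 1, |u x| ≤ M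
  fb : ∀ x ∈ hBc ln 0 1, (1 - ‖x‖) ^ 2 * |f1 x| ≤ F
  fH : ∀ x ∈ hBc ln 0 1, ∀ y ∈ hBc ln 0 1, ‖x - y‖ ≤ (1 - ‖x‖) / 2 →
    (1 - ‖x‖) ^ (2 + α) * |f1 x - f1 y| ≤ F * ‖x - y‖ ^ α
  eq : ∀ x ∈ halfBall n ln 1, opL ln b (a x) u x = f1 x
  gb : ∃ B, ∀ x ∈ halfBall n ln 1, ‖fderiv ℝ u x‖ ≤ B

/-- Weighted approximability at all boundary points. -/
def Val (ln : Fin n) (b α : ℝ) (a : Eu n → Fin n → Fin n → ℝ) (f1 u : Eu n → ℝ)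
    (δ μ A : ℝ) : Prop :=
  ∀ z : Eu n, z ln = 0 → ‖z‖ < 1 → ∀ r, 0 < r → r ≤ μ * (1 - ‖z‖) →
    ∃ p0 p Q, App ln b (a z) (f1 z) u z r (A / (1 - ‖z‖) ^ (2 + α) * ms α δ r) p0 p Q

theorem App.mono {ln : Fin n} {b : ℝ} {a0 : Fin n → Fin n → ℝ} {f0 : ℝ} {u : Eu n → ℝ} {z : Eu n}
    {r E E' : ℝ} {p0 : ℝ} {p : Eu n →L[ℝ] ℝ} {Q : Eu n →L[ℝ] Eu n →L[ℝ] ℝ}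
    (h : App ln b a0 f0 u z r E p0 p Q) (hE : E ≤ E') : App ln b a0 f0 u z r E' p0 p Q :=
  ⟨h.pp, h.lq, fun x hx => (h.ap x hx).trans hE⟩

theorem hB_sub_half {ln : Fin n} {z : Eu n} {R : ℝ} (h : R ≤ 1 - ‖z‖) :
    hB ln z R ⊆ halfBall n ln 1 := fun x hx => by
  rw [mem_hB] at hx
  rw [mem_halfBall]
  have := norm_add_le (x - z) z
  rw [sub_add_cancel] at this
  exact ⟨by linarith, hx.2⟩

theorem hBc_sub_hBc {ln : Fin n} {z : Eu n} {R : ℝ} (h : R ≤ 1 - ‖z‖) :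
    hBc ln z R ⊆ hBc ln 0 1 := fun x hx => by
  rw [mem_hBc] at hx
  rw [mem_hBc, sub_zero]
  have := norm_add_le (x - z) z
  rw [sub_add_cancel] at this
  exact ⟨by linarith, hx.2⟩

theorem rpow_frac (hα : 0 < α) (hα1 : α < 1) {c ρ ρ' : ℝ} (hc : 0 < c) (hc1 : c ≤ 1) (hρ : 0 < ρ)
    (h : c * ρ ≤ ρ') : c ^ 3 * ρ ^ (2 + α) ≤ ρ' ^ (2 + α) := by
  have h1 : (c * ρ) ^ (2 + α) ≤ ρ' ^ (2 + α) := Real.rpow_le_rpow (by positivity) h (by linarith)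
  rw [Real.mul_rpow hc.le hρ.le] at h1
  have h2 : c ^ (3:ℝ) ≤ c ^ (2 + α) := Real.rpow_le_rpow_of_exponent_ge hc hc1 (by linarith)
  have h3 : c ^ (3:ℝ) = c ^ 3 := by exact_mod_cast Real.rpow_natCast c 3
  rw [h3] at h2
  exact (mul_le_mul_of_nonneg_right h2 (by positivity)).trans h1

theorem Glob.loc {ln : Fin n} {b K M F : ℝ} {a : Eu n → Fin n → Fin n → ℝ} {f1 u : Eu n → ℝ}
    (hα : 0 < α) (hα1 : α < 1) (h : Glob ln b lam Lam α K a f1 u M F) {z : Eu n} {R F' : ℝ}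
    (hz : z ln = 0) (hz1 : ‖z‖ < 1) (hR : R ≤ (1 - ‖z‖) / 8)
    (hF' : 2 * F ≤ F' * (1 - ‖z‖) ^ (2 + α)) (hF0 : 0 ≤ F') :
    Loc ln b lam Lam α K a f1 u z R M F' := by
  have hs1 : hB ln z R ⊆ halfBall n ln 1 := hB_sub_half (by linarith)
  have hs2 : hBc ln z R ⊆ hBc ln 0 1 := hBc_sub_hBc (by linarith)
  refine ⟨hz, h.reg.mono hs1, h.coef.mono hs2, fun x hx => h.bd x (hs1 hx), fun x hx y hy => ?_,
    fun x hx => h.eq x (hs1 hx)⟩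
  have hx' := hs2 hx
  have hy' := hs2 hy
  rw [mem_hBc] at hx hy
  have e1 : 7 / 8 * (1 - ‖z‖) ≤ 1 - ‖x‖ := by
    have := norm_add_le (x - z) z
    rw [sub_add_cancel] at this
    linarith
  have e2 : ‖x - y‖ ≤ (1 - ‖x‖) / 2 := by
    have := norm_sub_le (x - z) (y - z)
    rw [sub_sub_sub_cancel_right] at this
    linarith
  have e3 := h.fH x hx' y hy' e2
  have e4 := rpow_frac hα hα1 (by norm_num) (by norm_num) (by linarith) e1
  have hp : 0 < (1 - ‖z‖) ^ (2 + α) := Real.rpow_pos_of_pos (by linarith) _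
  have e5 := mul_le_mul_of_nonneg_right e4 (abs_nonneg (f1 x - f1 y))
  have e6 : 0 ≤ (1 - ‖z‖) ^ (2 + α) * |f1 x - f1 y| := by positivity
  have e7 := mul_le_mul_of_nonneg_right hF' (by positivity : 0 ≤ ‖x - y‖ ^ α)
  refine le_of_mul_le_mul_left ?_ hp
  norm_num at e5
  linarith

theorem normal_quad (ln : Fin n) {b : ℝ} (hb : 0 < b) (hl : 0 < lam) {a0 : Fin n → Fin n → ℝ}
    (ha : Ell lam Lam a0) (f0 : ℝ) : ∃ Q : Eu n →L[ℝ] Eu n →L[ℝ] ℝ, PP ln 0 Q ∧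
      LQ ln b a0 Q = f0 ∧ ∀ x, |1 / 2 * Q x x| ≤ |f0| / lam * ‖x‖ ^ 2 := by
  have hd : lam ≤ a0 ln ln := (ha.diag ln).1
  have hpos : 0 < a0 ln ln * (1 + b) := mul_pos (by linarith) (by linarith)
  refine ⟨(f0 / (a0 ln ln * (1 + b))) • coF ln, ⟨fun x y => ?_, by simp, fun i hi => ?_⟩, ?_,
    fun x => ?_⟩
  · simp [coF_apply, mul_comm (x ln)]
  · simp [coF_apply, hi]
  · rw [LQ, qf_smul, qf_coF]
    simp [coF_apply]
    have hne : a0 ln ln ≠ 0 := (hl.trans_le hd).ne'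
    have hne' : 1 + b ≠ 0 := by positivity
    field_simp
  · have e : 1 / 2 * ((f0 / (a0 ln ln * (1 + b))) • coF ln) x x =
        1 / 2 * (f0 / (a0 ln ln * (1 + b)) * (x ln) ^ 2) := by
      simp [coF_apply, sq]
    rw [e, abs_mul, abs_mul, abs_of_pos (by norm_num : (0:ℝ) < 1 / 2), abs_div, abs_of_pos hpos,
      abs_of_nonneg (sq_nonneg (x ln))]
    have h1 : (x ln) ^ 2 ≤ ‖x‖ ^ 2 := by
      rw [← sq_abs (x ln)]
      exact pow_le_pow_left₀ (abs_nonneg _) (abs_coord_le x ln) 2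
    have h2 : |f0| / (a0 ln ln * (1 + b)) ≤ |f0| / lam := by
      refine div_le_div_of_nonneg_left (abs_nonneg _) hl ?_
      have : 0 ≤ a0 ln ln * b := mul_nonneg (by linarith) hb.le
      linarith
    have h3 := mul_le_mul h2 h1 (sq_nonneg _) (by positivity)
    have h4 : (0:ℝ) ≤ |f0| / lam * ‖x‖ ^ 2 := by positivity
    linarith

theorem glob_val (ln : Fin n) (hl : 0 < lam) (hL : 0 < Lam) (hα : 0 < α) (hα1 : α < 1) {b : ℝ}
    (hb : 1 < b) (K : ℝ) (hK : 0 ≤ K) :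
    ∃ μ C : ℝ, 0 < μ ∧ μ ≤ 1 / 8 ∧ 0 < C ∧ ∀ (a : Eu n → Fin n → Fin n → ℝ) (f1 u : Eu n → ℝ)
      (M F δ : ℝ), Glob ln b lam Lam α K a f1 u M F → 0 < M → 0 ≤ F → 0 < δ →
      Val ln b α a f1 u δ μ (C * (M + F)) := by
  have hb0 : 0 < b := by linarith
  obtain ⟨θ, Cs, hθ, hθ2, hCs, Hs⟩ := step_local ln hl hL hα hα1 hb K hK (1 / 32) (by norm_num)
  obtain ⟨μ, hμ, hμ8, hμα⟩ := exists_kappa (C := 8 * Cs) (by positivity) hα (1 / 4)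
    (by norm_num) (1 / 8) (by norm_num)
  set q : ℝ := (θ * μ / 4) ^ (2 + α) with hq
  have hq0 : 0 < q := by positivity
  set C0 : ℝ := 1 / 2 + 4 * Cs / μ ^ 2 + 16 * Cs + (1 + 1 / lam) / q with hC0
  refine ⟨μ, 3 * C0, hμ, hμ8, by positivity, ?_⟩
  intro a f1 u M F δ hG hM hF hδ
  set T := M + F with hT
  have hT0 : 0 < T := by positivity
  have hzmem : ∀ z : Eu n, z ln = 0 → ‖z‖ < 1 → z ∈ hBc ln 0 1 := fun z hz hz1 => by
    rw [mem_hBc, sub_zero]; exact ⟨hz1, hz.ge⟩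
  have habs := absorb (S := {A | Val ln b α a f1 u δ μ A}) (C0 := C0 * T) (by positivity)
    ?_ ?_ ?_
  · rw [mul_assoc]; exact habs
  · intro A hA A' hAA z hz hz1 r hr hrz
    obtain ⟨p0, p, Q, h⟩ := hA z hz hz1 r hr hrz
    refine ⟨p0, p, Q, h.mono (mul_le_mul_of_nonneg_right ?_ (ms_pos hr).le)⟩
    exact div_le_div_of_nonneg_right hAA (Real.rpow_nonneg (by linarith) _)
  · obtain ⟨B, hBn⟩ := hG.gb
    refine ⟨(2 * |B| + F / lam) / δ ^ (1 + α), fun z hz hz1 r hr hrz => ?_⟩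
    have hzm := hzmem z hz hz1
    obtain ⟨Q, hQ1, hQ2, hQ3⟩ := normal_quad ln hb0 hl (hG.coef.ell z hzm) (f1 z)
    set ρ := 1 - ‖z‖ with hρ
    have hρ0 : 0 < ρ := by linarith
    have hρ1 : ρ ≤ 1 := by linarith [norm_nonneg z]
    have hrρ : r ≤ ρ := hrz.trans (mul_le_of_le_one_left hρ0.le (by linarith))
    have hsub : hB ln z r ⊆ halfBall n ln 1 := hB_sub_half hrρ
    have hy0 : z + (r / 2) • bv ln ∈ hB ln z r :=
      ball_sub_hB hz hr (Metric.mem_ball_self (by positivity))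
    refine ⟨u (z + (r / 2) • bv ln), 0, Q, hQ1, hQ2, fun x hx => ?_⟩
    have e1 := (convex_halfBall (ln := ln) 1).norm_image_sub_le_of_norm_fderiv_le
      (fun y hy => C2on_differentiableAt (isOpen_halfBall ln 1) hG.reg hy)
      (fun y hy => (hBn y hy).trans (le_abs_self B)) (hsub hy0) (hsub hx)
    have e2 := hQ3 (x - z)
    rw [mem_hB] at hx hy0
    have e3 : ‖x - (z + (r / 2) • bv ln)‖ ≤ 2 * r := by
      have := norm_sub_le (x - z) (z + (r / 2) • bv ln - z)
      rw [sub_sub_sub_cancel_right] at this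
      linarith [hx.1, hy0.1]
    have e4 := mul_le_mul_of_nonneg_left e3 (abs_nonneg B)
    rw [Real.norm_eq_abs] at e1
    have hfz := hG.fb z hzm
    rw [← hρ] at hfz
    have e5 : |f1 z| ≤ F / ρ ^ 2 := by rw [le_div_iff₀ (by positivity)]; linarith
    have hxz : ‖x - z‖ ^ 2 ≤ r * ρ := by
      have := pow_le_pow_left₀ (norm_nonneg (x - z)) hx.1.le 2
      have := mul_le_mul_of_nonneg_left hrρ hr.le
      linarith
    have e6 : |f1 z| / lam * ‖x - z‖ ^ 2 ≤ F / ρ ^ 2 / lam * (r * ρ) :=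
      mul_le_mul (div_le_div_of_nonneg_right e5 hl.le) hxz (by positivity) (by positivity)
    have e7 : |u x - poly (u (z + (r / 2) • bv ln)) 0 Q (x - z)| ≤
        2 * |B| * r + F / lam * r / ρ := by
      have : u x - poly (u (z + (r / 2) • bv ln)) 0 Q (x - z) =
        (u x - u (z + (r / 2) • bv ln)) - 1 / 2 * Q (x - z) (x - z) := by simp [poly]; ring
      rw [this]
      refine (abs_sub _ _).trans ?_
      have e8 : F / ρ ^ 2 / lam * (r * ρ) = F / lam * r / ρ := by field_simp
      linarith
    refine e7.trans ?_
    have e9 := le_ms' hα (δ := δ) hr hδ.le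
    have e10 : (2 * |B| + F / lam) / δ ^ (1 + α) / ρ ^ (2 + α) * (r * δ ^ (1 + α)) ≤
        (2 * |B| + F / lam) / δ ^ (1 + α) / ρ ^ (2 + α) * ms α δ r :=
      mul_le_mul_of_nonneg_left e9 (by positivity)
    refine le_trans ?_ e10
    have e11 : (2 * |B| + F / lam) / δ ^ (1 + α) / ρ ^ (2 + α) * (r * δ ^ (1 + α)) =
      (2 * |B| + F / lam) * r / ρ ^ (2 + α) := by
        have := (Real.rpow_pos_of_pos hδ (1 + α)).ne'
        field_simp
    rw [e11, le_div_iff₀ (by positivity)]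
    have e12 : ρ ^ (2 + α) ≤ 1 := Real.rpow_le_one hρ0.le hρ1 (by linarith)
    have e13 : ρ ^ (2 + α) ≤ ρ := by
      calc _ ≤ ρ ^ (1:ℝ) := Real.rpow_le_rpow_of_exponent_ge hρ0 hρ1 (by linarith)
        _ = ρ := Real.rpow_one ρ
    have e14 := mul_le_mul_of_nonneg_left e12 (by positivity : 0 ≤ 2 * |B| * r)
    have e15 := mul_le_mul_of_nonneg_left e13 (by positivity : 0 ≤ F / lam * r / ρ)
    have e16 : F / lam * r / ρ * ρ = F / lam * r := by field_simp
    linarith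
  · intro A hA hA0 z hz hz1 r hr hrz
    have hzm := hzmem z hz hz1
    set ρ := 1 - ‖z‖ with hρ
    have hρ0 : 0 < ρ := by linarith
    have hρ1 : ρ ≤ 1 := by linarith [norm_nonneg z]
    have hρp : 0 < ρ ^ (2 + α) := by positivity
    by_cases hcase : r ≤ θ * (μ * ρ / 4)
    · set R1 := μ * ρ / 2 with hR1
      have hR10 : 0 < R1 := by positivity
      have hR1ρ : R1 ≤ ρ / 16 := by
        have := mul_le_mul_of_nonneg_right hμ8 hρ0.le
        rw [hR1]; linarith
      have hRle : r / θ ≤ μ * ρ / 4 := by rw [div_le_iff₀ hθ]; linarith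
      obtain ⟨p0, p, Q, h⟩ := Hs a f1 u z R1 M (16 * F / ρ ^ (2 + α)) (8 * (A + T) / ρ ^ (2 + α)) δ
        (r / θ) (by linarith) (by positivity) (by positivity) hδ.le (by positivity) (by linarith) hz
        (fun z' hz' hzz => by
          have f1 : 1 / 2 * ρ ≤ 1 - ‖z'‖ := by
            have := norm_add_le (z' - z) z
            rw [sub_add_cancel] at this
            linarith
          have f2 := rpow_frac hα hα1 (by norm_num) (by norm_num) hρ0 f1
          have f3 : ‖z'‖ < 1 := by linarith
          have f4 : 0 < (1 - ‖z'‖) ^ (2 + α) := Real.rpow_pos_of_pos (by linarith) _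
          refine ⟨hG.loc hα hα1 hz' f3 (by linarith) ?_ (by positivity), fun s hs hsR => ?_⟩
          · rw [div_mul_eq_mul_div, le_div_iff₀ hρp]
            have := mul_le_mul_of_nonneg_left f2 hF
            norm_num at this
            linarith
          · obtain ⟨q0, q, S, hS⟩ := hA z' hz' f3 s hs (hsR.trans (by
              have := mul_le_mul_of_nonneg_left f1 hμ.le
              rw [hR1]; linarith))
            refine ⟨q0, q, S, hS.mono (mul_le_mul_of_nonneg_right ?_ (ms_pos hs).le)⟩
            rw [div_le_div_iff₀ f4 hρp]
            have := mul_le_mul_of_nonneg_left f2 (by positivity : 0 ≤ 8 * (A + T))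
            have := mul_nonneg hT0.le hρp.le
            norm_num at *
            linarith)
        (by
          obtain ⟨B, hBn⟩ := hG.gb
          refine ⟨B, fun x hx => ?_⟩
          have e1 := hBn x (hB_sub_half (by linarith) hx)
          have e2 := (fderiv ℝ u x).le_opNorm (bv ln)
          rw [norm_bv, mul_one, Real.norm_eq_abs] at e2
          linarith)
      rw [mul_div_cancel₀ _ hθ.ne'] at h
      refine ⟨p0, p, Q, h.mono (mul_le_mul_of_nonneg_right ?_ (ms_pos hr).le)⟩
      rw [le_div_iff₀ hρp]
      have hR1μ : R1 ^ α ≤ μ ^ α := by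
        refine Real.rpow_le_rpow hR10.le ?_ hα.le
        have := mul_le_mul_of_nonneg_left hρ1 hμ.le
        rw [hR1]; linarith
      have g1 : M / R1 ^ 2 * ρ ^ (2 + α) ≤ 4 * M / μ ^ 2 := by
        rw [rpow_two_add hρ0, hR1]
        have : M / (μ * ρ / 2) ^ 2 * (ρ ^ 2 * ρ ^ α) = 4 * M / μ ^ 2 * ρ ^ α := by field_simp; ring
        rw [this]
        exact mul_le_of_le_one_right (by positivity) (rpow_le_one_of hα hρ0.le hρ1)
      have g2 : (1 / 32 * (8 * (A + T) / ρ ^ (2 + α)) + Cs * (M / R1 ^ 2 +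
          8 * (A + T) / ρ ^ (2 + α) * R1 ^ α + 16 * F / ρ ^ (2 + α))) * ρ ^ (2 + α) =
          1 / 4 * (A + T) + Cs * (M / R1 ^ 2 * ρ ^ (2 + α)) + 8 * Cs * R1 ^ α * (A + T) +
            16 * Cs * F := by
        field_simp; ring
      rw [g2]
      have g3 := mul_le_mul_of_nonneg_left g1 hCs.le
      have g4 := mul_le_mul_of_nonneg_left hR1μ (by positivity : 0 ≤ 8 * Cs)
      have g5 := mul_le_mul_of_nonneg_right (g4.trans hμα) (by positivity : 0 ≤ A + T)
      have g6 : Cs * (4 * M / μ ^ 2) ≤ 4 * Cs / μ ^ 2 * T := by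
        have : 0 ≤ 4 * Cs / μ ^ 2 * F := by positivity
        have e : Cs * (4 * M / μ ^ 2) = 4 * Cs / μ ^ 2 * M := by ring
        rw [e, hT]; linarith
      have g7 : 0 ≤ (1 + 1 / lam) / q * T := by positivity
      have g8 : 0 ≤ Cs * M := by positivity
      rw [hC0]
      linarith
    · push Not at hcase
      obtain ⟨Q, hQ1, hQ2, hQ3⟩ := normal_quad ln hb0 hl (hG.coef.ell z hzm) (f1 z)
      have hrρ : r ≤ ρ := hrz.trans (mul_le_of_le_one_left hρ0.le (by linarith))
      refine ⟨0, 0, Q, hQ1, hQ2, fun x hx => ?_⟩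
      have e1 := hG.bd x (hB_sub_half hrρ hx)
      have e2 := hQ3 (x - z)
      rw [mem_hB] at hx
      have hfz := hG.fb z hzm
      rw [← hρ] at hfz
      have e5 : |f1 z| ≤ F / ρ ^ 2 := by rw [le_div_iff₀ (by positivity)]; linarith
      have hxz : ‖x - z‖ ^ 2 ≤ ρ ^ 2 := pow_le_pow_left₀ (norm_nonneg _) (by linarith) 2
      have e6 : |f1 z| / lam * ‖x - z‖ ^ 2 ≤ F / ρ ^ 2 / lam * ρ ^ 2 :=
        mul_le_mul (div_le_div_of_nonneg_right e5 hl.le) hxz (by positivity) (by positivity)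
      have e7 : F / ρ ^ 2 / lam * ρ ^ 2 = F * (1 / lam) := by field_simp
      have e8 : |u x - poly 0 0 Q (x - z)| ≤ (1 + 1 / lam) * T := by
        have : u x - poly 0 0 Q (x - z) = u x - 1 / 2 * Q (x - z) (x - z) := by simp [poly]
        rw [this]
        refine (abs_sub _ _).trans ?_
        have : 0 ≤ M * (1 / lam) := by positivity
        rw [hT]
        linarith
      refine e8.trans ?_
      have e9 : (θ * μ / 4 * ρ) ^ (2 + α) ≤ r ^ (2 + α) :=
        Real.rpow_le_rpow (by positivity) (by linarith) (by linarith)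
      rw [Real.mul_rpow (by positivity) hρ0.le, ← hq] at e9
      have e10 := e9.trans (le_ms (δ := δ) hα hr)
      have hC0T : (1 + 1 / lam) / q * T ≤ A / 2 + C0 * T := by
        have : 0 ≤ (1 / 2 + 4 * Cs / μ ^ 2 + 16 * Cs) * T := by positivity
        rw [hC0]; linarith
      have e11 : (1 + 1 / lam) / q * T / ρ ^ (2 + α) * (q * ρ ^ (2 + α)) = (1 + 1 / lam) * T := by
        field_simp
      rw [← e11]
      exact mul_le_mul (div_le_div_of_nonneg_right hC0T hρp.le) e10 (by positivity)
        (by positivity)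

theorem glob_int (ln : Fin n) (hl : 0 < lam) (hL : 0 < Lam) (hα : 0 < α) (hα1 : α < 1) {b : ℝ}
    (hb : 0 < b) (K : ℝ) (hK : 0 ≤ K) :
    ∃ C : ℝ, 0 < C ∧ ∀ (a : Eu n → Fin n → Fin n → ℝ) (f1 u : Eu n → ℝ) (M F : ℝ) (x : Eu n) (s : ℝ),
      Glob ln b lam Lam α K a f1 u M F → 0 < M → 0 ≤ F → 0 < s → 2 * s ≤ x ln →
      s ≤ (1 - ‖x‖) / 16 →
      s ^ 2 * ‖D2 u x‖ ≤ C * (M + F) ∧ ∀ y ∈ Metric.ball x (s / 2),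
        s ^ (2 + α) * ‖D2 u x - D2 u y‖ ≤ C * (M + F) * ‖x - y‖ ^ α := by
  obtain ⟨Ci, hCi, H⟩ := int_scaled ln hl hL hα hα1 hb K hK
  refine ⟨Ci, hCi, fun a f1 u M F x s hG hM hF hs h2s hsx => ?_⟩
  have hx1 : ‖x‖ < 1 := by linarith
  have hcl : Metric.closedBall x s ⊆ halfBall n ln 1 := fun y hy => by
    rw [Metric.mem_closedBall, dist_eq_norm] at hy
    rw [mem_halfBall]
    have h1 := norm_add_le (y - x) x
    rw [sub_add_cancel] at h1
    have h2 := abs_coord_le (y - x) ln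
    rw [PiLp.sub_apply, abs_le] at h2
    exact ⟨by linarith, by linarith⟩
  have hsub : Metric.ball x s ⊆ halfBall n ln 1 := Metric.ball_subset_closedBall.trans hcl
  have hsub2 : Metric.ball x s ⊆ hBc ln 0 1 := fun y hy => by
    have := hsub hy
    rw [mem_halfBall] at this
    rw [mem_hBc, sub_zero]
    exact ⟨this.1, this.2.le⟩
  have hfar : ∀ y ∈ Metric.ball x s, 4 * s ≤ 1 - ‖y‖ := fun y hy => by
    rw [Metric.mem_ball, dist_eq_norm] at hy
    have h1 := norm_add_le (y - x) x
    rw [sub_add_cancel] at h1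
    linarith
  obtain ⟨h1, h2⟩ := H a x s M F (halfBall n ln 1) f1 u hs (by linarith [norm_nonneg x]) h2s hM hF
    (isOpen_halfBall ln 1) hcl hG.reg (hG.coef.mono hsub2) (fun y hy => hG.bd y (hsub hy))
    (fun y hy => by
      have e1 := hG.fb y (hsub2 hy)
      have e2 : s ^ 2 ≤ (1 - ‖y‖) ^ 2 := pow_le_pow_left₀ hs.le (by linarith [hfar y hy]) 2
      exact (mul_le_mul_of_nonneg_right e2 (abs_nonneg _)).trans e1)
    (fun y hy y' hy' => by
      have e0 := hfar y hy
      rw [Metric.mem_ball, dist_eq_norm] at *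
      have e3 : ‖y - y'‖ ≤ (1 - ‖y‖) / 2 := by
        have := norm_sub_le (y - x) (y' - x)
        rw [sub_sub_sub_cancel_right] at this
        linarith
      have e1 := hG.fH y (hsub2 (by rwa [Metric.mem_ball, dist_eq_norm])) y'
        (hsub2 (by rwa [Metric.mem_ball, dist_eq_norm])) e3
      have e2 : s ^ (2 + α) ≤ (1 - ‖y‖) ^ (2 + α) :=
        Real.rpow_le_rpow hs.le (by linarith) (by linarith)
      exact (mul_le_mul_of_nonneg_right e2 (abs_nonneg _)).trans e1)
    (fun y hy => hG.eq y (hsub hy))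
  have hx0 : x ∈ Metric.ball x (s / 2) := Metric.mem_ball_self (by positivity)
  exact ⟨(h1 x hx0).2, fun y hy => h2 x hx0 y hy⟩

/-- Weighted bound of the second derivatives up to the flat boundary. -/
theorem glob_sup (ln : Fin n) (hl : 0 < lam) (hL : 0 < Lam) (hα : 0 < α) (hα1 : α < 1) {b : ℝ}
    (hb : 1 < b) (K : ℝ) (hK : 0 ≤ K) :
    ∃ C : ℝ, 0 < C ∧ ∀ (a : Eu n → Fin n → Fin n → ℝ) (f1 u : Eu n → ℝ) (M F : ℝ),
      Glob ln b lam Lam α K a f1 u M F → 0 < M → 0 ≤ F → ∀ x ∈ halfBall n ln 1,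
      (1 - ‖x‖) ^ 2 * ‖D2 u x‖ ≤ C * (M + F) := by
  have hb0 : 0 < b := by linarith
  obtain ⟨μ, C0, hμ, hμ8, hC0, Hv⟩ := glob_val ln hl hL hα hα1 hb K hK
  obtain ⟨Ci, hCi, Hi⟩ := glob_int ln hl hL hα hα1 hb0 K hK
  obtain ⟨Cs, hCs, Hs⟩ := S_bound ln hl hL hα hα1 hb0 K hK
  refine ⟨Cs * (16 / μ ^ 2 + 2 * C0 + 2) + 256 * Ci / μ ^ 2, by positivity, ?_⟩
  intro a f1 u M F hG hM hF x hx
  rw [mem_halfBall] at hx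
  obtain ⟨hx1, hxn⟩ := hx
  set T := M + F with hT
  have hT0 : 0 < T := by positivity
  set ρ := 1 - ‖x‖ with hρ
  have hρ0 : 0 < ρ := by linarith
  have hρ1 : ρ ≤ 1 := by linarith [norm_nonneg x]
  have hμρ : μ * ρ ≤ ρ / 8 := by
    have := mul_le_mul_of_nonneg_right hμ8 hρ0.le
    linarith
  by_cases hcase : x ln ≤ μ * ρ / 8
  · set z := pr ln x with hz
    have hzx : ‖z‖ ≤ ‖x‖ := norm_pr_le ln x
    have hρp : 0 < ρ ^ (2 + α) := by positivity
    have hρz : ρ ^ (2 + α) ≤ (1 - ‖z‖) ^ (2 + α) :=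
      Real.rpow_le_rpow hρ0.le (by linarith) (by linarith)
    set R1 := μ * ρ / 4 with hR1
    have hR10 : 0 < R1 := by positivity
    have hloc := hG.loc hα hα1 (z := z) (R := R1) (F' := 2 * F / ρ ^ (2 + α)) (pr_ln ln x)
      (by linarith) (by linarith) (by
        rw [div_mul_eq_mul_div, le_div_iff₀ hρp]
        exact mul_le_mul_of_nonneg_left hρz (by positivity)) (by positivity)
    have hmain := (Hs a f1 u z R1 M (2 * F / ρ ^ (2 + α)) (C0 * T / ρ ^ (2 + α)) (x ln) (x ln) hloc
      (by linarith) (by positivity) (by positivity) hxn.le hxn (by linarith)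
      (fun r hr hrR => by
        obtain ⟨p0, p, Q, h⟩ := Hv a f1 u M F (x ln) hG hM hF hxn z (pr_ln ln x) (by linarith) r hr
          (by
            have := mul_le_mul_of_nonneg_left (by linarith : ρ ≤ 1 - ‖z‖) hμ.le
            linarith [mul_pos hμ hρ0])
        exact ⟨p0, p, Q, h.mono (mul_le_mul_of_nonneg_right
          (div_le_div_of_nonneg_left (by positivity) hρp hρz) (ms_pos hr).le)⟩)).1
    rw [hz, pr_add] at hmain
    have e1 : (x ln) ^ (1 + α) / x ln = (x ln) ^ α := by
      rw [Real.rpow_add hxn, Real.rpow_one]; field_simp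
    have e2 : (x ln) ^ α ≤ ρ ^ α := Real.rpow_le_rpow hxn.le (by linarith) hα.le
    have e3 : R1 ^ α ≤ ρ ^ α := Real.rpow_le_rpow hR10.le (by linarith) hα.le
    rw [e1] at hmain
    have e4 : C0 * T / ρ ^ (2 + α) * (R1 ^ α + (x ln) ^ α) ≤ C0 * T / ρ ^ (2 + α) * (2 * ρ ^ α) :=
      mul_le_mul_of_nonneg_left (by linarith) (by positivity)
    have e5 : 2 * F / ρ ^ (2 + α) * R1 ^ α ≤ 2 * F / ρ ^ (2 + α) * ρ ^ α :=
      mul_le_mul_of_nonneg_left e3 (by positivity)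
    have e6 := mul_le_mul_of_nonneg_left (hmain.trans (mul_le_mul_of_nonneg_left
      (add_le_add (add_le_add_right e4 (M / R1 ^ 2)) e5) hCs.le)) (sq_nonneg ρ)
    have e7 : ρ ^ 2 * (Cs * (M / R1 ^ 2 + C0 * T / ρ ^ (2 + α) * (2 * ρ ^ α) +
        2 * F / ρ ^ (2 + α) * ρ ^ α)) = Cs * (16 / μ ^ 2 * M + 2 * C0 * T + 2 * F) := by
      have h0 : ρ ^ α ≠ 0 := (Real.rpow_pos_of_pos hρ0 α).ne'
      rw [rpow_two_add hρ0, hR1]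
      field_simp
      ring
    rw [e7] at e6
    refine e6.trans ?_
    have e8 : Cs * (16 / μ ^ 2 * M + 2 * C0 * T + 2 * F) ≤ Cs * ((16 / μ ^ 2 + 2 * C0 + 2) * T) := by
      refine mul_le_mul_of_nonneg_left ?_ hCs.le
      have : 0 ≤ 16 / μ ^ 2 * F := by positivity
      rw [hT]; linarith
    have e9 : 0 ≤ 256 * Ci / μ ^ 2 * T := by positivity
    linarith
  · push Not at hcase
    have h := (Hi a f1 u M F x (μ * ρ / 16) hG hM hF (by positivity) (by linarith) (by linarith)).1
    have e : ρ ^ 2 * ‖D2 u x‖ = 256 / μ ^ 2 * ((μ * ρ / 16) ^ 2 * ‖D2 u x‖) := by field_simp; norm_num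
    rw [e]
    have h2 := mul_le_mul_of_nonneg_left h (by positivity : 0 ≤ 256 / μ ^ 2)
    have e9 : 0 ≤ Cs * (16 / μ ^ 2 + 2 * C0 + 2) * T := by positivity
    have e10 : 256 / μ ^ 2 * (Ci * T) = 256 * Ci / μ ^ 2 * T := by ring
    linarith

/-- Second order boundary Taylor expansion at the foot point. -/
theorem bdry_taylor (ln : Fin n) (hl : 0 < lam) (hL : 0 < Lam) (hα : 0 < α) (hα1 : α < 1) {b : ℝ}
    (hb : 1 < b) (K : ℝ) (hK : 0 ≤ K) :
    ∃ R1 C : ℝ, 0 < R1 ∧ R1 ≤ 1 / 64 ∧ 0 < C ∧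
      ∀ (a : Eu n → Fin n → Fin n → ℝ) (f1 u : Eu n → ℝ) (M F : ℝ),
      Glob ln b lam Lam α K a f1 u M F → 0 < M → 0 ≤ F → ∀ x ∈ halfBall n ln (1 / 2),
      2 * x ln ≤ R1 →
      (∀ R, 2 * x ln ≤ R → R ≤ R1 → ∃ p0 p Q, App ln b (a (pr ln x)) (f1 (pr ln x)) u (pr ln x) R
        (C * (M + F) * R ^ (2 + α)) p0 p Q ∧ ‖D2 u x - Q‖ ≤ C * (M + F) * R ^ α) ∧
      ∀ y ∈ Metric.ball x (x ln / 4), ‖D2 u x - D2 u y‖ ≤ C * (M + F) * ‖x - y‖ ^ α := by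
  have hb0 : 0 < b := by linarith
  obtain ⟨μ, C0, hμ, hμ8, hC0, Hv⟩ := glob_val ln hl hL hα hα1 hb K hK
  obtain ⟨Cn, hCn, Hn⟩ := near_est ln hl hL hα hα1 hb0 K hK
  obtain ⟨Cq, hCq, Hq⟩ := app_Q hα hα1
  set S := Cq * (64 / μ ^ 2 + 16 * C0) with hS
  have hS0 : 0 < S := by positivity
  set C1 := Cn * (16 * C0 + 16 + S) with hC1
  have hC10 : 0 < C1 := by positivity
  refine ⟨μ / 8, C1 + 16 * Cq * C0 + 8 * C0, by positivity, by linarith, by positivity, ?_⟩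
  intro a f1 u M F hG hM hF x hx hxR
  rw [mem_halfBall] at hx
  obtain ⟨hx1, hxn⟩ := hx
  set T := M + F with hT
  have hT0 : 0 < T := by positivity
  set d := x ln with hd
  have hd1 : d ≤ 1 := by linarith
  set R1 := μ / 8 with hR1
  have hR10 : 0 < R1 := by positivity
  set z := pr ln x with hz
  have hzx : ‖z‖ ≤ ‖x‖ := norm_pr_le ln x
  have hzl : z ln = 0 := pr_ln ln x
  have hzd : z + d • bv ln = x := pr_add ln x
  have h8 : 1 ≤ 8 * (1 - ‖z‖) ^ (2 + α) := by
    have := rpow_frac hα hα1 (c := 1 / 2) (ρ := 1) (ρ' := 1 - ‖z‖) (by norm_num) (by norm_num)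
      one_pos (by linarith)
    rw [Real.one_rpow] at this
    norm_num at this
    linarith
  have hzp : 0 < (1 - ‖z‖) ^ (2 + α) := Real.rpow_pos_of_pos (by linarith) _
  have hloc := hG.loc hα hα1 (z := z) (R := R1) (F' := 16 * F) hzl (by linarith) (by linarith) (by
    have := mul_le_mul_of_nonneg_left h8 (by positivity : 0 ≤ 2 * F)
    linarith) (by positivity)
  have hval : ∀ r, 0 < r → r ≤ R1 → ∃ p0 p Q, App ln b (a z) (f1 z) u z r
      (8 * C0 * T * ms α d r) p0 p Q := fun r hr hrR => by
    obtain ⟨p0, p, Q, h⟩ := Hv a f1 u M F d hG hM hF hxn z hzl (by linarith) r hr (by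
      have := mul_le_mul_of_nonneg_left (by linarith : 1 / 2 ≤ 1 - ‖z‖) hμ.le
      linarith)
    refine ⟨p0, p, Q, h.mono (mul_le_mul_of_nonneg_right ?_ (ms_pos hr).le)⟩
    rw [div_le_iff₀ hzp]
    have := mul_le_mul_of_nonneg_left h8 (by positivity : 0 ≤ C0 * T)
    linarith
  have e1 : d ^ (1 + α) / d = d ^ α := by
    rw [Real.rpow_add hxn, Real.rpow_one]; field_simp
  have e1' : d ^ (1 + α) / (2 * d) = d ^ α / 2 := by
    rw [Real.rpow_add hxn, Real.rpow_one]; field_simp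
  have hdα1 : d ^ α ≤ 1 := rpow_le_one_of hα hxn.le hd1
  have hdα : 0 < d ^ α := by positivity
  have hRα1 : R1 ^ α ≤ 1 := rpow_le_one_of hα hR10.le (by linarith)
  obtain ⟨p0, p, Q, hQ⟩ := hval (2 * d) (by positivity) hxR
  obtain ⟨hq1, hq2⟩ := Hq hzl hxn.le (by positivity) hval (2 * d) p0 p Q (by positivity) hQ
  have hQn : ‖Q‖ ≤ S * T := by
    refine (hq2 M hxR hloc.bd).trans ?_
    rw [e1', hS, mul_assoc Cq _ T]
    refine mul_le_mul_of_nonneg_left ?_ hCq.le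
    have f1 : M / R1 ^ 2 = 64 / μ ^ 2 * M := by rw [hR1]; field_simp; norm_num
    have f2 : 8 * C0 * T * (R1 ^ α + d ^ α / 2) ≤ 8 * C0 * T * 2 :=
      mul_le_mul_of_nonneg_left (by linarith) (by positivity)
    have f3 : 0 ≤ 64 / μ ^ 2 * F := by positivity
    rw [f1, hT] at *
    linarith
  obtain ⟨hn1, -, hn3⟩ := Hn a f1 u z R1 M (16 * F) (8 * C0 * T) d d p0 p Q hloc (by linarith)
    (by positivity) (by positivity) hxn.le hxn hxR hQ
  rw [e1, hzd] at hn1 hn3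
  have hW : Cn * (8 * C0 * T * (d ^ α + d ^ α) + d ^ α * (16 * F + ‖Q‖)) ≤ C1 * T * d ^ α := by
    have g1 : 16 * F + ‖Q‖ ≤ (16 + S) * T := by rw [hT] at *; linarith
    have g2 := mul_le_mul_of_nonneg_left g1 hdα.le
    have g3 : 8 * C0 * T * (d ^ α + d ^ α) + d ^ α * (16 * F + ‖Q‖) ≤
      (16 * C0 + 16 + S) * T * d ^ α := by linarith
    refine (mul_le_mul_of_nonneg_left g3 hCn.le).trans (le_of_eq ?_)
    rw [hC1]; ring
  refine ⟨fun R hdR hRR => ?_, fun y hy => ?_⟩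
  · have hR0 : 0 < R := by linarith
    have hRα : d ^ α ≤ R ^ α := Real.rpow_le_rpow hxn.le (by linarith) hα.le
    obtain ⟨p0', p', Q', hQ'⟩ := hval R hR0 hRR
    have k1 := hq1 R p0' p' Q' hdR hRR hQ'
    rw [e1'] at k1
    have k2 : Cq * (8 * C0 * T) * (R ^ α + d ^ α / 2) ≤ Cq * (8 * C0 * T) * (2 * R ^ α) :=
      mul_le_mul_of_nonneg_left (by linarith) (by positivity)
    refine ⟨p0', p', Q', hQ'.mono ?_, ?_⟩
    · rw [ms_eq (by linarith) hR0]
      refine mul_le_mul_of_nonneg_right (mul_le_mul_of_nonneg_right ?_ hT0.le) (by positivity)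
      linarith [mul_pos (mul_pos (by norm_num : (0:ℝ) < 16) hCq) hC0]
    · have k3 := norm_sub_le_norm_sub_add_norm_sub (E := Eu n →L[ℝ] Eu n →L[ℝ] ℝ) (D2 u x) Q Q'
      have k4 := mul_le_mul_of_nonneg_left hRα (by positivity : 0 ≤ C1 * T)
      have k5 : 0 ≤ 8 * C0 * T * R ^ α := by positivity
      linarith
  · have k1 := (hn3 y hy).trans (mul_le_mul_of_nonneg_right hW (by positivity))
    have k2 : ‖D2 u x - D2 u y‖ ≤ C1 * T * ‖x - y‖ ^ α := by
      refine le_of_mul_le_mul_left (k1.trans (le_of_eq ?_)) hdα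
      ring
    refine k2.trans ?_
    refine mul_le_mul_of_nonneg_right (mul_le_mul_of_nonneg_right ?_ hT0.le) (by positivity)
    have : 0 ≤ 16 * Cq * C0 := by positivity
    linarith

/-- Hölder bound of the second derivatives up to the flat boundary. -/
theorem glob_holder (ln : Fin n) (hl : 0 < lam) (hL : 0 < Lam) (hα : 0 < α) (hα1 : α < 1) {b : ℝ}
    (hb : 1 < b) (K : ℝ) (hK : 0 ≤ K) :
    ∃ C : ℝ, 0 < C ∧ ∀ (a : Eu n → Fin n → Fin n → ℝ) (f1 u : Eu n → ℝ) (M F : ℝ),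
      Glob ln b lam Lam α K a f1 u M F → 0 < M → 0 ≤ F → ∀ x ∈ halfBall n ln (1 / 2),
      ∀ y ∈ halfBall n ln (1 / 2), ‖D2 u x - D2 u y‖ ≤ C * (M + F) * ‖x - y‖ ^ α := by
  have hb0 : 0 < b := by linarith
  obtain ⟨Cs, hCs, Hs⟩ := glob_sup ln hl hL hα hα1 hb K hK
  obtain ⟨Ci, hCi, Hi⟩ := glob_int ln hl hL hα hα1 hb0 K hK
  obtain ⟨R1, Ct, hR1, hR64, hCt, Ht⟩ := bdry_taylor ln hl hL hα hα1 hb K hK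
  set c := R1 / 64 with hc
  have hc0 : 0 < c := by positivity
  set C := 8 * Cs / c ^ α + Ci / (R1 / 8) ^ (2 + α) + 16 ^ α * 1026 * Ct + Ct with hC
  refine ⟨C, by positivity, fun a f1 u M F hG hM hF => ?_⟩
  set T := M + F with hT
  have hT0 : 0 < T := by positivity
  have p1 : 0 < 8 * Cs / c ^ α := by positivity
  have p2 : 0 < Ci / (R1 / 8) ^ (2 + α) := by positivity
  have p3 : 0 < (16:ℝ) ^ α * 1026 * Ct := by positivity
  have hle : ∀ {A t : ℝ}, A ≤ C → 0 ≤ t → A * T * t ≤ C * T * t := fun hA ht =>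
    mul_le_mul_of_nonneg_right (mul_le_mul_of_nonneg_right hA hT0.le) ht
  suffices H : ∀ x ∈ halfBall n ln (1 / 2), ∀ y ∈ halfBall n ln (1 / 2), y ln ≤ x ln →
      ‖D2 u x - D2 u y‖ ≤ C * T * ‖x - y‖ ^ α by
    intro x hx y hy
    rcases le_total (y ln) (x ln) with h | h
    · exact H x hx y hy h
    · have := H y hy x hx h
      rwa [norm_sub_rev (E := Eu n →L[ℝ] Eu n →L[ℝ] ℝ), norm_sub_rev y x] at this
  intro x hx y hy hyx
  have hsup : ∀ w ∈ halfBall n ln (1 / 2), ‖D2 u w‖ ≤ 4 * (Cs * T) := fun w hw => by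
    have hw1 := halfBall_mono (by norm_num : (1:ℝ) / 2 ≤ 1) hw
    have h1 := Hs a f1 u M F hG hM hF w hw1
    rw [mem_halfBall] at hw
    have h2 : (1 / 2 : ℝ) ^ 2 ≤ (1 - ‖w‖) ^ 2 := pow_le_pow_left₀ (by norm_num) (by linarith [hw.1]) 2
    have h3 := mul_le_mul_of_nonneg_right h2 (norm_nonneg (D2 u w))
    norm_num at h3
    linarith
  have hx' := hx
  have hy' := hy
  rw [mem_halfBall] at hx hy
  set t := ‖x - y‖ with ht
  have ht0 : 0 ≤ t := norm_nonneg _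
  rcases le_or_gt c t with h1 | h1
  · have e1 := norm_sub_le (E := Eu n →L[ℝ] Eu n →L[ℝ] ℝ) (D2 u x) (D2 u y)
    have e2 : c ^ α ≤ t ^ α := Real.rpow_le_rpow hc0.le h1 hα.le
    have e3 : 8 * (Cs * T) = 8 * Cs / c ^ α * T * c ^ α := by field_simp
    have e4 := mul_le_mul_of_nonneg_left e2 (by positivity : 0 ≤ 8 * Cs / c ^ α * T)
    have e5 := hle (A := 8 * Cs / c ^ α) (by linarith) (by positivity : 0 ≤ t ^ α)
    linarith [hsup x hx', hsup y hy']
  rcases le_or_gt (R1 / 4) (x ln) with h2 | h2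
  · have e1 := (Hi a f1 u M F x (R1 / 8) hG hM hF (by positivity) (by linarith)
      (by linarith [hx.1])).2 y (by
        rw [Metric.mem_ball, dist_eq_norm, norm_sub_rev]; linarith)
    have hp : 0 < (R1 / 8) ^ (2 + α) := by positivity
    have e2 : ‖D2 u x - D2 u y‖ ≤ Ci / (R1 / 8) ^ (2 + α) * T * t ^ α := by
      refine le_of_mul_le_mul_left (e1.trans (le_of_eq ?_)) hp
      rw [← hT, ← ht]
      field_simp
    exact e2.trans (hle (by linarith) (by positivity))
  obtain ⟨hx1, hx2⟩ := Ht a f1 u M F hG hM hF x hx' (by linarith)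
  rcases lt_or_ge t (x ln / 4) with h3 | h3
  · refine (hx2 y ?_).trans (hle (by linarith) (by positivity))
    rw [Metric.mem_ball, dist_eq_norm, norm_sub_rev]
    exact h3
  · obtain ⟨hy1, -⟩ := Ht a f1 u M F hG hM hF y hy' (by linarith)
    have ht1 : 0 < t := by linarith [hx.2]
    set R := 16 * t with hR
    have hR0 : 0 < R := by positivity
    obtain ⟨p0, p, Q, hQ, hxQ⟩ := hx1 R (by linarith) (by linarith)
    obtain ⟨p0', p', Q', hQ', hyQ⟩ := hy1 R (by linarith) (by linarith)
    have hprt : ‖pr ln x - pr ln y‖ ≤ t := by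
      rw [pr_sub]; exact norm_pr_le ln _
    have k1 := poly_cmp hQ.pp.symm hQ'.pp.symm (z := pr ln x) (z' := pr ln y)
      (y0 := pr ln x + (R / 2) • bv ln) (s := R / 4) (E := 2 * (Ct * T * R ^ (2 + α))) (by positivity)
      (fun w hw => by
        have m1 := ball_sub_hB (pr_ln ln x) hR0 hw
        have m2 : w ∈ hB ln (pr ln y) R := by
          rw [Metric.mem_ball, dist_eq_norm] at hw
          refine mem_hB.2 ⟨?_, (mem_hB.1 m1).2⟩
          have e : w - pr ln y = (w - (pr ln x + (R / 2) • bv ln)) + (pr ln x - pr ln y) +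
            (R / 2) • bv ln := by abel
          have e1 : ‖(R / 2) • bv ln‖ = R / 2 := by
            rw [norm_smul, norm_bv, mul_one, Real.norm_eq_abs, abs_of_pos (by positivity)]
          rw [e]
          refine (norm_add₃_le).trans_lt ?_
          rw [e1]
          linarith
        have m3 := hQ.ap w m1
        have m4 := hQ'.ap w m2
        rw [abs_le] at *
        constructor <;> linarith)
    have k2 : 32 * (2 * (Ct * T * R ^ (2 + α))) / (R / 4) ^ 2 = 1024 * Ct * T * R ^ α := by
      rw [rpow_two_add hR0]; field_simp; norm_num
    rw [k2] at k1
    have k3 := norm_sub_le_norm_sub_add_norm_sub (E := Eu n →L[ℝ] Eu n →L[ℝ] ℝ) (D2 u x) Q (D2 u y)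
    have k4 := norm_sub_le_norm_sub_add_norm_sub (E := Eu n →L[ℝ] Eu n →L[ℝ] ℝ) Q Q' (D2 u y)
    rw [norm_sub_rev (E := Eu n →L[ℝ] Eu n →L[ℝ] ℝ) Q' (D2 u y)] at k4
    have k5 : R ^ α = 16 ^ α * t ^ α := Real.mul_rpow (by norm_num) ht0
    have k6 := hle (A := 16 ^ α * 1026 * Ct) (by linarith) (by positivity : 0 ≤ t ^ α)
    rw [k5] at hxQ hyQ k1
    linarith

theorem hBc_sub_closure (ln : Fin n) : hBc ln 0 1 ⊆ closure (halfBall n ln 1) := fun x hx => by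
  rw [mem_hBc, sub_zero] at hx
  have h1 : Tendsto (fun τ : ℝ => x + τ • bv ln) (𝓝[>] 0) (𝓝 x) := by
    have : Tendsto (fun τ : ℝ => x + τ • bv ln) (𝓝 0) (𝓝 (x + (0:ℝ) • bv ln)) :=
      Continuous.tendsto (by fun_prop) 0
    rw [zero_smul, add_zero] at this
    exact this.mono_left nhdsWithin_le_nhds
  refine mem_closure_of_tendsto h1 ?_
  have h2 : ∀ᶠ τ in 𝓝[>] (0:ℝ), ‖x + τ • bv ln‖ < 1 := h1.norm.eventually_lt_const hx.1
  filter_upwards [h2, self_mem_nhdsWithin] with τ hτ hτ0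
  rw [mem_halfBall]
  refine ⟨hτ, ?_⟩
  have : (0:ℝ) < τ := hτ0
  simp
  linarith [hx.2]

theorem closure_halfBall_sub (ln : Fin n) (r : ℝ) :
    closure (halfBall n ln r) ⊆ {x | ‖x‖ ≤ r ∧ 0 ≤ x ln} := by
  refine closure_minimal (fun x hx => ?_) ?_
  · rw [mem_halfBall] at hx
    exact ⟨hx.1.le, hx.2.le⟩
  · exact (isClosed_le continuous_norm continuous_const).inter
      (isClosed_le continuous_const (by fun_prop : Continuous fun x : Eu n => x ln))

theorem closure_half_sub (ln : Fin n) : closure (halfBall n ln (1 / 2)) ⊆ hBc ln 0 1 := fun x hx => by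
  have := closure_halfBall_sub ln _ hx
  rw [mem_hBc, sub_zero]
  exact ⟨lt_of_le_of_lt this.1 (by norm_num), this.2⟩

theorem halfBall_sub_hBc (ln : Fin n) : halfBall n ln 1 ⊆ hBc ln 0 1 := fun x hx => by
  rw [mem_halfBall] at hx
  rw [mem_hBc, sub_zero]
  exact ⟨hx.1, hx.2.le⟩

/-- The right hand side after moving the lower order terms. -/
def rhs (ln : Fin n) (bc : Fin n → Eu n → ℝ) (c f u : Eu n → ℝ) (G : Eu n → (Eu n →L[ℝ] ℝ))
    (x : Eu n) : ℝ :=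
  f x - (∑ i ∈ Finset.univ.erase ln, bc i x * G x (bv i)) - c x * u x

structure Full (ln : Fin n) (b lam Lam α K : ℝ) (a : Eu n → Fin n → Fin n → ℝ)
    (bc : Fin n → Eu n → ℝ) (c f u : Eu n → ℝ) (G : Eu n → (Eu n →L[ℝ] ℝ)) (M Kf : ℝ) : Prop where
  reg : ContDiffOn ℝ 2 u (halfBall n ln 1)
  der : ∀ x ∈ closure (halfBall n ln 1), HasFDerivWithinAt u (G x) (closure (halfBall n ln 1)) x
  derH : ∃ Ku, ∀ x ∈ closure (halfBall n ln 1), ∀ y ∈ closure (halfBall n ln 1),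
    ‖G x - G y‖ ≤ Ku * ‖x - y‖ ^ α
  coef : CoefOn lam Lam α K (hBc ln 0 1) a
  bK : ∀ i, ∀ x ∈ closure (halfBall n ln 1), |bc i x| ≤ K
  bH : ∀ i, ∀ x ∈ closure (halfBall n ln 1), ∀ y ∈ closure (halfBall n ln 1),
    |bc i x - bc i y| ≤ K * ‖x - y‖ ^ α
  cK : ∀ x ∈ closure (halfBall n ln 1), |c x| ≤ K
  cH : ∀ x ∈ closure (halfBall n ln 1), ∀ y ∈ closure (halfBall n ln 1),
    |c x - c y| ≤ K * ‖x - y‖ ^ α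
  fK : ∀ x ∈ closure (halfBall n ln 1), |f x| ≤ Kf
  fH : ∀ x ∈ closure (halfBall n ln 1), ∀ y ∈ closure (halfBall n ln 1),
    |f x - f y| ≤ Kf * ‖x - y‖ ^ α
  eq : ∀ x ∈ halfBall n ln 1, opL ln b (a x) u x = rhs ln bc c f u G x
  bd : ∀ x ∈ halfBall n ln 1, |u x| ≤ M

def VX (α : ℝ) (G : Eu n → (Eu n →L[ℝ] ℝ)) (S : Set (Eu n)) (X : ℝ) : Prop :=
  (∀ x ∈ S, (1 - ‖x‖) * ‖G x‖ ≤ X) ∧ ∀ x ∈ S, ∀ y ∈ S,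
    (min (1 - ‖x‖) (1 - ‖y‖)) ^ (1 + α) * ‖G x - G y‖ ≤ X * ‖x - y‖ ^ α

theorem fderiv_eq_of_closure {ln : Fin n} {u : Eu n → ℝ} {G : Eu n → (Eu n →L[ℝ] ℝ)}
    (h : ∀ x ∈ closure (halfBall n ln 1), HasFDerivWithinAt u (G x) (closure (halfBall n ln 1)) x)
    {x : Eu n} (hx : x ∈ halfBall n ln 1) : fderiv ℝ u x = G x :=
  ((h x (subset_closure hx)).hasFDerivAt
    (mem_of_superset ((isOpen_halfBall ln 1).mem_nhds hx) subset_closure)).fderiv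

theorem continuousOn_of_holder {E F : Type*} [NormedAddCommGroup E] [NormedAddCommGroup F] {S : Set E}
    {g : E → F} {k : ℝ} (hα : 0 < α) (h : ∀ x ∈ S, ∀ y ∈ S, ‖g x - g y‖ ≤ k * ‖x - y‖ ^ α) :
    ContinuousOn g S := by
  intro x hx
  rw [ContinuousWithinAt, tendsto_iff_norm_sub_tendsto_zero]
  have h1 : Tendsto (fun y => k * ‖y - x‖ ^ α) (𝓝[S] x) (𝓝 0) := by
    have : Continuous fun y => k * ‖y - x‖ ^ α :=
      continuous_const.mul ((continuous_id.sub continuous_const).norm.rpow_const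
        (fun _ => Or.inr hα.le))
    have h2 := this.tendsto x
    simp only [sub_self, norm_zero, Real.zero_rpow hα.ne', mul_zero] at h2
    exact h2.mono_left nhdsWithin_le_nhds
  exact squeeze_zero' (Eventually.of_forall fun y => norm_nonneg _)
    (by filter_upwards [self_mem_nhdsWithin] with y hy using h y hy x hx) h1

theorem VX.closure {G : Eu n → (Eu n →L[ℝ] ℝ)} {S : Set (Eu n)} {X : ℝ} (hα : 0 < α)
    (hG : ContinuousOn G (closure S)) (h : VX α G S X) : VX α G (closure S) X := by
  have hc : ∀ x ∈ _root_.closure S, ContinuousWithinAt G S x := fun x hx =>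
    (hG x hx).mono subset_closure
  refine ⟨fun x hx => ?_, ?_⟩
  · exact ContinuousWithinAt.closure_le hx
      ((by fun_prop : Continuous fun x : Eu n => 1 - ‖x‖).continuousWithinAt.mul (hc x hx).norm)
      continuousWithinAt_const h.1
  · have hm : ∀ y : Eu n, Continuous fun x : Eu n => (min (1 - ‖x‖) (1 - ‖y‖)) ^ (1 + α) :=
      fun y => ((continuous_const.sub continuous_norm).min continuous_const).rpow_const
        fun _ => Or.inr (by linarith)
    have hr : ∀ y : Eu n, Continuous fun x : Eu n => X * ‖x - y‖ ^ α := fun y =>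
      continuous_const.mul ((continuous_id.sub continuous_const).norm.rpow_const
        (fun _ => Or.inr hα.le))
    have h1 : ∀ x ∈ _root_.closure S, ∀ y ∈ S,
        (min (1 - ‖x‖) (1 - ‖y‖)) ^ (1 + α) * ‖G x - G y‖ ≤ X * ‖x - y‖ ^ α := fun x hx y hy =>
      ContinuousWithinAt.closure_le hx
        ((hm y).continuousWithinAt.mul ((hc x hx).sub continuousWithinAt_const).norm)
        (hr y).continuousWithinAt fun x' hx' => h.2 x' hx' y hy
    intro x hx y hy
    have := ContinuousWithinAt.closure_le hy
        ((hm x).continuousWithinAt.mul ((hc y hy).sub continuousWithinAt_const).norm)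
        (hr x).continuousWithinAt fun y' hy' => by
          have := h1 x hx y' hy'
          rwa [min_comm, norm_sub_rev (G x), norm_sub_rev x] at this
    change min (1 - ‖y‖) (1 - ‖x‖) ^ (1 + α) * ‖G y - G x‖ ≤ X * ‖y - x‖ ^ α at this
    rwa [min_comm, norm_sub_rev (G y), norm_sub_rev y] at this

theorem Full.bdc {ln : Fin n} {b K M Kf : ℝ} {a : Eu n → Fin n → Fin n → ℝ} {bc : Fin n → Eu n → ℝ}
    {c f u : Eu n → ℝ} {G : Eu n → (Eu n →L[ℝ] ℝ)} (h : Full ln b lam Lam α K a bc c f u G M Kf) :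
    ∀ x ∈ closure (halfBall n ln 1), |u x| ≤ M := fun x hx =>
  ContinuousWithinAt.closure_le hx
    (((h.der x hx).continuousWithinAt.mono subset_closure).abs) continuousWithinAt_const h.bd

theorem abs_mul_sub_mul_le (p q p' q' : ℝ) :
    |p * q - p' * q'| ≤ |p| * |q - q'| + |p - p'| * |q'| := by
  have : p * q - p' * q' = p * (q - q') + (p - p') * q' := by ring
  rw [this, ← abs_mul, ← abs_mul]
  exact abs_add_le _ _

theorem Full.grad_bdd {ln : Fin n} {b K M Kf : ℝ} {a : Eu n → Fin n → Fin n → ℝ}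
    {bc : Fin n → Eu n → ℝ} {c f u : Eu n → ℝ} {G : Eu n → (Eu n →L[ℝ] ℝ)} (hα : 0 < α)
    (h : Full ln b lam Lam α K a bc c f u G M Kf) :
    ∃ B, 0 ≤ B ∧ (∀ x ∈ closure (halfBall n ln 1), ‖G x‖ ≤ B) ∧
      ∀ x ∈ closure (halfBall n ln 1), ∀ y ∈ closure (halfBall n ln 1),
        ‖G x - G y‖ ≤ B * ‖x - y‖ ^ α := by
  obtain ⟨Ku, hKu⟩ := h.derH
  refine ⟨‖G 0‖ + |Ku|, by positivity, fun x hx => ?_, fun x hx y hy => ?_⟩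
  · have h0 : (0 : Eu n) ∈ closure (halfBall n ln 1) := hBc_sub_closure ln (by
      rw [mem_hBc]; simp)
    have h1 := hKu x hx 0 h0
    have hx1 := (closure_halfBall_sub ln 1 hx).1
    rw [sub_zero] at h1
    have h2 := norm_le_norm_sub_add (G x) (G 0)
    have h3 := rpow_le_one_of hα (norm_nonneg x) hx1
    have h4 := mul_le_mul_of_nonneg_right (le_abs_self Ku) (by positivity : 0 ≤ ‖x‖ ^ α)
    have h5 := mul_le_mul_of_nonneg_left h3 (abs_nonneg Ku)
    linarith
  · refine (hKu x hx y hy).trans (mul_le_mul_of_nonneg_right ?_ (by positivity))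
    linarith [le_abs_self Ku, norm_nonneg (G 0)]

theorem Full.glob {ln : Fin n} {b K M Kf X : ℝ} {a : Eu n → Fin n → Fin n → ℝ}
    {bc : Fin n → Eu n → ℝ} {c f u : Eu n → ℝ} {G : Eu n → (Eu n →L[ℝ] ℝ)} (hα : 0 < α) (hα1 : α < 1)
    (hK : 0 ≤ K) (h : Full ln b lam Lam α K a bc c f u G M Kf) (hM : 0 < M) (hKf : 0 ≤ Kf)
    (hX0 : 0 ≤ X) (hX : VX α G (closure (halfBall n ln 1)) X) :
    Glob ln b lam Lam α K a (rhs ln bc c f u G) u M (Kf + (6 * n + 2) * K * (X + M)) := by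
  have hcard : ((Finset.univ.erase ln).card : ℝ) ≤ n := by
    have := Finset.card_le_univ (Finset.univ.erase ln)
    rw [Fintype.card_fin] at this
    exact_mod_cast this
  have hn0 : (0:ℝ) ≤ n := Nat.cast_nonneg n
  have hGi : ∀ (S : Eu n →L[ℝ] ℝ) (i : Fin n), |S (bv i)| ≤ ‖S‖ := fun S i => by
    have := S.le_opNorm (bv i)
    rwa [norm_bv, mul_one, Real.norm_eq_abs] at this
  refine ⟨h.reg, h.coef, h.bd, fun x hx => ?_, fun x hx y hy ht => ?_, h.eq, ?_⟩
  · have hxc := hBc_sub_closure ln hx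
    rw [mem_hBc, sub_zero] at hx
    set ρ := 1 - ‖x‖ with hρ
    have hρ0 : 0 < ρ := by linarith [hx.1]
    have hρ1 : ρ ≤ 1 := by linarith [norm_nonneg x]
    have e1 : |∑ i ∈ Finset.univ.erase ln, bc i x * G x (bv i)| ≤ n * (K * ‖G x‖) := by
      refine (Finset.abs_sum_le_sum_abs _ _).trans ?_
      refine (Finset.sum_le_card_nsmul _ _ (K * ‖G x‖) fun i _ => ?_).trans ?_
      · rw [abs_mul]
        exact mul_le_mul (h.bK i x hxc) (hGi _ i) (abs_nonneg _) hK
      · rw [nsmul_eq_mul]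
        exact mul_le_mul_of_nonneg_right hcard (by positivity)
    have e2 : |c x * u x| ≤ K * M := by
      rw [abs_mul]
      exact mul_le_mul (h.cK x hxc) (h.bdc x hxc) (abs_nonneg _) hK
    have e3 : |rhs ln bc c f u G x| ≤ Kf + n * (K * ‖G x‖) + K * M := by
      have f1 := h.fK x hxc
      rw [rhs]
      rw [abs_le] at *
      constructor <;> linarith
    have e4 : ρ ^ 2 ≤ ρ := by
      have := mul_le_mul_of_nonneg_left hρ1 hρ0.le
      linarith
    have e5 := mul_le_mul e4 e3 (abs_nonneg _) hρ0.le
    have e6 := mul_le_mul_of_nonneg_left (hX.1 x hxc) (by positivity : 0 ≤ n * K)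
    have e7 := mul_le_mul_of_nonneg_right hρ1 (by positivity : 0 ≤ Kf + K * M)
    have e8 : 0 ≤ n * K * X := by positivity
    have e9 : 0 ≤ n * K * M := by positivity
    have e10 : 0 ≤ K * X := by positivity
    have e11 : 0 ≤ K * M := by positivity
    linarith
  · have hxc := hBc_sub_closure ln hx
    have hyc := hBc_sub_closure ln hy
    rw [mem_hBc, sub_zero] at hx hy
    set ρ := 1 - ‖x‖ with hρ
    set t := ‖x - y‖ with htd
    have ht0 : 0 ≤ t := norm_nonneg _
    have hρ0 : 0 < ρ := by linarith [hx.1]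
    have hρ1 : ρ ≤ 1 := by linarith [norm_nonneg x]
    have htα : t ≤ t ^ α := le_rpow_of hα1 ht0 (by linarith)
    have htα0 : 0 ≤ t ^ α := by positivity
    have hnear : ∀ w, ‖w - x‖ ≤ t → ρ / 2 ≤ 1 - ‖w‖ := fun w hw => by
      have := norm_add_le (w - x) x
      rw [sub_add_cancel] at this
      linarith
    have hyρ : ρ / 2 ≤ 1 - ‖y‖ := hnear y (by rw [norm_sub_rev])
    have p1 : ρ ^ (2 + α) ≤ ρ := by
      calc _ ≤ ρ ^ (1:ℝ) := Real.rpow_le_rpow_of_exponent_ge hρ0 hρ1 (by linarith)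
        _ = ρ := Real.rpow_one ρ
    have p2 : ρ ^ (2 + α) ≤ 4 * (min (1 - ‖x‖) (1 - ‖y‖)) ^ (1 + α) := by
      have q1 : ρ ^ (2 + α) ≤ ρ ^ (1 + α) :=
        Real.rpow_le_rpow_of_exponent_ge hρ0 hρ1 (by linarith)
      have q2 : (ρ / 2) ^ (1 + α) ≤ (min (1 - ‖x‖) (1 - ‖y‖)) ^ (1 + α) :=
        Real.rpow_le_rpow (by positivity) (le_min (by linarith) hyρ) (by linarith)
      have q3 : ρ ^ (1 + α) = 2 ^ (1 + α) * (ρ / 2) ^ (1 + α) := by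
        rw [← Real.mul_rpow (by norm_num) (by positivity)]
        congr 1; ring
      have q4 : (2:ℝ) ^ (1 + α) ≤ 4 := by
        calc (2:ℝ) ^ (1 + α) ≤ 2 ^ (2:ℝ) :=
              Real.rpow_le_rpow_of_exponent_le (by norm_num) (by linarith)
          _ = 4 := by norm_num
      have q5 := mul_le_mul_of_nonneg_right q4 (by positivity : 0 ≤ (ρ / 2) ^ (1 + α))
      linarith
    have hp0 : 0 ≤ ρ ^ (2 + α) := by positivity
    have hρ21 : ρ ^ (2 + α) ≤ 1 := p1.trans hρ1
    have g1 : ρ ^ (2 + α) * ‖G x - G y‖ ≤ 4 * X * t ^ α := by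
      have := mul_le_mul_of_nonneg_right p2 (norm_nonneg (G x - G y))
      have := hX.2 x hxc y hyc
      linarith
    have g2 : ρ ^ (2 + α) * ‖G y‖ ≤ 2 * X := by
      have q1 := mul_le_mul_of_nonneg_right p1 (norm_nonneg (G y))
      have q2 := mul_le_mul_of_nonneg_right hyρ (norm_nonneg (G y))
      have q3 := hX.1 y hyc
      linarith
    have g3 : ρ ^ (2 + α) * |u x - u y| ≤ 2 * X * t ^ α := by
      have hsub : Metric.closedBall x t ∩ {w | 0 ≤ w ln} ⊆ closure (halfBall n ln 1) := fun w hw => by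
        have hw1 := hw.1
        rw [Metric.mem_closedBall, dist_eq_norm] at hw1
        refine hBc_sub_closure ln ?_
        rw [mem_hBc, sub_zero]
        exact ⟨by linarith [hnear w hw1], hw.2⟩
      have q1 := Convex.norm_image_sub_le_of_norm_hasFDerivWithin_le
        (f := u) (f' := G) (C := 2 * X / ρ) (s := Metric.closedBall x t ∩ {w | 0 ≤ w ln})
        (fun w hw => (h.der w (hsub hw)).mono hsub) (fun w hw => by
          have hw1 := hw.1
          rw [Metric.mem_closedBall, dist_eq_norm] at hw1
          have r1 := mul_le_mul_of_nonneg_right (hnear w hw1) (norm_nonneg (G w))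
          have r2 := hX.1 w (hsub hw)
          rw [le_div_iff₀ hρ0]
          linarith)
        ((convex_closedBall x t).inter (by
          have : Convex ℝ {w : Eu n | (0:ℝ) ≤ EuclideanSpace.proj (𝕜 := ℝ) ln w} :=
            convex_halfSpace_ge (𝕜 := ℝ) (EuclideanSpace.proj (𝕜 := ℝ) ln).isLinear 0
          exact this))
        (x := y) (y := x) ⟨by rw [Metric.mem_closedBall, dist_eq_norm, norm_sub_rev], hy.2⟩
        ⟨Metric.mem_closedBall_self ht0, hx.2⟩
      rw [Real.norm_eq_abs, ← htd] at q1
      have q2 := mul_le_mul p1 q1 (abs_nonneg _) hρ0.le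
      have q3 : ρ * (2 * X / ρ * t) = 2 * X * t := by field_simp
      have q4 := mul_le_mul_of_nonneg_left htα (by positivity : 0 ≤ 2 * X)
      linarith
    have e1 : |∑ i ∈ Finset.univ.erase ln, (bc i x * G x (bv i) - bc i y * G y (bv i))| ≤
        n * (K * ‖G x - G y‖ + K * t ^ α * ‖G y‖) := by
      refine (Finset.abs_sum_le_sum_abs _ _).trans ?_
      refine (Finset.sum_le_card_nsmul _ _ (K * ‖G x - G y‖ + K * t ^ α * ‖G y‖)
        fun i _ => ?_).trans ?_
      · refine (abs_mul_sub_mul_le _ _ _ _).trans (add_le_add ?_ ?_)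
        · exact mul_le_mul (h.bK i x hxc) (hGi (G x - G y) i) (abs_nonneg _) hK
        · exact mul_le_mul (h.bH i x hxc y hyc) (hGi _ i) (abs_nonneg _) (by positivity)
      · rw [nsmul_eq_mul]
        exact mul_le_mul_of_nonneg_right hcard (by positivity)
    have e2 : |c x * u x - c y * u y| ≤ K * |u x - u y| + K * t ^ α * M :=
      (abs_mul_sub_mul_le _ _ _ _).trans (add_le_add
        (mul_le_mul_of_nonneg_right (h.cK x hxc) (abs_nonneg _))
        (mul_le_mul (h.cH x hxc y hyc) (h.bdc y hyc) (abs_nonneg _) (by positivity)))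
    have e3 : |rhs ln bc c f u G x - rhs ln bc c f u G y| ≤ Kf * t ^ α +
        n * (K * ‖G x - G y‖ + K * t ^ α * ‖G y‖) + (K * |u x - u y| + K * t ^ α * M) := by
      have f1 := h.fH x hxc y hyc
      rw [← htd] at f1
      rw [Finset.sum_sub_distrib] at e1
      rw [rhs, rhs]
      rw [abs_le] at *
      constructor <;> linarith
    refine (mul_le_mul_of_nonneg_left e3 hp0).trans ?_
    have k1 := mul_le_mul_of_nonneg_left g1 (by positivity : 0 ≤ n * K)
    have k2 := mul_le_mul_of_nonneg_left g2 (by positivity : 0 ≤ n * K * t ^ α)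
    have k3 := mul_le_mul_of_nonneg_left g3 hK
    have k4 := mul_le_mul_of_nonneg_right hρ21 (by positivity : 0 ≤ Kf * t ^ α + K * t ^ α * M)
    have e8 : 0 ≤ n * K * M * t ^ α := by positivity
    have e9 : 0 ≤ K * M * t ^ α := by positivity
    linarith
  · obtain ⟨B, -, hBn, -⟩ := h.grad_bdd hα
    refine ⟨B, fun x hx => ?_⟩
    rw [fderiv_eq_of_closure h.der hx]
    exact hBn x (subset_closure hx)

theorem convex_hB (ln : Fin n) (z : Eu n) (R : ℝ) : Convex ℝ (hB ln z R) :=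
  (convex_ball z R).inter (by
    have : Convex ℝ {w : Eu n | (0:ℝ) < EuclideanSpace.proj (𝕜 := ℝ) ln w} :=
      convex_halfSpace_gt (𝕜 := ℝ) (EuclideanSpace.proj (𝕜 := ℝ) ln).isLinear 0
    exact this)

theorem grad_weighted {ln : Fin n} {u : Eu n → ℝ} {M T κ : ℝ}
    (hu : ContDiffOn ℝ 2 u (halfBall n ln 1)) (hM : 0 < M) (hT : 0 ≤ T)
    (hbd : ∀ x ∈ halfBall n ln 1, |u x| ≤ M)
    (hD : ∀ x ∈ halfBall n ln 1, (1 - ‖x‖) ^ 2 * ‖D2 u x‖ ≤ T) (hκ : 0 < κ) (hκ1 : κ ≤ 1 / 4) :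
    (∀ x ∈ halfBall n ln 1, ∀ y ∈ halfBall n ln 1, ‖y - x‖ < (1 - ‖x‖) / 2 →
      ‖fderiv ℝ u x - fderiv ℝ u y‖ ≤ 4 * T / (1 - ‖x‖) ^ 2 * ‖x - y‖) ∧
    ∀ x ∈ halfBall n ln 1, (1 - ‖x‖) * ‖fderiv ℝ u x‖ ≤ 4 * M / κ + 6 * κ * T := by
  have hloc : ∀ x ∈ halfBall n ln 1, hB ln x ((1 - ‖x‖) / 2) ⊆ halfBall n ln 1 ∧
      ∀ w ∈ hB ln x ((1 - ‖x‖) / 2), ‖D2 u w‖ ≤ 4 * T / (1 - ‖x‖) ^ 2 := fun x hx => by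
    rw [mem_halfBall] at hx
    have h1 : hB ln x ((1 - ‖x‖) / 2) ⊆ halfBall n ln 1 := hB_sub_half (by linarith)
    refine ⟨h1, fun w hw => ?_⟩
    have h2 := hD w (h1 hw)
    rw [mem_hB] at hw
    have h3 := norm_add_le (w - x) x
    rw [sub_add_cancel] at h3
    have h4 : ((1 - ‖x‖) / 2) ^ 2 ≤ (1 - ‖w‖) ^ 2 := pow_le_pow_left₀ (by linarith) (by linarith) 2
    have h5 := mul_le_mul_of_nonneg_right h4 (norm_nonneg (D2 u w))
    have h6 : 0 < (1 - ‖x‖) ^ 2 := by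
      have : 0 < 1 - ‖x‖ := by linarith
      positivity
    rw [le_div_iff₀ h6]
    linarith
  have hlip : ∀ x ∈ halfBall n ln 1, ∀ y ∈ halfBall n ln 1, ‖y - x‖ < (1 - ‖x‖) / 2 →
      ‖fderiv ℝ u x - fderiv ℝ u y‖ ≤ 4 * T / (1 - ‖x‖) ^ 2 * ‖x - y‖ := fun x hx y hy hxy => by
    obtain ⟨h1, h2⟩ := hloc x hx
    rw [mem_halfBall] at hx hy
    exact fderiv_lip (isOpen_halfBall ln 1) hu (convex_hB ln x _) h1 h2
      (mem_hB.2 ⟨by rw [sub_self, norm_zero]; linarith, hx.2⟩) (mem_hB.2 ⟨hxy, hy.2⟩)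
  refine ⟨hlip, fun x hx => ?_⟩
  obtain ⟨h1, h2⟩ := hloc x hx
  have hx' := hx
  rw [mem_halfBall] at hx
  set ρ := 1 - ‖x‖ with hρ
  have hρ0 : 0 < ρ := by linarith
  set s := κ * ρ with hs
  have hs0 : 0 < s := by positivity
  have hsρ : s ≤ ρ / 4 := by
    have := mul_le_mul_of_nonneg_right hκ1 hρ0.le
    rw [hs]; linarith
  have hyl : (x + s • bv ln) ln = x ln + s := by simp
  have hyn : ‖x + s • bv ln - x‖ = s := by
    rw [add_sub_cancel_left, norm_smul, norm_bv, mul_one, Real.norm_eq_abs, abs_of_pos hs0]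
  have hball : Metric.ball (x + s • bv ln) s ⊆ hB ln x (ρ / 2) := fun w hw => by
    rw [Metric.mem_ball, dist_eq_norm] at hw
    have k1 := norm_sub_le_norm_sub_add_norm_sub w (x + s • bv ln) x
    have k2 := abs_coord_le (w - (x + s • bv ln)) ln
    rw [PiLp.sub_apply, hyl, abs_le] at k2
    exact mem_hB.2 ⟨by linarith, by linarith⟩
  have hymem := hball (Metric.mem_ball_self hs0)
  have h3 := grad_interp (hu.mono (hball.trans h1)) (s := s / 2) (by positivity) (by linarith) hM.le
    (by positivity : 0 ≤ 4 * T / ρ ^ 2) (fun w hw => hbd w (h1 (hball hw)))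
    (fun w hw => h2 w (hball hw))
  have h4 := hlip x hx' _ (h1 hymem) (by rw [hyn]; linarith)
  rw [norm_sub_rev x, hyn, ← hρ] at h4
  have h5 := norm_le_norm_sub_add (fderiv ℝ u x) (fderiv ℝ u (x + s • bv ln))
  have h6 := mul_le_mul_of_nonneg_left (h5.trans (add_le_add h4 h3)) hρ0.le
  refine h6.trans (le_of_eq ?_)
  rw [hs]
  field_simp
  ring

theorem vx_interp {ln : Fin n} {u : Eu n → ℝ} {M T κ : ℝ} (hα : 0 < α) (hα1 : α < 1)
    (hu : ContDiffOn ℝ 2 u (halfBall n ln 1)) (hM : 0 < M) (hT : 0 ≤ T)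
    (hbd : ∀ x ∈ halfBall n ln 1, |u x| ≤ M)
    (hD : ∀ x ∈ halfBall n ln 1, (1 - ‖x‖) ^ 2 * ‖D2 u x‖ ≤ T) (hκ : 0 < κ) (hκ1 : κ ≤ 1 / 4) :
    VX α (fderiv ℝ u) (halfBall n ln 1) (12 * M / κ ^ 3 + 18 * κ ^ (1 - α) * T) := by
  have hκ2 : κ ^ 2 ≤ κ := by
    have := mul_le_mul_of_nonneg_left hκ1 hκ.le
    linarith
  obtain ⟨hlip, hgr⟩ := grad_weighted hu hM hT hbd hD (κ := κ ^ 2) (by positivity) (by linarith)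
  have hκα : κ ≤ κ ^ (1 - α) := by
    calc κ = κ ^ (1:ℝ) := (Real.rpow_one κ).symm
      _ ≤ κ ^ (1 - α) := Real.rpow_le_rpow_of_exponent_ge hκ (by linarith) (by linarith)
  have hκα' : κ ≤ κ ^ α := by
    calc κ = κ ^ (1:ℝ) := (Real.rpow_one κ).symm
      _ ≤ κ ^ α := Real.rpow_le_rpow_of_exponent_ge hκ (by linarith) (by linarith)
  set Y := 4 * M / κ ^ 2 + 6 * κ ^ 2 * T with hY
  have hY0 : 0 ≤ Y := by positivity
  have hYκ : 2 * Y / κ ≤ 12 * M / κ ^ 3 + 18 * κ ^ (1 - α) * T := by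
    have e : 2 * Y / κ = 8 * M / κ ^ 3 + 12 * κ * T := by rw [hY]; field_simp; ring
    have e1 : 0 ≤ M / κ ^ 3 := by positivity
    have e2 := mul_le_mul_of_nonneg_right hκα hT
    have e3 : 8 * M / κ ^ 3 = 8 * (M / κ ^ 3) := by ring
    have e4 : 12 * M / κ ^ 3 = 12 * (M / κ ^ 3) := by ring
    have e5 : 0 ≤ κ * T := by positivity
    rw [e, e3, e4]
    linarith
  refine ⟨fun x hx => (hgr x hx).trans (le_trans ?_ hYκ), fun x hx y hy => ?_⟩
  · rw [le_div_iff₀ hκ]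
    have := mul_le_mul_of_nonneg_left hκ1 hY0
    linarith
  · have hx1 := (mem_halfBall.1 hx).1
    have hy1 := (mem_halfBall.1 hy).1
    set m := min (1 - ‖x‖) (1 - ‖y‖) with hm
    have hm0 : 0 < m := lt_min (by linarith) (by linarith)
    have hmx : m ≤ 1 - ‖x‖ := min_le_left _ _
    have hmy : m ≤ 1 - ‖y‖ := min_le_right _ _
    set t := ‖x - y‖ with ht
    have ht0 : 0 ≤ t := norm_nonneg _
    have htα0 : 0 ≤ t ^ α := by positivity
    have hmα : m ^ (1 + α) = m * m ^ α := by rw [Real.rpow_add hm0, Real.rpow_one]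
    rcases lt_or_ge t (κ * m) with h | h
    · have h1 : κ * m ≤ m / 4 := by
        have := mul_le_mul_of_nonneg_right hκ1 hm0.le
        linarith
      have h2 := hlip x hx y hy (by rw [norm_sub_rev]; linarith)
      have h3 : 4 * T / (1 - ‖x‖) ^ 2 ≤ 4 * T / m ^ 2 :=
        div_le_div_of_nonneg_left (by positivity) (by positivity) (pow_le_pow_left₀ hm0.le hmx 2)
      have h4 : t ≤ t ^ α * (κ ^ (1 - α) * m ^ (1 - α)) := by
        rcases ht0.eq_or_lt with h0 | h0
        · rw [← h0]; positivity
        · have k1 : t = t ^ α * t ^ (1 - α) := by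
            rw [← Real.rpow_add h0]; simp
          have k2 : t ^ (1 - α) ≤ κ ^ (1 - α) * m ^ (1 - α) := by
            rw [← Real.mul_rpow hκ.le hm0.le]
            exact Real.rpow_le_rpow ht0 h.le (by linarith)
          have k3 := mul_le_mul_of_nonneg_left k2 htα0
          rwa [← k1] at k3
      have h5 : ‖fderiv ℝ u x - fderiv ℝ u y‖ ≤
          4 * T / m ^ 2 * (t ^ α * (κ ^ (1 - α) * m ^ (1 - α))) :=
        h2.trans (mul_le_mul h3 h4 ht0 (by positivity))
      have h6 := mul_le_mul_of_nonneg_left h5 (by positivity : 0 ≤ m ^ (1 + α))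
      have h7 : m ^ (1 + α) * m ^ (1 - α) = m ^ 2 := by
        rw [← Real.rpow_add hm0]
        have : 1 + α + (1 - α) = (2:ℕ) := by push_cast; ring
        rw [this, Real.rpow_natCast]
      have h8 : m ^ (1 + α) * (4 * T / m ^ 2 * (t ^ α * (κ ^ (1 - α) * m ^ (1 - α)))) =
          4 * κ ^ (1 - α) * T * t ^ α := by
        calc _ = 4 * T / m ^ 2 * (t ^ α * κ ^ (1 - α)) * (m ^ (1 + α) * m ^ (1 - α)) := by ring
          _ = _ := by rw [h7]; field_simp
      rw [h8] at h6
      refine h6.trans (mul_le_mul_of_nonneg_right ?_ htα0)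
      have : 0 ≤ κ ^ (1 - α) * T := by positivity
      have : 0 ≤ 12 * M / κ ^ 3 := by positivity
      linarith
    · have h1 : κ * m ^ α ≤ t ^ α := by
        have k1 : (κ * m) ^ α ≤ t ^ α := Real.rpow_le_rpow (by positivity) h hα.le
        rw [Real.mul_rpow hκ.le hm0.le] at k1
        exact (mul_le_mul_of_nonneg_right hκα' (by positivity)).trans k1
      have h2 : m * ‖fderiv ℝ u x - fderiv ℝ u y‖ ≤ 2 * Y := by
        have k1 := mul_le_mul_of_nonneg_left (norm_sub_le (fderiv ℝ u x) (fderiv ℝ u y)) hm0.le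
        have k2 := mul_le_mul_of_nonneg_right hmx (norm_nonneg (fderiv ℝ u x))
        have k3 := mul_le_mul_of_nonneg_right hmy (norm_nonneg (fderiv ℝ u y))
        linarith [hgr x hx, hgr y hy]
      have h3 : m ^ (1 + α) * ‖fderiv ℝ u x - fderiv ℝ u y‖ ≤ 2 * Y / κ * t ^ α := by
        rw [hmα]
        have k1 := mul_le_mul_of_nonneg_left h2 (by positivity : 0 ≤ m ^ α)
        have k2 : 2 * Y / κ * (κ * m ^ α) = m ^ α * (2 * Y) := by field_simp
        have k3 := mul_le_mul_of_nonneg_left h1 (by positivity : 0 ≤ 2 * Y / κ)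
        linarith
      exact h3.trans (mul_le_mul_of_nonneg_right hYκ htα0)

theorem full_grad (ln : Fin n) (hl : 0 < lam) (hL : 0 < Lam) (hα : 0 < α) (hα1 : α < 1) {b : ℝ}
    (hb : 1 < b) (K : ℝ) (hK : 0 ≤ K) :
    ∃ C : ℝ, 0 < C ∧ ∀ (a : Eu n → Fin n → Fin n → ℝ) (bc : Fin n → Eu n → ℝ) (c f u : Eu n → ℝ)
      (G : Eu n → (Eu n →L[ℝ] ℝ)) (M Kf : ℝ), Full ln b lam Lam α K a bc c f u G M Kf →
      0 < M → 0 ≤ Kf → VX α G (closure (halfBall n ln 1)) (C * (M + Kf)) := by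
  obtain ⟨Cs, hCs, Hs⟩ := glob_sup ln hl hL hα hα1 hb K hK
  set Cn : ℝ := (6 * n + 2) * K with hCn
  have hCn0 : 0 ≤ Cn := by positivity
  obtain ⟨κ, hκ, hκ4, hκα⟩ := exists_kappa (C := 18 * Cs * (Cn + 1)) (by positivity)
    (α := 1 - α) (by linarith) (1 / 2) (by norm_num) (1 / 4) (by norm_num)
  refine ⟨3 * (12 / κ ^ 3 + 1 / 2), by positivity, fun a bc c f u G M Kf h hM hKf => ?_⟩
  rw [mul_assoc]
  have hGc : ContinuousOn G (closure (halfBall n ln 1)) := by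
    obtain ⟨Ku, hKu⟩ := h.derH
    exact continuousOn_of_holder hα hKu
  refine absorb (S := {X | VX α G (closure (halfBall n ln 1)) X})
    (C0 := (12 / κ ^ 3 + 1 / 2) * (M + Kf)) (by positivity) ?_ ?_ ?_
  · intro X hX X' hXX
    exact ⟨fun x hx => (hX.1 x hx).trans hXX, fun x hx y hy => (hX.2 x hx y hy).trans
      (mul_le_mul_of_nonneg_right hXX (by positivity))⟩
  · obtain ⟨B, hB0, hB1, hB2⟩ := h.grad_bdd hα
    refine ⟨B, fun x hx => ?_, fun x hx y hy => ?_⟩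
    · have h1 := mul_le_mul_of_nonneg_right (by linarith [norm_nonneg x] : 1 - ‖x‖ ≤ 1)
        (norm_nonneg (G x))
      linarith [hB1 x hx]
    · have h0 : 0 ≤ min (1 - ‖x‖) (1 - ‖y‖) := le_min
        (by linarith [(closure_halfBall_sub ln 1 hx).1])
        (by linarith [(closure_halfBall_sub ln 1 hy).1])
      have h1 : (min (1 - ‖x‖) (1 - ‖y‖)) ^ (1 + α) ≤ 1 := Real.rpow_le_one h0
        ((min_le_left _ _).trans (by linarith [norm_nonneg x])) (by linarith)
      have h2 := mul_le_mul_of_nonneg_right h1 (norm_nonneg (G x - G y))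
      linarith [hB2 x hx y hy]
  · intro X hX hX0
    have hG := h.glob hα hα1 hK hM hKf hX0 hX
    rw [← hCn] at hG
    have h1 := vx_interp hα hα1 h.reg hM (T := Cs * (M + (Kf + Cn * (X + M)))) (by positivity) h.bd
      (Hs a _ u M _ hG hM (by positivity)) hκ hκ4
    have h2 : 12 * M / κ ^ 3 + 18 * κ ^ (1 - α) * (Cs * (M + (Kf + Cn * (X + M)))) ≤
        X / 2 + (12 / κ ^ 3 + 1 / 2) * (M + Kf) := by
      have k1 : M + (Kf + Cn * (X + M)) ≤ (Cn + 1) * (X + M + Kf) := by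
        have := mul_nonneg hCn0 hKf
        linarith
      have k2 := mul_le_mul_of_nonneg_left k1 (by positivity : 0 ≤ 18 * κ ^ (1 - α) * Cs)
      have k3 := mul_le_mul_of_nonneg_right hκα (by positivity : 0 ≤ X + M + Kf)
      have k4 : 0 ≤ 12 / κ ^ 3 * Kf := by positivity
      have k5 : 12 * M / κ ^ 3 = 12 / κ ^ 3 * M := by ring
      rw [k5]
      linarith
    refine VX.closure hα hGc ⟨fun x hx => ?_, fun x hx y hy => ?_⟩
    · have := h1.1 x hx
      rw [fderiv_eq_of_closure h.der hx] at this
      exact this.trans h2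
    · have := h1.2 x hx y hy
      rw [fderiv_eq_of_closure h.der hx, fderiv_eq_of_closure h.der hy] at this
      exact this.trans (mul_le_mul_of_nonneg_right h2 (by positivity))

theorem quot_sub_le {A A' V V' w w' : ℝ} (hl : 0 < lam) (hA : lam ≤ A) (h : A * V = w)
    (h' : A' * V' = w') : lam * |V - V'| ≤ |w - w'| + |A - A'| * |V'| := by
  have e : A * (V - V') = (w - w') - (A - A') * V' := by rw [← h, ← h']; ring
  have hA0 : 0 < A := by linarith
  have e1 : A * |V - V'| = |A * (V - V')| := by rw [abs_mul, abs_of_pos hA0]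
  have e2 := mul_le_mul_of_nonneg_right hA (abs_nonneg (V - V'))
  have e3 := abs_sub (w - w') ((A - A') * V')
  rw [abs_mul (A - A')] at e3
  rw [e] at e1
  linarith

theorem Glob.rhs_half {ln : Fin n} {b K M F : ℝ} {a : Eu n → Fin n → Fin n → ℝ} {f1 u : Eu n → ℝ}
    (hα : 0 < α) (hα1 : α < 1) (h : Glob ln b lam Lam α K a f1 u M F) (hF : 0 ≤ F) :
    (∀ x ∈ halfBall n ln (1 / 2), |f1 x| ≤ 4 * F) ∧ ∀ x ∈ halfBall n ln (1 / 2),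
      ∀ y ∈ halfBall n ln (1 / 2), |f1 x - f1 y| ≤ 32 * F * ‖x - y‖ ^ α := by
  have hm : ∀ x ∈ halfBall n ln (1 / 2), x ∈ hBc ln 0 1 := fun x hx =>
    closure_half_sub ln (subset_closure hx)
  have h1 : ∀ x ∈ halfBall n ln (1 / 2), |f1 x| ≤ 4 * F := fun x hx => by
    have e := h.fb x (hm x hx)
    have hx1 := (mem_halfBall.1 hx).1
    have e1 : (1 / 4 : ℝ) ≤ (1 - ‖x‖) ^ 2 := by nlinarith
    have := mul_le_mul_of_nonneg_right e1 (abs_nonneg (f1 x))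
    linarith
  refine ⟨h1, fun x hx y hy => ?_⟩
  have hx1 := (mem_halfBall.1 hx).1
  have ht0 := norm_nonneg (x - y)
  by_cases ht : ‖x - y‖ ≤ 1 / 4
  · have e := h.fH x (hm x hx) y (hm y hy) (by linarith)
    have e1 := rpow_frac (c := 1 / 2) (ρ := 1) (ρ' := 1 - ‖x‖) hα hα1 (by norm_num) (by norm_num)
      one_pos (by linarith)
    rw [Real.one_rpow] at e1
    have e2 := mul_le_mul_of_nonneg_right e1 (abs_nonneg (f1 x - f1 y))
    have e3 : 0 ≤ F * ‖x - y‖ ^ α := by positivity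
    linarith
  · push Not at ht
    have e1 : (1 / 4 : ℝ) ≤ ‖x - y‖ ^ α := by
      calc (1 / 4 : ℝ) = (1 / 4) ^ (1:ℝ) := (Real.rpow_one _).symm
        _ ≤ (1 / 4) ^ α := Real.rpow_le_rpow_of_exponent_ge (by norm_num) (by norm_num) hα1.le
        _ ≤ _ := Real.rpow_le_rpow (by norm_num) ht.le hα.le
    have e2 := mul_le_mul_of_nonneg_left e1 hF
    have e3 := abs_sub (f1 x) (f1 y)
    have := h1 x hx
    have := h1 y hy
    linarith

theorem full_main (ln : Fin n) (hl : 0 < lam) (hL : 0 < Lam) (hα : 0 < α) (hα1 : α < 1) {b : ℝ}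
    (hb : 1 < b) (K : ℝ) (hK : 0 ≤ K) :
    ∃ C, 0 < C ∧ ∀ (a : Eu n → Fin n → Fin n → ℝ) (bc : Fin n → Eu n → ℝ) (c f u : Eu n → ℝ)
      (G : Eu n → (Eu n →L[ℝ] ℝ)) (M Kf : ℝ), Full ln b lam Lam α K a bc c f u G M Kf → 0 < M →
      0 ≤ Kf →
      (∀ x ∈ closure (halfBall n ln (1 / 2)), ‖G x‖ ≤ C * (M + Kf)) ∧
      (∀ x ∈ halfBall n ln (1 / 2), ‖D2 u x‖ ≤ C * (M + Kf)) ∧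
      (∀ x ∈ halfBall n ln (1 / 2), ∀ y ∈ halfBall n ln (1 / 2),
        ‖D2 u x - D2 u y‖ ≤ C * (M + Kf) * ‖x - y‖ ^ α) ∧
      (∀ x ∈ halfBall n ln (1 / 2), |fderiv ℝ u x (bv ln) / x ln| ≤ C * (M + Kf)) ∧
      (∀ x ∈ halfBall n ln (1 / 2), ∀ y ∈ halfBall n ln (1 / 2),
        |fderiv ℝ u x (bv ln) / x ln - fderiv ℝ u y (bv ln) / y ln| ≤
          C * (M + Kf) * ‖x - y‖ ^ α) := by
  obtain ⟨Cg, hCg, Hg⟩ := full_grad ln hl hL hα hα1 hb K hK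
  obtain ⟨Cs, hCs, Hs⟩ := glob_sup ln hl hL hα hα1 hb K hK
  obtain ⟨Ch, hCh, Hh⟩ := glob_holder ln hl hL hα hα1 hb K hK
  set Cn : ℝ := (6 * n + 2) * K with hCn
  have hCn0 : 0 ≤ Cn := by positivity
  set CF : ℝ := 1 + Cn * (Cg + 1) with hCF
  have hCF0 : 0 < CF := by positivity
  set S : ℝ := 4 * Cs * (1 + CF) with hS
  have hS0 : 0 < S := by positivity
  set H : ℝ := Ch * (1 + CF) with hH
  have hH0 : 0 < H := by positivity
  set W0 : ℝ := (4 * CF + n ^ 2 * Lam * S) with hW0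
  have hW00 : 0 < W0 := by positivity
  set W1 : ℝ := (32 * CF + n ^ 2 * Lam * H + n ^ 2 * K * S) with hW1
  have hW10 : 0 < W1 := by positivity
  set D : ℝ := (W1 + K * (W0 / lam)) / lam with hD
  have hD0 : 0 < D := by positivity
  refine ⟨2 * Cg + S + H + W0 / lam + D, by positivity, ?_⟩
  intro a bc c f u G M Kf h hM hKf
  set Z := M + Kf with hZ
  have hZ0 : 0 < Z := by positivity
  have hmono : ∀ {A : ℝ}, A ≤ 2 * Cg + S + H + W0 / lam + D → A * Z ≤
      (2 * Cg + S + H + W0 / lam + D) * Z := fun hA => mul_le_mul_of_nonneg_right hA hZ0.le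
  have hWl : 0 < W0 / lam := by positivity
  have hG := Hg a bc c f u G M Kf h hM hKf
  have hgl := h.glob hα hα1 hK hM hKf (X := Cg * Z) (by positivity) hG
  rw [← hCn] at hgl
  set F := Kf + Cn * (Cg * Z + M) with hF
  have hF0 : 0 ≤ F := by positivity
  have hFZ : F ≤ CF * Z := by
    have k1 := mul_nonneg hCn0 hKf
    rw [hF, hCF, hZ]
    linarith
  have hMF : M + F ≤ (1 + CF) * Z := by
    have : M ≤ Z := by linarith
    linarith
  have hsub : halfBall n ln (1 / 2) ⊆ halfBall n ln 1 := fun x hx => by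
    rw [mem_halfBall] at *
    exact ⟨by linarith [hx.1], hx.2⟩
  have hsubc : ∀ x ∈ halfBall n ln (1 / 2), x ∈ hBc ln 0 1 := fun x hx =>
    halfBall_sub_hBc ln (hsub hx)
  have g1 : ∀ x ∈ closure (halfBall n ln (1 / 2)), ‖G x‖ ≤ 2 * Cg * Z := fun x hx => by
    have e1 := hG.1 x (closure_mono hsub hx)
    have e2 := (closure_halfBall_sub ln _ hx).1
    have e3 := mul_le_mul_of_nonneg_right (by linarith : 1 / 2 ≤ 1 - ‖x‖) (norm_nonneg (G x))
    linarith
  have g2 : ∀ x ∈ halfBall n ln (1 / 2), ‖D2 u x‖ ≤ S * Z := fun x hx => by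
    have e1 := Hs a _ u M F hgl hM hF0 x (hsub hx)
    have hx1 := (mem_halfBall.1 hx).1
    have e2 : (1 / 4 : ℝ) ≤ (1 - ‖x‖) ^ 2 := by nlinarith
    have e3 := mul_le_mul_of_nonneg_right e2 (norm_nonneg (D2 u x))
    have e4 := mul_le_mul_of_nonneg_left hMF hCs.le
    rw [hS]
    linarith
  have g3 : ∀ x ∈ halfBall n ln (1 / 2), ∀ y ∈ halfBall n ln (1 / 2),
      ‖D2 u x - D2 u y‖ ≤ H * Z * ‖x - y‖ ^ α := fun x hx y hy => by
    have e1 := Hh a _ u M F hgl hM hF0 x hx y hy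
    have e4 := mul_le_mul_of_nonneg_left hMF hCh.le
    have e5 := mul_le_mul_of_nonneg_right e4 (by positivity : 0 ≤ ‖x - y‖ ^ α)
    rw [hH]
    linarith
  obtain ⟨r1, r2⟩ := hgl.rhs_half hα hα1 hF0
  set V : Eu n → ℝ := fun x => fderiv ℝ u x (bv ln) / x ln with hV
  set w : Eu n → ℝ := fun x => rhs ln bc c f u G x - qf (a x) (D2 u x) with hw
  have hell : ∀ x ∈ halfBall n ln (1 / 2), Ell lam Lam (a x) := fun x hx => h.coef.ell x (hsubc x hx)
  have hVe : ∀ x ∈ halfBall n ln (1 / 2), a x ln ln * V x = w x / b := fun x hx => by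
    have e := h.eq x (hsub hx)
    have hb0 : b ≠ 0 := by linarith
    rw [opL] at e
    rw [eq_div_iff hb0, hw, hV]
    dsimp only
    rw [← e]
    ring
  have hdb : ∀ s : ℝ, |s / b| ≤ |s| := fun s => by
    rw [abs_div, abs_of_pos (by linarith : 0 < b)]
    exact div_le_self (abs_nonneg _) hb.le
  have hw0 : ∀ x ∈ halfBall n ln (1 / 2), |w x| ≤ W0 * Z := fun x hx => by
    have e1 := r1 x hx
    have e2 := qf_abs_le (a x) (D2 u x) (fun i j => (hell x hx).abs_le hl i j)
    have e3 := mul_le_mul_of_nonneg_left (g2 x hx) (by positivity : 0 ≤ n ^ 2 * Lam)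
    have e4 := abs_sub (rhs ln bc c f u G x) (qf (a x) (D2 u x))
    rw [hW0]
    change |rhs ln bc c f u G x - qf (a x) (D2 u x)| ≤ _
    linarith
  have hw1 : ∀ x ∈ halfBall n ln (1 / 2), ∀ y ∈ halfBall n ln (1 / 2),
      |w x - w y| ≤ W1 * Z * ‖x - y‖ ^ α := fun x hx y hy => by
    have hp : 0 ≤ ‖x - y‖ ^ α := by positivity
    have e1 := r2 x hx y hy
    have e2 := qf_abs_le (a x) (D2 u x - D2 u y) (fun i j => (hell x hx).abs_le hl i j)
    have e3 := qf_abs_le (fun i j => a x i j - a y i j) (D2 u y)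
      (fun i j => h.coef.aH x (hsubc x hx) y (hsubc y hy) i j)
    rw [qf_sub] at e2
    rw [qf_sub_left] at e3
    have e4 := mul_le_mul_of_nonneg_left (g3 x hx y hy) (by positivity : 0 ≤ n ^ 2 * Lam)
    have e5 := mul_le_mul_of_nonneg_left (g2 y hy) (by positivity : 0 ≤ n ^ 2 * (K * ‖x - y‖ ^ α))
    have e6 := mul_le_mul_of_nonneg_right hFZ hp
    have e7 : |w x - w y| ≤ |rhs ln bc c f u G x - rhs ln bc c f u G y| +
        |qf (a x) (D2 u x) - qf (a x) (D2 u y)| + |qf (a x) (D2 u y) - qf (a y) (D2 u y)| := by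
      have : w x - w y = (rhs ln bc c f u G x - rhs ln bc c f u G y) -
        (qf (a x) (D2 u x) - qf (a x) (D2 u y)) - (qf (a x) (D2 u y) - qf (a y) (D2 u y)) := by
        simp only [hw]; ring
      rw [this]
      exact (abs_sub _ _).trans (add_le_add_left (abs_sub _ _) _)
    rw [hW1]
    linarith
  have hV0 : ∀ x ∈ halfBall n ln (1 / 2), |V x| ≤ W0 / lam * Z := fun x hx => by
    have e1 := quot_sub_le (V := V x) (V' := 0) (A' := a x ln ln) hl ((hell x hx).diag ln).1 (hVe x hx)
      (mul_zero _)
    rw [sub_zero, sub_zero, abs_zero, mul_zero, add_zero] at e1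
    have e2 := (e1.trans (hdb _)).trans (hw0 x hx)
    rw [div_mul_eq_mul_div, le_div_iff₀ hl]
    linarith
  have hV1 : ∀ x ∈ halfBall n ln (1 / 2), ∀ y ∈ halfBall n ln (1 / 2),
      |V x - V y| ≤ D * Z * ‖x - y‖ ^ α := fun x hx y hy => by
    have e1 := quot_sub_le (V := V x) (V' := V y) hl ((hell x hx).diag ln).1 (hVe x hx) (hVe y hy)
    rw [← sub_div] at e1
    have e2 := (hdb (w x - w y)).trans (hw1 x hx y hy)
    have e3 := mul_le_mul (h.coef.aH x (hsubc x hx) y (hsubc y hy) ln ln) (hV0 y hy) (abs_nonneg _)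
      (by positivity)
    have e4 : D * lam = W1 + K * (W0 / lam) := div_mul_cancel₀ _ hl.ne'
    have e5 : lam * (D * Z * ‖x - y‖ ^ α) = (W1 + K * (W0 / lam)) * (Z * ‖x - y‖ ^ α) := by
      rw [← e4]; ring
    refine le_of_mul_le_mul_left ?_ hl
    rw [e5]
    linarith
  refine ⟨fun x hx => (g1 x hx).trans (hmono (by linarith)), fun x hx => (g2 x hx).trans
    (hmono (by linarith)), fun x hx y hy => (g3 x hx y hy).trans (mul_le_mul_of_nonneg_right
    (hmono (by linarith)) (by positivity)), fun x hx => (hV0 x hx).trans (hmono (by linarith)),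
    fun x hx y hy => (hV1 x hx y hy).trans (mul_le_mul_of_nonneg_right
    (hmono (by linarith)) (by positivity))⟩

theorem exists_holder_extension {E F : Type*} [NormedAddCommGroup E] [NormedAddCommGroup F]
    [CompleteSpace F] {A : Set E} {g : E → F} {k B : ℝ} (hα : 0 < α) (hb : ∀ x ∈ A, ‖g x‖ ≤ B)
    (hh : ∀ x ∈ A, ∀ y ∈ A, ‖g x - g y‖ ≤ k * ‖x - y‖ ^ α) :
    ∃ H : E → F, ContinuousOn H (closure A) ∧ (∀ x ∈ A, H x = g x) ∧ (∀ x ∈ closure A, ‖H x‖ ≤ B) ∧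
      ∀ x ∈ closure A, ∀ y ∈ closure A, ‖H x - H y‖ ≤ k * ‖x - y‖ ^ α := by
  have hlim : ∀ x ∈ closure A, ∃ y, Tendsto g (𝓝[A] x) (𝓝 y) := fun x hx => by
    have : (𝓝[A] x).NeBot := mem_closure_iff_nhdsWithin_neBot.1 hx
    refine CompleteSpace.complete (f := map g (𝓝[A] x)) ?_
    rw [Metric.cauchy_iff]
    refine ⟨inferInstance, fun ε hε => ?_⟩
    have h1 : Tendsto (fun δ : ℝ => |k| * (2 * δ) ^ α) (𝓝[>] 0) (𝓝 0) := by
      have : Continuous fun δ : ℝ => |k| * (2 * δ) ^ α :=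
        continuous_const.mul ((continuous_const.mul continuous_id).rpow_const
          fun _ => Or.inr hα.le)
      have h2 := this.tendsto 0
      simp only [mul_zero, Real.zero_rpow hα.ne'] at h2
      exact h2.mono_left nhdsWithin_le_nhds
    obtain ⟨δ, hδ, hδ0⟩ := ((h1.eventually_lt_const hε).and self_mem_nhdsWithin).exists
    have hδ0 : 0 < δ := hδ0
    refine ⟨g '' (Metric.ball x δ ∩ A), image_mem_map
      (inter_mem (mem_nhdsWithin_of_mem_nhds (Metric.ball_mem_nhds x hδ0)) self_mem_nhdsWithin), ?_⟩
    rintro _ ⟨p, hp, rfl⟩ _ ⟨q, hq, rfl⟩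
    rw [dist_eq_norm]
    have e1 : ‖p - q‖ ≤ 2 * δ := by
      have := dist_triangle_right p q x
      have k1 := Metric.mem_ball.1 hp.1
      have k2 := Metric.mem_ball.1 hq.1
      rw [← dist_eq_norm]
      linarith
    have e2 : ‖p - q‖ ^ α ≤ (2 * δ) ^ α := Real.rpow_le_rpow (norm_nonneg _) e1 hα.le
    calc _ ≤ k * ‖p - q‖ ^ α := hh p hp.2 q hq.2
      _ ≤ |k| * (2 * δ) ^ α := mul_le_mul (le_abs_self k) e2 (by positivity) (abs_nonneg k)
      _ < ε := hδ
  have hc : ContinuousOn (extendFrom A g) (closure A) := continuousOn_extendFrom subset_rfl hlim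
  have heq : ∀ x ∈ A, extendFrom A g x = g x := fun x hx =>
    extendFrom_eq (subset_closure hx) (continuousOn_of_holder hα hh x hx)
  have hcw : ∀ x ∈ closure A, ContinuousWithinAt (extendFrom A g) A x := fun x hx =>
    (hc x hx).mono subset_closure
  have hr : ∀ y : E, Continuous fun x : E => k * ‖x - y‖ ^ α := fun y =>
    continuous_const.mul ((continuous_id.sub continuous_const).norm.rpow_const
      (fun _ => Or.inr hα.le))
  refine ⟨extendFrom A g, hc, heq, fun x hx => ContinuousWithinAt.closure_le hx (hcw x hx).norm
    continuousWithinAt_const fun y hy => by rw [heq y hy]; exact hb y hy, ?_⟩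
  have h1 : ∀ x ∈ closure A, ∀ y ∈ A,
      ‖extendFrom A g x - extendFrom A g y‖ ≤ k * ‖x - y‖ ^ α := fun x hx y hy =>
    ContinuousWithinAt.closure_le hx ((hcw x hx).sub continuousWithinAt_const).norm
      (hr y).continuousWithinAt fun z hz => by
        change ‖extendFrom A g z - extendFrom A g y‖ ≤ _
        rw [heq z hz, heq y hy]
        exact hh z hz y hy
  intro x hx y hy
  have := ContinuousWithinAt.closure_le hy ((hcw y hy).sub continuousWithinAt_const).norm
      (hr x).continuousWithinAt fun z hz => by
        change ‖extendFrom A g z - extendFrom A g x‖ ≤ _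
        have := h1 x hx z hz
        rwa [norm_sub_rev, norm_sub_rev x] at this
  change ‖extendFrom A g y - extendFrom A g x‖ ≤ k * ‖y - x‖ ^ α at this
  rwa [norm_sub_rev, norm_sub_rev y] at this

theorem le_of_forall_pos_add {A C Z B : ℝ} (h : ∀ ε, 0 < ε → A ≤ C * (Z + ε) * B) :
    A ≤ C * Z * B := by
  have h1 : Tendsto (fun ε : ℝ => C * (Z + ε) * B) (𝓝[>] 0) (𝓝 (C * (Z + 0) * B)) :=
    ((by fun_prop : Continuous fun ε : ℝ => C * (Z + ε) * B).tendsto 0).mono_left nhdsWithin_le_nhds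
  rw [add_zero] at h1
  exact ge_of_tendsto h1 (by filter_upwards [self_mem_nhdsWithin] with ε hε using h ε hε)

/-- Symmetrization of a coefficient matrix. -/
def symCoef (a : Fin n → Fin n → Eu n → ℝ) (x : Eu n) (i j : Fin n) : ℝ := (a i j x + a j i x) / 2

theorem sum_symCoef_mul (a : Fin n → Fin n → Eu n → ℝ) (x : Eu n) {T : Fin n → Fin n → ℝ}
    (hT : ∀ i j, T i j = T j i) :
    ∑ i, ∑ j, symCoef a x i j * T i j = ∑ i, ∑ j, a i j x * T i j := by
  have h1 : ∑ i, ∑ j, a j i x * T i j = ∑ i, ∑ j, a i j x * T i j := by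
    rw [Finset.sum_comm]
    exact Finset.sum_congr rfl fun i _ => Finset.sum_congr rfl fun j _ => by rw [hT]
  have h2 : ∑ i, ∑ j, symCoef a x i j * T i j =
      ((∑ i, ∑ j, a i j x * T i j) + ∑ i, ∑ j, a j i x * T i j) / 2 := by
    rw [← Finset.sum_add_distrib, Finset.sum_div]
    refine Finset.sum_congr rfl fun i _ => ?_
    rw [← Finset.sum_add_distrib, Finset.sum_div]
    exact Finset.sum_congr rfl fun j _ => by rw [symCoef]; ring
  rw [h2, h1]; ring

theorem symCoef_coefOn (ln : Fin n) {K : ℝ} (hα : 0 < α) {a : Fin n → Fin n → Eu n → ℝ}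
    (haH : ∀ i j, ∀ x ∈ closure (halfBall n ln 1), ∀ y ∈ closure (halfBall n ln 1),
      |a i j x - a i j y| ≤ K * ‖x - y‖ ^ α)
    (hE : ∀ x ∈ halfBall n ln 1, ∀ ξ : Fin n → ℝ,
      lam * (∑ i, ξ i ^ 2) ≤ (∑ i, ∑ j, a i j x * ξ i * ξ j) ∧
      (∑ i, ∑ j, a i j x * ξ i * ξ j) ≤ Lam * (∑ i, ξ i ^ 2)) :
    CoefOn lam Lam α K (hBc ln 0 1) (symCoef a) := by
  have hc : ∀ ξ : Fin n → ℝ, ContinuousOn (fun x => ∑ i, ∑ j, a i j x * ξ i * ξ j)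
      (closure (halfBall n ln 1)) := fun ξ =>
    continuousOn_finsetSum _ fun i _ => continuousOn_finsetSum _ fun j _ =>
      ((continuousOn_of_holder hα (haH i j)).mul continuousOn_const).mul continuousOn_const
  have hs : ∀ (x : Eu n) (ξ : Fin n → ℝ), ∑ i, ∑ j, symCoef a x i j * ξ i * ξ j =
      ∑ i, ∑ j, a i j x * ξ i * ξ j := fun x ξ => by
    simp only [mul_assoc]
    exact sum_symCoef_mul a x (T := fun i j => ξ i * ξ j) fun i j => mul_comm _ _
  refine ⟨fun x hx => ⟨fun i j => by rw [symCoef, symCoef, add_comm], fun ξ => ?_, fun ξ => ?_⟩,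
    fun x hx y hy i j => ?_⟩
  · have hx' := hBc_sub_closure ln hx
    rw [hs]
    exact ContinuousWithinAt.closure_le hx' continuousWithinAt_const
      (((hc ξ) x hx').mono subset_closure) fun y hy => (hE y hy ξ).1
  · have hx' := hBc_sub_closure ln hx
    rw [hs]
    exact ContinuousWithinAt.closure_le hx' (((hc ξ) x hx').mono subset_closure)
      continuousWithinAt_const fun y hy => (hE y hy ξ).2
  · have hx' := hBc_sub_closure ln hx
    have hy' := hBc_sub_closure ln hy
    have e1 := haH i j x hx' y hy'
    have e2 := haH j i x hx' y hy'
    rw [symCoef, symCoef]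
    rw [abs_le] at *
    constructor <;> linarith

end

theorem stmt19 (n : ℕ) (hn : 2 ≤ n) (ln : Fin n) (hln : (ln : ℕ) = n - 1)
    (α : ℝ) (hα : α ∈ Set.Ioo (0 : ℝ) 1)
    (lam Lam : ℝ) (hlam : 0 < lam) (hLam : lam ≤ Lam)
    (K : ℝ) (hK : 0 < K) (b : ℝ) (hb : 1 < b) :
    ∃ C : ℝ, 0 < C ∧
      ∀ (u : Eu n → ℝ) (G : Eu n → (Eu n →L[ℝ] ℝ)) (Ku : ℝ)
        (a : Fin n → Fin n → Eu n → ℝ) (bc : Fin n → Eu n → ℝ) (c f : Eu n → ℝ),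
        -- u ∈ C²(B₁⁺)
        ContDiffOn ℝ 2 u (halfBall n ln 1) →
        -- u ∈ C¹ of the closure of B₁⁺, with derivative G …
        (∀ x ∈ closure (halfBall n ln 1),
          HasFDerivWithinAt u (G x) (closure (halfBall n ln 1)) x) →
        -- … and Du = G is α-Hölder continuous on the closure
        (∀ x ∈ closure (halfBall n ln 1), ∀ y ∈ closure (halfBall n ln 1),
          ‖G x - G y‖ ≤ Ku * ‖x - y‖ ^ α) →
        -- the coefficients and f are α-Hölder on the closure of B₁⁺, with norm ≤ K
        (∀ g ∈ ({c, f} ∪ {g | ∃ i j, g = a i j} ∪ {g | ∃ i, g = bc i} :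
            Set (Eu n → ℝ)),
          (∀ x ∈ closure (halfBall n ln 1), |g x| ≤ K) ∧
          ∀ x ∈ closure (halfBall n ln 1), ∀ y ∈ closure (halfBall n ln 1),
            |g x - g y| ≤ K * ‖x - y‖ ^ α) →
        -- uniform ellipticity of (a^{ij})
        (∀ x ∈ halfBall n ln 1, ∀ ξ : Fin n → ℝ,
          lam * (∑ i, ξ i ^ 2) ≤ (∑ i, ∑ j, a i j x * ξ i * ξ j) ∧
          (∑ i, ∑ j, a i j x * ξ i * ξ j) ≤ Lam * (∑ i, ξ i ^ 2)) →
        -- bⁿ/aⁿⁿ ≡ b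
        (∀ x ∈ halfBall n ln 1, bc ln x / a ln ln x = b) →
        -- the equation Σ a^{ij}∂ᵢⱼu + Σ_{i<n} bⁱ∂ᵢu + (bⁿ/xₙ)∂ₙu + cu = f in B₁⁺
        (∀ x ∈ halfBall n ln 1,
          (∑ i, ∑ j, a i j x * pd2 u i j x)
            + (∑ i ∈ Finset.univ.erase ln, bc i x * pd u i x)
            + (bc ln x / x ln) * pd u ln x + c x * u x = f x) →
        -- conclusion: C^{2,α} regularity up to the boundary on B⁺_{1/2}
        ∀ Kf Mu : ℝ,
          -- Kf bounds ‖f‖_{C^α(closure B₁⁺)}, Mu bounds sup_{B₁⁺}|u|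
          ((∀ x ∈ closure (halfBall n ln 1), |f x| ≤ Kf) ∧
            ∀ x ∈ closure (halfBall n ln 1), ∀ y ∈ closure (halfBall n ln 1),
              |f x - f y| ≤ Kf * ‖x - y‖ ^ α) →
          (∀ x ∈ halfBall n ln 1, |u x| ≤ Mu) →
          ∃ H : Eu n → (Eu n →L[ℝ] Eu n →L[ℝ] ℝ),
            -- the second derivatives extend continuously to the closure of B⁺_{1/2}
            ContinuousOn H (closure (halfBall n ln (1 / 2))) ∧
            (∀ x ∈ halfBall n ln (1 / 2), H x = fderiv ℝ (fderiv ℝ u) x) ∧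
            -- ‖u‖_{C^{2,α}} bound
            (∀ x ∈ closure (halfBall n ln (1 / 2)),
              |u x| + ‖G x‖ + ‖H x‖ ≤ C * (Kf + Mu)) ∧
            (∀ x ∈ closure (halfBall n ln (1 / 2)),
              ∀ y ∈ closure (halfBall n ln (1 / 2)),
                ‖H x - H y‖ ≤ C * (Kf + Mu) * ‖x - y‖ ^ α) ∧
            -- ‖uₙ/xₙ‖_{C^α} bound
            (∀ x ∈ halfBall n ln (1 / 2), |pd u ln x / x ln| ≤ C * (Kf + Mu)) ∧
            (∀ x ∈ halfBall n ln (1 / 2), ∀ y ∈ halfBall n ln (1 / 2),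
              |pd u ln x / x ln - pd u ln y / y ln| ≤
                C * (Kf + Mu) * ‖x - y‖ ^ α) := by
  have hα0 := hα.1
  have hα1 := hα.2
  have hL : 0 < Lam := hlam.trans_le hLam
  obtain ⟨C, hC, HC⟩ := full_main ln hlam hL hα0 hα1 hb K hK.le
  refine ⟨3 * C + 1, by positivity, ?_⟩
  intro u G Ku a bc c f hreg hder hderH hcoef hE hb' heq Kf Mu hf hu
  have hsub : halfBall n ln (1 / 2) ⊆ halfBall n ln 1 := fun x hx => by
    rw [mem_halfBall] at *
    exact ⟨by linarith [hx.1], hx.2⟩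
  have h0 : (0 : Eu n) ∈ closure (halfBall n ln 1) := hBc_sub_closure ln (by
    rw [mem_hBc]; simp)
  have hKf : 0 ≤ Kf := (abs_nonneg _).trans (hf.1 0 h0)
  have hMu : 0 ≤ Mu := by
    obtain ⟨x, hx⟩ := closure_nonempty_iff.1 ⟨0, h0⟩
    exact (abs_nonneg _).trans (hu x hx)
  have hc' := hcoef c (Or.inl (Or.inl (Or.inl rfl)))
  have ha' : ∀ i j, _ := fun i j => hcoef (a i j) (Or.inl (Or.inr ⟨i, j, rfl⟩))
  have hbc' : ∀ i, _ := fun i => hcoef (bc i) (Or.inr ⟨i, rfl⟩)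
  have hco := symCoef_coefOn ln hα0 (fun i j => (ha' i j).2) hE
  have hopen := isOpen_halfBall ln (1 : ℝ)
  have hop : ∀ x ∈ halfBall n ln 1,
      opL ln b (symCoef a x) u x = rhs ln bc c f u G x := fun x hx => by
    have hpd : ∀ i, pd u i x = G x (bv i) := fun i => by
      rw [← fderiv_eq_of_closure hder hx, pd]
    have hpd2 : ∀ i j, pd2 u i j x = D2 u x (bv i) (bv j) := fun i j => by
      rw [pd2, pd, fderiv_pd hopen hreg hx]
    have hdiag : symCoef a x ln ln = a ln ln x := by rw [symCoef]; ring
    have hpos : 0 < a ln ln x := by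
      rw [← hdiag]
      exact hlam.trans_le ((hco.ell x (halfBall_sub_hBc ln hx)).diag ln).1
    have hbn : bc ln x = b * a ln ln x := by
      rw [← hb' x hx]; field_simp
    have e := heq x hx
    simp only [hpd, hpd2] at e
    rw [hbn, ← sum_symCoef_mul a x fun i j => C2on_symm hopen hreg hx (bv i) (bv j)] at e
    rw [opL, rhs, hdiag, fderiv_eq_of_closure hder hx, ← e, qf]
    ring
  have hfull : ∀ ε, 0 < ε → Full ln b lam Lam α K (symCoef a) bc c f u G (Mu + ε) Kf :=
    fun ε hε => ⟨hreg, hder, ⟨Ku, hderH⟩, hco, fun i => (hbc' i).1, fun i => (hbc' i).2, hc'.1, hc'.2,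
      hf.1, hf.2, hop, fun x hx => (hu x hx).trans (by linarith)⟩
  have hmain := fun ε hε => HC (symCoef a) bc c f u G (Mu + ε) Kf (hfull ε hε) (by linarith) hKf
  have hlim : ∀ {A B : ℝ}, (∀ ε, 0 < ε → A ≤ C * (Mu + ε + Kf) * B) → A ≤ C * (Kf + Mu) * B :=
    fun h => le_of_forall_pos_add fun ε hε => by
      have := h ε hε
      rwa [show Mu + ε + Kf = Kf + Mu + ε by ring] at this
  have hlim1 : ∀ {A : ℝ}, (∀ ε, 0 < ε → A ≤ C * (Mu + ε + Kf)) → A ≤ C * (Kf + Mu) := fun h => by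
    rw [← mul_one (C * (Kf + Mu))]
    exact hlim fun ε hε => by rw [mul_one]; exact h ε hε
  have hbc0 : ∀ x ∈ closure (halfBall n ln 1), |u x| ≤ Mu := fun x hx =>
    ContinuousWithinAt.closure_le hx
      (((hder x hx).continuousWithinAt.mono subset_closure).abs) continuousWithinAt_const hu
  obtain ⟨H, hHc, hHe, hHb, hHh⟩ := exists_holder_extension (A := halfBall n ln (1 / 2)) (g := D2 u)
    hα0 (fun x hx => hlim1 fun ε hε => (hmain ε hε).2.1 x hx)
    (fun x hx y hy => hlim fun ε hε => (hmain ε hε).2.2.1 x hx y hy)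
  have hZ : C * (Kf + Mu) ≤ (3 * C + 1) * (Kf + Mu) :=
    mul_le_mul_of_nonneg_right (by linarith) (by linarith)
  refine ⟨H, hHc, hHe, fun x hx => ?_, fun x hx y hy => ?_, fun x hx => ?_, fun x hx y hy => ?_⟩
  · have e1 := hbc0 x (closure_mono hsub hx)
    have e2 := hlim1 fun ε hε => (hmain ε hε).1 x hx
    have e3 := hHb x hx
    have e4 : 0 ≤ C * (Kf + Mu) := by positivity
    linarith
  · exact (hHh x hx y hy).trans (mul_le_mul_of_nonneg_right hZ (by positivity))
  · exact (hlim1 fun ε hε => (hmain ε hε).2.2.2.1 x hx).trans hZ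
  · exact (hlim fun ε hε => (hmain ε hε).2.2.2.2 x hx y hy).trans
      (mul_le_mul_of_nonneg_right hZ (by positivity))
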